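/- Every triconnected planar graph with no separating triangles has a subhamiltonian cycle that crosses every face at most once. -/

import Mathlib

open Set

universe u

/-- A topological embedding of a simple graph in the plane: vertices are mapped to
distinct points and every edge is realized by a simple arc joining the images of its
endpoints, such that two arcs of distinct edges meet only in common endpoints and no
vertex point lies in the interior of an arc. -/
structure PlaneEmbedding {V : Type u} (G : SimpleGraph V) where
  pos : V → ℝ × ℝ
  pos_inj : Function.Injective pos
  arc : ∀ ⦃u v : V⦄, G.Adj u v → Set (ℝ × ℝ)
  arc_symm : ∀ ⦃u v : V⦄ (h : G.Adj u v), arc h.symm = arc h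
  arc_curve : ∀ ⦃u v : V⦄ (h : G.Adj u v), ∃ f : ℝ → ℝ × ℝ,
    ContinuousOn f (Set.Icc 0 1) ∧ Set.InjOn f (Set.Icc 0 1) ∧
    f 0 = pos u ∧ f 1 = pos v ∧ f '' Set.Icc 0 1 = arc h
  arc_inter : ∀ ⦃u v w z : V⦄ (h₁ : G.Adj u v) (h₂ : G.Adj w z),
    s(u, v) ≠ s(w, z) → arc h₁ ∩ arc h₂ ⊆ ({pos u, pos v} ∩ {pos w, pos z} : Set (ℝ × ℝ))
  pos_arc : ∀ ⦃u v : V⦄ (h : G.Adj u v) (w : V), pos w ∈ arc h → w = u ∨ w = v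

/-- A graph is planar if it admits a topological embedding in the plane. -/
def SimpleGraph.IsPlanar {V : Type u} (G : SimpleGraph V) : Prop :=
  Nonempty (PlaneEmbedding G)

/-- The point set covered by a plane embedding. -/
def PlaneEmbedding.drawing {V : Type u} {G : SimpleGraph V} (E : PlaneEmbedding G) :
    Set (ℝ × ℝ) :=
  Set.range E.pos ∪ ⋃ (u : V) (v : V) (h : G.Adj u v), E.arc h

/-- A face of a plane embedding is a connected component of the complement of the drawing. -/
def PlaneEmbedding.IsFace {V : Type u} {G : SimpleGraph V} (E : PlaneEmbedding G)
    (F : Set (ℝ × ℝ)) : Prop :=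
  ∃ p, p ∉ E.drawing ∧ F = connectedComponentIn E.drawingᶜ p

/-- A vertex is incident to a face if its point lies on the boundary of the face. -/
def PlaneEmbedding.VertexOnFace {V : Type u} {G : SimpleGraph V} (E : PlaneEmbedding G)
    (v : V) (F : Set (ℝ × ℝ)) : Prop :=
  E.pos v ∈ closure F

/-- Maximum degree at most `d`. -/
def SimpleGraph.MaxDegreeLE {V : Type u} (G : SimpleGraph V) (d : ℕ) : Prop :=
  ∀ v : V, (G.neighborSet v).ncard ≤ d

/-- A graph is triconnected (3-connected) if it has more than three vertices, is
connected, and stays connected after removing any two vertices. -/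
def SimpleGraph.IsTriconnected {V : Type u} (G : SimpleGraph V) : Prop :=
  3 < Nat.card V ∧ G.Connected ∧
    ∀ u v : V, (G.induce {w : V | w ≠ u ∧ w ≠ v}).Connected

/-- A graph is biconnected (2-connected) if it has more than two vertices, is
connected, and stays connected after removing any single vertex. -/
def SimpleGraph.IsBiconnected {V : Type u} (G : SimpleGraph V) : Prop :=
  2 < Nat.card V ∧ G.Connected ∧ ∀ u : V, (G.induce {w : V | w ≠ u}).Connected

/-- A graph is subhamiltonian if it is a spanning subgraph of a planar hamiltonian graph. -/
def SimpleGraph.IsSubhamiltonian {V : Type u} [Fintype V] (G : SimpleGraph V) : Prop :=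
  ∃ H : SimpleGraph V, G ≤ H ∧ H.IsPlanar ∧ (letI := Classical.decEq V; H.IsHamiltonian)

/-- The graph consisting of the edges of the cyclic vertex sequence `σ`. -/
def cyclicSuccGraph {W : Type u} (σ : ZMod (Nat.card W) ≃ W) : SimpleGraph W :=
  SimpleGraph.fromRel fun u v => ∃ i, u = σ i ∧ v = σ (i + 1)

/-- The cyclic ordering `σ` of all vertices of `G` is a subhamiltonian cycle for `G` if
adding the edges between consecutive vertices of `σ` keeps the graph planar. -/
def SimpleGraph.IsSubhamiltonianCycle {W : Type u} (G : SimpleGraph W)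
    (σ : ZMod (Nat.card W) ≃ W) : Prop :=
  SimpleGraph.IsPlanar (G ⊔ cyclicSuccGraph σ)

/-- The edges (pairs of consecutive vertices) of the cyclic sequence `σ`. -/
def cycleEdges {W : Type u} (σ : ZMod (Nat.card W) ≃ W) : Set (Sym2 W) :=
  {e | ∃ i, e = s(σ i, σ (i + 1))}

/-- The subhamiltonian cycle `σ` crosses the face `F` at position `i` if the two
consecutive vertices `σ i` and `σ (i+1)` are both incident to `F` but not adjacent. -/
def CrossesFaceAt {V : Type u} {G : SimpleGraph V} (E : PlaneEmbedding G)
    (σ : ZMod (Nat.card V) ≃ V) (F : Set (ℝ × ℝ)) (i : ZMod (Nat.card V)) : Prop :=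
  E.VertexOnFace (σ i) F ∧ E.VertexOnFace (σ (i + 1)) F ∧ ¬ G.Adj (σ i) (σ (i + 1))

/-- A separating triangle: a triangle whose removal disconnects the graph. -/
def SimpleGraph.IsSepTriangle {V : Type u} (G : SimpleGraph V) (a b c : V) : Prop :=
  G.Adj a b ∧ G.Adj b c ∧ G.Adj a c ∧
    ¬ (G.induce {v : V | v ≠ a ∧ v ≠ b ∧ v ≠ c}).Connected

section Triangle

variable {V : Type u} {G : SimpleGraph V} (E : PlaneEmbedding G) {a b c : V}

/-- The Jordan curve formed by the drawing of the triangle `a b c`. -/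
def triangleDrawing (hab : G.Adj a b) (hbc : G.Adj b c) (hac : G.Adj a c) :
    Set (ℝ × ℝ) :=
  E.arc hab ∪ E.arc hbc ∪ E.arc hac

/-- The vertices strictly inside the triangle `a b c` (bounded side of the Jordan curve). -/
def insideTriangle (hab : G.Adj a b) (hbc : G.Adj b c) (hac : G.Adj a c) : Set V :=
  {v | v ≠ a ∧ v ≠ b ∧ v ≠ c ∧
    Bornology.IsBounded
      (connectedComponentIn (triangleDrawing E hab hbc hac)ᶜ (E.pos v))}

/-- The vertices strictly outside the triangle `a b c` (unbounded side of the Jordan curve). -/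
def outsideTriangle (hab : G.Adj a b) (hbc : G.Adj b c) (hac : G.Adj a c) : Set V :=
  {v | v ≠ a ∧ v ≠ b ∧ v ≠ c ∧
    ¬ Bornology.IsBounded
      (connectedComponentIn (triangleDrawing E hab hbc hac)ᶜ (E.pos v))}

end Triangle

set_option linter.all false

attribute [grind =] mem_union mem_sdiff mem_singleton_iff mem_insert_iff mem_ofPred_eq subset_def mem_inter_iff

section Abs
variable {U : Type u} {T : SimpleGraph U}

def Cn (T : SimpleGraph U) (S : Set U) : Prop :=
  S.Nonempty ∧ ∀ A ⊆ S, A.Nonempty → (∀ a ∈ A, ∀ b ∈ S, T.Adj a b → b ∈ A) → A = S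

def Tch (T : SimpleGraph U) (A B : Set U) : Prop := ∃ a ∈ A, ∃ b ∈ B, T.Adj a b

def Dj (A B : Set U) : Prop := ∀ x ∈ A, x ∉ B

attribute [grind =] Dj

theorem Dj.symm {A B : Set U} (h : Dj A B) : Dj B A := fun x hx hy => h x hy hx

theorem Tch.symm {A B : Set U} (h : Tch T A B) : Tch T B A := by
  obtain ⟨a, ha, b, hb, h⟩ := h
  exact ⟨b, hb, a, ha, h.symm⟩

theorem Tch.mono {A B A' B' : Set U} (h : Tch T A B) (hA : A ⊆ A') (hB : B ⊆ B') : Tch T A' B' := by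
  obtain ⟨a, ha, b, hb, h⟩ := h
  exact ⟨a, hA ha, b, hB hb, h⟩

theorem Tch.mo {A B A' B' : Set U} (h : Tch T A B) (hA : A ⊆ A' := by grind) (hB : B ⊆ B' := by grind) : Tch T A' B' :=
  h.mono hA hB

theorem Cn.single (x : U) : Cn T {x} := by
  refine ⟨⟨x, rfl⟩, fun A hA hn _ => ?_⟩
  exact (Set.subset_singleton_iff_eq.1 hA).resolve_left hn.ne_empty

/-- a core plus pieces touching it -/
theorem Cn.extend {A R : Set U} (hA : Cn T A)
    (h : ∀ S ⊆ R, S.Nonempty → ∃ s ∈ S, ∃ y, T.Adj s y ∧ (y ∈ A ∨ (y ∈ R ∧ y ∉ S))) :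
    Cn T (A ∪ R) := by
  refine ⟨hA.1.mono subset_union_left, fun B hB hBn hcl => ?_⟩
  by_cases hBA : (B ∩ A).Nonempty
  · have h1 : B ∩ A = A := hA.2 _ inter_subset_right hBA (fun a ha b hb hab =>
      ⟨hcl a ha.1 b (Or.inl hb) hab, hb⟩)
    have h1' : A ⊆ B := by grind
    by_contra hne
    have : ((A ∪ R) \ B).Nonempty := by
      rw [Set.sdiff_nonempty]; intro h2; exact hne (subset_antisymm hB h2)
    obtain ⟨s, hs, y, hy, hy'⟩ := h ((A ∪ R) \ B) (fun x hx => by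
      rcases hx.1 with h | h
      · grind
      · exact h) this
    have hyB : y ∈ B := by
      grind
    exact hs.2 (hcl y hyB s hs.1 hy.symm)
  · exfalso
    have hBA' : ∀ x ∈ B, x ∉ A := fun x hx hxa => hBA ⟨x, hx, hxa⟩
    grind
theorem Cn.touch {S A : Set U} (hS : Cn T S) (hA : A ⊆ S) (hn : A.Nonempty) (hne : ∃ x ∈ S, x ∉ A) :
    ∃ a ∈ A, ∃ b ∈ S, b ∉ A ∧ T.Adj a b := by
  by_contra hc
  push Not at hc
  have := hS.2 A hA hn (fun a ha b hb hab => by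
    by_contra h; exact hc a ha b hb h hab)
  obtain ⟨x, hx, hx'⟩ := hne
  exact hx' (this ▸ hx)

theorem Cn.union {A B : Set U} (hA : Cn T A) (hB : Cn T B) (h : Tch T A B) : Cn T (A ∪ B) := by
  refine hA.extend fun S hS hn => ?_
  by_cases hSB : ∃ x ∈ B, x ∉ S
  · obtain ⟨a, ha, b, hb, hba, hab⟩ := hB.touch hS hn hSB
    grind
  · push Not at hSB
    obtain ⟨a, ha, b, hb, hab⟩ := h
    exact ⟨b, hSB b hb, a, hab.symm, Or.inl ha⟩

theorem Cn.union' {A B : Set U} (hA : Cn T A) (hB : Cn T B) (h : (A ∩ B).Nonempty) :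
    Cn T (A ∪ B) := by
  have : A ∪ B = A ∪ (B \ A) := by simp
  rw [this]
  refine hA.extend fun S hS hn => ?_
  obtain ⟨x, hxA, hxB⟩ := h
  obtain ⟨a, ha, b, hb, hba, hab⟩ := hB.touch (A := S) (fun y hy => (hS hy).1) hn
    ⟨x, hxB, fun h => (hS h).2 hxA⟩
  refine ⟨a, ha, b, hab, ?_⟩
  by_cases hbA : b ∈ A
  · exact Or.inl hbA
  · grind
theorem Cn.sub_of_closed {K S : Set U} (hK : Cn T K) (h : (K ∩ S).Nonempty)
    (hcl : ∀ a ∈ S, ∀ b ∈ K, T.Adj a b → b ∈ S) : K ⊆ S := by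
  have := hK.2 (K ∩ S) inter_subset_left h (fun a ha b hb hab => ⟨hb, hcl a ha.2 b hb hab⟩)
  rw [← this]; exact inter_subset_right

/-- component of `x` in `S` -/
def Cmp (T : SimpleGraph U) (S : Set U) (x : U) : Set U :=
  {y | Relation.ReflTransGen (fun a b => T.Adj a b ∧ b ∈ S) x y}

theorem mem_Cmp_self {S : Set U} {x : U} : x ∈ Cmp T S x := Relation.ReflTransGen.refl

theorem Cmp_step {S : Set U} {x y z : U} (hy : y ∈ Cmp T S x) (hz : z ∈ S) (h : T.Adj y z) :
    z ∈ Cmp T S x := Relation.ReflTransGen.tail hy ⟨h, hz⟩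

theorem Cmp_sub {S : Set U} {x : U} (hx : x ∈ S) : Cmp T S x ⊆ S := by
  intro y hy
  induction hy with
  | refl => exact hx
  | tail _ h _ => exact h.2

theorem Cmp_Cn {S : Set U} {x : U} : Cn T (Cmp T S x) := by
  refine ⟨⟨x, mem_Cmp_self⟩, fun A hA hn hcl => subset_antisymm hA ?_⟩
  have key : ∀ y, y ∈ Cmp T S x → (y ∈ A ↔ x ∈ A) := by
    intro y hy
    induction hy with
    | refl => rfl
    | @tail b c hb h ih =>
      rw [← ih]
      constructor
      · intro h1; exact hcl c h1 b hb h.1.symm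
      · intro h1; exact hcl b h1 c (Relation.ReflTransGen.tail hb h) h.1
  obtain ⟨y, hy⟩ := hn
  grind
theorem Cn.sub_Cmp {K S : Set U} {x : U} (hK : Cn T K) (hKS : K ⊆ S) (hx : x ∈ K) :
    K ⊆ Cmp T S x :=
  hK.sub_of_closed ⟨x, hx, mem_Cmp_self⟩ fun _ ha _ hb hab => Cmp_step ha (hKS hb) hab

theorem Cn.sub_Cmp' {K S : Set U} {x : U} (hK : Cn T K) (hKS : K ⊆ S) (h : (K ∩ Cmp T S x).Nonempty) :
    K ⊆ Cmp T S x :=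
  hK.sub_of_closed h fun _ ha _ hb hab => Cmp_step ha (hKS hb) hab

theorem Cmp_mono {S S' : Set U} {x : U} (h : S ⊆ S') : Cmp T S x ⊆ Cmp T S' x := by
  intro y hy
  induction hy with
  | refl => exact mem_Cmp_self
  | tail _ hs ih => exact Cmp_step ih (h hs.2) hs.1

theorem Cn.chain {x : U} {l : List U} (h : (x :: l).IsChain T.Adj) : Cn T {y | y ∈ x :: l} := by
  induction l generalizing x with
  | nil => simpa using Cn.single (T := T) x
  | cons y l ih =>
    rw [List.isChain_cons_cons] at h
    have := (Cn.single (T := T) x).union (ih h.2) ⟨x, rfl, y, by simp, h.1⟩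
    convert this using 1
    ext z; simp

theorem Cn.chain' {l : List U} (hl : l ≠ []) (h : l.IsChain T.Adj) : Cn T {y | y ∈ l} := by
  cases l with
  | nil => exact absurd rfl hl
  | cons x l => exact Cn.chain h

/-- extension lemma -/
theorem ext_lemma [Finite U] {ι : Type*} (A : ι → Set U) (R : Set U) (hA : ∀ i, Cn T (A i))
    (hdj : ∀ i j, i ≠ j → Dj (A i) (A j)) (hR : ∀ i, Dj (A i) R)
    (h : ∀ S ⊆ R, S.Nonempty → ∃ s ∈ S, ∃ y, T.Adj s y ∧ ((∃ i, y ∈ A i) ∨ (y ∈ R ∧ y ∉ S))) :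
    ∃ B : ι → Set U, (∀ i, A i ⊆ B i) ∧ (∀ i, B i ⊆ A i ∪ R) ∧ (∀ i, Cn T (B i)) ∧
      (∀ i j, i ≠ j → Dj (B i) (B j)) ∧ ∀ x ∈ R, ∃ i, x ∈ B i := by
  classical
  induction hn : R.ncard generalizing A R with
  | zero =>
    rw [Set.ncard_eq_zero] at hn
    subst hn
    exact ⟨A, fun i => le_rfl, fun i => subset_union_left, hA, hdj, fun x hx => hx.elim⟩
  | succ n ih =>
    have hne : R.Nonempty := by
      rw [← Set.ncard_pos, hn]; omega
    obtain ⟨r, hr, y, hry, hy⟩ := h R le_rfl hne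
    rcases hy with ⟨i, hi⟩ | hy
    swap
    · grind
    obtain ⟨B, h1, h2, h3, h4, h5⟩ := ih (Function.update A i (A i ∪ {r})) (R \ {r})
      (fun j => by
        by_cases hj : j = i
        · subst hj; simp only [Function.update_self]
          exact (hA j).union (Cn.single r) ⟨y, hi, r, rfl, hry.symm⟩
        · rw [Function.update_of_ne hj]; exact hA j)
      (fun j k hjk x hx hx' => by
        have hr1 := fun l h => hR l r h hr
        by_cases hj : j = i
        · subst hj
          rw [Function.update_self] at hx
          rw [Function.update_of_ne hjk.symm] at hx'
          rcases hx with hx | hx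
          · exact hdj _ _ hjk x hx hx'
          all_goals grind
        · rw [Function.update_of_ne hj] at hx
          by_cases hk : k = i
          · subst hk
            rw [Function.update_self] at hx'
            rcases hx' with hx' | hx'
            · exact hdj _ _ hjk x hx hx'
            all_goals grind
          · rw [Function.update_of_ne hk] at hx'
            exact hdj _ _ hjk x hx hx')
      (fun j x hx hx' => by
        by_cases hj : j = i
        · grind
        · rw [Function.update_of_ne hj] at hx
          exact hR _ x hx hx'.1)
      (fun S hS hSn => by
        obtain ⟨s, hs, z, hz, hz'⟩ := h S (hS.trans sdiff_subset) hSn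
        refine ⟨s, hs, z, hz, ?_⟩
        rcases hz' with ⟨j, hj⟩ | hz'
        · left; refine ⟨j, ?_⟩
          grind
        · by_cases hzr : z = r
          · left; refine ⟨i, ?_⟩
            grind
          · right; exact ⟨⟨hz'.1, hzr⟩, hz'.2⟩)
      (by rw [Set.ncard_sdiff_singleton_of_mem hr, hn]; rfl)
    have hup : ∀ j, A j ⊆ Function.update A i (A i ∪ {r}) j := fun j => by
      grind
    have hup' : ∀ j, Function.update A i (A i ∪ {r}) j ⊆ A j ∪ R := fun j => by
      grind
    refine ⟨B, fun j => (hup j).trans (h1 j), fun j x hx => ?_, h3, h4, fun x hx => ?_⟩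
    · grind
    · grind
/-- two core version within a connected set -/
theorem split_two [Finite U] {Y A B : Set U} (hY : Cn T Y) (hA : Cn T A) (hB : Cn T B)
    (hAB : Dj A B) (hAY : A ⊆ Y) (hBY : B ⊆ Y) :
    ∃ A' B', A ⊆ A' ∧ B ⊆ B' ∧ A' ⊆ Y ∧ B' ⊆ Y ∧ Cn T A' ∧ Cn T B' ∧ Dj A' B' ∧ Tch T A' B' := by
  obtain ⟨F, h1, h2, h3, h4, h5⟩ := ext_lemma (T := T) (fun b : Bool => if b then A else B)
    (Y \ (A ∪ B)) (by rintro (_|_) <;> simpa) (by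
      rintro (_|_) (_|_) h <;> simp_all [Dj]
      exact fun x hx hx' => hAB x hx' hx) (by
      rintro (_|_) x hx hx' <;> simp_all) (fun S hS hn => by
        obtain ⟨a, ha⟩ := hA.1
        obtain ⟨s, hs, y, hy, hyS, hsy⟩ := hY.touch (A := S) (fun x hx => (hS hx).1) hn
          ⟨a, hAY ha, fun h => (hS h).2 (Or.inl ha)⟩
        refine ⟨s, hs, y, hsy, ?_⟩
        by_cases hyA : y ∈ A
        · exact Or.inl ⟨true, by simpa⟩
        by_cases hyB : y ∈ B
        · exact Or.inl ⟨false, by simpa⟩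
        exact Or.inr ⟨⟨hy, fun h => h.elim hyA hyB⟩, hyS⟩)
  have hA' := h1 true
  have hB' := h1 false
  have hAY' : F true ⊆ Y := (h2 true).trans (by simp [hAY])
  have hBY' : F false ⊆ Y := (h2 false).trans (by simp [hBY])
  simp only [if_true] at hA'
  simp only [Bool.false_eq_true, if_false] at hB'
  refine ⟨F true, F false, hA', hB', hAY', hBY', h3 _, h3 _, h4 _ _ (by simp), ?_⟩
  obtain ⟨b, hb⟩ := hB.1
  obtain ⟨s, hs, y, hy, hyS, hsy⟩ := hY.touch hAY' (h3 true).1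
    ⟨b, hBY hb, fun h => h4 true false (by simp) b h (hB' hb)⟩
  refine ⟨s, hs, y, ?_, hsy⟩
  by_cases hyA : y ∈ A
  · grind
  by_cases hyB : y ∈ B
  · exact hB' hyB
  obtain ⟨i, hi⟩ := h5 y ⟨hy, fun h => h.elim hyA hyB⟩
  cases i
  · exact hi
  · grind
structure Tri0 (T : SimpleGraph U) : Prop where
  k5 : ∀ A B C D E : Set U, Cn T A → Cn T B → Cn T C → Cn T D → Cn T E →
    Dj A B → Dj A C → Dj A D → Dj A E → Dj B C → Dj B D → Dj B E → Dj C D → Dj C E → Dj D E →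
    Tch T A B → Tch T A C → Tch T A D → Tch T A E → Tch T B C → Tch T B D → Tch T B E →
    Tch T C D → Tch T C E → Tch T D E → False
  k33 : ∀ A B C D E F : Set U, Cn T A → Cn T B → Cn T C → Cn T D → Cn T E → Cn T F →
    Dj A B → Dj A C → Dj A D → Dj A E → Dj A F → Dj B C → Dj B D → Dj B E → Dj B F →
    Dj C D → Dj C E → Dj C F → Dj D E → Dj D F → Dj E F →
    Tch T A D → Tch T A E → Tch T A F → Tch T B D → Tch T B E → Tch T B F →
    Tch T C D → Tch T C E → Tch T C F → False
  h4 : ∀ (S : Set U) (p q r : U), S.Nonempty →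
    (∀ s ∈ S, ∀ y, T.Adj s y → y ∈ S ∨ y = p ∨ y = q ∨ y = r) →
    ∀ y, y ∈ S ∨ y = p ∨ y = q ∨ y = r

theorem Tri0.k5' (h : Tri0 T) (A B C D E : Set U) (a : Cn T A) (b : Cn T B) (c : Cn T C) (d : Cn T D) (e : Cn T E)
    (dd : Dj A B ∧ Dj A C ∧ Dj A D ∧ Dj A E ∧ Dj B C ∧ Dj B D ∧ Dj B E ∧ Dj C D ∧ Dj C E ∧ Dj D E) :
    Tch T A B → Tch T A C → Tch T A D → Tch T A E → Tch T B C → Tch T B D → Tch T B E →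
    Tch T C D → Tch T C E → Tch T D E → False :=
  h.k5 A B C D E a b c d e dd.1 dd.2.1 dd.2.2.1 dd.2.2.2.1 dd.2.2.2.2.1 dd.2.2.2.2.2.1 dd.2.2.2.2.2.2.1 dd.2.2.2.2.2.2.2.1
    dd.2.2.2.2.2.2.2.2.1 dd.2.2.2.2.2.2.2.2.2

theorem Tri0.k33' (h : Tri0 T) (A B C D E F : Set U) (a : Cn T A) (b : Cn T B) (c : Cn T C) (d : Cn T D) (e : Cn T E) (f : Cn T F)
    (dd : Dj A B ∧ Dj A C ∧ Dj A D ∧ Dj A E ∧ Dj A F ∧ Dj B C ∧ Dj B D ∧ Dj B E ∧ Dj B F ∧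
      Dj C D ∧ Dj C E ∧ Dj C F ∧ Dj D E ∧ Dj D F ∧ Dj E F) :
    Tch T A D → Tch T A E → Tch T A F → Tch T B D → Tch T B E → Tch T B F →
    Tch T C D → Tch T C E → Tch T C F → False := by
  obtain ⟨d0, d1, d2, d3, d4, d5, d6, d7, d8, d9, d10, d11, d12, d13, d14⟩ := dd
  exact h.k33 A B C D E F a b c d e f d0 d1 d2 d3 d4 d5 d6 d7 d8 d9 d10 d11 d12 d13 d14

structure Tri (T : SimpleGraph U) : Prop extends Tri0 T where
  two : ∀ u v, T.Adj u v → ∃ x y, x ≠ y ∧ T.Adj u x ∧ T.Adj v x ∧ T.Adj u y ∧ T.Adj v y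

end Abs

section Abs2
variable {U : Type u} {T : SimpleGraph U}

theorem Tri0.three_aux (hT : Tri0 T) {u v x1 x2 x3 : U} {B1 B2 B3 : Set U} (huv : u ≠ v)
    (h1 : Cn T B1) (h2 : Cn T B2) (h3 : Cn T B3) (d12 : Dj B1 B2) (d13 : Dj B1 B3) (d23 : Dj B2 B3)
    (hc : ∀ y, y = u ∨ y = v ∨ y ∈ B1 ∨ y ∈ B2 ∨ y ∈ B3)
    (hu : u ∉ B1 ∧ u ∉ B2 ∧ u ∉ B3) (hv : v ∉ B1 ∧ v ∉ B2 ∧ v ∉ B3)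
    (m1 : x1 ∈ B1) (m2 : x2 ∈ B2) (m3 : x3 ∈ B3)
    (u1 : T.Adj u x1) (u2 : T.Adj u x2) (u3 : T.Adj u x3)
    (v1 : T.Adj v x1) (v2 : T.Adj v x2) (v3 : T.Adj v x3) (hn : ¬ Tch T B1 B3) : False := by
  set R : Set U := B1 ∪ (B2 \ {x2}) with hR
  set S := Cmp T R x1 with hS
  have hSR : S ⊆ R := Cmp_sub (Or.inl m1)
  have hS3 : ∃ y ∈ S, ∃ z ∈ B3, T.Adj y z := by
    by_contra hcon
    push Not at hcon
    have := hT.h4 S u v x2 ⟨x1, mem_Cmp_self⟩ (fun s hs y hsy => by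
      by_cases hyR : y ∈ R
      · exact Or.inl (Cmp_step hs hyR hsy)
      · have := hcon s hs y
        have := hc y
        grind) x3
    have hx3 : x3 ∉ S := fun h => by have := hSR h; unfold Dj at *; grind
    unfold Dj at *; grind
  obtain ⟨y, hyS, z, hz, hyz⟩ := hS3
  have hyB2 : y ∈ B2 \ {x2} := by
    rcases hSR hyS with h | h
    · exact absurd ⟨y, h, z, hz, hyz⟩ hn
    · exact h
  set Y := Cmp T (B2 \ {x2}) y with hY
  have hYB : Y ⊆ B2 \ {x2} := Cmp_sub hyB2
  have hYS : Y ⊆ S := by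
    intro w hw
    exact Cmp_Cn.sub_Cmp' (K := Y) (hYB.trans subset_union_right) ⟨y, mem_Cmp_self, hyS⟩ hw
  have t2 : Tch T Y {x2} := by
    obtain ⟨a, ha, b, hb, hba, hab⟩ := h2.touch (A := Y) (fun w hw => (hYB hw).1)
      ⟨y, mem_Cmp_self⟩ ⟨x2, m2, fun h => (hYB h).2 rfl⟩
    refine ⟨a, ha, b, ?_, hab⟩
    by_contra hbx
    exact hba (Cmp_step ha ⟨hb, hbx⟩ hab)
  have t1 : Tch T Y B1 := by
    obtain ⟨a, ha, b, hb, hba, hab⟩ := (Cmp_Cn (T := T) (S := R) (x := x1)).touch hYS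
      ⟨y, mem_Cmp_self⟩ ⟨x1, mem_Cmp_self, fun h => d12 _ m1 (hYB h).1⟩
    refine ⟨a, ha, b, ?_, hab⟩
    rcases hSR hb with h | h
    · exact h
    · exact absurd (Cmp_step ha h hab) hba
  have e1 : ∀ w ∈ Y, w ∈ B2 ∧ w ≠ x2 := fun w hw => hYB hw
  refine hT.k33 {u} {v} Y B1 B3 {x2} (Cn.single _) (Cn.single _) Cmp_Cn h1 h3 (Cn.single _)
    ?_ ?_ ?_ ?_ ?_ ?_ ?_ ?_ ?_ ?_ ?_ ?_ ?_ ?_ ?_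
    ⟨u, rfl, x1, m1, u1⟩ ⟨u, rfl, x3, m3, u3⟩ ⟨u, rfl, x2, rfl, u2⟩
    ⟨v, rfl, x1, m1, v1⟩ ⟨v, rfl, x3, m3, v3⟩ ⟨v, rfl, x2, rfl, v2⟩
    t1 ⟨y, mem_Cmp_self, z, hz, hyz⟩ t2
  all_goals (clear_value Y S R; unfold Dj at *; grind)

theorem Tri0.three [Finite U] (hT : Tri0 T) {u v x1 x2 x3 : U} (huv : T.Adj u v)
    (u1 : T.Adj u x1) (u2 : T.Adj u x2) (u3 : T.Adj u x3)
    (v1 : T.Adj v x1) (v2 : T.Adj v x2) (v3 : T.Adj v x3)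
    (h12 : x1 ≠ x2) (h13 : x1 ≠ x3) (h23 : x2 ≠ x3) : False := by
  have a1 := u1.ne
  have a2 := u2.ne
  have a3 := u3.ne
  have a4 := v1.ne
  have a5 := v2.ne
  have a6 := v3.ne
  obtain ⟨B, h1, h2, h3, h4, h5⟩ := ext_lemma (T := T) (fun i : Fin 3 => ({![x1, x2, x3] i} : Set U))
    {y | y ≠ u ∧ y ≠ v ∧ y ≠ x1 ∧ y ≠ x2 ∧ y ≠ x3} (fun i => Cn.single _)
    (fun i j hij x hx hx' => by
      fin_cases i <;> fin_cases j <;> simp_all)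
    (fun i x hx hx' => by
      fin_cases i <;> simp_all)
    (fun S hS hn => by
      by_contra hc
      push Not at hc
      have := hT.h4 S u v u hn (fun s hs y hsy => by
        have h := hc s hs y hsy
        have h0 := h.1 0
        have h1 := h.1 1
        have h2 := h.1 2
        simp at h0 h1 h2
        have := h.2
        simp only [mem_ofPred_eq] at this
        tauto) x1
      have h6 : x1 ∉ S := fun h => (hS h).2.2.1 rfl
      grind)
  have b1 : x1 ∈ B 0 := h1 0 (by simp)
  have b2 : x2 ∈ B 1 := h1 1 (by simp)
  have b3 : x3 ∈ B 2 := h1 2 (by simp)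
  have hc : ∀ y, y = u ∨ y = v ∨ y ∈ B 0 ∨ y ∈ B 1 ∨ y ∈ B 2 := by
    intro y
    by_cases hy : y ≠ u ∧ y ≠ v ∧ y ≠ x1 ∧ y ≠ x2 ∧ y ≠ x3
    · obtain ⟨i, hi⟩ := h5 y hy
      fin_cases i <;> simp_all
    · grind
  have hu : ∀ i, u ∉ B i := fun i hi => by
    have := h2 i hi
    fin_cases i <;> simp_all
  have hv : ∀ i, v ∉ B i := fun i hi => by
    have := h2 i hi
    fin_cases i <;> simp_all
  have d01 := h4 0 1 (by simp)
  have d02 := h4 0 2 (by simp)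
  have d12 := h4 1 2 (by simp)
  by_cases t02 : Tch T (B 0) (B 2)
  swap
  · exact hT.three_aux huv.ne (h3 0) (h3 1) (h3 2) d01 d02 d12 hc ⟨hu 0, hu 1, hu 2⟩
      ⟨hv 0, hv 1, hv 2⟩ b1 b2 b3 u1 u2 u3 v1 v2 v3 t02
  by_cases t01 : Tch T (B 0) (B 1)
  swap
  · exact hT.three_aux huv.ne (h3 0) (h3 2) (h3 1) d02 d01 d12.symm (fun y => by
      have := hc y; tauto) ⟨hu 0, hu 2, hu 1⟩
      ⟨hv 0, hv 2, hv 1⟩ b1 b3 b2 u1 u3 u2 v1 v3 v2 t01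
  by_cases t12 : Tch T (B 1) (B 2)
  swap
  · exact hT.three_aux huv.ne (h3 1) (h3 0) (h3 2) d01.symm d12 d02 (fun y => by
      have := hc y; tauto) ⟨hu 1, hu 0, hu 2⟩
      ⟨hv 1, hv 0, hv 2⟩ b2 b1 b3 u2 u1 u3 v2 v1 v3 t12
  have s1 : ∀ i, Dj {u} (B i) := fun i x hx => by rw [mem_singleton_iff.1 hx]; exact hu i
  have s2 : ∀ i, Dj {v} (B i) := fun i x hx => by rw [mem_singleton_iff.1 hx]; exact hv i
  exact hT.k5 {u} {v} (B 0) (B 1) (B 2) (Cn.single _) (Cn.single _) (h3 0) (h3 1) (h3 2)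
    (fun x hx hx' => huv.ne (hx.symm.trans hx')) (s1 _) (s1 _) (s1 _) (s2 _) (s2 _) (s2 _)
    d01 d02 d12 ⟨u, rfl, v, rfl, huv⟩ ⟨u, rfl, x1, b1, u1⟩ ⟨u, rfl, x2, b2, u2⟩ ⟨u, rfl, x3, b3, u3⟩
    ⟨v, rfl, x1, b1, v1⟩ ⟨v, rfl, x2, b2, v2⟩ ⟨v, rfl, x3, b3, v3⟩ t01 t02 t12

/-- link graph -/
def Lnk (T : SimpleGraph U) (v : U) : SimpleGraph U where
  Adj x y := T.Adj v x ∧ T.Adj v y ∧ T.Adj x y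
  symm := ⟨fun x y h => ⟨h.2.1, h.1, h.2.2.symm⟩⟩
  loopless := ⟨fun x h => T.loopless.irrefl x h.2.2⟩

theorem Tri.lnk_cycles [Finite U] (hT : Tri T) (v : U) : (Lnk T v).IsCycles := by
  intro x hx
  obtain ⟨y, hy⟩ := hx
  have hvx : T.Adj v x := hy.1
  obtain ⟨p, q, hpq, h1, h2, h3, h4⟩ := hT.two v x hvx
  rw [Set.ncard_eq_two]
  refine ⟨p, q, hpq, ?_⟩
  ext z
  simp only [SimpleGraph.mem_neighborSet, mem_insert_iff, mem_singleton_iff]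
  constructor
  · intro hz
    by_contra hc
    push Not at hc
    exact hT.three hvx hz.2.1 h1 h3 hz.2.2 h2 h4 hc.1 hc.2 hpq
  · rintro (rfl | rfl)
    · exact ⟨hvx, h1, h2⟩
    · exact ⟨hvx, h3, h4⟩

theorem list_split2 {l : List U} {x y : U} (hx : x ∈ l) (hy : y ∈ l) (hxy : x ≠ y) :
    (∃ a b c, l = a ++ x :: b ++ y :: c) ∨ (∃ a b c, l = a ++ y :: b ++ x :: c) := by
  obtain ⟨a, b, rfl⟩ := List.append_of_mem hx
  rcases List.mem_append.1 hy with h | h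
  · obtain ⟨c, d, rfl⟩ := List.append_of_mem h
    right; exact ⟨c, d, b, by simp⟩
  · rcases List.mem_cons.1 h with h | h
    · exact absurd h.symm hxy
    · obtain ⟨c, d, rfl⟩ := List.append_of_mem h
      left; exact ⟨a, c, d, by simp⟩

theorem chain_tch {a b : List U} (h : (a ++ b).IsChain T.Adj) (ha : a ≠ []) (hb : b ≠ []) :
    Tch T {x | x ∈ a} {x | x ∈ b} := by
  rw [List.isChain_append] at h
  exact ⟨a.getLast ha, by simp, b.head hb, by simp,
    h.2.2 _ (by simp [List.getLast?_eq_getLast_of_ne_nil ha]) _ (by simp [List.head?_eq_some_head hb])⟩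

theorem nd3 {A B C : List U} (h : (A ++ B ++ C).Nodup) (w : U) :
    (w ∈ A → w ∉ B) ∧ (w ∈ A → w ∉ C) ∧ (w ∈ B → w ∉ C) := by
  simp only [List.nodup_append] at h
  grind

/-- the link of a vertex as a cyclic list -/
theorem Tri.link_list [Finite U] (hT : Tri T) {v x : U} (hvx : T.Adj v x) :
    ∃ s : List U, (x :: s).IsChain T.Adj ∧ (x :: s).Nodup ∧
      T.Adj ((x :: s).getLast (by simp)) x ∧ ∀ y, y ∈ x :: s ↔ T.Adj v y := by
  classical
  obtain ⟨p, q, hpq, h1, h2, h3, h4⟩ := hT.two v x hvx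
  obtain ⟨c, hc, hcs⟩ := (hT.lnk_cycles v).exists_cycle_toSubgraph_verts_eq_connectedComponentSupp
    (v := x) (c := (Lnk T v).connectedComponentMk x) rfl ⟨p, hvx, h1, h2⟩
  have hmem : ∀ y, y ∈ c.support ↔ (Lnk T v).Reachable y x := by
    intro y
    rw [← SimpleGraph.Walk.mem_verts_toSubgraph, hcs]
    simp
  set l := c.support.dropLast with hl
  have hnd : l.Nodup := by
    have := hc.support_nodup
    exact c.tail_support_perm_dropLast_support.nodup_iff.1 this
  have hne : ¬ c.Nil := hc.not_nil
  have hsup : c.support = l ++ [x] := by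
    rw [hl]
    conv_lhs => rw [← List.dropLast_append_getLast (l := c.support) (by simp)]
    simp
  have hchain : (l ++ [x]).IsChain (Lnk T v).Adj := hsup ▸ c.isChain_adj_support
  have hlne : l ≠ [] := by
    intro h0
    rw [h0] at hsup
    apply hne
    rw [SimpleGraph.Walk.nil_iff_support_eq]; simpa using hsup
  obtain ⟨s, hs⟩ : ∃ s, l = x :: s := by
    cases hl' : l with
    | nil => exact absurd hl' hlne
    | cons z s =>
      rw [hl'] at hsup
      have : c.support.head (by simp) = x := by simp
      simp [hsup] at this
      exact ⟨s, by rw [this]⟩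
  rw [hs] at hnd hsup hchain
  have hin : ∀ y, y ∈ x :: s ↔ (Lnk T v).Reachable y x := by
    intro y
    rw [← hmem, hsup]
    simp
    grind
  have hch := List.isChain_append.1 hchain
  have hTch : (x :: s).IsChain T.Adj := hch.1.imp fun a b h => h.2.2
  have hlast : (Lnk T v).Adj ((x :: s).getLast (by simp)) x :=
    hch.2.2 _ (by simp [List.getLast?_eq_getLast_of_ne_nil]) _ (by simp)
  have hv : ∀ y ∈ x :: s, T.Adj v y := by
    intro y hy
    rw [hin] at hy
    obtain ⟨w⟩ := hy
    cases w with
    | nil => exact hvx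
    | cons h _ => exact h.1
  refine ⟨s, hTch, hnd, hlast.2.2, fun y => ⟨hv y, fun hvy => ?_⟩⟩
  by_contra hyA
  have hstep : ∀ a ∈ x :: s, ∀ b, T.Adj v b → T.Adj a b → b ∈ x :: s := by
    intro a ha b hb hab
    rw [hin] at ha ⊢
    exact (SimpleGraph.Adj.reachable (G := Lnk T v) ⟨hb, hv a ((hin a).2 ha), hab.symm⟩).trans ha
  have hvA : v ∉ x :: s := fun h => T.loopless.irrefl v (hv v h)
  set R : Set U := {z | z ≠ v ∧ z ∉ x :: s} with hR
  set Q := Cmp T R y with hQ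
  have hyR : y ∈ R := ⟨fun h => T.loopless.irrefl v (h ▸ hvy), hyA⟩
  have hQR : Q ⊆ R := Cmp_sub hyR
  have hpm : p ∈ x :: s := hstep x (by simp) p h1 h2
  have hqm : q ∈ x :: s := hstep x (by simp) q h3 h4
  have hQN : ∀ a b, ∃ z ∈ x :: s, z ≠ a ∧ z ≠ b ∧ Tch T Q {z} := by
    intro a b
    by_contra hcon
    push Not at hcon
    have hu := hT.h4 Q v a b ⟨y, mem_Cmp_self⟩ (fun w hw z hwz => by
      by_cases hzR : z ∈ R
      · exact Or.inl (Cmp_step hw hzR hwz)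
      · by_cases hzv : z = v
        · exact Or.inr (Or.inl hzv)
        · have hz : z ∈ x :: s := by
            by_contra h; exact hzR ⟨hzv, h⟩
          by_contra hc
          push Not at hc
          exact hcon z hz hc.2.2.1 hc.2.2.2 ⟨w, hw, z, rfl, hwz⟩)
    have f : ∀ z ∈ x :: s, z = a ∨ z = b := by
      intro z hz
      rcases hu z with h | h | h
      · exact absurd hz (hQR h).2
      · exact absurd (h ▸ hz) hvA
      · exact h
    have fx := f x (by simp)
    have fp := f p hpm
    have fq := f q hqm
    have := h2.ne
    have := h4.ne
    grind
  obtain ⟨z1, hz1, -, -, t1⟩ := hQN v v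
  obtain ⟨z2, hz2, hz21, -, t2⟩ := hQN z1 z1
  obtain ⟨z3, hz3, hz31, hz32, t3⟩ := hQN z1 z2
  have main : ∀ z1 z2 z3 : U, ∀ a b c d : List U, x :: s = a ++ z1 :: b ++ z2 :: c ++ z3 :: d →
      Tch T Q {z1} → Tch T Q {z2} → Tch T Q {z3} → False := by
    intro z1 z2 z3 a b c d he t1 t2 t3
    have hvm : ∀ z, z ∈ x :: s → Tch T {v} {z} := fun z hz => ⟨v, rfl, z, rfl, hv z hz⟩
    have m1 := hvm z1 (by rw [he]; simp)
    have m2 := hvm z2 (by rw [he]; simp)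
    have m3 := hvm z3 (by rw [he]; simp)
    have hla : T.Adj ((a ++ z1 :: b ++ z2 :: c ++ z3 :: d).getLast (by simp))
        ((a ++ z1 :: b ++ z2 :: c ++ z3 :: d).head (by simp)) := by
      have h0 := hlast.2.2
      have e2 : (a ++ z1 :: b ++ z2 :: c ++ z3 :: d).head (by simp) = x := by
        simp only [← he]; rfl
      rw [e2]; simp only [← he]; exact h0
    have hmem' : ∀ z, z ∈ a ++ z1 :: b ++ z2 :: c ++ z3 :: d → z ≠ v ∧ z ∉ Q := by
      intro z hz
      rw [← he] at hz
      exact ⟨fun h => hvA (h ▸ hz), fun h => (hQR h).2 hz⟩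
    rw [he] at hTch hnd
    have hvQ : v ∉ Q := fun h => (hQR h).1 rfl
    have c1 : Cn T {w | w ∈ a ++ z1 :: b} := Cn.chain' (by simp) (hTch.left_of_append.left_of_append)
    have c2 : Cn T {w | w ∈ z2 :: c} := Cn.chain' (by simp) (hTch.left_of_append.right_of_append)
    have c3 : Cn T {w | w ∈ z3 :: d} := Cn.chain' (by simp) (hTch.right_of_append)
    have k12 : Tch T {w | w ∈ a ++ z1 :: b} {w | w ∈ z2 :: c} :=
      chain_tch hTch.left_of_append (by simp) (by simp)
    have k23 : Tch T {w | w ∈ z2 :: c} {w | w ∈ z3 :: d} :=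
      chain_tch (a := z2 :: c) (b := z3 :: d) (by
        have : a ++ z1 :: b ++ z2 :: c ++ z3 :: d = (a ++ z1 :: b) ++ (z2 :: c ++ z3 :: d) := by simp
        rw [this] at hTch; exact hTch.right_of_append) (by simp) (by simp)
    have k13 : Tch T {w | w ∈ a ++ z1 :: b} {w | w ∈ z3 :: d} := by
      refine Tch.symm ⟨_, ?_, _, ?_, hla⟩
      · rw [List.getLast_append_of_ne_nil _ (by simp)]
        exact List.getLast_mem _
      · have : (a ++ z1 :: b ++ z2 :: c ++ z3 :: d).head (by simp) = (a ++ z1 :: b).head (by simp) := by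
          simp only [List.append_assoc]
          cases a <;> simp
        rw [this]; exact List.head_mem _
    clear_value Q
    refine hT.k5 {v} Q {w | w ∈ a ++ z1 :: b} {w | w ∈ z2 :: c} {w | w ∈ z3 :: d}
      (Cn.single _) (hQ ▸ Cmp_Cn) c1 c2 c3 ?_ ?_ ?_ ?_ ?_ ?_ ?_ ?_ ?_ ?_
      ⟨v, rfl, y, hQ ▸ mem_Cmp_self, hvy⟩ (m1.mono le_rfl (by simp)) (m2.mono le_rfl (by simp))
      (m3.mono le_rfl (by simp))
      (t1.mono le_rfl (by simp)) (t2.mono le_rfl (by simp)) (t3.mono le_rfl (by simp)) k12 k13 k23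
    all_goals intro w hw hw'
    · exact hvQ (mem_singleton_iff.1 hw ▸ hw')
    · exact (hmem' w (List.mem_append_left _ (List.mem_append_left _ hw'))).1 hw
    · exact (hmem' w (List.mem_append_left _ (List.mem_append_right _ hw'))).1 hw
    · exact (hmem' w (List.mem_append_right _ hw')).1 hw
    · exact (hmem' w (List.mem_append_left _ (List.mem_append_left _ hw'))).2 hw
    · exact (hmem' w (List.mem_append_left _ (List.mem_append_right _ hw'))).2 hw
    · exact (hmem' w (List.mem_append_right _ hw')).2 hw
    · exact (nd3 hnd w).1 hw hw'
    · exact (nd3 hnd w).2.1 hw hw'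
    · exact (nd3 hnd w).2.2 hw hw'
  have srt : ∀ z1 z2 z3 : U, ∀ a b c : List U, x :: s = a ++ z1 :: b ++ z2 :: c → z3 ∈ x :: s →
      z3 ≠ z1 → z3 ≠ z2 → Tch T Q {z1} → Tch T Q {z2} → Tch T Q {z3} → False := by
    intro z1 z2 z3 a b c he h3 h31 h32 t1 t2 t3
    rw [he] at h3
    have : z3 ∈ a ∨ z3 ∈ b ∨ z3 ∈ c := by simp at h3; tauto
    rcases this with h | h | h
    · obtain ⟨d, e, rfl⟩ := List.append_of_mem h
      exact main z3 z1 z2 d e b c (by rw [he]; try simp) t3 t1 t2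
    · obtain ⟨d, e, rfl⟩ := List.append_of_mem h
      exact main z1 z3 z2 a d e c (by rw [he]; simp) t1 t3 t2
    · obtain ⟨d, e, rfl⟩ := List.append_of_mem h
      exact main z1 z2 z3 a b d e (by rw [he]; simp) t1 t2 t3
  rcases list_split2 hz1 hz2 hz21.symm with ⟨a, b, c, he⟩ | ⟨a, b, c, he⟩
  · exact srt z1 z2 z3 a b c he hz3 hz31 hz32 t1 t2 t3
  · exact srt z2 z1 z3 a b c he hz3 hz32 hz31 t2 t1 t3

end Abs2

section Abs3
variable {U : Type u} {T : SimpleGraph U}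

theorem split_first (P : U → Prop) : ∀ {l : List U}, (∃ x ∈ l, P x) →
    ∃ a x b, l = a ++ x :: b ∧ P x ∧ ∀ y ∈ a, ¬ P y := by
  intro l
  induction l with
  | nil => simp
  | cons z l ih =>
    intro h
    by_cases hz : P z
    · exact ⟨[], z, l, rfl, hz, by simp⟩
    · obtain ⟨a, x, b, h1, h2, h3⟩ := ih (by grind)
      grind
theorem split_last (P : U → Prop) : ∀ {l : List U}, (∃ x ∈ l, P x) →
    ∃ a x b, l = a ++ x :: b ∧ P x ∧ ∀ y ∈ b, ¬ P y := by
  intro l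
  induction l with
  | nil => simp
  | cons z l ih =>
    intro h
    by_cases hz : ∃ x ∈ l, P x
    · grind
    · exact ⟨[], z, l, rfl, by grind, by grind⟩

theorem Tri.lemN [Finite U] (hT : Tri T) {v : U} {M A B : Set U} (hM : Cn T M) (hB : Cn T B)
    (hA : A.Nonempty → Cn T A) (dMA : Dj M A) (dMB : Dj M B) (dAB : Dj A B)
    (vM : v ∉ M) (vA : v ∉ A) (vB : v ∉ B) (tM : Tch T {v} M) (tB : Tch T {v} B) (tMB : Tch T M B)
    (hN : ∀ m ∈ M, ∀ y, T.Adj m y → y ∈ M ∨ y = v ∨ y ∈ A ∨ y ∈ B) :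
    ∃ m ∈ M, ∃ b ∈ B, T.Adj v m ∧ T.Adj v b ∧ T.Adj m b := by
  obtain ⟨v', rfl, m, hm, hvm⟩ := tM
  obtain ⟨v, rfl, b0, hb0, hvb0⟩ := tB
  obtain ⟨s, hch, hnd, hlast, hmem⟩ := hT.link_list hvm
  have hb0s : b0 ∈ s := by
    grind
  obtain ⟨s0, β, s1, hs, hβ, hs0⟩ := split_first (· ∈ B) ⟨b0, hb0s, hb0⟩
  obtain ⟨t0, m', R1, ht, hm', hR1⟩ := split_last (l := m :: s0) (· ∈ M) ⟨m, by simp, hm⟩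
  obtain ⟨c, β', u1, hc, hβ', hu1⟩ := split_last (l := β :: s1) (· ∈ B) ⟨β, by simp, hβ⟩
  obtain ⟨R2, m'', w, hw, hm'', hR2⟩ := split_first (l := u1 ++ [m]) (· ∈ M) ⟨m, by simp, hm⟩
  have hch2 : (m :: s ++ [m]).IsChain T.Adj := by
    rw [List.isChain_append]
    grind
  have e1 : m :: s ++ [m] = t0 ++ (m' :: R1 ++ [β]) ++ (s1 ++ [m]) := by
    grind
  have e2 : m :: s ++ [m] = (m :: s0 ++ c) ++ (β' :: R2 ++ [m'']) ++ w := by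
    grind
  have k1 : (m' :: R1 ++ [β]).IsChain T.Adj := by
    rw [e1] at hch2; exact hch2.left_of_append.right_of_append
  have k2 : (β' :: R2 ++ [m'']).IsChain T.Adj := by
    rw [e2] at hch2; exact hch2.left_of_append.right_of_append
  have a1 : ∀ y ∈ m :: s0, T.Adj v y := fun y hy => (hmem y).1 (by rw [hs]; simp at hy ⊢; tauto)
  have a2 : ∀ y ∈ β :: s1, T.Adj v y := fun y hy => (hmem y).1 (by rw [hs]; simp at hy ⊢; tauto)
  have a3 : ∀ y ∈ u1 ++ [m], T.Adj v y := fun y hy => by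
    grind
  have vm' : T.Adj v m' := a1 _ (by rw [ht]; simp)
  have vβ : T.Adj v β := a2 _ (by simp)
  have vβ' : T.Adj v β' := a2 _ (by rw [hc]; simp)
  have vm'' : T.Adj v m'' := a3 _ (by rw [hw]; simp)
  have vR1 : ∀ y ∈ R1, T.Adj v y ∧ y ∉ M ∧ y ∉ B ∧ y ∈ s0 := fun y hy => by
    grind
  have vR2 : ∀ y ∈ R2, T.Adj v y ∧ y ∉ M ∧ y ∉ B ∧ y ∈ u1 := fun y hy => by
    grind
  have dR : ∀ y ∈ R1, y ∉ R2 := fun y h1 h2 => by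
    grind
  cases R1 with
  | nil =>
    simp at k1
    exact ⟨m', hm', β, hβ, vm', vβ, k1⟩
  | cons f1 R1 =>
  rcases List.eq_nil_or_concat R2 with rfl | ⟨R2, l2, rfl⟩
  · simp at k2
    exact ⟨m'', hm'', β', hβ', vm'', vβ', k2.symm⟩
  simp only [List.concat_eq_append] at *
  have j1 : T.Adj m' f1 := by simp at k1; exact k1.1
  have hlist1 : β' :: (R2 ++ [l2]) ++ [m''] = (β' :: R2) ++ [l2, m''] := by simp
  have j2 : T.Adj l2 m'' := by
    rw [hlist1] at k2
    simpa using k2.right_of_append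
  have f1A : f1 ∈ A := by
    have h := vR1 f1 (by simp)
    rcases hN m' hm' f1 j1 with h1 | h1 | h1 | h1
    · grind
    · exact absurd h.1 (h1 ▸ T.loopless.irrefl _)
    all_goals grind
  have l2A : l2 ∈ A := by
    have h := vR2 l2 (by simp)
    rcases hN m'' hm'' l2 j2.symm with h1 | h1 | h1 | h1
    · grind
    · exact absurd h.1 (h1 ▸ T.loopless.irrefl _)
    all_goals grind
  have c1 : Cn T {y | y ∈ f1 :: R1} := Cn.chain' (by simp) (by
    have : m' :: (f1 :: R1) ++ [β] = [m'] ++ (f1 :: R1) ++ [β] := by simp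
    rw [this] at k1
    exact k1.left_of_append.right_of_append)
  have c2 : Cn T {y | y ∈ R2 ++ [l2]} := Cn.chain' (by simp) (by
    have : β' :: (R2 ++ [l2]) ++ [m''] = [β'] ++ (R2 ++ [l2]) ++ [m''] := by simp
    rw [this] at k2
    exact k2.left_of_append.right_of_append)
  have t1 : Tch T {y | y ∈ f1 :: R1} B :=
    (chain_tch (a := f1 :: R1) (b := [β]) (by
      have : m' :: (f1 :: R1) ++ [β] = [m'] ++ ((f1 :: R1) ++ [β]) := by simp
      rw [this] at k1
      exact k1.right_of_append) (by simp) (by simp)).mono le_rfl (by simpa using hβ)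
  have t2 : Tch T {y | y ∈ R2 ++ [l2]} B :=
    (chain_tch (a := [β']) (b := R2 ++ [l2]) (by
      have : β' :: (R2 ++ [l2]) ++ [m''] = ([β'] ++ (R2 ++ [l2])) ++ [m''] := by simp
      rw [this] at k2
      exact k2.left_of_append) (by simp) (by simp)).symm.mono le_rfl (by simpa using hβ')
  have hAc := hA ⟨_, f1A⟩
  have hY : Cn T (A ∪ {y | y ∈ f1 :: R1} ∪ {y | y ∈ R2 ++ [l2]}) :=
    (hAc.union' c1 ⟨f1, f1A, by simp⟩).union' c2 ⟨l2, Or.inl l2A, by simp⟩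
  obtain ⟨A', A'', h1, h2, h3, h4, h5, h6, h7, h8⟩ := split_two hY c1 c2 dR
    (by intro y hy; exact Or.inl (Or.inr hy)) (by intro y hy; exact Or.inr hy)
  have hYp : ∀ y ∈ A ∪ {y | y ∈ f1 :: R1} ∪ {y | y ∈ R2 ++ [l2]}, y ≠ v ∧ y ∉ M ∧ y ∉ B := by
    rintro y ((h | h) | h)
    · grind
    · have := vR1 y h
      exact ⟨fun h' => T.loopless.irrefl v (h' ▸ this.1), this.2.1, this.2.2.1⟩
    · have := vR2 y h
      exact ⟨fun h' => T.loopless.irrefl v (h' ▸ this.1), this.2.1, this.2.2.1⟩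
  have g1 : f1 ∈ A' := h1 (by simp)
  have g2 : l2 ∈ A'' := h2 (by simp)
  exfalso
  exact hT.k5 {v} M B A' A'' (Cn.single _) hM hB h5 h6
    (fun x hx => by rw [mem_singleton_iff.1 hx]; exact vM)
    (fun x hx => by rw [mem_singleton_iff.1 hx]; exact vB)
    (fun x hx hx' => (hYp x (h3 hx')).1 hx) (fun x hx hx' => (hYp x (h4 hx')).1 hx)
    dMB (fun x hx hx' => (hYp x (h3 hx')).2.1 hx) (fun x hx hx' => (hYp x (h4 hx')).2.1 hx)
    (fun x hx hx' => (hYp x (h3 hx')).2.2 hx) (fun x hx hx' => (hYp x (h4 hx')).2.2 hx) h7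
    ⟨v, rfl, m, hm, hvm⟩ ⟨v, rfl, β, hβ, vβ⟩ ⟨v, rfl, f1, g1, (vR1 f1 (by simp)).1⟩
    ⟨v, rfl, l2, g2, (vR2 l2 (by simp)).1⟩ tMB
    ⟨m', hm', f1, g1, j1⟩ ⟨m'', hm'', l2, g2, j2.symm⟩ (t1.mono h1 le_rfl).symm
    (t2.mono h2 le_rfl).symm h8

end Abs3

section Abs4
variable {U : Type u} {T : SimpleGraph U}

def Nb (T : SimpleGraph U) (K S : Set U) : Set U := {v | v ∈ S ∧ ∃ k ∈ K, T.Adj k v}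

open Classical in
noncomputable def tc (T : SimpleGraph U) (K X : Set U) : ℕ := if Tch T K X then 1 else 0

noncomputable def nc (T : SimpleGraph U) (K S : Set U) : ℕ := (Nb T K S).ncard

theorem tc_le (K X : Set U) : tc T K X ≤ 1 := by unfold tc; split_ifs <;> simp
theorem tc_eq {K X : Set U} (h : Tch T K X) : tc T K X = 1 := by simp [tc, h]
theorem tc_zero {K X : Set U} (h : ¬ Tch T K X) : tc T K X = 0 := by simp [tc, h]
theorem tc_pos {K X : Set U} (h : 1 ≤ tc T K X) : Tch T K X := by
  by_contra hc; rw [tc_zero hc] at h; omega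
theorem tc_mono {K X K' X' : Set U} (h : K ⊆ K') (h' : X ⊆ X') : tc T K X ≤ tc T K' X' := by
  by_cases hc : Tch T K X
  · rw [tc_eq hc, tc_eq (hc.mo)]
  · rw [tc_zero hc]; omega
theorem tc_union (K X Y : Set U) : tc T K (X ∪ Y) ≤ tc T K X + tc T K Y := by
  by_cases hc : Tch T K (X ∪ Y)
  · obtain ⟨a, ha, b, hb | hb, h⟩ := hc
    · rw [tc_eq (X := X) ⟨a, ha, b, hb, h⟩]; have := tc_le (T := T) K (X ∪ Y); omega
    · rw [tc_eq (X := Y) ⟨a, ha, b, hb, h⟩]; have := tc_le (T := T) K (X ∪ Y); omega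
  · rw [tc_zero hc]; omega

theorem nc_mono [Finite U] {K S K' S' : Set U} (h : K ⊆ K') (h' : S ⊆ S') : nc T K S ≤ nc T K' S' :=
  Set.ncard_le_ncard (fun x ⟨hx, k, hk, hkx⟩ => ⟨h' hx, k, h hk, hkx⟩)
theorem nc_union [Finite U] (K S S' : Set U) : nc T K (S ∪ S') ≤ nc T K S + nc T K S' := by
  refine le_trans (Set.ncard_le_ncard (t := Nb T K S ∪ Nb T K S') ?_) (Set.ncard_union_le _ _)
  rintro x ⟨hx | hx, h⟩
  · exact Or.inl ⟨hx, h⟩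
  · exact Or.inr ⟨hx, h⟩
/-- only neighbours matter -/
theorem nc_sub [Finite U] {K S S' : Set U} (h : ∀ x ∈ S, ∀ k ∈ K, T.Adj k x → x ∈ S') :
    nc T K S ≤ nc T K S' :=
  Set.ncard_le_ncard (fun x ⟨hx, k, hk, hkx⟩ => ⟨h x hx k hk hkx, k, hk, hkx⟩)
theorem tc_sub {K S S' : Set U} (h : ∀ x ∈ S, ∀ k ∈ K, T.Adj k x → x ∈ S') :
    tc T K S ≤ tc T K S' := by
  by_cases hc : Tch T K S
  · obtain ⟨a, ha, b, hb, hab⟩ := hc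
    rw [tc_eq (X := S') ⟨a, ha, b, h b hb a ha hab, hab⟩]; exact tc_le _ _
  · rw [tc_zero hc]; omega
theorem nc_single [Finite U] (K : Set U) (x : U) : nc T K {x} ≤ tc T K {x} := by
  by_cases hc : Tch T K {x}
  · rw [tc_eq hc]
    have := Set.ncard_le_ncard (s := Nb T K {x}) (t := {x}) (fun y hy => hy.1)
    rwa [Set.ncard_singleton] at this
  · rw [tc_zero hc]
    have : Nb T K {x} = ∅ := by
      ext y; constructor
      · rintro ⟨hy, k, hk, hky⟩; exact hc ⟨k, hk, y, hy, hky⟩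
      · simp
    simp [nc, this]
theorem nc_zero [Finite U] {K S : Set U} (h : ¬ Tch T K S) : nc T K S = 0 := by
  have : Nb T K S = ∅ := by
    ext y; constructor
    · rintro ⟨hy, k, hk, hky⟩; exact h ⟨k, hk, y, hy, hky⟩
    · simp
  simp [nc, this]
theorem nc_pos [Finite U] {K S : Set U} (h : 1 ≤ nc T K S) : Tch T K S := by
  by_contra hc; rw [nc_zero hc] at h; omega
theorem nc_two [Finite U] {K S : Set U} (h : 2 ≤ nc T K S) :
    ∃ x ∈ S, ∃ y ∈ S, x ≠ y ∧ Tch T K {x} ∧ Tch T K {y} := by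
  obtain ⟨x, hx, y, hy, hxy⟩ := (Set.one_lt_ncard (s := Nb T K S)).1 (by unfold nc at h; omega)
  obtain ⟨hxS, k, hk, hkx⟩ := hx
  obtain ⟨hyS, k', hk', hky⟩ := hy
  exact ⟨x, hxS, y, hyS, hxy, ⟨k, hk, x, rfl, hkx⟩, ⟨k', hk', y, rfl, hky⟩⟩
theorem nc_pos_of [Finite U] {K S : Set U} (h : Tch T K S) : 1 ≤ nc T K S := by
  obtain ⟨k, hk, x, hx, h⟩ := h
  exact (Set.ncard_pos).2 ⟨x, hx, k, hk, h⟩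

/-- paths -/
structure Pth (T : SimpleGraph U) (D : Set U) (a b : U) (l : List U) : Prop where
  ch : l.IsChain T.Adj
  nd : l.Nodup
  hd : l.head? = some a
  lt : l.getLast? = some b
  sub : ∀ x ∈ l, x ∈ D

theorem Pth.ne {D : Set U} {a b : U} {l : List U} (h : Pth T D a b l) : l ≠ [] := by
  rintro rfl; have := h.hd; simp at this
theorem Pth.fst {D : Set U} {a b : U} {l : List U} (h : Pth T D a b l) : a ∈ l :=
  List.mem_of_mem_head? h.hd
theorem Pth.last {D : Set U} {a b : U} {l : List U} (h : Pth T D a b l) : b ∈ l :=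
  List.mem_of_mem_getLast? h.lt
theorem Pth.cn {D : Set U} {a b : U} {l : List U} (h : Pth T D a b l) : Cn T {x | x ∈ l} :=
  Cn.chain' h.ne h.ch
theorem Pth.mono {D D' : Set U} {a b : U} {l : List U} (h : Pth T D a b l) (hD : D ⊆ D') :
    Pth T D' a b l := ⟨h.ch, h.nd, h.hd, h.lt, fun x hx => hD (h.sub x hx)⟩
theorem Pth.snoc {D : Set U} {a b c : U} {l : List U} (h : Pth T D a b l) (hbc : T.Adj b c)
    (hc : c ∉ l) (hcD : c ∈ D) : Pth T D a c (l ++ [c]) := by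
  refine ⟨?_, ?_, ?_, by simp, ?_⟩
  · rw [List.isChain_append]
    refine ⟨h.ch, by simp, fun x hx y hy => ?_⟩
    rw [h.lt] at hx; simp at hx hy; subst hx hy; exact hbc
  · rw [List.nodup_append]; refine ⟨h.nd, by simp, ?_⟩
    grind
  · have := h.ne
    cases l with
    | nil => exact absurd rfl this
    | cons z l => have := h.hd; simpa using this
  · intro x hx; rcases List.mem_append.1 hx with hx | hx
    · exact h.sub x hx
    all_goals grind
theorem Pth.cons {D : Set U} {a b c : U} {l : List U} (h : Pth T D a b l) (hca : T.Adj c a)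
    (hc : c ∉ l) (hcD : c ∈ D) : Pth T D c b (c :: l) := by
  refine ⟨?_, ?_, by simp, ?_, ?_⟩
  · have := h.ne
    cases l with
    | nil => exact absurd rfl this
    | cons z l =>
      have := h.hd; simp at this; subst this
      exact List.isChain_cons_cons.2 ⟨hca, h.ch⟩
  · exact List.nodup_cons.2 ⟨hc, h.nd⟩
  · rw [List.getLast?_cons, h.lt]; simp
  · intro x hx; rcases List.mem_cons.1 hx with hx | hx
    · grind
    · exact h.sub x hx
theorem Pth.single {D : Set U} {a : U} (h : a ∈ D) : Pth T D a a [a] :=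
  ⟨by simp, by simp, by simp, by simp, by simpa using h⟩
theorem Pth.joined {D : Set U} {a b : U} {l : List U} (h : Pth T D a b l) : b ∈ Cmp T D a :=
  h.cn.sub_Cmp (fun x hx => h.sub x hx) h.fst h.last

/-- concatenation at a common vertex -/
theorem Pth.trans {D : Set U} {a b c : U} {l m : List U} (h : Pth T D a b l) (h' : Pth T D b c m)
    (hd : ∀ x ∈ l, x ∈ m → x = b) :
    ∃ n, Pth T D a c n ∧ ∀ x, x ∈ n ↔ x ∈ l ∨ x ∈ m := by
  have hm := h'.ne
  cases m with
  | nil => exact absurd rfl hm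
  | cons z m =>
    have hz := h'.hd; simp at hz; subst hz
    have hbm : z ∉ m := (List.nodup_cons.1 h'.nd).1
    refine ⟨l ++ m, ⟨?_, ?_, ?_, ?_, ?_⟩, ?_⟩
    · rw [List.isChain_append]
      have := h'.ch
      refine ⟨h.ch, ?_, fun x hx y hy => ?_⟩
      · exact (List.isChain_cons.1 this).2
      · rw [h.lt] at hx; simp at hx; subst hx
        exact (List.isChain_cons.1 this).1 y hy
    · rw [List.nodup_append]
      refine ⟨h.nd, (List.nodup_cons.1 h'.nd).2, ?_⟩
      grind
    · have := h.ne
      cases l with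
      | nil => exact absurd rfl this
      | cons z l => have := h.hd; simpa using this
    · have := h'.lt
      cases m with
      | nil => simpa using h.lt.trans (by simpa using this)
      | cons w m => simpa [List.getLast?_append] using this
    · intro x hx; rcases List.mem_append.1 hx with hx | hx
      · exact h.sub x hx
      · exact h'.sub x (List.mem_cons_of_mem _ hx)
    · intro x
      have := h.last
      grind
theorem Cn.addList {X : Set U} (hX : Cn T X) {p : List U} (hp : p.IsChain T.Adj)
    (h : p ≠ [] → Tch T X {x | x ∈ p}) : Cn T (X ∪ {x | x ∈ p}) := by
  by_cases hp0 : p = []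
  · subst hp0; simpa using hX
  · exact hX.union (Cn.chain' hp0 hp) (h hp0)

theorem Cn.addSet {X Y : Set U} (hX : Cn T X) 
    (h : Y.Nonempty → Cn T Y ∧ Tch T X Y) : Cn T (X ∪ Y) := by
  rcases Y.eq_empty_or_nonempty with rfl | hn
  · simpa using hX
  · exact hX.union (h hn).1 (h hn).2

theorem cmp_tch {D : Set U} {a b : U} (ha : a ∈ D) (hb : b ∈ D) (hab : a ≠ b) (hj : b ∈ Cmp T D a) :
    Tch T {b} (Cmp T (D \ {b}) a) := by
  have h1 : Cmp T (D \ {b}) a ⊆ D \ {b} := Cmp_sub ⟨ha, hab⟩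
  obtain ⟨x, hx, y, hy, hyx, hxy⟩ := (Cmp_Cn (T := T) (S := D) (x := a)).touch
    (Cmp_mono (T := T) (x := a) (sdiff_subset (s := D) (t := {b}))) ⟨a, mem_Cmp_self⟩ ⟨b, hj, fun h => (h1 h).2 rfl⟩
  by_cases hyb : y = b
  · exact ⟨b, rfl, x, hx, hyb ▸ hxy.symm⟩
  · exact absurd (Cmp_step hx ⟨Cmp_sub ha hy, hyb⟩ hxy) hyx

/-- configurations -/
structure Cfg (T : SimpleGraph U) (X1 X2 X3 D : Set U) (a b : U) : Prop where
  c1 : Cn T X1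
  c2 : Cn T X2
  c3 : Cn T X3
  d12 : Dj X1 X2
  d13 : Dj X1 X3
  d23 : Dj X2 X3
  e1 : Dj X1 D
  e2 : Dj X2 D
  e3 : Dj X3 D
  cov : ∀ y, y ∈ X1 ∨ y ∈ X2 ∨ y ∈ X3 ∨ y ∈ D
  t12 : Tch T X1 X2
  t13 : Tch T X1 X3
  t23 : Tch T X2 X3
  ha : a ∈ D
  hb : b ∈ D
  a1 : Tch T {a} X1
  a3 : Tch T {a} X3
  b1 : Tch T {b} X1
  b2 : Tch T {b} X2
  jn : b ∈ Cmp T D a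

def Good (T : SimpleGraph U) (X1 X2 X3 D : Set U) (l : List U) : Prop :=
  ∀ K, Cn T K → K ⊆ D → (∀ x ∈ K, x ∉ l) →
    tc T K X1 + tc T K X2 + tc T K X3 + nc T K {x | x ∈ l} ≤ 3

def TH (T : SimpleGraph U) (n : ℕ) : Prop :=
  ∀ X1 X2 X3 D a b, Cfg T X1 X2 X3 D a b → D.ncard < n → ∃ l, Pth T D a b l ∧ Good T X1 X2 X3 D l

theorem dj_single {x : U} {S : Set U} (h : x ∉ S) : Dj {x} S := by
  grind
theorem Cfg.k5P (hT : Tri T) {X1 X2 X3 D K : Set U} {a b : U} {l : List U} (c : Cfg T X1 X2 X3 D a b)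
    (hl : Pth T D a b l) (hK : Cn T K) (hKD : K ⊆ D) (hKl : ∀ x ∈ K, x ∉ l)
    (t1 : Tch T K X1) (t2 : Tch T K X2) (t3 : Tch T K X3) (tl : Tch T K {x | x ∈ l}) : False := by
  have sa : ({a} : Set U) ⊆ {x | x ∈ l} := by simpa using hl.fst
  have sb : ({b} : Set U) ⊆ {x | x ∈ l} := by simpa using hl.last
  have hs : {x | x ∈ l} ⊆ D := fun x hx => hl.sub x hx
  exact hT.k5 K X1 X2 X3 {x | x ∈ l} hK c.c1 c.c2 c.c3 hl.cn
    (fun x hx hx' => c.e1 x hx' (hKD hx)) (fun x hx hx' => c.e2 x hx' (hKD hx))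
    (fun x hx hx' => c.e3 x hx' (hKD hx)) hKl c.d12 c.d13
    (fun x hx hx' => c.e1 x hx (hs hx')) c.d23 (fun x hx hx' => c.e2 x hx (hs hx'))
    (fun x hx hx' => c.e3 x hx (hs hx'))
    t1 t2 t3 tl c.t12 c.t13 (c.a1.mo).symm c.t23 (c.b2.mo).symm
    (c.a3.mo).symm

theorem Cfg.eq_case [Finite U] (hT : Tri T) {X1 X2 X3 D : Set U} {a : U} (c : Cfg T X1 X2 X3 D a a) :
    ∃ l, Pth T D a a l ∧ Good T X1 X2 X3 D l := by
  refine ⟨[a], Pth.single c.ha, fun K hK hKD hKl => ?_⟩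
  by_contra hc
  have h1 := tc_le (T := T) K X1
  have h2 := tc_le (T := T) K X2
  have h3 := tc_le (T := T) K X3
  have h4 := nc_single (T := T) K a
  have h5 := tc_le (T := T) K {a}
  have e : {x | x ∈ [a]} = ({a} : Set U) := by ext; simp
  have hc' := hc
  rw [e] at hc'
  refine c.k5P hT (Pth.single c.ha) hK hKD hKl (tc_pos ?_) (tc_pos ?_) (tc_pos ?_) (e ▸ nc_pos ?_) <;> omega

/-- semi-good path -/
def SG (T : SimpleGraph U) (X1 X2 X3 D : Set U) (l : List U) : Prop :=
  ∀ K, Cn T K → K ⊆ D → (∀ x ∈ K, x ∉ l) →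
    tc T K X1 + tc T K (X2 ∪ X3) + nc T K {x | x ∈ l} ≤ 3

theorem Cfg.sg [Finite U] (hT : Tri T) {X1 X2 X3 D : Set U} {a b : U} (c : Cfg T X1 X2 X3 D a b)
    (hab : a ≠ b) (ih : TH T D.ncard) : ∃ l, Pth T D a b l ∧ SG T X1 X2 X3 D l := by
  have hM : Cmp T (D \ {b}) a ⊆ D \ {b} := Cmp_sub ⟨c.ha, hab⟩
  have h23 : Cn T (X2 ∪ X3) := c.c2.union c.c3 c.t23
  have dd : Dj (X2 ∪ X3) (D \ {b}) := fun x hx hx' => hx.elim (fun h => c.e2 x h hx'.1) (fun h => c.e3 x h hx'.1)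
  have bX : b ∉ X2 ∪ X3 := fun h => h.elim (fun h => c.e2 b h c.hb) (fun h => c.e3 b h c.hb)
  have bX1 : b ∉ X1 := fun h => c.e1 b h c.hb
  have d1 : Dj X1 (X2 ∪ X3) := fun x hx hx' => hx'.elim (fun h => c.d12 x hx h) (fun h => c.d13 x hx h)
  obtain ⟨b', hb', β, hβ, h1, h2, h3⟩ := hT.lemN (v := b) (M := Cmp T (D \ {b}) a) (A := X1) (B := X2 ∪ X3)
    Cmp_Cn h23 (fun _ => c.c1) (fun x hx hx' => c.e1 x hx' (hM hx).1)
    (fun x hx hx' => dd x hx' (hM hx)) d1 (fun h => (hM h).2 rfl) bX1 bX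
    (cmp_tch c.ha c.hb hab c.jn) (c.b2.mo)
    (c.a3.mono (by simpa using mem_Cmp_self) subset_union_right)
    (fun m hm y hy => by
      by_cases hyb : y = b
      · grind
      rcases c.cov y with h | h | h | h
      · grind
      · grind
      · grind
      · exact Or.inl (Cmp_step hm ⟨h, hyb⟩ hy))
  have c' : Cfg T (X2 ∪ X3) {b} X1 (D \ {b}) a b' :=
    { c1 := h23, c2 := Cn.single _, c3 := c.c1, d12 := (dj_single bX).symm, d13 := d1.symm
      d23 := dj_single bX1, e1 := dd, e2 := dj_single (fun h => h.2 rfl)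
      e3 := fun x hx hx' => c.e1 x hx hx'.1
      cov := fun y => by have := c.cov y; by_cases y = b <;> simp_all <;> tauto
      t12 := (c.b2.mo).symm
      t13 := (c.t12.mo).symm
      t23 := c.b1, ha := ⟨c.ha, hab⟩, hb := hM hb'
      a1 := c.a3.mo, a3 := c.a1
      b1 := ⟨b', rfl, β, hβ, h3⟩, b2 := ⟨b', rfl, b, rfl, h1.symm⟩, jn := hb' }
  obtain ⟨l, hl, hg⟩ := ih _ _ _ _ _ _ c' (Set.ncard_sdiff_singleton_lt_of_mem c.hb)
  refine ⟨l ++ [b], (hl.mono sdiff_subset).snoc h1.symm (fun h => (hl.sub b h).2 rfl) c.hb, ?_⟩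
  intro K hK hKD hKl
  have := hg K hK (fun x hx => ⟨hKD hx, fun h => hKl x hx (by simp at h; simp [h])⟩) (fun x hx h => hKl x hx (by simp [h]))
  have e : {x | x ∈ l ++ [b]} = {x | x ∈ l} ∪ {b} := by ext; simp; tauto
  rw [e]
  have h6 := nc_union (T := T) K {x | x ∈ l} {b}
  have h7 := nc_single (T := T) K b
  omega

/-- data of a bad component -/
structure BadC (T : SimpleGraph U) (X1 X2 X3 D C : Set U) (p1 p2 p3 : List U) (k1 k2 : U) : Prop where
  cn : Cn T C
  sub : C ⊆ D
  dj : ∀ x ∈ C, x ∉ p1 ++ k1 :: p2 ++ k2 :: p3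
  t2 : Tch T C X2
  t3 : Tch T C X3
  tk1 : Tch T C {k1}
  tk2 : Tch T C {k2}
  nb : ∀ c ∈ C, ∀ y, T.Adj c y → y ∈ C ∨ y ∈ X2 ∨ y ∈ X3 ∨ y = k1 ∨ y = k2

theorem Cfg.bad [Finite U] (hT : Tri T) {X1 X2 X3 D : Set U} {a b : U} (c : Cfg T X1 X2 X3 D a b)
    {l : List U} (hl : Pth T D a b l) (hsg : SG T X1 X2 X3 D l) (hng : ¬ Good T X1 X2 X3 D l) :
    ∃ C p1 p2 p3 k1 k2, l = p1 ++ k1 :: p2 ++ k2 :: p3 ∧ BadC T X1 X2 X3 D C p1 p2 p3 k1 k2 := by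
  unfold Good at hng
  push Not at hng
  obtain ⟨K, hK, hKD, hKl, hs⟩ := hng
  obtain ⟨x, hx⟩ := hK.1
  set C := Cmp T (D \ {x | x ∈ l}) x with hC
  have hKC : K ⊆ C := hK.sub_Cmp (fun y hy => ⟨hKD hy, hKl y hy⟩) hx
  have hCs : C ⊆ D \ {x | x ∈ l} := Cmp_sub ⟨hKD hx, hKl x hx⟩
  have hCn : Cn T C := Cmp_Cn
  clear_value C
  have m1 := tc_mono (T := T) hKC (le_refl X1)
  have m2 := tc_mono (T := T) hKC (le_refl X2)
  have m3 := tc_mono (T := T) hKC (le_refl X3)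
  have m4 := nc_mono (T := T) hKC (le_refl {x | x ∈ l})
  have n1 := tc_le (T := T) C X1
  have n2 := tc_le (T := T) C X2
  have n3 := tc_le (T := T) C X3
  have g := hsg C hCn (fun y hy => (hCs hy).1) (fun y hy => (hCs hy).2)
  have g2 := tc_mono (T := T) (le_refl C) (subset_union_left (s := X2) (t := X3))
  have g3 := tc_mono (T := T) (le_refl C) (subset_union_right (s := X2) (t := X3))
  have t2 : Tch T C X2 := tc_pos (by omega)
  have t3 : Tch T C X3 := tc_pos (by omega)
  have e2 := tc_eq t2
  have e3 := tc_eq t3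
  have e1 : ¬ Tch T C X1 := by
    intro h
    have := tc_eq h
    exact c.k5P hT hl hCn (fun y hy => (hCs hy).1) (fun y hy => (hCs hy).2) h t2 t3 (nc_pos (by omega))
  have e1' := tc_zero e1
  have hn : nc T C {x | x ∈ l} = 2 := by omega
  obtain ⟨k1, k2, hkk, hNb⟩ := Set.ncard_eq_two.1 hn
  have hcl : ∀ c' ∈ C, ∀ y, T.Adj c' y → y ∈ C ∨ y ∈ X2 ∨ y ∈ X3 ∨ y = k1 ∨ y = k2 := by
    intro c' hc' y hy
    rcases c.cov y with h | h | h | h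
    · exact absurd ⟨c', hc', y, h, hy⟩ e1
    · grind
    · grind
    · by_cases hyl : y ∈ l
      · have : y ∈ Nb T C {x | x ∈ l} := ⟨hyl, c', hc', hy⟩
        grind
      · left
        rw [hC] at hc' ⊢
        exact Cmp_step hc' ⟨h, hyl⟩ hy
  have hk1 : k1 ∈ Nb T C {x | x ∈ l} := by rw [hNb]; simp
  have hk2 : k2 ∈ Nb T C {x | x ∈ l} := by rw [hNb]; simp
  obtain ⟨hk1l, w1, hw1, hwk1⟩ := hk1
  obtain ⟨hk2l, w2, hw2, hwk2⟩ := hk2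
  rcases list_split2 hk1l hk2l hkk with ⟨p1, p2, p3, he⟩ | ⟨p1, p2, p3, he⟩
  · exact ⟨C, p1, p2, p3, k1, k2, he, hCn, fun y hy => (hCs hy).1, fun y hy => he ▸ (hCs hy).2,
      t2, t3, ⟨w1, hw1, k1, rfl, hwk1⟩, ⟨w2, hw2, k2, rfl, hwk2⟩, hcl⟩
  · exact ⟨C, p1, p2, p3, k2, k1, he, hCn, fun y hy => (hCs hy).1, fun y hy => he ▸ (hCs hy).2,
      t2, t3, ⟨w2, hw2, k2, rfl, hwk2⟩, ⟨w1, hw1, k1, rfl, hwk1⟩, fun c' hc' y hy => by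
        have := hcl c' hc' y hy; tauto⟩

end Abs4

section Abs5
variable {U : Type u} {T : SimpleGraph U}

theorem bad_small [Finite U] {X1 X2 X3 D C : Set U} {p1 p2 p3 : List U} {a b k1 k2 : U}
    (hl : Pth T D a b (p1 ++ k1 :: p2 ++ k2 :: p3)) (hC : BadC T X1 X2 X3 D C p1 p2 p3 k1 k2)
    (h : ¬ D ⊆ C ∪ {k1, k2}) : (C ∪ {k1, k2}).ncard < D.ncard := by
  refine Set.ncard_lt_ncard ⟨?_, h⟩
  rintro x (hx | rfl | rfl)
  · exact hC.sub hx
  · exact hl.sub _ (by simp)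
  · exact hl.sub _ (by simp)

theorem bad_two {X1 X2 X3 D C : Set U} {p1 p2 p3 : List U} {a b k1 k2 : U}
    (hl : Pth T D a b (p1 ++ k1 :: p2 ++ k2 :: p3)) (hC : BadC T X1 X2 X3 D C p1 p2 p3 k1 k2)
    (h : D ⊆ C ∪ {k1, k2}) : p1 = [] ∧ p2 = [] ∧ p3 = [] := by
  have h1 : ∀ x ∈ p1 ++ k1 :: p2 ++ k2 :: p3, x = k1 ∨ x = k2 := by
    intro x hx
    rcases h (hl.sub x hx) with h | h | h
    · exact absurd hx (hC.dj x h)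
    all_goals grind
  have hn := hl.nd
  have e : ∀ p : List U, (∀ x ∈ p, False) → p = [] := fun p hp => List.eq_nil_iff_forall_not_mem.2 hp
  have hn2 : ∀ x ∈ p1 ++ p2 ++ p3, x ≠ k1 ∧ x ≠ k2 := by
    grind
  refine ⟨e _ fun x hx => ?_, e _ fun x hx => ?_, e _ fun x hx => ?_⟩
  all_goals
    have a1 := h1 x (by simp [hx])
    have a2 := hn2 x (by simp [hx])
    tauto

theorem Cfg.sg2 [Finite U] (hT : Tri T) {X1 X2 X3 D : Set U} {a b : U} (c : Cfg T X1 X2 X3 D a b)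
    (hab : a ≠ b) (ih : TH T D.ncard) :
    (∃ l, Pth T D a b l ∧ Good T X1 X2 X3 D l) ∨
    ∃ C p1 p2 p3 k1 k2, Pth T D a b (p1 ++ k1 :: p2 ++ k2 :: p3) ∧
      BadC T X1 X2 X3 D C p1 p2 p3 k1 k2 ∧ (C ∪ {k1, k2}).ncard < D.ncard := by
  obtain ⟨l, hl, hsg⟩ := c.sg hT hab ih
  by_cases hg : Good T X1 X2 X3 D l
  · grind
  obtain ⟨C, p1, p2, p3, k1, k2, rfl, hC⟩ := c.bad hT hl hsg hg
  by_cases hD : D ⊆ C ∪ {k1, k2}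
  swap
  · exact Or.inr ⟨C, p1, p2, p3, k1, k2, hl, hC, bad_small hl hC hD⟩
  obtain ⟨rfl, rfl, rfl⟩ := bad_two hl hC hD
  have h1 := hl.hd
  have h2 := hl.lt
  simp at h1 h2
  subst h1 h2
  have adj : T.Adj k1 k2 := by simpa using hl.ch
  have kC1 : k1 ∉ C := fun h => hC.dj _ h (by simp)
  have kC2 : k2 ∉ C := fun h => hC.dj _ h (by simp)
  set XX := X1 ∪ (X2 ∪ X3) with hXX
  have XXm : ∀ y, y ∈ XX ↔ y ∈ X1 ∨ y ∈ X2 ∨ y ∈ X3 := fun y => Iff.rfl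
  have cX : Cn T XX := c.c1.union (c.c2.union c.c3 c.t23) (c.t12.mo)
  have dX : Dj XX D := by
    have e1 := c.e1; have e2 := c.e2; have e3 := c.e3
    grind
  have s1 : X1 ⊆ XX := subset_union_left
  have s2 : X2 ⊆ XX := fun x hx => Or.inr (Or.inl hx)
  have s3 : X3 ⊆ XX := fun x hx => Or.inr (Or.inr hx)
  clear_value XX
  have dCX : Dj C XX := fun x hx hx' => dX x hx' (hC.sub hx)
  have nb : ∀ m ∈ C, ∀ y, T.Adj m y → y ∈ C ∨ y = k1 ∨ y = k2 ∨ y ∈ XX := by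
    intro m hm y hy
    have := hC.nb m hm y hy
    grind
  obtain ⟨a', ha', α, hα, p1, p2, p3⟩ := hT.lemN (v := k1) (M := C) (A := {k2}) (B := XX) hC.cn cX
    (fun _ => Cn.single _) (dj_single kC2).symm dCX (dj_single fun h => dX _ h c.hb)
    kC1 (by simpa using adj.ne) (fun h => dX _ h c.ha) hC.tk1.symm (c.a1.mo)
    (hC.t2.mo) (fun m hm y hy => by have := nb m hm y hy; simp; tauto)
  obtain ⟨b', hb', β, hβ, q1, q2, q3⟩ := hT.lemN (v := k2) (M := C) (A := {k1}) (B := XX) hC.cn cX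
    (fun _ => Cn.single _) (dj_single kC1).symm dCX (dj_single fun h => dX _ h c.ha)
    kC2 (by simpa using adj.ne.symm) (fun h => dX _ h c.hb) hC.tk2.symm (c.b1.mo)
    (hC.t2.mo) (fun m hm y hy => by have := nb m hm y hy; simp; tauto)
  have c' : Cfg T XX {k2} {k1} C a' b' :=
    { c1 := cX, c2 := Cn.single _, c3 := Cn.single _, d12 := (dj_single fun h => dX _ h c.hb).symm
      d13 := (dj_single fun h => dX _ h c.ha).symm, d23 := dj_single (by simpa using adj.ne.symm)
      e1 := dCX.symm, e2 := dj_single kC2, e3 := dj_single kC1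
      cov := fun y => by
        have := c.cov y
        grind
      t12 := (c.b1.mo).symm
      t13 := (c.a1.mo).symm
      t23 := ⟨k2, rfl, k1, rfl, adj.symm⟩, ha := ha', hb := hb'
      a1 := ⟨a', rfl, α, hα, p3⟩, a3 := ⟨a', rfl, k1, rfl, p1.symm⟩
      b1 := ⟨b', rfl, β, hβ, q3⟩, b2 := ⟨b', rfl, k2, rfl, q1.symm⟩
      jn := hC.cn.sub_Cmp le_rfl ha' hb' }
  obtain ⟨l, hl', hg'⟩ := ih _ _ _ _ _ _ c' (Set.ncard_lt_ncard ⟨hC.sub, fun h => kC1 (h c.ha)⟩)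
  have hP : Pth T D k1 k2 (k1 :: l ++ [k2]) :=
    ((hl'.mono hC.sub).cons p1 (fun h => kC1 (hl'.sub _ h)) c.ha).snoc q1.symm
      (by intro h; simp at h; rcases h with h | h
          · exact adj.ne h.symm
          · exact kC2 (hl'.sub _ h)) c.hb
  have hsg' : SG T X1 X2 X3 D (k1 :: l ++ [k2]) := by
    intro K hK hKD hKl
    have hKC : K ⊆ C := fun x hx => by
      grind
    have := hg' K hK hKC (fun x hx h => hKl x hx (by simp [h]))
    have h1 : tc T K X1 = 0 := tc_zero (by
      rintro ⟨x, hx, y, hy, h⟩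
      have e := hC.nb x (hKC hx) y h
      have e1 := c.e1 y hy
      have e2 := c.d12 y hy
      have e3 := c.d13 y hy
      have e4 := fun h => hC.sub (a := y) h
      have e5 := c.ha
      have e6 := c.hb
      grind)
    have h2 : tc T K (X2 ∪ X3) ≤ tc T K XX := tc_mono le_rfl (union_subset s2 s3)
    have e : {x | x ∈ k1 :: l ++ [k2]} = {x | x ∈ l} ∪ {k1} ∪ {k2} := by grind
    rw [e]
    have h6 := nc_union (T := T) K ({x | x ∈ l} ∪ {k1}) {k2}
    have h7 := nc_union (T := T) K {x | x ∈ l} {k1}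
    have h8 := nc_single (T := T) K k1
    have h9 := nc_single (T := T) K k2
    omega
  by_cases hg2 : Good T X1 X2 X3 D (k1 :: l ++ [k2])
  · grind
  obtain ⟨C', r1, r2, r3, j1, j2, he, hC'⟩ := c.bad hT hP hsg' hg2
  rw [he] at hP
  refine Or.inr ⟨C', r1, r2, r3, j1, j2, hP, hC', bad_small hP hC' fun hD' => ?_⟩
  obtain ⟨rfl, rfl, rfl⟩ := bad_two hP hC' hD'
  have := hl'.ne
  have h3 := congrArg List.length he
  simp at h3
  exact this h3

/-- Θ2 -/
theorem th2 [Finite U] (hT : Tri T) {A Z D : Set U} {s t : U} (cA : Cn T A) (cZ : Cn T Z)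
    (dAZ : Dj A Z) (dA : Dj A D) (dZ : Dj Z D) (cov : ∀ y, y ∈ A ∨ y ∈ Z ∨ y ∈ D) (tAZ : Tch T A Z)
    (hs : s ∈ D) (ht : t ∈ D) (sA : Tch T {s} A) (sZ : Tch T {s} Z) (tA : Tch T {t} A)
    (tZ : Tch T {t} Z) (jn : t ∈ Cmp T D s) {n : ℕ} (ih : TH T n) (hn : D.ncard < n) :
    ∃ l, Pth T D s t l ∧ ∀ K, Cn T K → K ⊆ D → (∀ x ∈ K, x ∉ l) →
      tc T K A + tc T K Z + nc T K {x | x ∈ l} ≤ 3 := by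
  by_cases hst : s = t
  · subst hst
    refine ⟨[s], Pth.single hs, fun K hK hKD hKl => ?_⟩
    have h1 := tc_le (T := T) K A
    have h2 := tc_le (T := T) K Z
    have h4 := nc_single (T := T) K s
    have h5 := tc_le (T := T) K {s}
    have e : {x | x ∈ [s]} = ({s} : Set U) := by ext; simp
    grind
  have hj : s ∈ Cmp T D t := Cmp_Cn.sub_Cmp (Cmp_sub hs) jn mem_Cmp_self
  have hM : Cmp T (D \ {s}) t ⊆ D \ {s} := Cmp_sub ⟨ht, Ne.symm hst⟩
  obtain ⟨s', hs', β, hβ, h1, h2, h3⟩ := hT.lemN (v := s) (M := Cmp T (D \ {s}) t) (A := Z) (B := A)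
    Cmp_Cn cA (fun _ => cZ) (fun x hx hx' => dZ x hx' (hM hx).1)
    (fun x hx hx' => dA x hx' (hM hx).1) dAZ.symm (fun h => (hM h).2 rfl) (fun h => dZ _ h hs)
    (fun h => dA _ h hs) (cmp_tch ht hs (Ne.symm hst) hj) sA
    (tA.mono (by simpa using mem_Cmp_self) le_rfl)
    (fun m hm y hy => by
      by_cases hyb : y = s
      · grind
      rcases cov y with h | h | h
      · grind
      · grind
      · exact Or.inl (Cmp_step hm ⟨h, hyb⟩ hy))
  have c' : Cfg T A Z {s} (D \ {s}) s' t :=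
    { c1 := cA, c2 := cZ, c3 := Cn.single _, d12 := dAZ, d13 := (dj_single fun h => dA _ h hs).symm
      d23 := (dj_single fun h => dZ _ h hs).symm, e1 := fun x hx h => dA x hx h.1
      e2 := fun x hx h => dZ x hx h.1, e3 := dj_single (fun h => h.2 rfl)
      cov := fun y => by have := cov y; by_cases y = s <;> simp_all
      t12 := tAZ, t13 := sA.symm, t23 := sZ.symm, ha := hM hs', hb := ⟨ht, Ne.symm hst⟩
      a1 := ⟨s', rfl, β, hβ, h3⟩, a3 := ⟨s', rfl, s, rfl, h1.symm⟩, b1 := tA, b2 := tZ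
      jn := Cmp_Cn.sub_Cmp hM hs' mem_Cmp_self }
  obtain ⟨l, hl, hg⟩ := ih _ _ _ _ _ _ c' (lt_of_le_of_lt (Set.ncard_le_ncard sdiff_subset) hn)
  refine ⟨s :: l, (hl.mono sdiff_subset).cons h1 (fun h => (hl.sub s h).2 rfl) hs, ?_⟩
  intro K hK hKD hKl
  have := hg K hK (fun x hx => ⟨hKD hx, fun h => hKl x hx (by simp at h; simp [h])⟩) (fun x hx h => hKl x hx (by simp [h]))
  have e : {x | x ∈ s :: l} = {x | x ∈ l} ∪ {s} := by ext; simp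
  rw [e]
  have h6 := nc_union (T := T) K {x | x ∈ l} {s}
  have h7 := nc_single (T := T) K s
  omega

end Abs5

section Abs6
variable {U : Type u} {T : SimpleGraph U}

structure SplF (T : SimpleGraph U) (D : Set U) (a b : U) (p1 p3 : List U) (k1 k2 : U) : Prop where
  c1 : p1.IsChain T.Adj
  c3 : p3.IsChain T.Adj
  n1 : p1 ≠ [] → a ∈ p1 ∧ Tch T {k1} {x | x ∈ p1}
  n3 : p3 ≠ [] → b ∈ p3 ∧ Tch T {k2} {x | x ∈ p3}
  z1 : p1 = [] → k1 = a
  z3 : p3 = [] → k2 = b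
  s1 : ∀ x ∈ p1, x ∈ D
  s3 : ∀ x ∈ p3, x ∈ D
  m1 : k1 ∈ D
  m2 : k2 ∈ D
  ne : k1 ≠ k2
  d1 : ∀ x ∈ p1, x ≠ k1 ∧ x ≠ k2 ∧ x ∉ p3
  d3 : ∀ x ∈ p3, x ≠ k1 ∧ x ≠ k2
  P1 : Pth T D a k1 (p1 ++ [k1])
  P3 : Pth T D k2 b (k2 :: p3)

theorem Pth.spl {D : Set U} {a b k1 k2 : U} {p1 p2 p3 : List U}
    (h : Pth T D a b (p1 ++ k1 :: p2 ++ k2 :: p3)) : SplF T D a b p1 p3 k1 k2 := by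
  have e1 : p1 ++ k1 :: p2 ++ k2 :: p3 = (p1 ++ [k1]) ++ (p2 ++ k2 :: p3) := by simp
  have e2 : p1 ++ k1 :: p2 ++ k2 :: p3 = (p1 ++ k1 :: p2) ++ (k2 :: p3) := by simp
  have C1 : (p1 ++ [k1]).IsChain T.Adj := (e1 ▸ h.ch).left_of_append
  have C3 : (k2 :: p3).IsChain T.Adj := (e2 ▸ h.ch).right_of_append
  have N := h.nd
  have hd1 : (p1 ++ [k1]).head? = some a := by
    have := h.hd
    grind
  have hl3 : (k2 :: p3).getLast? = some b := by
    have := h.lt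
    grind
  have D1 : ∀ x ∈ p1, x ≠ k1 ∧ x ≠ k2 ∧ x ∉ p3 := by
    grind
  have D3 : ∀ x ∈ p3, x ≠ k1 ∧ x ≠ k2 := by
    grind
  refine ⟨C1.left_of_append, (List.isChain_cons.1 C3).2, fun hp => ⟨?_, ?_⟩, fun hp => ⟨?_, ?_⟩, ?_, ?_,
    fun x hx => h.sub x (by simp [hx]), fun x hx => h.sub x (by simp [hx]), h.sub _ (by simp),
    h.sub _ (by simp), ?_, D1, D3, ⟨C1, ?_, hd1, by simp, fun x hx => h.sub x ?_⟩,
    ⟨C3, ?_, by simp, hl3, fun x hx => h.sub x ?_⟩⟩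
  · rw [List.head?_append_of_ne_nil _ hp] at hd1; exact List.mem_of_mem_head? hd1
  · exact (chain_tch C1 hp (by simp)).symm.mo
  · grind
  · exact (chain_tch (a := [k2]) C3 (by simp) hp).mo
  · grind
  · grind
  · grind
  · grind
  · grind
  · grind
  · grind
theorem Cfg.k1X3 [Finite U] (hT : Tri T) {X1 X2 X3 D C : Set U} {a b k1 k2 : U} {p1 p2 p3 : List U}
    (c : Cfg T X1 X2 X3 D a b) (f : SplF T D a b p1 p3 k1 k2)
    (hC : BadC T X1 X2 X3 D C p1 p2 p3 k1 k2) : Tch T {k1} X3 := by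
  have kC : k1 ∉ C ∧ k2 ∉ C := ⟨fun h => hC.dj _ h (by simp), fun h => hC.dj _ h (by simp)⟩
  have pC : ∀ x ∈ C, x ∉ p1 ∧ x ∉ p3 := fun x hx => by
    have := hC.dj x hx; simp at this; tauto
  have sp : ∀ {x : U} {p : List U}, x ∈ p → ({x} : Set U) ⊆ {y | y ∈ p} := by
    grind
  have hB : Cn T (X3 ∪ X1 ∪ {x | x ∈ p1}) := (c.c3.union c.c1 c.t13.symm).addList f.c1
    (fun hp => (c.a1.mono (sp (f.n1 hp).1) subset_union_right).symm)
  have hA : Cn T ({k2} ∪ {x | x ∈ p3} ∪ X2) := ((Cn.single k2).addList f.c3 (fun hp => (f.n3 hp).2)).union c.c2 (by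
    refine c.b2.mono ?_ le_rfl
    by_cases hp : p3 = []
    · rw [f.z3 hp]; exact subset_union_left
    · exact (sp (f.n3 hp).1).trans subset_union_right)
  obtain ⟨m, hm, β, hβ, h1, h2, h3⟩ := hT.lemN (v := k1) (M := C) (A := {k2} ∪ {x | x ∈ p3} ∪ X2)
    (B := X3 ∪ X1 ∪ {x | x ∈ p1}) hC.cn hB (fun _ => hA)
    (by have := hC.sub; have := c.e2; have := c.e1; have := c.e3; unfold Dj at *; clear hC; intro x hx hx'; have := pC x hx; simp at hx'; grind)
    (by have := hC.sub; have := c.e2; have := c.e1; have := c.e3; unfold Dj at *; clear hC; intro x hx hx'; have := pC x hx; simp at hx'; grind)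
    (by have := f.d1; have := f.s1; have := f.s3; have := f.m2; have := c.e2; have := c.e1; have := c.e3; have := c.d12; have := c.d23
        unfold Dj at *; clear hC; intro x hx hx'; simp at hx hx'; grind)
    kC.1
    (by have := f.d3; have := f.m1; have := c.e2; have := f.ne; unfold Dj at *; simp; grind)
    (by have := f.d1; have := f.m1; have := c.e1; have := c.e3; unfold Dj at *; simp; grind)
    hC.tk1.symm
    (by by_cases hp : p1 = []
        · rw [f.z1 hp]; exact c.a3.mo
        · exact (f.n1 hp).2.mo)
    (hC.t3.mo)
    (fun m hm y hy => by
      have := hC.nb m hm y hy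
      simp; tauto)
  refine ⟨k1, rfl, β, ?_, h2⟩
  have e := hC.nb m hm β h3
  have e1 := c.e1 β
  have e2 := c.d12 β
  have e3 := c.d13 β
  have e4 := c.e3 β
  have e5 := fun h => hC.sub (a := β) h
  have e6 := f.m1
  have e7 := f.m2
  have e8 := f.d1 β
  have e9 := f.s1 β
  have e10 := c.e2 β
  have e11 := pC β
  simp at hβ
  clear hC hA hB pC
  grind

theorem Cfg.symm {X1 X2 X3 D : Set U} {a b : U} (c : Cfg T X1 X2 X3 D a b) : Cfg T X1 X3 X2 D b a :=
  ⟨c.c1, c.c3, c.c2, c.d13, c.d12, c.d23.symm, c.e1, c.e3, c.e2, fun y => by have := c.cov y; tauto,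
    c.t13, c.t12, c.t23.symm, c.hb, c.ha, c.b1, c.b2, c.a1, c.a3,
    Cmp_Cn.sub_Cmp (Cmp_sub c.ha) c.jn mem_Cmp_self⟩

theorem Pth.rev {D : Set U} {a b : U} {l : List U} (h : Pth T D a b l) : Pth T D b a l.reverse :=
  ⟨by rw [List.isChain_reverse]; exact h.ch.imp fun x y h => h.symm,
    by simpa using h.nd, by simpa using h.lt, by simpa using h.hd, fun x hx => h.sub x (by simpa using hx)⟩

theorem Cfg.k2X2 [Finite U] (hT : Tri T) {X1 X2 X3 D C : Set U} {a b k1 k2 : U} {p1 p2 p3 : List U}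
    (c : Cfg T X1 X2 X3 D a b) (hP : Pth T D a b (p1 ++ k1 :: p2 ++ k2 :: p3))
    (hC : BadC T X1 X2 X3 D C p1 p2 p3 k1 k2) : Tch T {k2} X2 := by
  have h' := hP.rev
  have e : (p1 ++ k1 :: p2 ++ k2 :: p3).reverse = p3.reverse ++ k2 :: p2.reverse ++ k1 :: p1.reverse := by simp
  rw [e] at h'
  have hC' : BadC T X1 X3 X2 D C p3.reverse p2.reverse p1.reverse k2 k1 :=
    ⟨hC.cn, hC.sub, fun x hx => by rw [← e, List.mem_reverse]; exact hC.dj x hx, hC.t3, hC.t2, hC.tk2, hC.tk1,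
      fun c' hc y hy => by have := hC.nb c' hc y hy; tauto⟩
  exact c.symm.k1X3 hT h'.spl hC'

theorem ext3 [Finite U] {A1 A2 A3 R : Set U} (c1 : Cn T A1) (c2 : Cn T A2) (c3 : Cn T A3)
    (d12 : Dj A1 A2) (d13 : Dj A1 A3) (d23 : Dj A2 A3) (r1 : Dj A1 R) (r2 : Dj A2 R) (r3 : Dj A3 R)
    (h : ∀ S ⊆ R, S.Nonempty → ∃ s ∈ S, ∃ y, T.Adj s y ∧ y ∉ S ∧ (y ∈ A1 ∨ y ∈ A2 ∨ y ∈ A3 ∨ y ∈ R)) :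
    ∃ B1 B2 B3, A1 ⊆ B1 ∧ A2 ⊆ B2 ∧ A3 ⊆ B3 ∧ B1 ⊆ A1 ∪ R ∧ B2 ⊆ A2 ∪ R ∧ B3 ⊆ A3 ∪ R ∧
      Cn T B1 ∧ Cn T B2 ∧ Cn T B3 ∧ Dj B1 B2 ∧ Dj B1 B3 ∧ Dj B2 B3 ∧
      ∀ x ∈ R, x ∈ B1 ∨ x ∈ B2 ∨ x ∈ B3 := by
  obtain ⟨B, h1, h2, h3, h4, h5⟩ := ext_lemma (T := T) (fun i : Fin 3 => (![A1, A2, A3] i : Set U)) R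
    (fun i => by fin_cases i; exacts [c1, c2, c3])
    (fun i j hij => by
      fin_cases i <;> fin_cases j
      exacts [absurd rfl hij, d12, d13, d12.symm, absurd rfl hij, d23, d13.symm, d23.symm, absurd rfl hij])
    (fun i => by fin_cases i; exacts [r1, r2, r3])
    (fun S hS hn => by
      obtain ⟨s, hs, y, hy, hyS, h | h | h | h⟩ := h S hS hn
      · exact ⟨s, hs, y, hy, Or.inl ⟨0, h⟩⟩
      · exact ⟨s, hs, y, hy, Or.inl ⟨1, h⟩⟩
      · exact ⟨s, hs, y, hy, Or.inl ⟨2, h⟩⟩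
      · exact ⟨s, hs, y, hy, Or.inr ⟨h, hyS⟩⟩)
  refine ⟨B 0, B 1, B 2, h1 0, h1 1, h1 2, h2 0, h2 1, h2 2, h3 0, h3 1, h3 2, h4 _ _ (by simp),
    h4 _ _ (by simp), h4 _ _ (by simp), fun x hx => ?_⟩
  obtain ⟨i, hi⟩ := h5 x hx
  fin_cases i
  exacts [Or.inl hi, Or.inr (Or.inl hi), Or.inr (Or.inr hi)]

/-- a nonempty set with at most three outer neighbours is everything else -/
theorem Tri.esc [Finite U] (hT : Tri T) {S : Set U} (x1 x2 x3 : U) (hn : S.Nonempty)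
    {z : U} (hz : z ∉ S) (h1 : z ≠ x1) (h2 : z ≠ x2) (h3 : z ≠ x3) :
    ∃ s ∈ S, ∃ y, T.Adj s y ∧ y ∉ S ∧ y ≠ x1 ∧ y ≠ x2 ∧ y ≠ x3 := by
  by_contra hc
  push Not at hc
  have := hT.h4 S x1 x2 x3 hn (fun s hs y hsy => by
    by_cases h : y ∈ S
    · exact Or.inl h
    by_cases e1 : y = x1
    · tauto
    by_cases e2 : y = x2
    · tauto
    have := hc s hs y hsy h e1 e2
    tauto) z
  tauto

theorem Cfg.top [Finite U] (hT : Tri T) {X1 X2 X3 D C : Set U} {a b k1 k2 : U} {p1 p2 p3 : List U}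
    (c : Cfg T X1 X2 X3 D a b) (hP : Pth T D a b (p1 ++ k1 :: p2 ++ k2 :: p3))
    (hC : BadC T X1 X2 X3 D C p1 p2 p3 k1 k2) (hcard : (C ∪ {k1, k2}).ncard < D.ncard)
    (ih : TH T D.ncard) :
    ∃ l, Pth T (C ∪ {k1, k2}) k1 k2 l ∧ Good T X1 X2 X3 C l := by
  have f := hP.spl
  have h13 := c.k1X3 hT f hC
  have h22 := c.k2X2 hT hP hC
  have kC : k1 ∉ C ∧ k2 ∉ C := ⟨fun h => hC.dj _ h (by simp), fun h => hC.dj _ h (by simp)⟩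
  have pC : ∀ x ∈ C, x ∉ p1 ∧ x ∉ p3 := fun x hx => by
    have := hC.dj x hx; simp at this; tauto
  have sp : ∀ {x : U} {p : List U}, x ∈ p → ({x} : Set U) ⊆ {y | y ∈ p} := by
    grind
  set Y1 := X1 ∪ {x | x ∈ p1} ∪ {x | x ∈ p3} with hY1
  have Y1m : ∀ y, y ∈ Y1 ↔ y ∈ X1 ∨ y ∈ p1 ∨ y ∈ p3 := fun y => by rw [hY1]; simp [or_assoc]
  have cY1 : Cn T Y1 := (c.c1.addList f.c1 (fun hp => (c.a1.mono (sp (f.n1 hp).1) le_rfl).symm)).addList f.c3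
    (fun hp => (c.b1.mono (sp (f.n3 hp).1) subset_union_left).symm)
  clear_value Y1
  have cl : ∀ y, (y ∈ X1 → y ∉ X2 ∧ y ∉ X3 ∧ y ∉ D) ∧ (y ∈ X2 → y ∉ X3 ∧ y ∉ D) ∧ (y ∈ X3 → y ∉ D) ∧
      (y ∈ C → y ∈ D ∧ y ∉ p1 ∧ y ∉ p3 ∧ y ≠ k1 ∧ y ≠ k2) ∧ (y ∈ p1 → y ∈ D ∧ y ∉ p3 ∧ y ≠ k1 ∧ y ≠ k2) ∧
      (y ∈ p3 → y ∈ D ∧ y ≠ k1 ∧ y ≠ k2) ∧ (y = k1 → y ∈ D) ∧ (y = k2 → y ∈ D) := by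
    intro y
    refine ⟨fun h => ⟨c.d12 y h, c.d13 y h, c.e1 y h⟩, fun h => ⟨c.d23 y h, c.e2 y h⟩, c.e3 y,
      fun h => ⟨hC.sub h, (pC y h).1, (pC y h).2, fun h' => kC.1 (h' ▸ h), fun h' => kC.2 (h' ▸ h)⟩,
      fun h => ⟨f.s1 y h, (f.d1 y h).2.2, (f.d1 y h).1, (f.d1 y h).2.1⟩, fun h => ⟨f.s3 y h, f.d3 y h⟩,
      fun h => h ▸ f.m1, fun h => h ▸ f.m2⟩
  set R : Set U := {y | y ∈ D ∧ y ∉ C ∧ y ≠ k1 ∧ y ≠ k2 ∧ y ∉ p1 ∧ y ∉ p3} with hR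
  have Rm : ∀ y, y ∈ R ↔ y ∈ D ∧ y ∉ C ∧ y ≠ k1 ∧ y ≠ k2 ∧ y ∉ p1 ∧ y ∉ p3 := fun y => Iff.rfl
  clear_value R
  have cov := c.cov
  have nb := hC.nb
  have dd : Dj Y1 X2 ∧ Dj Y1 X3 ∧ Dj Y1 R ∧ Dj X2 R ∧ Dj X3 R := by
    clear cov hC hP c f hT ih nb
    unfold Dj
    grind
  obtain ⟨x, hx⟩ := c.c1.1
  obtain ⟨B1, B2, B3, b0, b1, b2, s0, s1, s2, e1, e2, e3, f1, f2, f3, h5⟩ := ext3 (R := R) cY1 c.c2 c.c3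
    dd.1 dd.2.1 c.d23 dd.2.2.1 dd.2.2.2.1 dd.2.2.2.2
    (fun S hS hn => by
      have h1 := (cl x).1 hx
      obtain ⟨s, hs, y, hy, hyS, g1, g2, g3⟩ := hT.esc (S := S) k1 k2 k1 hn (z := x)
        (fun h => h1.2.2 ((Rm x).1 (hS h)).1)
        (fun h => h1.2.2 (h ▸ f.m1)) (fun h => h1.2.2 (h ▸ f.m2)) (fun h => h1.2.2 (h ▸ f.m1))
      refine ⟨s, hs, y, hy, hyS, ?_⟩
      have k1 := cov y
      have k2 := Y1m y
      have k3 := Rm y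
      have k5 := (Rm s).1 (hS hs)
      have k6 := cl s
      have k7 := nb y
      have k8 := hy.symm
      clear hC hP c f hT ih nb cov dd cl hcard
      grind)
  have bX1 : X1 ⊆ B1 := fun x hx => b0 ((Y1m x).2 (Or.inl hx))
  have bp1 : {x | x ∈ p1} ⊆ B1 := fun x hx => b0 ((Y1m x).2 (Or.inr (Or.inl hx)))
  have bp3 : {x | x ∈ p3} ⊆ B1 := fun x hx => b0 ((Y1m x).2 (Or.inr (Or.inr hx)))
  have bd : Dj B1 (C ∪ {k1, k2}) ∧ Dj B2 (C ∪ {k1, k2}) ∧ Dj B3 (C ∪ {k1, k2}) := by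
    refine ⟨fun y hy hy' => ?_, fun y hy hy' => ?_, fun y hy hy' => ?_⟩
    · have g1 := s0 hy; have g2 := cl y; have g3 := Rm y; have g4 := Y1m y
      grind
    · have g1 := s1 hy; have g2 := cl y; have g3 := Rm y
      grind
    · have g1 := s2 hy; have g2 := cl y; have g3 := Rm y
      grind
  have c' : Cfg T B1 B2 B3 (C ∪ {k1, k2}) k1 k2 :=
    { c1 := e1, c2 := e2, c3 := e3, d12 := f1, d13 := f2, d23 := f3, e1 := bd.1, e2 := bd.2.1, e3 := bd.2.2
      cov := fun y => by
        grind
      t12 := c.t12.mo, t13 := c.t13.mo, t23 := c.t23.mo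
      ha := by simp, hb := by simp
      a1 := by
        by_cases hp : p1 = []
        · rw [f.z1 hp]; exact c.a1.mo
        · exact (f.n1 hp).2.mo
      a3 := h13.mo
      b1 := by
        by_cases hp : p3 = []
        · rw [f.z3 hp]; exact c.b1.mo
        · exact (f.n3 hp).2.mo
      b2 := h22.mo
      jn := by
        have hc3 : Cn T (C ∪ {k1} ∪ {k2}) := (hC.cn.union (Cn.single _) hC.tk1).union (Cn.single _)
          (hC.tk2.mo)
        refine hc3.sub_Cmp ?_ (by simp) (by simp)
        intro x; simp only [mem_union, mem_insert_iff, mem_singleton_iff]; exact or_assoc.1 }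
  obtain ⟨l, hl, hg⟩ := ih _ _ _ _ _ _ c' hcard
  refine ⟨l, hl, fun K hK hKC hKl => ?_⟩
  have := hg K hK (hKC.trans subset_union_left) hKl
  have q1 := tc_mono (T := T) (le_refl K) bX1
  have q2 := tc_mono (T := T) (le_refl K) b1
  have q3 := tc_mono (T := T) (le_refl K) b2
  omega

end Abs6

section Abs7
variable {U : Type u} {T : SimpleGraph U}

/-- the state after peeling off the leg -/
structure Stp (T : SimpleGraph U) (X1 X2 X3 C M W : Set U) (a b k1 k2 : U) : Prop where
  c1 : Cn T X1
  c2 : Cn T X2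
  c3 : Cn T X3
  cC : Cn T C
  cM : Cn T (X1 ∪ X3 ∪ M)
  cov : ∀ y, y ∈ X1 ∨ y ∈ X2 ∨ y ∈ X3 ∨ y ∈ C ∨ y ∈ M ∨ y ∈ W
  cl : ∀ y, (y ∈ X1 → y ∉ X2 ∧ y ∉ X3 ∧ y ∉ C ∧ y ∉ M ∧ y ∉ W) ∧
    (y ∈ X2 → y ∉ X3 ∧ y ∉ C ∧ y ∉ M ∧ y ∉ W) ∧ (y ∈ X3 → y ∉ C ∧ y ∉ M ∧ y ∉ W) ∧
    (y ∈ C → y ∉ M ∧ y ∉ W) ∧ (y ∈ M → y ∉ W)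
  t12 : Tch T X1 X2
  t13 : Tch T X1 X3
  t23 : Tch T X2 X3
  tC2 : Tch T C X2
  tC3 : Tch T C X3
  nC : ∀ c ∈ C, ∀ y, T.Adj c y → y ∈ C ∨ y ∈ X2 ∨ y ∈ X3 ∨ y = k1 ∨ y = k2
  aM : a ∈ M
  k1M : k1 ∈ M
  k2W : k2 ∈ W
  bW : b ∈ W
  a1 : Tch T {a} X1
  a3 : Tch T {a} X3
  b1 : Tch T {b} X1
  b2 : Tch T {b} X2
  k13 : Tch T {k1} X3
  k1C : Tch T {k1} C
  k2C : Tch T {k2} C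
  k2M : Tch T {k2} (X1 ∪ X3 ∪ M)
  jM : k1 ∈ Cmp T M a
  jW : b ∈ Cmp T W k2
  m1 : ∀ w ∈ W, w ≠ k2 → Tch T {w} (X1 ∪ X3 ∪ M) → b ∉ Cmp T (W \ {w}) k2
  m2 : Cn T (X2 ∪ C ∪ W)

theorem Cfg.stp [Finite U] (hT : Tri T) {X1 X2 X3 D C : Set U} {a b k1 k2 : U} {p1 p2 p3 : List U}
    (c : Cfg T X1 X2 X3 D a b) (hP : Pth T D a b (p1 ++ k1 :: p2 ++ k2 :: p3))
    (hC : BadC T X1 X2 X3 D C p1 p2 p3 k1 k2) :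
    ∃ M W, D = C ∪ M ∪ W ∧ Stp T X1 X2 X3 C M W a b k1 k2 := by
  have f := hP.spl
  have h13 := c.k1X3 hT f hC
  have kC : k1 ∉ C ∧ k2 ∉ C := ⟨fun h => hC.dj _ h (by simp), fun h => hC.dj _ h (by simp)⟩
  have pC : ∀ x ∈ C, x ∉ p1 ∧ x ∉ p3 := fun x hx => by
    have := hC.dj x hx; simp at this; tauto
  have sp : ∀ {x : U} {p : List U}, x ∈ p → ({x} : Set U) ⊆ {y | y ∈ p} := by
    grind
  set fam : Set (Set U) := {M | M ⊆ D \ C ∧ Cn T (X1 ∪ X3 ∪ M) ∧ k2 ∉ M ∧ b ∈ Cmp T ((D \ C) \ M) k2} with hf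
  have h0 : {x | x ∈ p1 ++ [k1]} ∈ fam := by
    refine ⟨fun x hx => ⟨f.P1.sub x hx, fun h => ?_⟩, ?_, fun h => ?_, ?_⟩
    · grind
    · exact (c.c1.union c.c3 c.t13).addList f.P1.ch (fun _ => (c.a1.mono (sp f.P1.fst) subset_union_left).symm)
    · have h1 := f.d1 k2; have h2 := f.ne; simp at h; grind
    · refine (Pth.mono (D := (D \ C) \ {x | x ∈ p1 ++ [k1]}) ⟨f.P3.ch, f.P3.nd, f.P3.hd, f.P3.lt, fun x hx => ?_⟩ le_rfl).joined
      have h1 := pC x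
      have h2 := f.P3.sub x hx
      have h3 := f.d1 x
      have h4 := f.d3 x
      have h5 := f.ne
      grind
  obtain ⟨M, hM0, hM, hmax⟩ := (Set.toFinite fam).exists_le_maximal h0
  obtain ⟨g1, g2, g3, g4⟩ := hM
  set W := (D \ C) \ M with hW
  have Wm : ∀ y, y ∈ W ↔ y ∈ D ∧ y ∉ C ∧ y ∉ M := fun y => by rw [hW]; simp [and_assoc]
  have Mm : ∀ y ∈ M, y ∈ D ∧ y ∉ C := fun y hy => g1 hy
  have k2W : k2 ∈ W := (Wm _).2 ⟨f.m2, kC.2, g3⟩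
  have bW : b ∈ W := Cmp_sub k2W g4
  have m1 : ∀ w ∈ W, w ≠ k2 → Tch T {w} (X1 ∪ X3 ∪ M) → b ∉ Cmp T (W \ {w}) k2 := by
    intro w hw hwk ht hb
    have h1 : M ∪ {w} ∈ fam := by
      refine ⟨?_, ?_, ?_, ?_⟩
      · grind
      · rw [← union_assoc]; exact g2.union (Cn.single _) ht.symm
      · grind
      · rwa [← sdiff_sdiff, ← hW]
    grind
  have cov : ∀ y, y ∈ X1 ∨ y ∈ X2 ∨ y ∈ X3 ∨ y ∈ C ∨ y ∈ M ∨ y ∈ W := by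
    intro y
    have h1 := c.cov y
    grind
  have c2C := c.c2.union hC.cn hC.t2.symm
  have m2 : Cn T (X2 ∪ C ∪ W) := by
    refine c2C.extend fun S hS hn => ?_
    by_contra hc
    push Not at hc
    have hk : k2 ∉ S := fun h => by
      obtain ⟨x, hx, y, rfl, hxy⟩ := hC.tk2
      exact (hc y h x hxy.symm).1 (Or.inr hx)
    have hX2 : ∀ s ∈ S, ∀ y, T.Adj s y → y ∉ S → y ∈ X1 ∪ X3 ∪ M := by
      grind
    obtain ⟨x, hx⟩ := c.c1.1
    have hxD := c.e1 x hx
    obtain ⟨s, hs, y, hy, hyS, -⟩ := hT.esc (S := S) k2 k2 k2 hn (z := x) (fun h => hxD ((Wm x).1 (hS h)).1)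
      (fun h => hxD (h ▸ f.m2)) (fun h => hxD (h ▸ f.m2)) (fun h => hxD (h ▸ f.m2))
    refine m1 s (hS hs) (fun h => hk (h ▸ hs)) ⟨s, rfl, y, hX2 s hs y hy hyS, hy⟩ ?_
    refine (Cmp_Cn (T := T) (S := W) (x := k2)).sub_Cmp ?_ mem_Cmp_self g4
    intro z hz
    refine ⟨Cmp_sub k2W hz, fun h => ?_⟩
    have hzS : z ∈ S := by grind
    exact hk ((Cmp_Cn (T := T) (S := W) (x := k2)).sub_of_closed ⟨z, hz, hzS⟩ (fun u hu v hv huv =>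
      (hc u hu v huv).2 (Cmp_sub k2W hv)) mem_Cmp_self)
  have p1M : ∀ x ∈ p1 ++ [k1], x ∈ M := fun x hx => hM0 hx
  have k1M : k1 ∈ M := p1M _ (by simp)
  have k2M : Tch T {k2} (X1 ∪ X3 ∪ M) := by
    obtain ⟨m, hm, β, hβ, q1, q2, q3⟩ := hT.lemN (v := k2) (M := C) (A := X2)
      (B := X1 ∪ X3 ∪ M ∪ {x | x ∈ p3}) hC.cn
      (g2.addList f.c3 (fun hp => (c.b1.mono (sp (f.n3 hp).1) (subset_union_left.trans subset_union_left)).symm))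
      (fun _ => c.c2) (fun x hx hx' => c.e2 x hx' (hC.sub hx))
      (fun x hx hx' => by
        have e1 := c.e1 x; have e2 := c.e3 x; have e3 := Mm x; have e4 := pC x; have e5 := hC.sub hx
        simp at hx'
        clear hC hP c f hT hmax
        grind)
      (fun x hx hx' => by
        have e1 := c.d12 x; have e2 := c.d23 x; have e3 := Mm x; have e4 := f.s3 x; have e5 := c.e2 x
        simp at hx'
        clear hC hP c f hT hmax
        grind)
      kC.2 (fun h => c.e2 _ h f.m2)
      (fun hx' => by
        have e1 := c.e1 k2; have e2 := c.e3 k2; have e3 := f.d3 k2; have e4 := f.m2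
        simp at hx'
        clear hC hP c f hT hmax
        grind)
      hC.tk2.symm
      (by by_cases hp : p3 = []
          · rw [f.z3 hp]; exact c.b1.mono le_rfl (fun x hx => Or.inl (Or.inl (Or.inl hx)))
          · exact (f.n3 hp).2.mo)
      (hC.t3.mono le_rfl (fun x hx => Or.inl (Or.inl (Or.inr hx))))
      (fun m hm y hy => by
        have := hC.nb m hm y hy
        simp only [mem_union]
        rcases this with h | h | h | rfl | h
        exacts [Or.inl h, Or.inr (Or.inr (Or.inl h)), Or.inr (Or.inr (Or.inr (Or.inl (Or.inl (Or.inr h))))),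
          Or.inr (Or.inr (Or.inr (Or.inl (Or.inr k1M)))), Or.inr (Or.inl h)])
    refine ⟨k2, rfl, β, ?_, q2⟩
    rcases hβ with h | h
    · exact h
    rcases hC.nb m hm β q3 with h' | h' | h' | rfl | rfl
    · grind
    · exact absurd (f.s3 β h) (c.e2 β h')
    · grind
    · exact Or.inr k1M
    · exact absurd rfl (f.d3 _ h).2
  refine ⟨M, W, ?_, ?_⟩
  · ext y
    have h1 := Wm y; have h2 := Mm y; have h3 := hC.sub (a := y)
    grind
  · exact { c1 := c.c1, c2 := c.c2, c3 := c.c3, cC := hC.cn, cM := g2, cov := cov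
            cl := fun y => by
              have h1 := c.d12 y; have h2 := c.d13 y; have h3 := c.e1 y; have h4 := c.d23 y
              have h5 := c.e2 y; have h6 := c.e3 y; have h7 := Mm y; have h8 := Wm y; have h9 := hC.sub (a := y)
              clear_value W
              clear * - h1 h2 h3 h4 h5 h6 h7 h8 h9
              refine ⟨?_, ?_, ?_, ?_, ?_⟩ <;> grind
            t12 := c.t12, t13 := c.t13, t23 := c.t23, tC2 := hC.t2, tC3 := hC.t3, nC := hC.nb, aM := p1M _ f.P1.fst
            k1M := k1M, k2W := k2W, bW := bW, a1 := c.a1, a3 := c.a3, b1 := c.b1, b2 := c.b2, k13 := h13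
            k1C := hC.tk1.symm, k2C := hC.tk2.symm, k2M := k2M
            jM := (Pth.mk (D := M) f.P1.ch f.P1.nd f.P1.hd f.P1.lt p1M).joined
            jW := g4, m1 := m1, m2 := m2 }

end Abs7

section Abs8
variable {U : Type u} {T : SimpleGraph U}

structure Leg (T : SimpleGraph U) (X1 X2 X3 C M W : Set U) (a b k1 k2 : U) (P Q : List U) : Prop
    extends Stp T X1 X2 X3 C M W a b k1 k2 where
  hP : Pth T M a k1 P
  hQ : Pth T W k2 b Q
  gP : Good T X3 (X2 ∪ C ∪ W) X1 M P
  gQ : ∀ K, Cn T K → K ⊆ W → (∀ x ∈ K, x ∉ Q) →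
      tc T K (X2 ∪ C) + tc T K (X1 ∪ X3 ∪ M) + nc T K {x | x ∈ Q} ≤ 3

theorem Stp.leg [Finite U] (hT : Tri T) {X1 X2 X3 C M W : Set U} {a b k1 k2 : U}
    (s : Stp T X1 X2 X3 C M W a b k1 k2) {n : ℕ} (ih : TH T n) (hn : (C ∪ M ∪ W).ncard ≤ n) :
    ∃ P Q, Leg T X1 X2 X3 C M W a b k1 k2 P Q := by
  have cov := s.cov
  have cl := s.cl
  have hM : M.ncard < n := lt_of_lt_of_le (Set.ncard_lt_ncard (t := C ∪ M ∪ W) ⟨fun x hx => Or.inl (Or.inr hx),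
    fun h => (cl k2).2.2.2.2 (h (Or.inr s.k2W)) s.k2W⟩) hn
  have hW : W.ncard < n := lt_of_lt_of_le (Set.ncard_lt_ncard (t := C ∪ M ∪ W) ⟨fun x hx => Or.inr hx,
    fun h => (cl a).2.2.2.2 s.aM (h (a := a) (Or.inl (Or.inr s.aM)))⟩) hn
  have dd : Dj (X2 ∪ C) (X1 ∪ X3 ∪ M) ∧ Dj (X2 ∪ C) W ∧ Dj (X1 ∪ X3 ∪ M) W ∧ Dj X3 (X2 ∪ C ∪ W) ∧
      Dj (X2 ∪ C ∪ W) X1 ∧ Dj (X2 ∪ C ∪ W) M := by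
    clear * - cl
    refine ⟨?_, ?_, ?_, ?_, ?_, ?_⟩ <;>
    · grind
  obtain ⟨Q, hQ, gQ⟩ := th2 hT (s.c2.union s.cC s.tC2.symm) s.cM dd.1 dd.2.1 dd.2.2.1
    (fun y => by
      have := cov y
      simp only [mem_union]
      clear * - this
      grind)
    (s.t12.symm.mo) s.k2W s.bW
    (s.k2C.mo) s.k2M (s.b2.mo)
    (s.b1.mo) s.jW ih hW
  obtain ⟨P, hP, gP⟩ := ih X3 (X2 ∪ C ∪ W) X1 M a k1
    { c1 := s.c3, c2 := s.m2, c3 := s.c1, d12 := dd.2.2.2.1, d13 := fun y h h' => ((cl y).1 h').2.1 h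
      d23 := dd.2.2.2.2.1, e1 := fun y h => ((cl y).2.2.1 h).2.1, e2 := dd.2.2.2.2.2
      e3 := fun y h => ((cl y).1 h).2.2.2.1
      cov := fun y => by
        grind
      t12 := s.t23.symm.mo, t13 := s.t13.symm
      t23 := s.t12.symm.mo
      ha := s.aM, hb := s.k1M, a1 := s.a3, a3 := s.a1, b1 := s.k13
      b2 := s.k1C.mo, jn := s.jM } hM
  exact ⟨P, Q, { toStp := s, hP := hP, hQ := hQ, gP := gP, gQ := gQ }⟩

/-- components of `M \ P` -/
structure Kc (T : SimpleGraph U) (M : Set U) (P : List U) (K : Set U) : Prop where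
  cn : Cn T K
  sub : K ⊆ M
  np : ∀ x ∈ K, x ∉ P
  cl : ∀ k ∈ K, ∀ y ∈ M, y ∉ P → T.Adj k y → y ∈ K

variable {X1 X2 X3 C M W : Set U} {a b k1 k2 : U} {P Q : List U}

theorem Leg.w1 (g : Leg T X1 X2 X3 C M W a b k1 k2 P Q) {w y : U} (hw : w ∈ W) (hy : T.Adj w y)
    (hyM : y ∈ X1 ∨ y ∈ X3 ∨ y ∈ M) : w ∈ Q := by
  by_contra hc
  refine g.m1 w hw (fun h => hc (h ▸ g.hQ.fst)) ⟨w, rfl, y, ?_, hy⟩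
    (Pth.mk (D := W \ {w}) g.hQ.ch g.hQ.nd g.hQ.hd g.hQ.lt fun x hx => ⟨g.hQ.sub x hx, fun h => hc ?_⟩).joined
  · grind
  · grind
theorem Leg.nbK (g : Leg T X1 X2 X3 C M W a b k1 k2 P Q) {K : Set U} (hK : Kc T M P K) {k y : U}
    (hk : k ∈ K) (hy : T.Adj k y) : y ∈ K ∨ y ∈ X1 ∨ y ∈ X2 ∨ y ∈ X3 ∨ y ∈ P ∨ y ∈ Q := by
  have h1 := hK.sub hk
  have h2 := hK.np k hk
  rcases g.cov y with h | h | h | h | h | h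
  · grind
  · grind
  · grind
  · exfalso
    have h3 := g.cl k
    have h4 := g.k2W
    rcases g.nC y h k hy.symm with h' | h' | h' | h' | h'
    · grind
    · grind
    · grind
    · exact h2 (h' ▸ g.hP.last)
    all_goals grind
  · by_cases hp : y ∈ P
    · grind
    · exact Or.inl (hK.cl k hk y h hp hy)
  · exact Or.inr (Or.inr (Or.inr (Or.inr (Or.inr (g.w1 h hy.symm (Or.inr (Or.inr h1)))))))

theorem Leg.tK (g : Leg T X1 X2 X3 C M W a b k1 k2 P Q) {K : Set U} (hK : Kc T M P K) :
    Tch T K (X1 ∪ {x | x ∈ P} ∪ X3) := by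
  obtain ⟨x, hx⟩ := g.c1.1
  obtain ⟨k, hk, y, hy, hyK, hky⟩ := g.cM.touch (A := K) (fun y hy => Or.inr (hK.sub hy)) hK.cn.1
    ⟨x, Or.inl (Or.inl hx), fun h => ((g.cl x).1 hx).2.2.2.1 (hK.sub h)⟩
  refine ⟨k, hk, y, ?_, hky⟩
  rcases hy with (h | h) | h
  · grind
  · exact Or.inr h
  · by_contra hc
    exact hyK (hK.cl k hk y h (fun h' => hc (Or.inl (Or.inr h'))) hky)

theorem Leg.cZ0 (g : Leg T X1 X2 X3 C M W a b k1 k2 P Q) : Cn T (X1 ∪ {x | x ∈ P} ∪ X3) :=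
  (g.c1.addList g.hP.ch fun _ => (g.a1.mono (by simpa using g.hP.fst) le_rfl).symm).union g.c3
    (g.t13.mo)

/-- everything of `Mp` except a component -/
theorem Leg.cZ [Finite U] (g : Leg T X1 X2 X3 C M W a b k1 k2 P Q) {K : Set U} (hK : Kc T M P K) :
    Cn T (X1 ∪ X3 ∪ M \ K) := by
  have e : X1 ∪ X3 ∪ M \ K = (X1 ∪ {x | x ∈ P} ∪ X3) ∪ (M \ K) := by
    ext y
    have h1 : y ∈ P → y ∈ M ∧ y ∉ K := fun h => ⟨g.hP.sub y h, fun h' => hK.np y h' h⟩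
    grind
  rw [e]
  refine g.cZ0.extend fun S hS hn => ?_
  obtain ⟨x, hx⟩ := g.c1.1
  obtain ⟨s, hs, y, hy, hyK, hky⟩ := g.cM.touch (A := S) (fun y hy => Or.inr (hS hy).1) hn
    ⟨x, Or.inl (Or.inl hx), fun h => ((g.cl x).1 hx).2.2.2.1 (hS h).1⟩
  by_cases hyP : y ∈ P
  · grind
  rcases hy with (h | h) | h
  · grind
  · grind
  · by_cases h1 : s ∈ P
    · -- a vertex of the path: walk along the whole set
      have hs1 : s ∈ X1 ∪ {x | x ∈ P} ∪ X3 := by grind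
      obtain ⟨u, hu, v, hv, hvS, huv⟩ := g.cZ0.touch (A := S ∩ (X1 ∪ {x | x ∈ P} ∪ X3)) inter_subset_right
        ⟨s, hs, hs1⟩ ⟨x, Or.inl (Or.inl hx), fun h => ((g.cl x).1 hx).2.2.2.1 (hS h.1).1⟩
      grind
    · have h2 : y ∉ K := fun h' => (hS hs).2 (hK.cl y h' s (hS hs).1 h1 hky.symm)
      exact ⟨s, hs, y, hky, Or.inr ⟨⟨h, h2⟩, hyK⟩⟩

/-- splitting the blocks -/
theorem Leg.spP (g : Leg T X1 X2 X3 C M W a b k1 k2 P Q) {c1 c2 : List U} (h : P = c1 ++ c2) :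
    Cn T (X1 ∪ {x | x ∈ c1}) ∧ Cn T ({x | x ∈ c2} ∪ X3) := by
  have hc := g.hP.ch
  have hh := g.hP.hd
  have hl := g.hP.lt
  rw [h] at hc hh hl
  constructor
  · refine g.c1.addList hc.left_of_append fun hp => (g.a1.mono ?_ le_rfl).symm
    rw [List.head?_append_of_ne_nil _ hp] at hh
    simpa using List.mem_of_mem_head? hh
  · rw [union_comm]
    refine g.c3.addList hc.right_of_append fun hp => (g.k13.mono ?_ le_rfl).symm
    rw [List.getLast?_append_of_ne_nil _ hp] at hl
    grind
theorem two_split [Finite U] {K : Set U} (h : 2 ≤ nc T K {x | x ∈ P}) :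
    ∃ c1 c2, P = c1 ++ c2 ∧ Tch T K {x | x ∈ c1} ∧ Tch T K {x | x ∈ c2} := by
  obtain ⟨x, hx, y, hy, hxy, h1, h2⟩ := nc_two h
  rcases list_split2 hx hy hxy with ⟨p, q, r, e⟩ | ⟨p, q, r, e⟩
  · exact ⟨p ++ [x], q ++ y :: r, by simp [e], h1.mo, h2.mo⟩
  · exact ⟨p ++ [y], q ++ x :: r, by simp [e], h2.mo, h1.mo⟩

theorem blk_split [Finite U] {K : Set U} (h : 2 ≤ tc T K X1 + tc T K X3 + nc T K {x | x ∈ P}) :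
    ∃ c1 c2, P = c1 ++ c2 ∧ Tch T K (X1 ∪ {x | x ∈ c1}) ∧ Tch T K ({x | x ∈ c2} ∪ X3) := by
  have l1 := tc_le (T := T) K X1
  have l2 := tc_le (T := T) K X3
  by_cases h2 : 2 ≤ nc T K {x | x ∈ P}
  · obtain ⟨c1, c2, e, t1, t2⟩ := two_split h2
    exact ⟨c1, c2, e, t1.mo, t2.mo⟩
  by_cases h1 : 1 ≤ tc T K X1
  · have t := tc_pos h1
    by_cases h3 : 1 ≤ tc T K X3
    · exact ⟨P, [], by simp, t.mo, (tc_pos h3).mo⟩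
    · exact ⟨[], P, by simp, t.mo,
        (nc_pos (S := {x | x ∈ P}) (by omega)).mono le_rfl subset_union_left⟩
  · exact ⟨P, [], by simp, (nc_pos (S := {x | x ∈ P}) (by omega)).mono le_rfl subset_union_right,
      (tc_pos (by omega)).mono le_rfl subset_union_right⟩

/-- splitting the leg -/
theorem Leg.spQ (g : Leg T X1 X2 X3 C M W a b k1 k2 P Q) {c1 c2 : List U} (h : Q = c1 ++ c2)
    (h1 : c1 ≠ []) (h2 : c2 ≠ []) : Cn T {x | x ∈ c1} ∧ Cn T {x | x ∈ c2} ∧ k2 ∈ c1 ∧ b ∈ c2 ∧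
      Tch T {x | x ∈ c1} {x | x ∈ c2} ∧ (∀ x ∈ c1, x ∈ W ∧ x ∉ c2) ∧ (∀ x ∈ c2, x ∈ W) := by
  have hc := g.hQ.ch
  have hh := g.hQ.hd
  have hl := g.hQ.lt
  have hn := g.hQ.nd
  have hs := g.hQ.sub
  rw [h] at hc hh hl hn hs
  rw [List.head?_append_of_ne_nil _ h1] at hh
  rw [List.getLast?_append_of_ne_nil _ h2] at hl
  refine ⟨Cn.chain' h1 hc.left_of_append, Cn.chain' h2 hc.right_of_append, List.mem_of_mem_head? hh,
    List.mem_of_mem_getLast? hl, chain_tch hc h1 h2, fun x hx => ⟨hs x (by simp [hx]), fun h' => ?_⟩,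
    fun x hx => hs x (by simp [hx])⟩
  exact (List.nodup_append.1 hn).2.2 x hx x h' rfl

theorem tch_ne {K : Set U} {l : List U} (h : Tch T K {x | x ∈ l}) : l ≠ [] := by
  rintro rfl; obtain ⟨_, _, x, hx, _⟩ := h; simp at hx

theorem Leg.f1a [Finite U] (hT : Tri T) (g : Leg T X1 X2 X3 C M W a b k1 k2 P Q) {K : Set U} (hK : Kc T M P K)
    (t2 : Tch T K X2) (tQ : Tch T K {x | x ∈ Q}) (o : 2 ≤ tc T K X1 + tc T K X3 + nc T K {x | x ∈ P}) :
    False := by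
  obtain ⟨c1, c2, e, t3, t4⟩ := blk_split o
  have hs := g.spP e
  have hn := g.hP.nd
  rw [e, List.nodup_append] at hn
  have hps : ∀ y, (y ∈ c1 → y ∈ M ∧ y ∈ P ∧ y ∉ c2) ∧ (y ∈ c2 → y ∈ M ∧ y ∈ P) := fun y =>
    ⟨fun h => have h' : y ∈ P := by rw [e]; simp [h]
      ⟨g.hP.sub y h', h', fun h'' => hn.2.2 y h y h'' rfl⟩,
     fun h => have h' : y ∈ P := by rw [e]; simp [h]
      ⟨g.hP.sub y h', h'⟩⟩
  have hqs : ∀ y, y ∈ Q → y ∈ W := g.hQ.sub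
  have cl := g.cl
  have hKs : ∀ y, y ∈ K → y ∈ M ∧ y ∉ P := fun y hy => ⟨hK.sub hy, hK.np y hy⟩
  have bQ : ({b} : Set U) ⊆ {x | x ∈ Q} ∪ C := fun x hx => Or.inl (by rw [mem_singleton_iff.1 hx]; exact g.hQ.last)
  have kQ : ({k2} : Set U) ⊆ {x | x ∈ Q} := fun x hx => by rw [mem_singleton_iff.1 hx]; exact g.hQ.fst
  refine hT.k5' K X2 ({x | x ∈ Q} ∪ C) (X1 ∪ {x | x ∈ c1}) ({x | x ∈ c2} ∪ X3) hK.cn g.c2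
    (g.hQ.cn.union g.cC (g.k2C.mo)) hs.1 hs.2 ?_
    t2 (tQ.mo) t3 t4 (g.tC2.symm.mo)
    (g.t12.symm.mo) (g.t23.mo)
    (g.b1.mo) (g.tC3.mo)
    (g.t13.mo)
  clear * - hps hqs cl hKs
  and_intros <;>
  · grind

theorem Leg.f1b [Finite U] (hT : Tri T) (g : Leg T X1 X2 X3 C M W a b k1 k2 P Q) {K : Set U} (hK : Kc T M P K)
    (t2 : Tch T K X2) (tQ : 2 ≤ nc T K {x | x ∈ Q}) : False := by
  obtain ⟨c1, c2, e, t3, t4⟩ := two_split tQ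
  obtain ⟨s1, s2, s3, s4, s5, s6, s7⟩ := g.spQ e (tch_ne t3) (tch_ne t4)
  have hps : ∀ y, y ∈ P → y ∈ M := g.hP.sub
  have cl := g.cl
  have hKs : ∀ y, y ∈ K → y ∈ M ∧ y ∉ P := fun y hy => ⟨hK.sub hy, hK.np y hy⟩
  have k2s : ({k2} : Set U) ⊆ {x | x ∈ c1} := fun x hx => by rw [mem_singleton_iff.1 hx]; exact s3
  have bs : ({b} : Set U) ⊆ {x | x ∈ c2} := fun x hx => by rw [mem_singleton_iff.1 hx]; exact s4
  refine hT.k5' K X2 (X1 ∪ {x | x ∈ P} ∪ X3) ({x | x ∈ c1} ∪ C) {x | x ∈ c2} hK.cn g.c2 g.cZ0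
    (s1.union g.cC (g.k2C.mo)) s2 ?_ t2 (g.tK hK)
    (t3.mo) t4 (g.t12.symm.mo)
    (g.tC2.symm.mo) (g.b2.symm.mo)
    (g.tC3.symm.mo)
    (g.b1.symm.mo) (s5.mo)
  clear * - hps s6 s7 cl hKs
  and_intros <;>
  · grind

theorem Leg.nonbad [Finite U] (hT : Tri T) (g : Leg T X1 X2 X3 C M W a b k1 k2 P Q) {K : Set U} (hK : Kc T M P K)
    (h : ¬ 2 ≤ nc T K {x | x ∈ Q}) :
    tc T K X1 + tc T K X2 + tc T K X3 + nc T K {x | x ∈ P} + nc T K {x | x ∈ Q} ≤ 3 := by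
  have h1 := g.gP K hK.cn hK.sub hK.np
  have h2 := tc_mono (T := T) (le_refl K) (show X2 ⊆ X2 ∪ C ∪ W from fun x hx => Or.inl (Or.inl hx))
  have h3 := tc_le (T := T) K X2
  by_cases hQ : Tch T K {x | x ∈ Q}
  · have h4 := tc_eq (hQ.mono (le_refl K) (show {x | x ∈ Q} ⊆ X2 ∪ C ∪ W from fun x hx => Or.inr (g.hQ.sub x hx)))
    by_cases h5 : 1 ≤ tc T K X2
    · have := mt (g.f1a hT hK (tc_pos h5) hQ) id
      omega
    · omega
  · rw [nc_zero hQ]; omega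

theorem Leg.isbad [Finite U] (hT : Tri T) (g : Leg T X1 X2 X3 C M W a b k1 k2 P Q) {K : Set U} (hK : Kc T M P K)
    (h : 2 ≤ nc T K {x | x ∈ Q}) :
    ¬ Tch T K X2 ∧ tc T K X1 + tc T K X3 + nc T K {x | x ∈ P} ≤ 2 := by
  have h1 := g.gP K hK.cn hK.sub hK.np
  have hQ : Tch T K {x | x ∈ Q} := nc_pos (by omega)
  have h4 := tc_eq (hQ.mono (le_refl K) (show {x | x ∈ Q} ⊆ X2 ∪ C ∪ W from fun x hx => Or.inr (g.hQ.sub x hx)))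
  exact ⟨fun h' => g.f1b hT hK h' h, by omega⟩

/-- two components straddling a split -/
theorem Leg.f2 [Finite U] (hT : Tri T) (g : Leg T X1 X2 X3 C M W a b k1 k2 P Q) {K K' : Set U} (hK : Kc T M P K)
    (hK' : Kc T M P K') (dK : Dj K K') {c1 c2 : List U} {q : List U} (e : Q = c1 ++ q ++ c2)
    (t1 : Tch T K {x | x ∈ c1}) (t2 : Tch T K {x | x ∈ c2})
    (t1' : Tch T K' {x | x ∈ c1}) (t2' : Tch T K' {x | x ∈ c2}) : False := by
  obtain ⟨s1, -, s3, -, -, s6, -⟩ := g.spQ (c2 := q ++ c2) (by rw [e]; simp) (tch_ne t1) (by simp [tch_ne t2])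
  obtain ⟨-, s2, -, s4, -, -, s7⟩ := g.spQ (c1 := c1 ++ q) e (by simp [tch_ne t1]) (tch_ne t2)
  have hps : ∀ y, y ∈ P → y ∈ M := g.hP.sub
  have cl := g.cl
  have hKs : ∀ y, y ∈ K → y ∈ M ∧ y ∉ P := fun y hy => ⟨hK.sub hy, hK.np y hy⟩
  have hKs' : ∀ y, y ∈ K' → y ∈ M ∧ y ∉ P := fun y hy => ⟨hK'.sub hy, hK'.np y hy⟩
  have k2s : ({k2} : Set U) ⊆ {x | x ∈ c1} := fun x hx => by rw [mem_singleton_iff.1 hx]; exact s3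
  have bs : ({b} : Set U) ⊆ {x | x ∈ c2} := fun x hx => by rw [mem_singleton_iff.1 hx]; exact s4
  refine hT.k33' K K' (X2 ∪ C) {x | x ∈ c1} {x | x ∈ c2} (X1 ∪ {x | x ∈ P} ∪ X3) hK.cn hK'.cn
    (g.c2.union g.cC g.tC2.symm) s1 s2 g.cZ0 ?_
    t1 t2 (g.tK hK) t1' t2' (g.tK hK') (g.k2C.symm.mo)
    (g.b2.symm.mo) (g.t12.symm.mo)
  clear * - hps s6 s7 cl hKs hKs' dK
  and_intros <;>
  · grind

/-- a leg vertex strictly between neighbours of `K` sees nothing else in `Mp` -/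
theorem Leg.f2' [Finite U] (hT : Tri T) (g : Leg T X1 X2 X3 C M W a b k1 k2 P Q) {K : Set U} (hK : Kc T M P K)
    {c1 c2 : List U} {q : U} (e : Q = c1 ++ q :: c2)
    (t1 : Tch T K {x | x ∈ c1}) (t2 : Tch T K {x | x ∈ c2}) {y : U} (hy : T.Adj q y)
    (hyM : y ∈ X1 ∨ y ∈ X3 ∨ y ∈ M) : y ∈ K := by
  by_contra hyK
  obtain ⟨s1, -, s3, -, s5, s6, -⟩ := g.spQ e (tch_ne t1) (by simp)
  obtain ⟨-, s2, -, s4, s5', s6', s7⟩ := g.spQ (c1 := c1 ++ [q]) (c2 := c2) (by rw [e]; simp) (by simp) (tch_ne t2)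
  have cl := g.cl
  have hKs : ∀ y, y ∈ K → y ∈ M ∧ y ∉ P := fun y hy => ⟨hK.sub hy, hK.np y hy⟩
  have k2s : ({k2} : Set U) ⊆ {x | x ∈ c1} := fun x hx => by rw [mem_singleton_iff.1 hx]; exact s3
  have bs : ({b} : Set U) ⊆ {x | x ∈ c2} := fun x hx => by rw [mem_singleton_iff.1 hx]; exact s4
  have tZ : Tch T K (X1 ∪ X3 ∪ M \ K) := by
    refine (g.tK hK).mono le_rfl ?_
    rintro x ((h | h) | h)
    exacts [Or.inl (Or.inl h), Or.inr ⟨g.hP.sub x h, fun h' => hK.np x h' h⟩, Or.inl (Or.inr h)]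
  have hch := g.hQ.ch
  rw [e] at hch
  have hq1 : Tch T {q} {x | x ∈ c1} := by
    have e2 : c1 ++ q :: c2 = (c1 ++ [q]) ++ c2 := by simp
    rw [e2] at hch
    exact (chain_tch hch.left_of_append (tch_ne t1) (by simp)).symm.mo
  have hq2 : Tch T {q} {x | x ∈ c2} :=
    (chain_tch (a := [q]) (b := c2) hch.right_of_append (by simp) (tch_ne t2)).mo
  refine hT.k33' K {q} (X2 ∪ C) {x | x ∈ c1} {x | x ∈ c2} (X1 ∪ X3 ∪ M \ K) hK.cn (Cn.single q)
    (g.c2.union g.cC g.tC2.symm) s1 s2 (g.cZ hK) ?_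
    t1 t2 tZ hq1 hq2 ⟨q, rfl, y, by
      rcases hyM with h | h | h
      exacts [Or.inl (Or.inl h), Or.inl (Or.inr h), Or.inr ⟨h, hyK⟩], hy⟩
    (g.k2C.symm.mo)
    (g.b2.symm.mo) (g.t12.symm.mo)
  clear * - s6 s6' s7 cl hKs
  and_intros <;>
  · intro y h h'
    grind

end Abs8

section Abs9
variable {U : Type u} {T : SimpleGraph U}

theorem side {W : Set U} {k b s : U} {Q1 Q2 : List U} (hQ : Pth T W k b (Q1 ++ s :: Q2))
    (hm : s ≠ k → b ∉ Cmp T (W \ {s}) k) :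
    ∃ L, L ⊆ W \ {s} ∧ (∀ x ∈ Q1, x ∈ L) ∧ (∀ x ∈ Q2, x ∉ L) ∧
      (L.Nonempty → Cn T L ∧ k ∈ L ∧ Tch T {s} L) ∧
      (∀ x ∈ L, ∀ y ∈ W, y ≠ s → T.Adj x y → y ∈ L) ∧ (k = s ∧ Q1 = [] ∨ k ∈ L ∧ k ∈ Q1) := by
  have hn := hQ.nd
  have hc := hQ.ch
  have hh := hQ.hd
  have hl := hQ.lt
  have hs := hQ.sub
  rw [List.nodup_append, List.nodup_cons] at hn
  cases Q1 with
  | nil =>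
    simp at hh
    exact ⟨∅, by simp, by simp, by simp, by simp, by simp, Or.inl ⟨hh.symm, rfl⟩⟩
  | cons z Q1 =>
    simp at hh
    subst hh
    have hks : s ≠ z := fun h => hn.2.2 z (by simp) s (by simp) h.symm
    have hzW : z ∈ W := hs z (by simp)
    have c1 : Cn T {y | y ∈ z :: Q1} := Cn.chain' (by simp) hc.left_of_append
    have hzs : z ∈ W \ {s} := ⟨hzW, fun h => hks (mem_singleton_iff.1 h).symm⟩
    refine ⟨Cmp T (W \ {s}) z, Cmp_sub hzs, fun x hx => ?_, fun x hx hx' => hm hks ?_, fun _ => ⟨Cmp_Cn, mem_Cmp_self, ?_⟩,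
      fun x hx y hy hys hxy => Cmp_step hx ⟨hy, hys⟩ hxy, Or.inr ⟨mem_Cmp_self, by simp⟩⟩
    · refine c1.sub_Cmp ?_ (by simp) hx
      intro y hy
      exact ⟨hs y (List.mem_append_left _ hy), fun h => hn.2.2 y hy s (by simp) (mem_singleton_iff.1 h)⟩
    · have hne : Q2 ≠ [] := by rintro rfl; simp at hx
      have c2 : Cn T {y | y ∈ Q2} := Cn.chain' hne (List.isChain_cons.1 hc.right_of_append).2
      refine c2.sub_Cmp' ?_ ⟨x, hx, hx'⟩ ?_
      · intro y hy
        exact ⟨hs y (by simp; exact Or.inr (Or.inr (Or.inr hy))), fun h => hn.2.1.1 (mem_singleton_iff.1 h ▸ hy)⟩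
      · rw [List.getLast?_append_of_ne_nil _ (by simp), List.getLast?_cons] at hl
        cases Q2 with
        | nil => simp at hne
        | cons w Q2 =>
          rw [List.getLast?_cons] at hl
          simp only [Option.getD_some, Option.some.injEq] at hl
          show b ∈ w :: Q2
          rw [← hl]
          apply List.mem_of_mem_getLast?
          rw [List.getLast?_cons]; rfl
    · have hsm : s ∈ z :: Q1 ++ s :: Q2 := by simp
      exact cmp_tch hzW (hs s hsm) hks.symm (hQ.cn.sub_Cmp (fun x hx => hs x hx) hQ.fst hsm)

/-- a bad component -/
structure BK (T : SimpleGraph U) (X1 X2 X3 C M W : Set U) (b k2 : U) (P Q : List U)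
    (K L R Y : Set U) (s t : U) (Q1 Qm Q3 : List U) : Prop where
  hK : Kc T M P K
  n2 : ¬ Tch T K X2
  o : tc T K X1 + tc T K X3 + nc T K {x | x ∈ P} ≤ 2
  eQ : Q = Q1 ++ s :: (Qm ++ t :: Q3)
  ts : Tch T {s} K
  tt : Tch T {t} K
  nK : ∀ k ∈ K, ∀ y ∈ Q, T.Adj k y → y = s ∨ y ∈ Qm ∨ y = t
  cov : ∀ y, y ∈ W ↔ y ∈ L ∨ y = s ∨ y ∈ Y ∨ y = t ∨ y ∈ R
  dj : ∀ y, (y ∈ L → y ≠ s ∧ y ∉ Y ∧ y ≠ t ∧ y ∉ R) ∧ (y ∈ Y → y ≠ s ∧ y ≠ t ∧ y ∉ R) ∧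
    (y ∈ R → y ≠ s ∧ y ≠ t)
  st : s ≠ t
  q1 : ∀ x ∈ Q1, x ∈ L
  qm : ∀ x ∈ Qm, x ∈ Y
  q3 : ∀ x ∈ Q3, x ∈ R
  cL : L.Nonempty → Cn T L ∧ k2 ∈ L ∧ Tch T {s} L
  cR : R.Nonempty → Cn T R ∧ b ∈ R ∧ Tch T {t} R
  kL : k2 = s ∧ Q1 = [] ∨ k2 ∈ L ∧ k2 ∈ Q1
  bR : b = t ∧ Q3 = [] ∨ b ∈ R ∧ b ∈ Q3
  nY : ∀ y ∈ Y, ∀ z, T.Adj y z → z ∈ K ∨ z ∈ Y ∨ z = s ∨ z = t ∨ z ∈ X2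
  sB : ∃ z, (z ∈ X1 ∨ z ∈ P ∨ z ∈ X3) ∧ T.Adj s z ∧ Tch T K {z}
  tB : ∃ z, (z ∈ X1 ∨ z ∈ P ∨ z ∈ X3) ∧ T.Adj t z ∧ Tch T K {z}

variable {X1 X2 X3 C M W : Set U} {a b k1 k2 : U} {P Q : List U}

/-- the attachment of an end of the interval -/
theorem Leg.att [Finite U] (hT : Tri T) (g : Leg T X1 X2 X3 C M W a b k1 k2 P Q) {K : Set U} (hK : Kc T M P K)
    (n2 : ¬ Tch T K X2) {s : U} {A B : List U} (hs : s ∈ Q) (tK : Tch T {s} K)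
    (hq : ∀ y, y ∈ Q ↔ y ∈ A ∨ y = s ∨ y ∈ B) (hd : ∀ y, (y ∈ A → y ≠ s ∧ y ∉ B) ∧ (y ∈ B → y ≠ s))
    (nA : ∀ k ∈ K, ∀ y ∈ A, ¬ T.Adj k y) (cA : A = [] ∨ Cn T {x | x ∈ A} ∧ Tch T {x | x ∈ A} (X2 ∪ C) ∧ Tch T {s} {x | x ∈ A})
    (cA' : A = [] → Tch T {s} (X2 ∪ C)) (cB : B ≠ [] → Cn T {x | x ∈ B}) :
    ∃ z, (z ∈ X1 ∨ z ∈ P ∨ z ∈ X3) ∧ T.Adj s z ∧ Tch T K {z} := by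
  have hps : ∀ y, y ∈ P → y ∈ M := g.hP.sub
  have hqs : ∀ y, y ∈ Q → y ∈ W := g.hQ.sub
  have cl := g.cl
  have hKs : ∀ y, y ∈ K → y ∈ M ∧ y ∉ P := fun y hy => ⟨hK.sub hy, hK.np y hy⟩
  have dd : Dj K {x | x ∈ B} ∧ Dj K (X1 ∪ {x | x ∈ P} ∪ X3 ∪ (X2 ∪ C) ∪ {x | x ∈ A}) ∧
      Dj {x | x ∈ B} (X1 ∪ {x | x ∈ P} ∪ X3 ∪ (X2 ∪ C) ∪ {x | x ∈ A}) ∧ Dj {s} K ∧ Dj {s} {x | x ∈ B} ∧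
      Dj {s} (X1 ∪ {x | x ∈ P} ∪ X3 ∪ (X2 ∪ C) ∪ {x | x ∈ A}) := by
    clear * - hps hqs hq hd cl hKs
    refine ⟨?_, ?_, ?_, ?_, ?_, ?_⟩ <;>
    · intro y h h'
      have := cl y; have := hKs y; have := hd y; have := hq y; have := hps y; have := hqs y
      simp only [mem_union, mem_ofPred_eq, mem_singleton_iff] at *
      clear cl hKs hd hq hps hqs
      grind
  obtain ⟨d1, d2, d3, d4, d5, d6⟩ := dd
  have cO : Cn T (X1 ∪ {x | x ∈ P} ∪ X3 ∪ (X2 ∪ C)) := g.cZ0.union (g.c2.union g.cC g.tC2.symm)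
    (g.t12.mono (subset_union_left.trans subset_union_left) subset_union_left)
  have cB' : Cn T (X1 ∪ {x | x ∈ P} ∪ X3 ∪ (X2 ∪ C) ∪ {x | x ∈ A}) := by
    rcases cA with rfl | h
    · simpa using cO
    · exact cO.union h.1 (h.2.1.symm.mono subset_union_right le_rfl)
  have tB : Tch T {s} (X1 ∪ {x | x ∈ P} ∪ X3 ∪ (X2 ∪ C) ∪ {x | x ∈ A}) := by
    rcases cA with h | h
    · exact (cA' h).mono le_rfl (fun x hx => Or.inl (Or.inr hx))
    · exact h.2.2.mono le_rfl subset_union_right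
  obtain ⟨m, hm, z, hz, h1, h2, h3⟩ := hT.lemN (v := s) hK.cn cB' (A := {x | x ∈ B})
    (fun ⟨x, hx⟩ => cB (List.ne_nil_of_mem hx)) d1 d2 d3 (d4 s rfl) (d5 s rfl) (d6 s rfl) tK tB
    ((g.tK hK).mono le_rfl fun x hx => Or.inl (Or.inl hx)) (fun m hm y hy => by
      have h1 := g.nbK hK hm hy
      have h2 := hq y
      simp only [mem_union, mem_ofPred_eq]
      clear * - h1 h2
      grind)
  refine ⟨z, ?_, h2, m, hm, z, rfl, h3⟩
  rcases g.nbK hK hm h3 with h | h | h | h | h | h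
  · exact absurd hz (d2 z h)
  · exact Or.inl h
  · exact absurd ⟨m, hm, z, h, h3⟩ n2
  · exact Or.inr (Or.inr h)
  · exact Or.inr (Or.inl h)
  · have := nA m hm z
    have h4 := cl z
    have h5 := hps z
    have h6 := hqs z h
    simp only [mem_union, mem_ofPred_eq] at hz
    clear * - this h3 hz h4 h5 h6
    grind

theorem Leg.bk [Finite U] (hT : Tri T) (g : Leg T X1 X2 X3 C M W a b k1 k2 P Q) {K : Set U} (hK : Kc T M P K)
    (h : 2 ≤ nc T K {x | x ∈ Q}) :
    ∃ L R Y s t Q1 Qm Q3, BK T X1 X2 X3 C M W b k2 P Q K L R Y s t Q1 Qm Q3 := by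
  obtain ⟨n2, ho⟩ := g.isbad hT hK h
  obtain ⟨x, hx, y, hy, hxy, h1, h2⟩ := nc_two h
  obtain ⟨Q1, s, Q2, e1, ts, n1⟩ := split_first (fun z => Tch T K {z}) ⟨x, hx, h1⟩
  have h3 : ∃ z ∈ Q2, Tch T K {z} := by
    simp only [mem_ofPred_eq, e1, List.mem_append, List.mem_cons] at hx hy
    rcases hx with hx | rfl | hx
    · exact absurd h1 (n1 x hx)
    · rcases hy with hy | rfl | hy
      · exact absurd h2 (n1 y hy)
      · exact absurd rfl hxy
      · exact ⟨y, hy, h2⟩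
    · exact ⟨x, hx, h1⟩
  obtain ⟨Qm, t, Q3, e2, tt, n3⟩ := split_last (fun z => Tch T K {z}) h3
  subst e2
  have hQ := g.hQ
  rw [e1] at hQ
  have hn := hQ.nd
  have hch := hQ.ch
  have st : s ≠ t := by
    rintro rfl; simp [List.nodup_append] at hn
  have tk2 : t ≠ k2 := by
    rintro rfl
    have h1 := hQ.hd
    cases Q1 with
    | nil => simp at h1; exact st h1
    | cons z Q1 => simp at h1; subst h1; simp [List.nodup_append] at hn
  have hsQ : s ∈ Q := by rw [e1]; simp
  have htQ : t ∈ Q := by rw [e1]; simp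
  have toM : ∀ {w}, Tch T K {w} → Tch T {w} (X1 ∪ X3 ∪ M) := fun h =>
    h.symm.mono le_rfl fun y hy => Or.inr (hK.sub hy)
  obtain ⟨L, l1, l2, l3, l4, l5, l6⟩ := side hQ fun hk => g.m1 s (g.hQ.sub s hsQ) hk (toM ts)
  have hQr : Pth T W b k2 (Q3.reverse ++ t :: (Qm.reverse ++ s :: Q1.reverse)) := by
    have := hQ.rev; simpa using this
  obtain ⟨R, r1, r2, r3, r4, r5, r6⟩ := side hQr fun hk h => g.m1 t (g.hQ.sub t htQ) tk2 (toM tt) (by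
    have htw : b ∈ W \ {t} := ⟨g.bW, fun h => hk (mem_singleton_iff.1 h).symm⟩
    exact (Cmp_Cn (T := T) (S := W \ {t}) (x := b)).sub_Cmp (Cmp_sub htw) h mem_Cmp_self)
  have kR : k2 ∉ R := by
    rcases l6 with h | h
    · exact r3 k2 (by rw [h.1]; simp)
    · exact r3 k2 (by simp [h.2])
  have LR : ∀ x ∈ L, x ∉ R := by
    intro x hx hx'
    obtain ⟨cL, kL, -⟩ := l4 ⟨x, hx⟩
    refine kR (cL.sub_of_closed ⟨x, hx, hx'⟩ (fun u hu v hv huv => r5 u hu v (l1 hv).1 ?_ huv) kL)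
    rintro rfl
    exact l3 v (by simp) hv
  have sW := g.hQ.sub s hsQ
  have tW := g.hQ.sub t htQ
  have tL : t ∉ L := l3 t (by simp)
  have sR : s ∉ R := r3 s (by simp)
  have hqs : ∀ y, y ∈ Q → y ∈ W := g.hQ.sub
  have nd2 : s ∉ Qm ∧ t ∉ Qm ∧ s ∉ Q1 ∧ t ∉ Q1 ∧ s ∉ Q3 ∧ t ∉ Q3 ∧ (∀ x ∈ Q1, x ∉ Qm ∧ x ∉ Q3) ∧ (∀ x ∈ Qm, x ∉ Q3) := by
    clear * - hn
    simp only [List.nodup_append, List.nodup_cons, List.mem_append, List.mem_cons] at hn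
    grind
  have nK : ∀ k ∈ K, ∀ y ∈ Q, T.Adj k y → y = s ∨ y ∈ Qm ∨ y = t := by
    intro k hk y hy hky
    have h1 : Tch T K {y} := ⟨k, hk, y, rfl, hky⟩
    have h2 := fun h => n1 y h h1
    have h3 := fun h => n3 y h h1
    rw [e1] at hy
    simp only [List.mem_append, List.mem_cons] at hy
    clear * - hy h2 h3
    grind
  have c1 : Q1 ≠ [] → Cn T {x | x ∈ Q1} ∧ Tch T {s} {x | x ∈ Q1} := fun h =>
    ⟨Cn.chain' h hch.left_of_append, ((chain_tch (a := Q1) (b := [s]) (by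
      have e : Q1 ++ s :: (Qm ++ t :: Q3) = (Q1 ++ [s]) ++ (Qm ++ t :: Q3) := by simp
      rw [e] at hch
      exact hch.left_of_append) h (by simp)).symm).mono (by simp) le_rfl⟩
  have c3 : Q3 ≠ [] → Cn T {x | x ∈ Q3} ∧ Tch T {t} {x | x ∈ Q3} := fun h => by
    have e : Q1 ++ s :: (Qm ++ t :: Q3) = (Q1 ++ s :: Qm) ++ ([t] ++ Q3) := by simp
    rw [e] at hch
    exact ⟨Cn.chain' h hch.right_of_append.right_of_append,
      (chain_tch (a := [t]) (b := Q3) hch.right_of_append (by simp) h).mono (by simp) le_rfl⟩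
  refine ⟨L, R, (W \ {s, t}) \ (L ∪ R), s, t, Q1, Qm, Q3, ?_⟩
  refine { hK := hK, n2 := n2, o := ho, eQ := e1, ts := ts.symm, tt := tt.symm, nK := nK, st := st, q1 := l2, cL := l4, cR := r4, kL := l6, bR := by simpa using r6, cov := ?_, dj := ?_, qm := ?_, q3 := fun x hx => r2 x (by simpa using hx), nY := ?_, sB := ?_, tB := ?_ }
  · intro y
    have h1 := @l1 y
    have h2 := @r1 y
    simp only [mem_union, mem_sdiff, mem_insert_iff, mem_singleton_iff] at *
    by_cases hy1 : y = s
    · subst hy1; exact iff_of_true sW (Or.inr (Or.inl rfl))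
    by_cases hy2 : y = t
    · subst hy2; exact iff_of_true tW (Or.inr (Or.inr (Or.inr (Or.inl rfl))))
    clear * - h1 h2 hy1 hy2
    grind
  · intro y
    have h1 := @l1 y
    have h2 := @r1 y
    have h3 := LR y
    have h4 : y ∈ L → y ≠ t := fun h h' => tL (h' ▸ h)
    have h5 : y ∈ R → y ≠ s := fun h h' => sR (h' ▸ h)
    simp only [mem_union, mem_sdiff, mem_insert_iff, mem_singleton_iff] at *
    clear * - h1 h2 h3 h4 h5
    grind
  · intro y hy
    have h1 := l3 y (by simp [hy])
    have h2 := r3 y (by simp [hy])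
    have h3 : y ∈ W := hqs y (by rw [e1]; simp [hy])
    have h4 : y ≠ s := fun h => nd2.1 (h ▸ hy)
    have h5 : y ≠ t := fun h => nd2.2.1 (h ▸ hy)
    simp only [mem_union, mem_sdiff, mem_insert_iff, mem_singleton_iff]
    clear * - h1 h2 h3 h4 h5
    grind
  · rintro y ⟨⟨hyW, hyst⟩, hyLR⟩ z hyz
    simp only [mem_insert_iff, mem_singleton_iff, mem_union, not_or] at hyst hyLR
    have hM : (z ∈ X1 ∨ z ∈ X3 ∨ z ∈ M) → z ∈ K := by
      intro hz
      have hyQ := g.w1 hyW hyz hz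
      have hyQm : y ∈ Qm := by
        have h1 := l2 y
        have h2 := r2 y
        rw [e1] at hyQ
        simp only [List.mem_append, List.mem_cons, List.mem_reverse] at hyQ h2
        clear * - h1 h2 hyQ hyst hyLR
        grind
      obtain ⟨u, v, e⟩ := List.append_of_mem hyQm
      refine g.f2' hT hK (c1 := Q1 ++ s :: u) (c2 := v ++ t :: Q3) (q := y) (by rw [e1, e]; simp)
        (ts.mono le_rfl (by simp)) (tt.mono le_rfl (by simp)) hyz hz
    rcases g.cov z with h | h | h | h | h | h
    · exact Or.inl (hM (Or.inl h))
    · exact Or.inr (Or.inr (Or.inr (Or.inr h)))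
    · exact Or.inl (hM (Or.inr (Or.inl h)))
    · exfalso
      rcases g.nC z h y hyz.symm with h' | h' | h' | h' | h'
      · exact ((g.cl y).2.2.2.1 h').2 hyW
      · exact ((g.cl y).2.1 h').2.2.2 hyW
      · exact ((g.cl y).2.2.1 h').2.2 hyW
      · exact (g.cl y).2.2.2.2 (h' ▸ g.k1M) hyW
      · rcases l6 with h6 | h6
        · exact hyst.1 (h'.trans h6.1)
        · exact hyLR.1 (h' ▸ h6.1)
    · exact Or.inl (hM (Or.inr (Or.inr h)))
    · by_cases hz1 : z = s
      · exact Or.inr (Or.inr (Or.inl hz1))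
      by_cases hz2 : z = t
      · exact Or.inr (Or.inr (Or.inr (Or.inl hz2)))
      refine Or.inr (Or.inl ⟨⟨h, by simp [hz1, hz2]⟩, ?_⟩)
      rintro (h' | h')
      · exact hyLR.1 (l5 z h' y hyW hyst.1 hyz.symm)
      · exact hyLR.2 (r5 z h' y hyW hyst.2 hyz.symm)
  · refine g.att hT hK n2 (A := Q1) (B := Qm ++ t :: Q3) hsQ ts.symm (by rw [e1]; simp) ?_ ?_ ?_ ?_ ?_
    · intro y
      simp only [List.mem_append, List.mem_cons]
      clear * - nd2 st
      grind
    · intro k hk y hy hky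
      exact n1 y hy ⟨k, hk, y, rfl, hky⟩
    · by_cases h0 : Q1 = []
      · exact Or.inl h0
      · have hk : k2 ∈ Q1 := by
          rcases l6 with h | h
          exacts [absurd h.2 h0, h.2]
        exact Or.inr ⟨(c1 h0).1, g.k2C.mono (by simpa using hk) subset_union_right, (c1 h0).2⟩
    · intro h0
      have : k2 = s := by
        rcases l6 with h | h
        exacts [h.1, by rw [h0] at h; simp at h]
      rw [← this]
      exact g.k2C.mono le_rfl subset_union_right
    · intro h0
      exact Cn.chain' h0 (List.isChain_cons.1 hch.right_of_append).2
  · refine g.att hT hK n2 (A := Q3) (B := Q1 ++ s :: Qm) htQ tt.symm ?_ ?_ ?_ ?_ ?_ ?_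
    · intro y; rw [e1]
      simp only [List.mem_append, List.mem_cons]
      clear * - y
      grind
    · intro y
      simp only [List.mem_append, List.mem_cons]
      clear * - nd2 st
      grind
    · intro k hk y hy hky
      exact n3 y hy ⟨k, hk, y, rfl, hky⟩
    · by_cases h0 : Q3 = []
      · exact Or.inl h0
      · have hk : b ∈ Q3 := by
          rcases r6 with h | h
          exacts [absurd (by simpa using h.2) h0, by simpa using h.2]
        exact Or.inr ⟨(c3 h0).1, g.b2.mono (by simpa using hk) subset_union_left, (c3 h0).2⟩
    · intro h0
      have : b = t := by
        rcases r6 with h | h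
        exacts [h.1, by rw [h0] at h; simp at h]
      rw [← this]
      exact g.b2.mono le_rfl subset_union_left
    · intro h0
      have e : Q1 ++ s :: (Qm ++ t :: Q3) = (Q1 ++ s :: Qm) ++ (t :: Q3) := by simp
      rw [e] at hch
      exact Cn.chain' h0 hch.left_of_append

end Abs9

section Abs10
variable {U : Type u} {T : SimpleGraph U}
variable {X1 X2 X3 C M W : Set U} {a b k1 k2 : U} {P Q : List U}

structure Blk (T : SimpleGraph U) (O Z l : Set U) : Prop where
  c : Cn T l
  c' : Cn T (Z \ l)
  t : Tch T l (Z \ l)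
  t' : Tch T O (Z \ l)

theorem Leg.blk1 (g : Leg T X1 X2 X3 C M W a b k1 k2 P Q) :
    Blk T (X2 ∪ C) (X1 ∪ {x | x ∈ P} ∪ X3) X1 := by
  have e : (X1 ∪ {x | x ∈ P} ∪ X3) \ X1 = {x | x ∈ P} ∪ X3 := by
    ext y
    have h1 := g.cl y
    have h2 := g.hP.sub y
    grind
  refine ⟨g.c1, ?_, ?_, ?_⟩ <;> rw [e]
  · simpa using (g.spP (c1 := []) (c2 := P) (by simp)).2
  · exact g.t13.mo
  · exact g.t23.mo

theorem Leg.blk3 (g : Leg T X1 X2 X3 C M W a b k1 k2 P Q) :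
    Blk T (X2 ∪ C) (X1 ∪ {x | x ∈ P} ∪ X3) X3 := by
  have e : (X1 ∪ {x | x ∈ P} ∪ X3) \ X3 = X1 ∪ {x | x ∈ P} := by
    ext y
    have h1 := g.cl y
    have h2 := g.hP.sub y
    grind
  refine ⟨g.c3, ?_, ?_, ?_⟩ <;> rw [e]
  · exact (g.spP (c1 := P) (c2 := []) (by simp)).1
  · exact g.t13.symm.mo
  · exact g.t12.symm.mo

theorem Leg.blkp (g : Leg T X1 X2 X3 C M W a b k1 k2 P Q) {p : U} (hp : p ∈ P) :
    Blk T (X2 ∪ C) (X1 ∪ {x | x ∈ P} ∪ X3) {p} := by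
  obtain ⟨c1, c2, e0⟩ := List.append_of_mem hp
  have hn := g.hP.nd
  rw [e0, List.nodup_append, List.nodup_cons] at hn
  have e : (X1 ∪ {x | x ∈ P} ∪ X3) \ {p} = (X1 ∪ {x | x ∈ c1}) ∪ ({x | x ∈ c2} ∪ X3) := by
    ext y
    have h1 := g.cl y
    have h2 := g.hP.sub p hp
    grind
  have s1 := g.spP (c1 := c1) (c2 := p :: c2) e0
  have s2 := g.spP (c1 := c1 ++ [p]) (c2 := c2) (by rw [e0]; simp)
  have cc : Cn T ((X1 ∪ {x | x ∈ c1}) ∪ ({x | x ∈ c2} ∪ X3)) :=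
    s1.1.union s2.2 (g.t13.mo)
  refine ⟨Cn.single p, ?_, ?_, ?_⟩ <;> rw [e]
  · exact cc
  · obtain ⟨x, hx⟩ := g.c1.1
    have hpM := g.hP.sub p hp
    have hxp : x ≠ p := fun h => ((g.cl x).1 hx).2.2.2.1 (h ▸ hpM)
    obtain ⟨y, hy, z, hz, hzy, hyz⟩ := g.cZ0.touch (A := {p}) (fun y hy => Or.inl (Or.inr (by rw [mem_singleton_iff.1 hy]; exact hp)))
      ⟨p, rfl⟩ ⟨x, Or.inl (Or.inl hx), hxp⟩
    refine ⟨y, hy, z, ?_, hyz⟩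
    grind
  · exact g.t12.symm.mo

theorem Leg.blocks [Finite U] (g : Leg T X1 X2 X3 C M W a b k1 k2 P Q) {K : Set U}
    (o : tc T K X1 + tc T K X3 + nc T K {x | x ∈ P} ≤ 2) :
    ∃ c1 c2 la lb, P = c1 ++ c2 ∧ la ⊆ X1 ∪ {x | x ∈ c1} ∧ lb ⊆ {x | x ∈ c2} ∪ X3 ∧
      Blk T (X2 ∪ C) (X1 ∪ {x | x ∈ P} ∪ X3) la ∧ Blk T (X2 ∪ C) (X1 ∪ {x | x ∈ P} ∪ X3) lb ∧
      (∀ k ∈ K, ∀ z ∈ X1 ∪ {x | x ∈ P} ∪ X3, T.Adj k z → z ∈ la ∨ z ∈ lb) ∧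
      ∀ K2, (∀ k ∈ K2, ∀ z ∈ X1 ∪ {x | x ∈ P} ∪ X3, T.Adj k z → z ∈ la ∨ z ∈ lb) →
        tc T K2 X1 + tc T K2 X3 + nc T K2 {x | x ∈ P} ≤ tc T K2 la + tc T K2 lb := by
  have cl := g.cl
  have hps := g.hP.sub
  have nt : ∀ {A B : Set U}, ¬ Tch T A B → ∀ k ∈ A, ∀ z ∈ B, ¬ T.Adj k z := fun h k hk z hz hkz => h ⟨k, hk, z, hz, hkz⟩
  have hN : ∀ {x}, x ∈ P → ¬ x ∈ X1 ∧ ¬ x ∈ X3 := fun {x} hx =>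
    ⟨fun h => ((cl x).1 h).2.2.2.1 (hps x hx), fun h => ((cl x).2.2.1 h).2.1 (hps x hx)⟩
  by_cases h0 : Tch T K {x | x ∈ P}
  swap
  · refine ⟨[], P, X1, X3, by simp, subset_union_left, subset_union_right, g.blk1, g.blk3, ?_, ?_⟩
    · grind
    · intro K2 h2
      have : ¬ Tch T K2 {x | x ∈ P} := by
        rintro ⟨k, hk, z, hz, hkz⟩
        grind
      rw [nc_zero this]; omega
  obtain ⟨k0, hk0, p, hp, hkp⟩ := h0
  have tp : Tch T K {p} := ⟨k0, hk0, p, rfl, hkp⟩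
  by_cases hone : ∀ k ∈ K, ∀ z ∈ P, T.Adj k z → z = p
  · have h1 : 1 ≤ nc T K {x | x ∈ P} := nc_pos_of ⟨k0, hk0, p, hp, hkp⟩
    by_cases h3 : Tch T K X3
    · have h4 : ¬ Tch T K X1 := fun h => by rw [tc_eq h, tc_eq h3] at o; omega
      refine ⟨P, [], {p}, X3, by simp, by simpa using Or.inr hp, by simp, g.blkp hp, g.blk3, ?_, ?_⟩
      · grind
      · intro K2 h2
        have h5 : ¬ Tch T K2 X1 := by
          rintro ⟨k, hk, z, hz, hkz⟩
          grind
        have h6 : nc T K2 {x | x ∈ P} ≤ nc T K2 {p} := nc_sub fun z hz k hk hkz => by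
          grind
        have h7 := nc_single (T := T) K2 p
        rw [tc_zero h5]; omega
    · refine ⟨[], P, X1, {p}, by simp, subset_union_left, by simpa using Or.inl hp, g.blk1, g.blkp hp, ?_, ?_⟩
      · grind
      · intro K2 h2
        have h5 : ¬ Tch T K2 X3 := by
          rintro ⟨k, hk, z, hz, hkz⟩
          grind
        have h6 : nc T K2 {x | x ∈ P} ≤ nc T K2 {p} := nc_sub fun z hz k hk hkz => by
          grind
        have h7 := nc_single (T := T) K2 p
        rw [tc_zero h5]; omega
  · push Not at hone
    obtain ⟨k1', hk1', q, hq, hkq, hqp⟩ := hone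
    have two : ({p, q} : Set U) ⊆ Nb T K {x | x ∈ P} := by
      rintro y (rfl | rfl)
      exacts [⟨hp, k0, hk0, hkp⟩, ⟨hq, k1', hk1', hkq⟩]
    have h2c : ({p, q} : Set U).ncard = 2 := Set.ncard_pair hqp.symm
    have hge := Set.ncard_le_ncard two
    rw [h2c] at hge
    change 2 ≤ nc T K {x | x ∈ P} at hge
    have n1 : ¬ Tch T K X1 := fun h => by rw [tc_eq h] at o; omega
    have n3 : ¬ Tch T K X3 := fun h => by rw [tc_eq h] at o; omega
    have eN : ({p, q} : Set U) = Nb T K {x | x ∈ P} :=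
      Set.eq_of_subset_of_ncard_le two (by rw [h2c]; change nc T K {x | x ∈ P} ≤ 2; omega)
    have hK : ∀ k ∈ K, ∀ z ∈ X1 ∪ {x | x ∈ P} ∪ X3, T.Adj k z → z = p ∨ z = q := by
      rintro k hk z ((h | h) | h) hkz
      · grind
      · have : z ∈ ({p, q} : Set U) := by rw [eN]; exact ⟨h, k, hk, hkz⟩
        simpa using this
      all_goals grind
    have main : ∀ {p q : U}, p ∈ P → q ∈ P → ∀ K2, (∀ k ∈ K2, ∀ z ∈ X1 ∪ {x | x ∈ P} ∪ X3, T.Adj k z → z ∈ ({p} : Set U) ∨ z ∈ ({q} : Set U)) →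
        tc T K2 X1 + tc T K2 X3 + nc T K2 {x | x ∈ P} ≤ tc T K2 {p} + tc T K2 {q} := by
      intro p q hp hq K2 h2
      have h5 : ¬ Tch T K2 X3 := by
        rintro ⟨k, hk, z, hz, hkz⟩
        grind
      have h5' : ¬ Tch T K2 X1 := by
        rintro ⟨k, hk, z, hz, hkz⟩
        grind
      have h6 : nc T K2 {x | x ∈ P} ≤ nc T K2 ({p} ∪ {q}) := nc_sub fun z hz k hk hkz =>
        h2 k hk z (Or.inl (Or.inr hz)) hkz
      have h7 := nc_single (T := T) K2 p
      have h8 := nc_single (T := T) K2 q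
      have h9 := nc_union (T := T) K2 {p} {q}
      rw [tc_zero h5, tc_zero h5']; omega
    rcases list_split2 hp hq hqp.symm with ⟨u, v, w, e⟩ | ⟨u, v, w, e⟩
    · exact ⟨u ++ [p], v ++ q :: w, {p}, {q}, by rw [e]; simp, by simp, by simp, g.blkp hp, g.blkp hq, hK, main hp hq⟩
    · exact ⟨u ++ [q], v ++ p :: w, {q}, {p}, by rw [e]; simp, by simp, by simp, g.blkp hq, g.blkp hp,
        fun k hk z hz h => (hK k hk z hz h).symm, main hq hp⟩

end Abs10

section Abs11
variable {U : Type u} {T : SimpleGraph U}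
variable {X1 X2 X3 C M W : Set U} {a b k1 k2 : U} {P Q : List U}
variable {K L R Y : Set U} {s t : U} {Q1 Qm Q3 : List U}

/-- if both ends attach to one block, `K` touches nothing else -/
theorem Leg.oneblk (hT : Tri T) (g : Leg T X1 X2 X3 C M W a b k1 k2 P Q)
    (k : BK T X1 X2 X3 C M W b k2 P Q K L R Y s t Q1 Qm Q3) {l l' : Set U}
    (hl : Blk T (X2 ∪ C) (X1 ∪ {x | x ∈ P} ∪ X3) l) (hlZ : l ⊆ X1 ∪ {x | x ∈ P} ∪ X3)
    (hl' : l' ⊆ (X1 ∪ {x | x ∈ P} ∪ X3) \ l) (sl : Tch T {s} l) (tl : Tch T {t} l) : ¬ Tch T K l' := by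
  intro hKl
  have e1 : Q = (Q1 ++ [s]) ++ (Qm ++ t :: Q3) := by rw [k.eQ]; simp
  obtain ⟨s1, s2, s3, s4, s5, s6, s7⟩ := g.spQ e1 (by simp) (by simp)
  have hps : ∀ y, y ∈ P → y ∈ M := g.hP.sub
  have cl := g.cl
  have hKs : ∀ y, y ∈ K → y ∈ M ∧ y ∉ P := fun y hy => ⟨k.hK.sub hy, k.hK.np y hy⟩
  have hlZ' : ∀ y, y ∈ l → y ∈ X1 ∨ y ∈ P ∨ y ∈ X3 := fun y hy => by
    grind
  have k2s : ({k2} : Set U) ⊆ {x | x ∈ Q1 ++ [s]} := fun x hx => by rw [mem_singleton_iff.1 hx]; exact s3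
  have bs : ({b} : Set U) ⊆ {x | x ∈ Qm ++ t :: Q3} := fun x hx => by rw [mem_singleton_iff.1 hx]; exact s4
  have ss : ({s} : Set U) ⊆ {x | x ∈ Q1 ++ [s]} := by simp
  have ts : ({t} : Set U) ⊆ {x | x ∈ Qm ++ t :: Q3} := by simp
  refine hT.k33' K l (X2 ∪ C) {x | x ∈ Q1 ++ [s]} {x | x ∈ Qm ++ t :: Q3} ((X1 ∪ {x | x ∈ P} ∪ X3) \ l)
    k.hK.cn hl.c (g.c2.union g.cC g.tC2.symm) s1 s2 hl.c' ?_
    (k.ts.symm.mo) (k.tt.symm.mo) (hKl.mo)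
    (sl.symm.mo) (tl.symm.mo) hl.t
    (g.k2C.symm.mo) (g.b2.symm.mo) hl.t'
  clear * - hps s6 s7 cl hKs hlZ'
  generalize Q1 ++ [s] = c1 at *
  generalize Qm ++ t :: Q3 = c2 at *
  and_intros <;>
  · grind

/-- the outside of a bad component -/
theorem Leg.xa (g : Leg T X1 X2 X3 C M W a b k1 k2 P Q)
    (k : BK T X1 X2 X3 C M W b k2 P Q K L R Y s t Q1 Qm Q3) :
    Cn T (X2 ∪ C ∪ L ∪ R) ∧ Tch T {s} (X2 ∪ C ∪ L ∪ R) ∧ Tch T {t} (X2 ∪ C ∪ L ∪ R) ∧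
    t ∈ Cmp T (K ∪ Y ∪ {s, t}) s := by
  refine ⟨((g.c2.union g.cC g.tC2.symm).addSet fun h => ⟨(k.cL h).1, ?_⟩).addSet fun h => ⟨(k.cR h).1, ?_⟩, ?_, ?_, ?_⟩
  · exact g.k2C.symm.mono subset_union_right (by simpa using (k.cL h).2.1)
  · exact g.b2.symm.mono (fun x hx => Or.inl (Or.inl hx)) (by simpa using (k.cR h).2.1)
  · rcases k.kL with h | h
    · rw [← h.1]; exact g.k2C.mono le_rfl (fun x hx => Or.inl (Or.inl (Or.inr hx)))
    · exact (k.cL ⟨_, h.1⟩).2.2.mo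
  · rcases k.bR with h | h
    · rw [← h.1]; exact g.b2.mono le_rfl (fun x hx => Or.inl (Or.inl (Or.inl hx)))
    · exact (k.cR ⟨_, h.1⟩).2.2.mo
  · have : Cn T (K ∪ {s} ∪ {t}) := (k.hK.cn.union (Cn.single s) k.ts.symm).union (Cn.single t)
      (k.tt.symm.mo)
    refine this.sub_Cmp ?_ (Or.inl (Or.inr rfl)) (Or.inr rfl)
    grind
theorem Leg.det3 [Finite U] (hT : Tri T) (g : Leg T X1 X2 X3 C M W a b k1 k2 P Q)
    (k : BK T X1 X2 X3 C M W b k2 P Q K L R Y s t Q1 Qm Q3) {n : ℕ} (ih : TH T n) (hn : (C ∪ M ∪ W).ncard ≤ n)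
    {A B : Set U} (cA : Cn T A) (cB : Cn T B) (dAB : Dj A B) (hAB : ∀ y, (y ∈ A ∨ y ∈ B) ↔ (y ∈ X1 ∨ y ∈ P ∨ y ∈ X3))
    (tAB : Tch T A B) (tA : Tch T X2 A) (tB : Tch T X2 B) (sA : Tch T {s} A) (tB' : Tch T {t} B) :
    ∃ l, Pth T (K ∪ Y ∪ {s, t}) s t l ∧ ∀ K2, Cn T K2 → K2 ⊆ K ∪ Y → (∀ x ∈ K2, x ∉ l) →
      tc T K2 X2 + tc T K2 B + tc T K2 A + nc T K2 {x | x ∈ l} ≤ 3 := by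
  obtain ⟨x1, x2, x3, x4⟩ := g.xa k
  have hps : ∀ y, y ∈ P → y ∈ M := g.hP.sub
  have cl := g.cl
  have cov := g.cov
  have kcov := k.cov
  have kdj := k.dj
  have hKs : ∀ y, y ∈ K → y ∈ M ∧ y ∉ P := fun y hy => ⟨k.hK.sub hy, k.hK.np y hy⟩
  have dd : Dj (X2 ∪ C ∪ L ∪ R) B ∧ Dj (X2 ∪ C ∪ L ∪ R) A ∧ Dj (X2 ∪ C ∪ L ∪ R) ((M \ {x | x ∈ P}) \ K) ∧
      Dj B ((M \ {x | x ∈ P}) \ K) ∧ Dj A ((M \ {x | x ∈ P}) \ K) ∧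
      Dj (X2 ∪ C ∪ L ∪ R) (K ∪ Y ∪ {s, t}) ∧ Dj B (K ∪ Y ∪ {s, t}) ∧ Dj A (K ∪ Y ∪ {s, t}) ∧
      Dj ((M \ {x | x ∈ P}) \ K) (K ∪ Y ∪ {s, t}) := by
    clear * - hps cl hKs hAB kcov kdj
    refine ⟨?_, ?_, ?_, ?_, ?_, ?_, ?_, ?_, ?_⟩ <;>
    · grind
  obtain ⟨d1, d2, d3, d4, d5, d6, d7, d8, d9⟩ := dd
  obtain ⟨B1, B2, B3, i1, i2, i3, u1, u2, u3, b1, b2, b3, e1, e2, e3, hc⟩ := ext3 (T := T) x1 cB cA d1 d2 dAB.symm d3 d4 d5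
    (fun S hS hSn => by
      obtain ⟨x, hx⟩ := g.c1.1
      obtain ⟨p, hp, y, hy, hyS, hpy⟩ := (g.cZ k.hK).touch (A := S) (fun y hy => Or.inr ⟨(hS hy).1.1, (hS hy).2⟩) hSn
        ⟨x, Or.inl (Or.inl hx), fun h => ((g.cl x).1 hx).2.2.2.1 (hS h).1.1⟩
      refine ⟨p, hp, y, hpy, hyS, ?_⟩
      have := hAB y
      simp only [mem_union, mem_ofPred_eq, mem_sdiff] at hy ⊢
      clear * - hy this
      grind)
  have dD : ∀ {B' A' : Set U}, B' ⊆ A' ∪ ((M \ {x | x ∈ P}) \ K) → Dj A' (K ∪ Y ∪ {s, t}) → Dj B' (K ∪ Y ∪ {s, t}) := by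
    grind
  obtain ⟨l, hl, gl⟩ := ih B1 B2 B3 (K ∪ Y ∪ {s, t}) s t
    { c1 := b1, c2 := b2, c3 := b3, d12 := e1, d13 := e2, d23 := e3, e1 := dD u1 d6, e2 := dD u2 d7, e3 := dD u3 d8
      cov := fun y => by
        grind
      t12 := tB.mono (fun x hx => i1 (Or.inl (Or.inl (Or.inl hx)))) i2
      t13 := tA.mono (fun x hx => i1 (Or.inl (Or.inl (Or.inl hx)))) i3
      t23 := tAB.symm.mo
      ha := Or.inr (Or.inl rfl), hb := Or.inr (Or.inr rfl)
      a1 := x2.mo, a3 := sA.mo, b1 := x3.mo, b2 := tB'.mo, jn := x4 }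
    (by
      refine lt_of_lt_of_le (Set.ncard_lt_ncard (t := C ∪ M ∪ W) ⟨?_, fun h => ?_⟩) hn
      · grind
      · have h1 := h (a := a) (Or.inl (Or.inr g.aM))
        have h2 := hKs a
        have h3 := g.hP.fst
        have h4 := (cl a).2.2.2.2 g.aM
        have h5 := kcov a
        simp only [mem_union, mem_insert_iff, mem_singleton_iff] at h1
        clear * - h1 h2 h3 h4 h5
        grind)
  refine ⟨l, hl, fun K2 c2 s2 n2 => ?_⟩
  have := gl K2 c2 (s2.trans subset_union_left) n2
  have h1 := tc_mono (T := T) (le_refl K2) (show X2 ⊆ B1 from fun x hx => i1 (Or.inl (Or.inl (Or.inl hx))))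
  have h2 := tc_mono (T := T) (le_refl K2) i2
  have h3 := tc_mono (T := T) (le_refl K2) i3
  omega

theorem Leg.det2 [Finite U] (hT : Tri T) (g : Leg T X1 X2 X3 C M W a b k1 k2 P Q)
    (k : BK T X1 X2 X3 C M W b k2 P Q K L R Y s t Q1 Qm Q3) {n : ℕ} (ih : TH T n) (hn : (C ∪ M ∪ W).ncard ≤ n) :
    ∃ l, Pth T (K ∪ Y ∪ {s, t}) s t l ∧ ∀ K2, Cn T K2 → K2 ⊆ K ∪ Y → (∀ x ∈ K2, x ∉ l) →
      tc T K2 X2 + tc T K2 (X1 ∪ X3 ∪ M \ K) + nc T K2 {x | x ∈ l} ≤ 3 := by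
  obtain ⟨x1, x2, x3, x4⟩ := g.xa k
  have hps : ∀ y, y ∈ P → y ∈ M := g.hP.sub
  have cl := g.cl
  have cov := g.cov
  have kcov := k.cov
  have kdj := k.dj
  have hKs : ∀ y, y ∈ K → y ∈ M ∧ y ∉ P := fun y hy => ⟨k.hK.sub hy, k.hK.np y hy⟩
  have dd : Dj (X2 ∪ C ∪ L ∪ R) (X1 ∪ X3 ∪ M \ K) ∧ Dj (X2 ∪ C ∪ L ∪ R) (K ∪ Y ∪ {s, t}) ∧
      Dj (X1 ∪ X3 ∪ M \ K) (K ∪ Y ∪ {s, t}) := by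
    clear * - hps cl hKs kcov kdj
    refine ⟨?_, ?_, ?_⟩ <;>
    · grind
  obtain ⟨d1, d2, d3⟩ := dd
  have zz : ∀ {v}, (∃ z, (z ∈ X1 ∨ z ∈ P ∨ z ∈ X3) ∧ T.Adj v z ∧ Tch T K {z}) → Tch T {v} (X1 ∪ X3 ∪ M \ K) := by
    rintro v ⟨z, hz, hvz, -⟩
    refine ⟨v, rfl, z, ?_, hvz⟩
    grind
  obtain ⟨l, hl, gl⟩ := th2 hT x1 (g.cZ k.hK) d1 d2 d3 (fun y => by
      have h1 := cov y; have h2 := kcov y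
      simp only [mem_union, mem_ofPred_eq, mem_sdiff, mem_insert_iff, mem_singleton_iff] at h1 h2 ⊢
      clear * - h1 h2
      grind)
    (g.t12.symm.mono (fun x hx => (Or.inl (Or.inl (Or.inl hx)))) (fun x hx => Or.inl (Or.inl hx)))
    (Or.inr (Or.inl rfl)) (Or.inr (Or.inr rfl)) x2 (zz k.sB) x3 (zz k.tB) x4 ih
    (by
      refine lt_of_lt_of_le (Set.ncard_lt_ncard (t := C ∪ M ∪ W) ⟨?_, fun h => ?_⟩) hn
      · grind
      · have h1 := h (a := a) (Or.inl (Or.inr g.aM))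
        have h2 := hKs a
        have h3 := g.hP.fst
        have h4 := (cl a).2.2.2.2 g.aM
        have h5 := kcov a
        simp only [mem_union, mem_insert_iff, mem_singleton_iff] at h1
        clear * - h1 h2 h3 h4 h5
        grind)
  refine ⟨l, hl, fun K2 c2 s2 n2 => ?_⟩
  have := gl K2 c2 (s2.trans subset_union_left) n2
  have h1 := tc_mono (T := T) (le_refl K2) (show X2 ⊆ X2 ∪ C ∪ L ∪ R from fun x hx => (Or.inl (Or.inl (Or.inl hx))))
  omega

theorem Leg.det [Finite U] (hT : Tri T) (g : Leg T X1 X2 X3 C M W a b k1 k2 P Q)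
    (k : BK T X1 X2 X3 C M W b k2 P Q K L R Y s t Q1 Qm Q3) {n : ℕ} (ih : TH T n) (hn : (C ∪ M ∪ W).ncard ≤ n) :
    ∃ l, Pth T (K ∪ Y ∪ {s, t}) s t l ∧ ∀ K2, Cn T K2 → K2 ⊆ K ∪ Y → (∀ x ∈ K2, x ∉ l) →
      tc T K2 X1 + tc T K2 X2 + tc T K2 X3 + nc T K2 {x | x ∈ P} + nc T K2 {x | x ∈ l} ≤ 3 := by
  obtain ⟨c1, c2, la, lb, e, ha, hb, ba, bb, hK, main⟩ := g.blocks k.o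
  have sp := g.spP e
  have nd := g.hP.nd
  rw [e, List.nodup_append] at nd
  have hps : ∀ y, y ∈ P → y ∈ M := g.hP.sub
  have cl := g.cl
  have pm : ∀ y, y ∈ P ↔ y ∈ c1 ∨ y ∈ c2 := fun y => by rw [e]; simp
  have dab : Dj (X1 ∪ {x | x ∈ c1}) ({x | x ∈ c2} ∪ X3) := by
    grind
  have hAB : ∀ y, (y ∈ X1 ∪ {x | x ∈ c1} ∨ y ∈ {x | x ∈ c2} ∪ X3) ↔ (y ∈ X1 ∨ y ∈ P ∨ y ∈ X3) := by
    grind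
  have haZ : la ⊆ X1 ∪ {x | x ∈ P} ∪ X3 := fun y hy => by
    grind
  have hbZ : lb ⊆ X1 ∪ {x | x ∈ P} ∪ X3 := fun y hy => by
    grind
  have tAB : Tch T (X1 ∪ {x | x ∈ c1}) ({x | x ∈ c2} ∪ X3) := g.t13.mo
  have tA : Tch T X2 (X1 ∪ {x | x ∈ c1}) := g.t12.symm.mo
  have tB : Tch T X2 ({x | x ∈ c2} ∪ X3) := g.t23.mo
  have nK2 : ∀ K2, K2 ⊆ K ∪ Y → ∀ k ∈ K2, ∀ z ∈ X1 ∪ {x | x ∈ P} ∪ X3, T.Adj k z → z ∈ K ∨ k ∈ K := by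
    intro K2 h2 y hy z hz hyz
    rcases h2 hy with h | h
    · exact Or.inr h
    · exfalso
      have h1 := k.nY y h z hyz
      have h2 := cl z
      have h3 := k.cov z
      have h4 : z ∈ K → z ∈ M ∧ z ∉ P := fun hy => ⟨k.hK.sub hy, k.hK.np z hy⟩
      grind
  have nK3 : ∀ K2, K2 ⊆ K ∪ Y → ∀ k ∈ K2, ∀ z ∈ X1 ∪ {x | x ∈ P} ∪ X3, T.Adj k z → k ∈ K := by
    intro K2 h2 y hy z hz hyz
    rcases nK2 K2 h2 y hy z hz hyz with h | h
    · exfalso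
      have h2 := cl z
      have h4 : z ∈ K → z ∈ M ∧ z ∉ P := fun hy => ⟨k.hK.sub hy, k.hK.np z hy⟩
      grind
    · exact h
  have main' := fun K2 (h2 : K2 ⊆ K ∪ Y) => main K2 fun y hy z hz hyz => hK y (nK3 K2 h2 y hy z hz hyz) z hz hyz
  obtain ⟨zs, hzs, hszs, hKzs⟩ := k.sB
  obtain ⟨zt, hzt, htzt, hKzt⟩ := k.tB
  have toZ : ∀ {z}, (z ∈ X1 ∨ z ∈ P ∨ z ∈ X3) → z ∈ X1 ∪ {x | x ∈ P} ∪ X3 := fun h => by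
    grind
  have ls : zs ∈ la ∨ zs ∈ lb := by
    obtain ⟨y, hy, z, hz, h⟩ := hKzs
    grind
  have lt : zt ∈ la ∨ zt ∈ lb := by
    obtain ⟨y, hy, z, hz, h⟩ := hKzt
    grind
  have one : ∀ {l l' : Set U}, l ⊆ X1 ∪ {x | x ∈ P} ∪ X3 → l' ⊆ X1 ∪ {x | x ∈ P} ∪ X3 → Dj l l' →
      Blk T (X2 ∪ C) (X1 ∪ {x | x ∈ P} ∪ X3) l → zs ∈ l → zt ∈ l →
      (∀ K2, K2 ⊆ K ∪ Y → tc T K2 X1 + tc T K2 X3 + nc T K2 {x | x ∈ P} ≤ tc T K2 l + tc T K2 l') →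
    ∃ l, Pth T (K ∪ Y ∪ {s, t}) s t l ∧ ∀ K2, Cn T K2 → K2 ⊆ K ∪ Y → (∀ x ∈ K2, x ∉ l) →
      tc T K2 X1 + tc T K2 X2 + tc T K2 X3 + nc T K2 {x | x ∈ P} + nc T K2 {x | x ∈ l} ≤ 3 := by
    intro l l' hl hl' dl bl h1 h2 h3
    have h4 := g.oneblk hT k bl hl (fun y hy => ⟨hl' hy, fun h => dl y h hy⟩) ⟨s, rfl, zs, h1, hszs⟩ ⟨t, rfl, zt, h2, htzt⟩
    obtain ⟨d, hd, gd⟩ := g.det2 hT k ih hn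
    refine ⟨d, hd, fun K2 c2 s2 n2 => ?_⟩
    have h5 := gd K2 c2 s2 n2
    have h6 : ¬ Tch T K2 l' := by
      rintro ⟨y, hy, z, hz, hyz⟩
      exact h4 ⟨y, nK3 K2 s2 y hy z (hl' hz) hyz, z, hz, hyz⟩
    have h7 := h3 K2 s2
    rw [tc_zero h6] at h7
    have h8 := tc_mono (T := T) (le_refl K2) (show l ⊆ X1 ∪ X3 ∪ M \ K from fun z hz => by
      rcases hl hz with (h | h) | h
      exacts [Or.inl (Or.inl h), Or.inr ⟨hps z h, fun h' => k.hK.np z h' h⟩, Or.inl (Or.inr h)])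
    omega
  have dl : Dj la lb := fun y h h' => dab y (ha h) (hb h')
  rcases ls with ls | ls <;> rcases lt with lt | lt
  · grind
  · obtain ⟨d, hd, gd⟩ := g.det3 hT k ih hn sp.1 sp.2 dab hAB tAB tA tB ⟨s, rfl, zs, ha ls, hszs⟩ ⟨t, rfl, zt, hb lt, htzt⟩
    refine ⟨d, hd, fun K2 c2 s2 n2 => ?_⟩
    have h5 := gd K2 c2 s2 n2
    have h6 := main' K2 s2
    have h7 := tc_mono (T := T) (le_refl K2) ha
    have h8 := tc_mono (T := T) (le_refl K2) hb
    omega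
  · obtain ⟨d, hd, gd⟩ := g.det3 hT k ih hn sp.2 sp.1 dab.symm (fun y => or_comm.trans (hAB y)) tAB.symm tB tA ⟨s, rfl, zs, hb ls, hszs⟩ ⟨t, rfl, zt, ha lt, htzt⟩
    refine ⟨d, hd, fun K2 c2 s2 n2 => ?_⟩
    have h5 := gd K2 c2 s2 n2
    have h6 := main' K2 s2
    have h7 := tc_mono (T := T) (le_refl K2) ha
    have h8 := tc_mono (T := T) (le_refl K2) hb
    omega
  · grind
end Abs11

section Abs12
variable {U : Type u} {T : SimpleGraph U}

theorem nd_split {A A' B B' : List U} {x : U} (h : A ++ x :: B = A' ++ x :: B') (hn : (A ++ x :: B).Nodup) :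
    A = A' ∧ B = B' := by
  have h1 : x ∉ A := fun hx => (List.nodup_append.1 hn).2.2 x hx x (by simp) rfl
  have h2 : x ∉ A' := fun hx => by
    grind
  rcases List.append_eq_append_iff.1 h with ⟨c, h3, h4⟩ | ⟨c, h3, h4⟩
  · cases c with
    | nil => simp at h3 h4; exact ⟨h3.symm, h4⟩
    | cons z c => simp at h4; exact absurd (by rw [h3, ← h4.1]; simp) h2
  · cases c with
    | nil => simp at h3 h4; exact ⟨h3, h4.symm⟩
    | cons z c => simp at h4; exact absurd (by rw [h3, ← h4.1]; simp) h1

theorem asm {ι : Type*} {W D : Set U} {k b : U} {Q : List U} (hQ : Pth T W k b Q) (hWD : W ⊆ D)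
    {A B E d : ι → List U} {s t : ι → U} {Y : ι → Set U}
    (e : ∀ i, Q = A i ++ s i :: (B i ++ t i :: E i)) (hYD : ∀ i, Y i ⊆ D)
    (hY : ∀ i, ∀ x ∈ Q, x ∈ Y i ↔ x ∈ B i)
    (sn : ∀ i j, s i ∉ Y j) (tn : ∀ i j, t i ∉ Y j) (inj : ∀ i j, s i = s j → i = j)
    (hd : ∀ i, Pth T (Y i ∪ {s i, t i}) (s i) (t i) (d i))
    (dd : ∀ i j, i ≠ j → ∀ x ∈ d i, x ∉ Y j) :
    ∃ l, Pth T D k b l ∧ ∀ x, x ∈ l ↔ (x ∈ Q ∧ ∀ i, x ∉ Y i) ∨ ∃ i, x ∈ d i := by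
  have sQ : ∀ i, s i ∈ Q := fun i => by rw [e i]; simp
  have tQ : ∀ i, t i ∈ Q := fun i => by rw [e i]; simp
  have dD : ∀ i, Y i ∪ {s i, t i} ⊆ D := by
    rintro i x (h | rfl | rfl)
    exacts [hYD i h, hWD (hQ.sub _ (sQ i)), hWD (hQ.sub _ (tQ i))]
  have key : ∀ n, ∀ F x S, S.length = n → Q = F ++ x :: S → (∀ i, x ∉ Y i) →
      ∃ l, Pth T D x b l ∧ ∀ z, z ∈ l ↔ (z ∈ x :: S ∧ ∀ i, z ∉ Y i) ∨ ∃ i, s i ∈ x :: S ∧ z ∈ d i := by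
    intro n
    induction n using Nat.strong_induction_on with
    | _ n ih =>
    intro F x S hS hQe hx
    have hn := hQ.nd
    have hch := hQ.ch
    have hlt := hQ.lt
    rw [hQe] at hn hch hlt
    have hn' := hn
    rw [List.nodup_append, List.nodup_cons] at hn'
    have inQ : ∀ z ∈ x :: S, z ∈ Q := fun z hz => by rw [hQe]; exact List.mem_append_right _ hz
    -- the right end lies beyond the left one
    have st : ∀ i, s i ∈ S → t i ∈ S := by
      intro i hi
      obtain ⟨u, v, huv⟩ := List.append_of_mem hi
      have h1 : A i ++ s i :: (B i ++ t i :: E i) = (F ++ x :: u) ++ s i :: v := by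
        grind
      have h2 := (nd_split h1 (by rw [← e i]; exact hQ.nd)).2
      grind
    by_cases hs : ∃ i, s i = x
    · obtain ⟨i, rfl⟩ := hs
      obtain ⟨h1, h2⟩ := nd_split ((e i).symm.trans hQe) (by rw [← e i]; exact hQ.nd)
      subst h2
      obtain ⟨l, hl, ml⟩ := ih (E i).length (by rw [← hS]; simp; omega) (F ++ s i :: B i) (t i) (E i) rfl
        (by rw [hQe]; simp) (tn i)
      have d1 : ∀ z ∈ B i, z ∈ Y i := by grind
      have nsE : s i ∉ t i :: E i := by grind
      obtain ⟨l2, hl2, ml2⟩ := ((hd i).mono (dD i)).trans hl (fun z hz hz' => by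
        have hz2 := (hd i).sub z hz
        have hend : z ∈ t i :: E i → (∀ j, j ≠ i → z ∉ Y j) → z ∉ Y i → z = t i := by
          grind
        rcases (ml z).1 hz' with ⟨h3, h4⟩ | ⟨j, hj, hzj⟩
        · grind
        · have hji : j ≠ i := by grind
          have h5 := dd i j hji.symm z hz
          have h6 := dd j i hji z hzj
          rcases hz2 with h | h | h
          · grind
          · rcases (hd j).sub z hzj with h7 | h7 | h7
            all_goals grind
          · exact h)
      refine ⟨l2, hl2, fun z => ?_⟩
      rw [ml2, ml]
      have sd := (hd i).fst
      have td := (hd i).last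
      constructor
      · rintro (h | ⟨h, h'⟩ | ⟨j, h, h'⟩)
        all_goals grind
      · rintro (⟨h, h'⟩ | ⟨j, h, h'⟩)
        all_goals grind
    · cases S with
      | nil =>
        have : b = x := by simp at hlt; exact hlt.symm
        subst this
        refine ⟨[b], Pth.single (hWD (hQ.sub b hQ.last)), fun z => ?_⟩
        constructor
        · grind
        · grind
      | cons y S =>
        have hy : ∀ i, y ∉ Y i := by
          intro i hi
          have h1 := (hY i y (inQ y (by simp))).1 hi
          obtain ⟨u, v, huv⟩ := List.append_of_mem h1
          have h2 : (A i ++ s i :: u) ++ y :: (v ++ t i :: E i) = (F ++ [x]) ++ y :: S := by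
            grind
          have h3 := (nd_split h2 (by have := e i; rw [huv] at this; simp at this ⊢; rw [← this]; exact hQ.nd)).1
          rcases List.eq_nil_or_concat u with hu | ⟨u', w, hu⟩
          · subst hu
            grind
          · rw [hu] at h3
            have h4 : (A i ++ s i :: u') ++ [w] = F ++ [x] := by grind
            have := List.append_inj_right' h4 rfl
            simp at this
            refine hx i ((hY i x (inQ x (by simp))).2 ?_)
            grind
        obtain ⟨l, hl, ml⟩ := ih S.length (by rw [← hS]; simp) (F ++ [x]) y S rfl (by rw [hQe]; simp) hy
        have hxy : T.Adj x y := (List.isChain_cons_cons.1 hch.right_of_append).1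
        refine ⟨x :: l, hl.cons hxy ?_ (hWD (hQ.sub x (inQ x (by simp)))), fun z => ?_⟩
        · intro hxl
          rcases (ml x).1 hxl with ⟨h, -⟩ | ⟨j, h, h'⟩
          · exact hn'.2.1.1 h
          · rcases (hd j).sub x h' with h7 | h7 | h7
            all_goals grind
        · rw [List.mem_cons, ml]
          constructor
          · rintro (rfl | ⟨h, h'⟩ | ⟨j, h, h'⟩)
            all_goals grind
          all_goals grind
  cases Q with
  | nil => exact absurd rfl hQ.ne
  | cons z S =>
    have hz := hQ.hd
    simp at hz; subst hz
    have hk : ∀ i, z ∉ Y i := by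
      intro i hi
      have h1 := (hY i z (by simp)).1 hi
      have hn := hQ.nd
      have := e i
      cases hA : A i with
      | nil => rw [hA] at this; simp at this; rw [this.1] at hi; exact sn i i hi
      | cons w A' =>
        rw [hA] at this; simp at this
        rw [List.nodup_cons] at hn
        exact hn.1 (by rw [this.2]; simp [h1])
    obtain ⟨l, hl, ml⟩ := key S.length [] z S rfl rfl hk
    refine ⟨l, hl, fun x => ?_⟩
    rw [ml]
    constructor
    · grind
    · grind
variable {X1 X2 X3 C M W : Set U} {a b k1 k2 : U} {P Q : List U}
variable {K L R Y K' L' R' Y' : Set U} {s t s' t' : U} {Q1 Qm Q3 Q1' Qm' Q3' : List U}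

theorem Kc.dj (h : Kc T M P K) (h' : Kc T M P K') (hne : K ≠ K') : Dj K K' := by
  intro x hx hx'
  refine hne (Subset.antisymm ?_ ?_)
  · exact h.cn.sub_of_closed ⟨x, hx, hx'⟩ fun u hu v hv huv => h'.cl u hu v (h.sub hv) (h.np v hv) huv
  · exact h'.cn.sub_of_closed ⟨x, hx', hx⟩ fun u hu v hv huv => h.cl u hu v (h'.sub hv) (h'.np v hv) huv

theorem Leg.no [Finite U] (hT : Tri T) (g : Leg T X1 X2 X3 C M W a b k1 k2 P Q)
    (k : BK T X1 X2 X3 C M W b k2 P Q K L R Y s t Q1 Qm Q3)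
    (k' : BK T X1 X2 X3 C M W b k2 P Q K' L' R' Y' s' t' Q1' Qm' Q3') (hne : K ≠ K') {c1 c2 : List U}
    (e : Q = c1 ++ c2) (h1 : s ∈ c1) (h2 : s' ∈ c1) (h3 : t ∈ c2) (h4 : t' ∈ c2) : False :=
  g.f2 hT k.hK k'.hK (k.hK.dj k'.hK hne) (c1 := c1) (c2 := c2) (q := []) (by simpa using e)
    (k.ts.symm.mono le_rfl (by simpa using h1)) (k.tt.symm.mono le_rfl (by simpa using h3))
    (k'.ts.symm.mono le_rfl (by simpa using h2)) (k'.tt.symm.mono le_rfl (by simpa using h4))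

theorem BK.hY (g : Leg T X1 X2 X3 C M W a b k1 k2 P Q)
    (k : BK T X1 X2 X3 C M W b k2 P Q K L R Y s t Q1 Qm Q3) {x : U} (hx : x ∈ Q) : x ∈ K ∪ Y ↔ x ∈ Qm := by
  have h1 : x ∈ W := g.hQ.sub x hx
  have h2 : x ∉ K := fun h => (g.cl x).2.2.2.2 (k.hK.sub h) h1
  have h3 := k.dj x
  have h4 := k.qm x
  have h5 := k.q1 x
  have h6 := k.q3 x
  rw [k.eQ] at hx
  simp only [List.mem_append, List.mem_cons] at hx
  simp only [mem_union]
  clear * - h2 h3 h4 h5 h6 hx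
  grind

theorem Leg.pair [Finite U] (hT : Tri T) (g : Leg T X1 X2 X3 C M W a b k1 k2 P Q)
    (k : BK T X1 X2 X3 C M W b k2 P Q K L R Y s t Q1 Qm Q3)
    (k' : BK T X1 X2 X3 C M W b k2 P Q K' L' R' Y' s' t' Q1' Qm' Q3') (hne : K ≠ K') :
    s ≠ s' ∧ s ∉ Qm' ∧ t ∉ Qm' ∧ ¬ (s = t' ∧ t = s') := by
  have hn := g.hQ.nd
  refine ⟨?_, ?_, ?_, ?_⟩
  · rintro rfl
    have := nd_split (k.eQ.symm.trans k'.eQ) (by rw [← k.eQ]; exact hn)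
    refine g.no hT k k' hne (c1 := Q1 ++ [s]) (c2 := Qm ++ t :: Q3) (by rw [k.eQ]; simp) (by simp) (by simp) (by simp) ?_
    grind
  · intro h
    obtain ⟨u, v, huv⟩ := List.append_of_mem h
    have h1 : Q1 ++ s :: (Qm ++ t :: Q3) = (Q1' ++ s' :: u) ++ s :: (v ++ t' :: Q3') := by
      rw [← k.eQ, k'.eQ, huv]; simp
    have := nd_split h1 (by rw [← k.eQ]; exact hn)
    refine g.no hT k k' hne (c1 := Q1 ++ [s]) (c2 := Qm ++ t :: Q3) (by rw [k.eQ]; simp) (by simp) ?_ (by simp) ?_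
    all_goals grind
  · intro h
    obtain ⟨u, v, huv⟩ := List.append_of_mem h
    have h1 : (Q1 ++ s :: Qm) ++ t :: Q3 = (Q1' ++ s' :: u) ++ t :: (v ++ t' :: Q3') := by
      have := k.eQ.symm.trans k'.eQ; rw [huv] at this; simpa using this
    have := nd_split h1 (by have := k.eQ; simp at this ⊢; rw [← this]; exact hn)
    refine g.no hT k k' hne (c1 := Q1 ++ s :: Qm) (c2 := t :: Q3) (by rw [k.eQ]; simp) (by simp) ?_ (by simp) ?_
    all_goals grind
  · rintro ⟨rfl, rfl⟩
    have h1 : Q1 ++ s :: (Qm ++ t :: Q3) = (Q1' ++ t :: Qm') ++ s :: Q3' := by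
      rw [← k.eQ, k'.eQ]; simp
    have := nd_split h1 (by rw [← k.eQ]; exact hn)
    have hn' := hn
    rw [k.eQ, this.1] at hn'
    grind
theorem Leg.sep [Finite U] (hT : Tri T) (g : Leg T X1 X2 X3 C M W a b k1 k2 P Q)
    (k : BK T X1 X2 X3 C M W b k2 P Q K L R Y s t Q1 Qm Q3)
    (k' : BK T X1 X2 X3 C M W b k2 P Q K' L' R' Y' s' t' Q1' Qm' Q3') (hne : K ≠ K') {d : List U}
    (hd : Pth T (K ∪ Y ∪ {s, t}) s t d) {x : U} (hx : x ∈ d) : x ∉ K' ∪ Y' := by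
  obtain ⟨p1, p2, p3, p4⟩ := g.pair hT k k' hne
  obtain ⟨p1', p2', p3', -⟩ := g.pair hT k' k hne.symm
  have sQ : s ∈ Q := by rw [k.eQ]; simp
  have tQ : t ∈ Q := by rw [k.eQ]; simp
  have sQ' : s' ∈ Q := by rw [k'.eQ]; simp
  have tQ' : t' ∈ Q := by rw [k'.eQ]; simp
  rw [← k'.hY g sQ] at p2
  rw [← k'.hY g tQ] at p3
  rw [← k.hY g sQ'] at p2'
  rw [← k.hY g tQ'] at p3'
  have dK := k.hK.dj k'.hK hne
  intro hx'
  have cl := g.cl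
  have hKs : ∀ y, y ∈ K → y ∈ M := fun y hy => k.hK.sub hy
  have hKs' : ∀ y, y ∈ K' → y ∈ M := fun y hy => k'.hK.sub hy
  have hxA : x ∈ Y ∩ Y' := by
    have h0 := hd.sub x hx
    have h1 := cl x; have h2 := hKs x; have h3 := hKs' x; have h4 := k.cov x; have h5 := k'.cov x; have h6 := dK x
    grind
  -- leaving the common part only through a common end
  have out : ∀ y ∈ Y ∩ Y', ∀ z ∈ d, z ∉ Y ∩ Y' → T.Adj y z → (z = s ∨ z = t) ∧ (z = s' ∨ z = t') := by
    intro y hy z hz hzA hyz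
    have h0 := hd.sub z hz
    have h7 := k.nY y hy.1 z hyz
    have h8 := k'.nY y hy.2 z hyz
    have h1 := cl z; have h2 := hKs z; have h3 := hKs' z; have h4 := k.cov z; have h5 := k'.cov z; have h6 := dK z
    grind
  have go : ∀ {S : Set U}, Cn T S → S ⊆ {z | z ∈ d} → x ∈ S → (∃ y ∈ S, y ∉ Y ∩ Y') →
      ∃ z ∈ S, z ∉ Y ∩ Y' ∧ (z = s ∨ z = t) ∧ (z = s' ∨ z = t') := by
    rintro S hS hSd hxS ⟨y, hy, hyA⟩
    obtain ⟨u, hu, v, hv, hvu, huv⟩ := hS.touch (A := S ∩ (Y ∩ Y')) inter_subset_left ⟨x, hxS, hxA⟩ ⟨y, hy, fun h => hyA h.2⟩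
    exact ⟨v, hv, fun h => hvu ⟨hv, h⟩, out u hu.2 v (hSd hv) (fun h => hvu ⟨hv, h⟩) huv⟩
  have sA : s ∉ Y ∩ Y' := fun h => p2 (Or.inr h.2)
  have tA : t ∉ Y ∩ Y' := fun h => p3 (Or.inr h.2)
  obtain ⟨u, v, e⟩ := List.append_of_mem hx
  have hch := hd.ch
  have hnd := hd.nd
  have hs := hd.hd
  have ht := hd.lt
  have e' : d = (u ++ [x]) ++ v := by rw [e]; simp
  have su : s ∈ u ++ [x] := by
    rw [e'] at hs
    rw [List.head?_append_of_ne_nil _ (by simp)] at hs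
    exact List.mem_of_mem_head? hs
  have tv : t ∈ x :: v := by
    grind
  obtain ⟨z1, hz1, nz1, e1, e1'⟩ := go (S := {z | z ∈ u ++ [x]}) (Cn.chain' (by simp) (by rw [e'] at hch; exact hch.left_of_append))
    (fun z hz => by rw [e']; exact List.mem_append_left _ hz) (by simp) ⟨s, su, sA⟩
  obtain ⟨z2, hz2, nz2, e2, e2'⟩ := go (S := {z | z ∈ x :: v}) (Cn.chain' (by simp) (by rw [e] at hch; exact hch.right_of_append))
    (fun z hz => by rw [e]; exact List.mem_append_right _ hz) (by simp) ⟨t, tv, tA⟩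
  have hz12 : z1 ≠ z2 := by
    grind
  clear * - e1 e1' e2 e2' hz12 p1 p4
  grind

end Abs12

section Abs13
variable {U : Type u} {T : SimpleGraph U}
variable {X1 X2 X3 C M W : Set U} {a b k1 k2 : U} {P Q : List U}

theorem Leg.fin [Finite U] (hT : Tri T) (g : Leg T X1 X2 X3 C M W a b k1 k2 P Q) {n : ℕ} (ih : TH T n)
    (hn : (C ∪ M ∪ W).ncard ≤ n) {tp : List U} (hp : Pth T (C ∪ {k1, k2}) k1 k2 tp)
    (gp : Good T X1 X2 X3 C tp) : ∃ l, Pth T (C ∪ M ∪ W) a b l ∧ Good T X1 X2 X3 (C ∪ M ∪ W) l := by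
  obtain ⟨ι, K, hK, hK2, hinj, hall⟩ : ∃ (ι : Type u) (K : ι → Set U), (∀ i, Kc T M P (K i)) ∧
      (∀ i, 2 ≤ nc T (K i) {x | x ∈ Q}) ∧ (∀ i j, i ≠ j → K i ≠ K j) ∧
      ∀ K', Kc T M P K' → 2 ≤ nc T K' {x | x ∈ Q} → ∃ i, K i = K' :=
    ⟨{K : Set U // Kc T M P K ∧ 2 ≤ nc T K {x | x ∈ Q}}, fun i => i.1, fun i => i.2.1, fun i => i.2.2,
      fun i j h h' => h (Subtype.ext h'), fun K' h h' => ⟨⟨K', h, h'⟩, rfl⟩⟩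
  have hbk := fun i => g.bk hT (hK i) (hK2 i)
  choose L R Y s t Q1 Qm Q3 k using hbk
  have hdet := fun i => g.det hT (k i) ih hn
  choose d hd gd using hdet
  have cl := g.cl
  have sQ : ∀ i, s i ∈ Q := fun i => by rw [(k i).eQ]; simp
  have tQ : ∀ i, t i ∈ Q := fun i => by rw [(k i).eQ]; simp
  have hY := fun i => fun x (hx : x ∈ Q) => (k i).hY g hx
  have kM : ∀ i, ∀ x, x ∈ K i → x ∈ M := fun i x hx => (hK i).sub hx
  have YW : ∀ i, ∀ x, x ∈ Y i → x ∈ W := fun i x hx => ((k i).cov x).2 (Or.inr (Or.inr (Or.inl hx)))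
  have QW := g.hQ.sub
  have PM := g.hP.sub
  have self : ∀ i, s i ∉ K i ∪ Y i ∧ t i ∉ K i ∪ Y i := by
    intro i
    have h1 := (k i).dj (s i); have h2 := (k i).dj (t i)
    grind
  have dd : ∀ i j, i ≠ j → ∀ x ∈ d i, x ∉ K j ∪ Y j := fun i j h x hx => g.sep hT (k i) (k j) (hinj i j h) (hd i) hx
  obtain ⟨Q', hQ', mQ⟩ := asm (D := M ∪ W) (Y := fun i => K i ∪ Y i) g.hQ (fun x hx => Or.inr hx) (fun i => (k i).eQ)
    (fun i x hx => hx.elim (fun h => Or.inl (kM i x h)) (fun h => Or.inr (YW i x h))) hY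
    (fun i j => by
      by_cases h : i = j
      · grind
      · rw [hY j _ (sQ i)]; exact (g.pair hT (k i) (k j) (hinj i j h)).2.1)
    (fun i j => by
      by_cases h : i = j
      · grind
      · rw [hY j _ (tQ i)]; exact (g.pair hT (k i) (k j) (hinj i j h)).2.2.1)
    (fun i j h => by
      by_contra hc; exact (g.pair hT (k i) (k j) (hinj i j hc)).1 h) hd dd
  have dS : ∀ i, ∀ x ∈ d i, x ∈ K i ∪ Y i ∨ x ∈ Q := by
    intro i x hx
    rcases (hd i).sub x hx with h | h | h
    exacts [Or.inl h, Or.inr (h ▸ sQ i), Or.inr (mem_singleton_iff.1 h ▸ tQ i)]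
  have sd : ∀ i, s i ∈ Q' := fun i => (mQ _).2 (Or.inr ⟨i, (hd i).fst⟩)
  have td : ∀ i, t i ∈ Q' := fun i => (mQ _).2 (Or.inr ⟨i, (hd i).last⟩)
  have Q'S : ∀ x ∈ Q', x ∈ Q ∨ ∃ i, x ∈ K i ∪ Y i := by
    grind
  have PQ' : ∀ x ∈ P, x ∉ Q' := by
    intro x hx hx'
    have h1 := PM x hx
    have h3 := (cl x).2.2.2.2 h1
    rcases Q'S x hx' with h | ⟨i, h | h⟩
    · grind
    · exact (hK i).np x h hx
    all_goals grind
  have hp' : ∀ x ∈ tp, x ∈ C ∨ x = k1 ∨ x = k2 := hp.sub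
  have k1P := g.hP.last
  have k2Q := g.hQ.fst
  have k2Q' := hQ'.fst
  obtain ⟨l1, hl1, ml1⟩ := (g.hP.mono (D' := C ∪ M ∪ W) (fun x hx => Or.inl (Or.inr hx))).trans
    (hp.mono (D' := C ∪ M ∪ W) (by
      rintro x (h | h | h)
      exacts [Or.inl (Or.inl h), Or.inl (Or.inr (h ▸ g.k1M)), Or.inr (mem_singleton_iff.1 h ▸ g.k2W)]))
    (fun x hx hx' => by
      rcases hp' x hx' with h | h | h
      · grind
      · exact h
      · exact absurd (h ▸ k2Q') (PQ' x hx))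
  obtain ⟨l, hl, ml⟩ := hl1.trans (hQ'.mono (D' := C ∪ M ∪ W) (by
      rintro x (h | h)
      exacts [Or.inl (Or.inr h), Or.inr h]))
    (fun x hx hx' => by
      rcases (ml1 x).1 hx with h | h
      · grind
      rcases hp' x h with h | h | h
      · grind
      · grind
      · exact h)
  have ml' : ∀ x, x ∈ l ↔ x ∈ P ∨ x ∈ tp ∨ x ∈ Q' := fun x => by rw [ml, ml1, or_assoc]
  refine ⟨l, hl, fun J hJ hJD hJl => ?_⟩
  have Jp : ∀ x ∈ J, x ∉ P ∧ x ∉ tp ∧ x ∉ Q' := fun x hx => by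
    grind
  have k1J : k1 ∉ J := fun h => (Jp _ h).1 k1P
  have k2J : k2 ∉ J := fun h => (Jp _ h).2.2 k2Q'
  by_cases c1 : (J ∩ C).Nonempty
  · have hJC : J ⊆ C := hJ.sub_of_closed c1 (by
      intro u hu v hv huv
      have h1 := g.nC u hu v huv
      have h2 := hJD hv
      have h3 := cl v
      have h4 : v ≠ k1 := fun h => k1J (h ▸ hv)
      have h5 : v ≠ k2 := fun h => k2J (h ▸ hv)
      simp only [mem_union] at h2
      clear * - h1 h2 h3 h4 h5
      grind)
    refine le_trans (Nat.add_le_add_left (nc_sub (S' := {x | x ∈ tp}) ?_) _) (gp J hJ hJC (fun x hx => (Jp x hx).2.1))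
    intro x hx j hj hjx
    have h1 := g.nC j (hJC hj) x hjx
    have h3 := cl x
    have h4 : x = k1 → x ∈ tp := fun h => h ▸ hp.fst
    have h5 : x = k2 → x ∈ tp := fun h => h ▸ hp.last
    grind
  by_cases c2 : ∃ i, (J ∩ (K i ∪ Y i)).Nonempty
  · obtain ⟨i, c2⟩ := c2
    have nbi : ∀ u ∈ K i ∪ Y i, ∀ v, T.Adj u v → v ∈ K i ∪ Y i ∨ v = s i ∨ v = t i ∨ v ∈ X1 ∨ v ∈ X2 ∨ v ∈ X3 ∨ v ∈ P := by
      intro u hu v huv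
      rcases hu with hu | hu
      · have h1 := g.nbK (hK i) hu huv
        have h2 := (k i).nK u hu v
        grind
      · have h1 := (k i).nY u hu v huv
        grind
    have hJi : J ⊆ K i ∪ Y i := hJ.sub_of_closed c2 (by
      intro u hu v hv huv
      have h1 := nbi u hu v huv
      have h2 := hJD hv
      have h3 := cl v
      have h4 : v ≠ s i := fun h => (Jp v hv).2.2 (h ▸ sd i)
      have h5 : v ≠ t i := fun h => (Jp v hv).2.2 (h ▸ td i)
      have h6 := (Jp v hv).1
      simp only [mem_union] at *
      clear * - h1 h2 h3 h4 h5 h6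
      grind)
    have key := gd i J hJ hJi (fun x hx hx' => (Jp x hx).2.2 ((mQ x).2 (Or.inr ⟨i, hx'⟩)))
    have h10 : nc T J {x | x ∈ l} ≤ nc T J ({x | x ∈ P} ∪ {x | x ∈ d i}) := by
      refine nc_sub ?_
      intro x hx j hj hjx
      have h1 := nbi j (hJi hj) x hjx
      have h2 := hl.sub x hx
      have h3 := cl x
      have h4 : x = s i → x ∈ d i := fun h => h ▸ (hd i).fst
      have h5 : x = t i → x ∈ d i := fun h => h ▸ (hd i).last
      have h6 : x ∈ K i ∪ Y i → x ∈ P ∨ x ∈ d i := by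
        intro h6
        have h9 : x ∉ C := by grind
        have h7 : x ∈ P ∨ x ∈ Q' := by
          grind
        grind
      grind
    have h11 := nc_union (T := T) J {x | x ∈ P} {x | x ∈ d i}
    omega
  have nJ : ∀ i, ∀ x ∈ J, x ∉ K i ∪ Y i := fun i x hx h => c2 ⟨i, x, hx, h⟩
  have nQ : ∀ x ∈ J, x ∉ Q := by
    grind
  by_cases c3 : (J ∩ M).Nonempty
  · obtain ⟨x0, hx0, hxM⟩ := c3
    have hx0' : x0 ∈ M \ {x | x ∈ P} := by grind
    have hKc : Kc T M P (Cmp T (M \ {x | x ∈ P}) x0) :=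
      ⟨Cmp_Cn, fun x hx => (Cmp_sub hx0' hx).1, fun x hx => (Cmp_sub hx0' hx).2,
        fun u hu v hv hvP huv => Cmp_step hu ⟨hv, hvP⟩ huv⟩
    have hx0K : x0 ∈ Cmp T (M \ {x | x ∈ P}) x0 := mem_Cmp_self
    generalize Cmp T (M \ {x | x ∈ P}) x0 = K0 at hKc hx0K
    have hb : ¬ 2 ≤ nc T K0 {x | x ∈ Q} := fun h => by
      grind
    have hJK : J ⊆ K0 := hJ.sub_of_closed ⟨x0, hx0, hx0K⟩ (by
      intro u hu v hv huv
      have h1 := g.nbK hKc hu huv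
      have h2 := hJD hv
      have h3 := cl v
      have h4 := nQ v hv
      have h6 := (Jp v hv).1
      simp only [mem_union] at *
      clear * - h1 h2 h3 h4 h6
      grind)
    have h1 := g.nonbad hT hKc hb
    have h10 : nc T J {x | x ∈ l} ≤ nc T K0 ({x | x ∈ P} ∪ {x | x ∈ Q}) := by
      refine le_trans (nc_sub (S' := {x | x ∈ P} ∪ {x | x ∈ Q}) ?_) (nc_mono hJK le_rfl)
      intro x hx j hj hjx
      have h2 := g.nbK hKc (hJK hj) hjx
      have h3 := cl x
      have h4 := hl.sub x hx
      have h5 : x ∈ K0 → x ∈ P ∨ x ∈ Q := by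
        intro h5
        have h6 := hKc.sub h5
        rcases (ml' x).1 hx with h | h | h
        · exact Or.inl h
        · grind
        · rcases Q'S x h with h | ⟨i, h | h⟩
          · exact Or.inr h
          · exfalso
            have : K i = K0 := by
              by_contra hc; exact (hK i).dj hKc hc x h h5
            grind
          all_goals grind
      grind
    have h11 := nc_union (T := T) K0 {x | x ∈ P} {x | x ∈ Q}
    have h12 := tc_mono (T := T) hJK (le_refl X1)
    have h13 := tc_mono (T := T) hJK (le_refl X2)
    have h14 := tc_mono (T := T) hJK (le_refl X3)
    omega
  have hJW : J ⊆ W := by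
    intro x hx
    rcases hJD hx with (h | h) | h
    exacts [absurd ⟨x, hx, h⟩ c1, absurd ⟨x, hx, h⟩ c3, h]
  have h1 := g.gQ J hJ hJW nQ
  have nt : ∀ j ∈ J, ∀ y, T.Adj j y → y ∉ X1 ∧ y ∉ X3 ∧ y ∉ M := by
    intro j hj y hjy
    exact ⟨fun h => nQ j hj (g.w1 (hJW hj) hjy (Or.inl h)), fun h => nQ j hj (g.w1 (hJW hj) hjy (Or.inr (Or.inl h))),
      fun h => nQ j hj (g.w1 (hJW hj) hjy (Or.inr (Or.inr h)))⟩
  have h2 : tc T J X1 = 0 := tc_zero fun ⟨j, hj, y, hy, h⟩ => (nt j hj y h).1 hy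
  have h3 : tc T J X3 = 0 := tc_zero fun ⟨j, hj, y, hy, h⟩ => (nt j hj y h).2.1 hy
  have h4 := tc_mono (T := T) (le_refl J) (show X2 ⊆ X2 ∪ C from subset_union_left)
  have h5 : nc T J {x | x ∈ l} ≤ nc T J {x | x ∈ Q} := by
    refine nc_sub ?_
    intro x hx j hj hjx
    have h6 := nt j hj x hjx
    have hC : x ∉ C := by
      intro h
      have h7 := g.nC x h j hjx.symm
      grind
    have hQx : x ∈ Q' := by
      grind
    rcases Q'S x hQx with h | ⟨i, h | h⟩
    · exact h
    · grind
    · exfalso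
      rcases (k i).nY x h j hjx.symm with h7 | h7 | h7 | h7 | h7
      all_goals grind
  omega

theorem theta [Finite U] (hT : Tri T) (n : ℕ) : TH T n := by
  induction n with
  | zero => intro X1 X2 X3 D a b c h; omega
  | succ n ih =>
    intro X1 X2 X3 D a b c h
    have ih' : TH T D.ncard := fun Y1 Y2 Y3 D' a' b' c' h' => ih Y1 Y2 Y3 D' a' b' c' (by omega)
    by_cases hab : a = b
    · subst hab; exact c.eq_case hT
    rcases c.sg2 hT hab ih' with h | ⟨C, p1, p2, p3, k1, k2, hP, hC, hcard⟩
    · exact h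
    obtain ⟨tp, hp, gp⟩ := c.top hT hP hC hcard ih'
    obtain ⟨M, W, rfl, hs⟩ := c.stp hT hP hC
    obtain ⟨P, Q, g⟩ := hs.leg hT ih' le_rfl
    exact g.fin hT ih' le_rfl hp gp

end Abs13

section Abs14
variable {U : Type u} {T : SimpleGraph U}

theorem three_cov {S : Set U} [Finite U] (h : S.ncard ≤ 3) (hn : Nonempty U) : ∃ p q r : U, ∀ x ∈ S, x = p ∨ x = q ∨ x = r := by
  obtain ⟨z⟩ := hn
  have h' : S.ncard = 0 ∨ S.ncard = 1 ∨ S.ncard = 2 ∨ S.ncard = 3 := by omega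
  rcases h' with h | h | h | h
  · rw [Set.ncard_eq_zero] at h
    exact ⟨z, z, z, by simp [h]⟩
  · obtain ⟨a, rfl⟩ := Set.ncard_eq_one.1 h
    exact ⟨a, a, a, by simp⟩
  · obtain ⟨a, b, -, rfl⟩ := Set.ncard_eq_two.1 h
    exact ⟨a, b, b, by simp⟩
  · obtain ⟨a, b, c, -, -, -, rfl⟩ := Set.ncard_eq_three.1 h
    exact ⟨a, b, c, by simp⟩

theorem Tri.ham [Finite U] (hT : Tri T) {p1 p2 : U} (h12 : T.Adj p1 p2) :
    ∃ l : List U, l.Nodup ∧ (∀ x, x ∈ l) ∧ l.IsChain T.Adj ∧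
      ∃ a z, l.head? = some a ∧ l.getLast? = some z ∧ T.Adj z a := by
  obtain ⟨p3, -, -, h13, h23, -⟩ := hT.two p1 p2 h12
  have other : ∀ u v w, T.Adj u v → ∃ x, x ≠ w ∧ T.Adj u x ∧ T.Adj v x := by
    intro u v w huv
    obtain ⟨x, y, hxy, h1, h2, h3, h4⟩ := hT.two u v huv
    grind
  obtain ⟨a, ha2, ha1, ha3⟩ := other p1 p3 p2 h13
  obtain ⟨b, hb3, hb1, hb2⟩ := other p1 p2 p3 h12
  have n1 := h12.ne; have n2 := h13.ne; have n3 := h23.ne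
  have n4 := ha1.ne; have n5 := ha3.ne; have n6 := hb1.ne; have n7 := hb2.ne
  let D : Set U := {x | x ≠ p1 ∧ x ≠ p2 ∧ x ≠ p3}
  have aD : a ∈ D := ⟨n4.symm, ha2, n5.symm⟩
  have bD : b ∈ D := ⟨n6.symm, n7.symm, hb3⟩
  have jn : b ∈ Cmp T D a := by
    rcases hT.h4 (Cmp T D a) p1 p2 p3 ⟨a, mem_Cmp_self⟩ (fun s hs y hsy => by
      by_cases hy : y ∈ D
      · exact Or.inl (Cmp_step hs hy hsy)
      · by_cases h1 : y = p1
        · grind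
        by_cases h2 : y = p2
        · grind
        by_cases h3 : y = p3
        · grind
        exact absurd ⟨h1, h2, h3⟩ hy) b with h | h | h | h
    exacts [h, absurd h.symm n6, absurd h.symm n7, absurd h hb3]
  have tt : ∀ {x y : U}, T.Adj x y → Tch T {x} {y} := fun h => ⟨_, rfl, _, rfl, h⟩
  have cfg : Cfg T {p1} {p2} {p3} D a b :=
    { c1 := Cn.single _, c2 := Cn.single _, c3 := Cn.single _
      d12 := dj_single n1, d13 := dj_single n2, d23 := dj_single n3
      e1 := dj_single (fun h => h.1 rfl), e2 := dj_single (fun h => h.2.1 rfl), e3 := dj_single (fun h => h.2.2 rfl)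
      cov := fun y => by
        grind
      t12 := tt h12, t13 := tt h13, t23 := tt h23, ha := aD, hb := bD
      a1 := tt ha1.symm, a3 := tt ha3.symm, b1 := tt hb1.symm, b2 := tt hb2.symm, jn := jn }
  obtain ⟨l, hl, hg⟩ := theta hT _ _ _ _ _ _ _ cfg (Nat.lt_succ_self _)
  have cov : ∀ x ∈ D, x ∈ l := by
    intro x hx
    by_contra hxl
    have hx' : x ∈ D \ {y | y ∈ l} := by grind
    have hs := Cmp_sub (T := T) hx'
    have h1 := hg (Cmp T (D \ {y | y ∈ l}) x) Cmp_Cn (fun y hy => (hs hy).1) (fun y hy => (hs hy).2)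
    set K := Cmp T (D \ {y | y ∈ l}) x with hKdef
    have e : ∀ z, nc T K {z} ≤ tc T K {z} := fun z => nc_single K z
    have h2 : nc T K ({p1} ∪ {p2} ∪ {p3} ∪ {y | y ∈ l}) ≤ 3 := by
      have h3 := nc_union (T := T) K ({p1} ∪ {p2} ∪ {p3}) {y | y ∈ l}
      have h4 := nc_union (T := T) K ({p1} ∪ {p2}) {p3}
      have h5 := nc_union (T := T) K {p1} {p2}
      grind
    obtain ⟨p, q, r, hpqr⟩ := three_cov h2 ⟨x⟩
    have h4 := hT.h4 K p q r ⟨x, mem_Cmp_self⟩ (fun s hs' y hsy => by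
      by_cases hy : y ∈ D \ {y | y ∈ l}
      · exact Or.inl (Cmp_step hs' hy hsy)
      · refine Or.inr (hpqr y ⟨?_, s, hs', hsy⟩)
        rcases cfg.cov y with h | h | h | h
        · grind
        · grind
        · grind
        · right; by_contra hc; exact hy ⟨h, hc⟩)
    have k1 : p1 ∉ K := by grind
    have k2 : p2 ∉ K := by grind
    have k3 : p3 ∉ K := by grind
    have k4 : a ∉ K := fun h => (hs h).2 hl.fst
    grind
  have s1 := (hl.mono (subset_univ D)).snoc hb2.symm (fun h => (hl.sub _ h).2.1 rfl) (mem_univ _)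
  have s2 := s1.snoc h12.symm (fun h => by
    rcases List.mem_append.1 h with h | h
    · exact (hl.sub _ h).1 rfl
    · exact n1 (by simpa using h)) (mem_univ _)
  have s3 := s2.snoc h13 (fun h => by
    simp only [List.mem_append, List.mem_singleton] at h
    rcases h with (h | h) | h
    · exact (hl.sub _ h).2.2 rfl
    · exact n3 h.symm
    · exact n2 h.symm) (mem_univ _)
  refine ⟨_, s3.nd, fun x => ?_, s3.ch, a, p3, s3.hd, s3.lt, ha3⟩
  simp only [List.mem_append, List.mem_singleton]
  rcases cfg.cov x with h | h | h | h
  exacts [Or.inl (Or.inr h), Or.inl (Or.inl (Or.inr h)), Or.inr h, Or.inl (Or.inl (Or.inl (cov x h)))]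

end Abs14

section Top1
open Complex Topology Filter
abbrev Pl := ℝ × ℝ

noncomputable def cx : Pl ≃L[ℝ] ℂ := Complex.equivRealProdCLM.symm

lemma cx_ne {p q : Pl} (h : p ≠ q) : cx p - cx q ≠ 0 := fun h' => h (cx.injective (sub_eq_zero.1 h'))

@[fun_prop] lemma cx_cont : Continuous cx := cx.continuous

lemma log_ex {A : Type} [TopologicalSpace A] [SimplyConnectedSpace A] [LocallyPathConnectedSpace A]
    (f : A → ℂ) (hf : Continuous f) (h0 : ∀ a, f a ≠ 0) : ∃ g : A → ℂ, Continuous g ∧ ∀ a, exp (g a) = f a := by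
  have a₀ : A := Classical.choice inferInstance
  obtain ⟨F, ⟨_, hF⟩, _⟩ := Complex.isCoveringMapOn_exp.existsUnique_continuousMap_lifts ⟨f, hf⟩
    (a₀ := a₀) (e₀ := Complex.log (f a₀)) (Complex.exp_log (h0 a₀)) (fun a => h0 a)
  exact ⟨F, F.continuous, fun a => congrFun hF a⟩

lemma log_const {A : Type*} [TopologicalSpace A] {S : Set A} (hS : IsPreconnected S) {h : A → ℂ}
    (hc : ContinuousOn h S) {c : ℂ} (he : ∀ z ∈ S, exp (h z) = c) {x y : A} (hx : x ∈ S) (hy : y ∈ S) :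
    h x = h y := by
  refine hS.induction₂ (fun x y => h x = h y) ?_ (fun x y z _ _ _ h1 h2 => h1.trans h2)
    (fun x y _ _ h1 => h1.symm) hx hy
  intro x hx
  filter_upwards [(hc x hx) (Metric.ball_mem_nhds (h x) one_pos), self_mem_nhdsWithin] with y hy hyS
  have h1 : exp (h y - h x) = 1 := by rw [exp_sub, he y hyS, ← he x hx, div_self (exp_ne_zero _)]
  obtain ⟨n, hn⟩ := Complex.exp_eq_one_iff.1 h1
  have h2 : ‖h y - h x‖ < 1 := by simpa [dist_eq_norm] using hy
  rw [hn] at h2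
  rcases eq_or_ne n 0 with rfl | h0
  · grind
  · have h3 : (1 : ℝ) ≤ |(n : ℝ)| := by exact_mod_cast Int.one_le_abs h0
    have h4 := Real.pi_gt_three
    simp [abs_of_pos Real.pi_pos] at h2
    nlinarith

def HL (K : Set Pl) (p q : Pl) : Prop :=
  ∃ g : Pl → ℂ, ContinuousOn g K ∧ ∀ z ∈ K, cx z - cx p = exp (g z) * (cx z - cx q)

def Jn (K : Set Pl) (p q : Pl) : Prop := ∃ S, IsPreconnected S ∧ Disjoint S K ∧ p ∈ S ∧ q ∈ S

lemma HL.symm {K p q} (h : HL K p q) : HL K q p := by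
  obtain ⟨g, hg, h⟩ := h
  refine ⟨fun z => - g z, hg.neg, fun z hz => ?_⟩
  rw [h z hz, ← mul_assoc, ← exp_add]; simp

lemma Jn.HL {K p q} (hK : IsCompact K) (h : Jn K p q) : HL K p q := by
  obtain ⟨S, hS, hSK, hp, hq⟩ := h
  refine hS.induction₂ (_root_.HL K) ?_ ?_ (fun _ _ _ _ => HL.symm) hp hq
  · intro x hx
    have hc : IsOpen (cx '' K)ᶜ := (hK.image cx.continuous).isClosed.isOpen_compl
    have hxK : cx x ∈ (cx '' K)ᶜ := by
      rintro ⟨y, hy, h⟩; rw [cx.injective h] at hy; exact hSK.le_bot ⟨hx, hy⟩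
    obtain ⟨r, hr, hb⟩ := Metric.isOpen_iff.1 hc _ hxK
    refine mem_nhdsWithin_of_mem_nhds ?_
    filter_upwards [cx.continuous.continuousAt (Metric.ball_mem_nhds (cx x) (half_pos hr))] with y hy
    have hy' : ‖cx y - cx x‖ < r / 2 := by simpa [dist_eq_norm] using hy
    have key : ∀ z ∈ K, ‖cx y - cx x‖ < ‖cx z - cx y‖ := by
      intro z hz
      have h1 : r ≤ ‖cx z - cx x‖ := by
        by_contra h; push Not at h
        exact hb (by simpa [dist_eq_norm] using h) ⟨z, hz, rfl⟩
      have h2 := norm_add_le (cx z - cx y) (cx y - cx x)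
      grind
    have kn : ∀ z ∈ K, cx z - cx y ≠ 0 := fun z hz h => by
      have := key z hz; rw [h, norm_zero] at this; exact absurd this (not_lt.2 (norm_nonneg _))
    have ks : ∀ z ∈ K, (cx z - cx x) / (cx z - cx y) ∈ slitPlane := by
      intro z hz
      have : (cx z - cx x) / (cx z - cx y) = 1 + (cx y - cx x) / (cx z - cx y) := by
        grind
      rw [this]
      refine mem_slitPlane_of_norm_lt_one ?_
      rw [norm_div, div_lt_one (by have := key z hz; have := norm_nonneg (cx y - cx x); linarith)]
      grind
    refine ⟨fun z => Complex.log ((cx z - cx x) / (cx z - cx y)), ?_, ?_⟩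
    · refine ContinuousOn.clog (ContinuousOn.div (by fun_prop) (by fun_prop) kn) ks
    · intro z hz
      rw [exp_log (slitPlane_ne_zero (ks z hz)), div_mul_cancel₀ _ (kn z hz)]
  · rintro x y z - - - ⟨g, hg, h⟩ ⟨g', hg', h'⟩
    refine ⟨fun z => g z + g' z, hg.add hg', fun w hw => ?_⟩
    rw [h w hw, h' w hw, exp_add]; ring

lemma HL_core {K U : Set Pl} {p q : Pl} (hK : IsClosed K) (hUb : Bornology.IsBounded U)
    (hUf : frontier U ⊆ K) (hp : p ∈ U) (hq : q ∉ U) (h : HL K p q) : False := by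
  classical
  obtain ⟨g, hg, h⟩ := h
  obtain ⟨G, hG⟩ := ContinuousMap.exists_restrict_eq hK ⟨_, continuousOn_iff_continuous_domRestrict.1 hg⟩
  have hG' : ∀ z ∈ K, G z = g z := fun z hz => DFunLike.congr_fun hG ⟨z, hz⟩
  obtain ⟨L, hL, hL'⟩ := log_ex (fun z : Pl => if z ∈ U then exp (G z) * (cx z - cx q) else cx z - cx p)
    (Continuous.if (fun z hz => by rw [hG' z (hUf hz), h z (hUf hz)]) (by fun_prop) (by fun_prop))
    (fun z => by
      split_ifs with hz
      · exact mul_ne_zero (exp_ne_zero _) (cx_ne (by rintro rfl; exact hq hz))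
      · exact cx_ne (by rintro rfl; exact hz hp))
  have hb : Bornology.IsBounded (cx '' U) := cx.lipschitz.isBounded_image hUb
  obtain ⟨R, hR, hR'⟩ := hb.subset_ball_lt 0 (cx p)
  have hout : ∀ θ : ℝ, cx.symm (cx p + R * exp (θ * I)) ∉ U := by
    intro θ hθ
    have := hR' ⟨_, hθ, rfl⟩
    simp [norm_exp_ofReal_mul_I, abs_of_pos hR] at this
  have hc : Continuous (fun θ : ℝ => L (cx.symm (cx p + R * exp (θ * I))) - θ * I) := by
    have := cx.symm.continuous
    fun_prop
  have := log_const (S := univ) isPreconnected_univ hc.continuousOn (c := R) (x := 0) (y := 2 * Real.pi) (by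
    intro θ _
    rw [exp_sub, hL', if_neg (hout θ)]
    field_simp [exp_ne_zero]
    simp) trivial trivial
  simp at this
  have h := congrArg im this
  simp at h
  linarith [Real.pi_pos]

lemma compl_ball_conn (R : ℝ) (hR : 0 < R) : IsPreconnected (cx ⁻¹' (Metric.ball 0 R)ᶜ) := by
  have : cx ⁻¹' (Metric.ball 0 R)ᶜ = (fun x : ℝ × ℝ => cx.symm (x.1 * exp (x.2 * I))) '' (Ici R ×ˢ univ) := by
    ext z
    simp only [mem_preimage, mem_compl_iff, Metric.mem_ball, dist_zero_right, not_lt, mem_image, mem_prod,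
      mem_Ici, mem_univ, and_true, Prod.exists]
    constructor
    · intro h; exact ⟨_, _, h, by rw [norm_mul_exp_arg_mul_I]; simp⟩
    · rintro ⟨a, b, h, rfl⟩; simp [norm_exp_ofReal_mul_I]; exact h.trans (le_abs_self a)
  rw [this]
  refine ((convex_Ici R).isPreconnected.prod isPreconnected_univ).image _ ?_
  have := cx.symm.continuous
  fun_prop

lemma cc_frontier {K : Set Pl} (hK : IsClosed K) (p : Pl) : frontier (connectedComponentIn Kᶜ p) ⊆ K := by
  intro z hz
  by_contra hzK
  have h1 := hK.isOpen_compl.connectedComponentIn (x := p)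
  have h2 := hK.isOpen_compl.connectedComponentIn (x := z)
  rw [h1.frontier_eq] at hz
  obtain ⟨w, hw, hw'⟩ := mem_closure_iff.1 hz.1 _ h2 (mem_connectedComponentIn hzK)
  refine hz.2 ?_
  rw [connectedComponentIn_eq hw', ← connectedComponentIn_eq hw]
  exact mem_connectedComponentIn hzK

lemma HL.Jn {K p q} (hK : IsCompact K) (hp : p ∉ K) (hq : q ∉ K) (h : HL K p q) : Jn K p q := by
  have kp : ∀ p, p ∉ K → ∀ q ∈ connectedComponentIn Kᶜ p, _root_.Jn K p q := fun p hp q hq =>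
    ⟨_, isPreconnected_connectedComponentIn, disjoint_left.2 fun x hx => connectedComponentIn_subset _ _ hx,
      mem_connectedComponentIn hp, hq⟩
  by_contra hn
  have h1 : ¬ Bornology.IsBounded (connectedComponentIn Kᶜ p) := fun hb =>
    HL_core hK.isClosed hb (cc_frontier hK.isClosed p) (mem_connectedComponentIn hp) (fun h => hn (kp p hp q h)) h
  have h2 : ¬ Bornology.IsBounded (connectedComponentIn Kᶜ q) := fun hb =>
    HL_core hK.isClosed hb (cc_frontier hK.isClosed q) (mem_connectedComponentIn hq)
      (fun h => hn (by obtain ⟨S, a, b, c, d⟩ := kp q hq p h; exact ⟨S, a, b, d, c⟩)) h.symm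
  obtain ⟨R, hR, hR'⟩ := (hK.image cx.continuous).isBounded.subset_ball_lt 0 0
  have hd : Disjoint (cx ⁻¹' (Metric.ball 0 R)ᶜ) K := by grind
  have far : ∀ S : Set Pl, ¬ Bornology.IsBounded S → ∃ z ∈ S, z ∈ cx ⁻¹' (Metric.ball 0 R)ᶜ := by
    intro S hS; by_contra hc; push Not at hc
    refine hS ((cx.symm.lipschitz.isBounded_image (Metric.isBounded_ball (x := 0) (r := R))).subset ?_)
    intro z hz
    have := hc z hz
    simp only [mem_preimage, mem_compl_iff, not_not] at this
    exact ⟨_, this, by simp⟩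
  obtain ⟨z, hz, hz'⟩ := far _ h1
  obtain ⟨w, hw, hw'⟩ := far _ h2
  obtain ⟨S, a, b, c, d⟩ := kp p hp z hz
  obtain ⟨S', a', b', c', d'⟩ := kp q hq w hw
  exact hn ⟨_, (a.union z d hz' (compl_ball_conn R hR)).union w (Or.inr hw') d' a', by
    simp only [disjoint_union_left]; exact ⟨⟨b, hd⟩, b'⟩, Or.inl (Or.inl c), Or.inr c'⟩

lemma HL.union {A B p q} (hA : IsClosed A) (hB : IsClosed B) (hAB : IsPreconnected (A ∩ B)) (hq : q ∉ A)
    (h : HL A p q) (h' : HL B p q) : HL (A ∪ B) p q := by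
  classical
  obtain ⟨g, hg, h⟩ := h
  obtain ⟨g', hg', h'⟩ := h'
  have he : ∀ z ∈ A ∩ B, exp (g z - g' z) = 1 := by
    intro z hz
    have := (h z hz.1).symm.trans (h' z hz.2)
    rw [exp_sub, mul_right_cancel₀ (cx_ne (by rintro rfl; exact hq hz.1)) this, div_self (exp_ne_zero _)]
  obtain ⟨c, hc, hc'⟩ : ∃ c, exp c = 1 ∧ ∀ z ∈ A ∩ B, g z = g' z + c := by
    rcases (A ∩ B).eq_empty_or_nonempty with h0 | ⟨w, hw⟩
    · exact ⟨0, exp_zero, by simp [h0]⟩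
    · refine ⟨g w - g' w, he w hw, fun z hz => ?_⟩
      have := log_const hAB ((hg.mono inter_subset_left).sub (hg'.mono inter_subset_right)) he hw hz
      simp only [Pi.sub_apply] at this
      grind
  refine ⟨A.piecewise g (fun z => g' z + c), ?_, ?_⟩
  · refine ContinuousOn.union_of_isClosed (hg.congr (piecewise_eqOn _ _ _))
      ((hg'.add continuousOn_const).congr (f := fun z => g' z + c) fun z hz => ?_) hA hB
    by_cases hzA : z ∈ A
    · rw [piecewise_eq_of_mem _ _ _ hzA, hc' z ⟨hzA, hz⟩]
    · rw [piecewise_eq_of_notMem _ _ _ hzA]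
  · intro z hz
    by_cases hzA : z ∈ A
    · rw [piecewise_eq_of_mem _ _ _ hzA]; exact h z hzA
    · rw [piecewise_eq_of_notMem _ _ _ hzA, exp_add, hc, mul_one]; exact h' z (hz.resolve_left hzA)

lemma jan {A B p q} (hA : IsCompact A) (hB : IsCompact B) (hAB : IsPreconnected (A ∩ B)) 
    (h : Jn A p q) (h' : Jn B p q) : Jn (A ∪ B) p q := by
  have a := h.HL hA; have b := h'.HL hB
  obtain ⟨S, -, c, d, e⟩ := h
  obtain ⟨S', -, c', d', e'⟩ := h'
  have k : ∀ x ∈ S, x ∉ A := fun x hx => disjoint_left.1 c hx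
  have k' : ∀ x ∈ S', x ∉ B := fun x hx => disjoint_left.1 c' hx
  exact (a.union hA.isClosed hB.isClosed hAB (k q e) b).Jn (hA.union hB)
    (fun h => h.elim (k p d) (k' p d')) (fun h => h.elim (k q e) (k' q e'))
end Top1

section Top2
open Complex Topology Filter Function

lemma inv_cont {f : ℝ → Pl} {a b : ℝ} (hf : ContinuousOn f (Icc a b)) (hi : InjOn f (Icc a b)) :
    ContinuousOn (invFunOn f (Icc a b)) (f '' Icc a b) := by
  rw [continuousOn_iff_isClosed]
  intro t ht
  refine ⟨f '' (Icc a b ∩ t), ((isCompact_Icc.inter_right ht).image_of_continuousOn (hf.mono inter_subset_left)).isClosed, ?_⟩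
  ext z
  constructor
  · rintro ⟨h, x, hx, rfl⟩
    rw [mem_preimage, hi.leftInvOn_invFunOn hx] at h
    exact ⟨⟨x, ⟨hx, h⟩, rfl⟩, x, hx, rfl⟩
  · rintro ⟨⟨x, hx, rfl⟩, h⟩
    exact ⟨by rw [mem_preimage, hi.leftInvOn_invFunOn hx.1]; exact hx.2, h⟩

def NS (α : Set Pl) : Prop := ∀ p q, p ∉ α → q ∉ α → Jn α p q

lemma arc_NS {f : ℝ → Pl} {a b : ℝ} (hab : a ≤ b) (hf : ContinuousOn f (Icc a b)) (hi : InjOn f (Icc a b)) :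
    NS (f '' Icc a b) := by
  intro p q hp hq
  refine HL.Jn (isCompact_Icc.image_of_continuousOn hf) hp hq ?_
  have hc : Continuous (fun t : ℝ => f (projIcc a b hab t)) := 
    (continuousOn_iff_continuous_domRestrict.1 hf).comp continuous_projIcc
  have hm : ∀ t : ℝ, f (projIcc a b hab t) ∈ f '' Icc a b := fun t => ⟨_, (projIcc a b hab t).2, rfl⟩
  have n1 : ∀ t : ℝ, cx (f (projIcc a b hab t)) - cx p ≠ 0 := fun t => cx_ne fun h => hp (h ▸ hm t)
  have n2 : ∀ t : ℝ, cx (f (projIcc a b hab t)) - cx q ≠ 0 := fun t => cx_ne fun h => hq (h ▸ hm t)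
  obtain ⟨g, hg, he⟩ := log_ex (fun t : ℝ => (cx (f (projIcc a b hab t)) - cx p) / (cx (f (projIcc a b hab t)) - cx q))
    (((cx_cont.comp hc).sub continuous_const).div ((cx_cont.comp hc).sub continuous_const) n2) (fun t => div_ne_zero (n1 t) (n2 t))
  refine ⟨fun z => g (invFunOn f (Icc a b) z), hg.comp_continuousOn (inv_cont hf hi), ?_⟩
  rintro _ ⟨t, ht, rfl⟩
  have := n2 t
  beta_reduce
  rw [hi.leftInvOn_invFunOn ht, he]
  rw [projIcc_of_mem hab ht] at this ⊢
  field_simp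

lemma NS.union {A B : Set Pl} (hA : IsCompact A) (hB : IsCompact B) (h : IsPreconnected (A ∩ B)) (a : NS A) (b : NS B) :
    NS (A ∪ B) := fun p q hp hq => jan hA hB h (a p q (fun h => hp (Or.inl h)) fun h => hq (Or.inl h))
      (b p q (fun h => hp (Or.inr h)) fun h => hq (Or.inr h))

lemma pend {Y α Ω : Set Pl} {z : Pl} (hY : IsCompact Y) (hα : IsCompact α) (hn : NS α)
    (hs : (Y ∩ α).Subsingleton) (hz : z ∉ Y) (hO : IsOpen Ω) (hd : Disjoint Ω (Y ∪ α))
    (hcl : closure Ω ⊆ Ω ∪ (Y ∪ α)) (hzc : z ∈ closure Ω) : ∀ᶠ x in 𝓝 z, x ∈ Ω ∪ (Y ∪ α) := by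
  obtain ⟨r, hr, hb⟩ := Metric.isOpen_iff.1 hY.isClosed.isOpen_compl z hz
  obtain ⟨w, hw, hwO⟩ := mem_closure_iff.1 hzc _ Metric.isOpen_ball (Metric.mem_ball_self hr)
  filter_upwards [Metric.ball_mem_nhds z hr] with x hx
  by_contra hxn
  have hx' : x ∉ Ω ∧ x ∉ Y ∧ x ∉ α := by simpa [not_or] using hxn
  have hw' : w ∉ Y ∪ α := disjoint_left.1 hd hwO
  obtain ⟨S, h1, h2, h3, h4⟩ := jan hY hα hs.isPreconnected
    ⟨_, (convex_ball z r).isPreconnected, disjoint_left.2 hb, hw, hx⟩ (hn w x (fun h => hw' (Or.inr h)) hx'.2.2)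
  refine hx'.1 (h1.subset_of_closure_inter_subset hO ⟨w, h3, hwO⟩ ?_ h4)
  rintro y ⟨hy, hyS⟩
  exact (hcl hy).resolve_right (disjoint_left.1 h2 hyS)

lemma arc_no_int {f : ℝ → Pl} {a b : ℝ} (hf : ContinuousOn f (Icc a b)) (hi : InjOn f (Icc a b)) {U : Set Pl}
    (hU : IsOpen U) (hs : U ⊆ f '' Icc a b) : U = ∅ := by
  by_contra hne
  obtain ⟨z, hz⟩ := nonempty_iff_ne_empty.2 hne
  have hV : IsOpen (cx.symm ⁻¹' U) := hU.preimage cx.symm.continuous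
  obtain ⟨r, hr, hb⟩ := Metric.isOpen_iff.1 hV (cx z) (by simpa using hz)
  let c : ℝ → Pl := fun θ => cx.symm (cx z + (r / 2 : ℝ) * exp (θ * I))
  have hc : Continuous c := by have := cx.symm.continuous; fun_prop
  have hcU : ∀ θ, c θ ∈ U := fun θ => hb (by
    simp only [Metric.mem_ball, dist_eq_norm, add_sub_cancel_left, norm_mul, norm_exp_ofReal_mul_I, norm_real]
    rw [Real.norm_of_nonneg (by positivity)]; linarith)
  let φ : ℝ → ℝ := fun θ => invFunOn f (Icc a b) (c θ)
  have hφ : Continuous φ := (inv_cont hf hi).comp_continuous hc fun θ => hs (hcU θ)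
  have hper : c (Real.pi + Real.pi) = c 0 := by
    simp only [c]; congr 3; push_cast; rw [← two_mul, exp_two_pi_mul_I]; simp
  have hψ : Continuous fun θ => φ θ - φ (θ + Real.pi) := by fun_prop
  obtain ⟨θ, hθ⟩ : ∃ θ, φ θ - φ (θ + Real.pi) = 0 := by
    have e : φ Real.pi - φ (Real.pi + Real.pi) = - (φ 0 - φ (0 + Real.pi)) := by
      have : φ (Real.pi + Real.pi) = φ 0 := by simp only [φ, hper]
      rw [this, zero_add]; ring
    rcases le_total (φ 0 - φ (0 + Real.pi)) 0 with h | h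
    · exact mem_range_of_exists_le_of_exists_ge hψ ⟨0, h⟩ ⟨Real.pi, by rw [e]; linarith⟩
    · exact mem_range_of_exists_le_of_exists_ge hψ ⟨Real.pi, by rw [e]; linarith⟩ ⟨0, h⟩
  have h1 : c θ = c (θ + Real.pi) := by
    have := congrArg f (sub_eq_zero.1 hθ)
    simp only [φ] at this
    rwa [invFunOn_eq (hs (hcU _)), invFunOn_eq (hs (hcU _))] at this
  have h2 := cx.symm.injective h1
  push_cast at h2
  rw [add_mul, exp_add, exp_pi_mul_I] at h2
  have h3 : ((r : ℂ)) * exp (θ * I) = 0 := by linear_combination h2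
  simp [exp_ne_zero, hr.ne'] at h3
end Top2

section WDs
open Complex Topology Filter Function

structure WD {U : Type u} (T : SimpleGraph U) (p : U → Pl) (R : U → U → Set Pl) : Prop where
  joined : ∀ x y, T.Adj x y → JoinedIn (R x y) (p x) (p y)
  indep : ∀ x y z w, T.Adj x y → T.Adj z w → x ≠ z → x ≠ w → y ≠ z → y ≠ w → Disjoint (R x y) (R z w)
  off : ∀ x y z, T.Adj x y → z ≠ x → z ≠ y → p z ∉ R x y
  inj : Injective p

def II {U : Type*} [LinearOrder U] (a b : U) : ℤ := if a < b then 1 else 0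

lemma WD.cochain {U : Type u} [LinearOrder U] {T : SimpleGraph U} {p : U → Pl} {R : U → U → Set Pl}
    (h : WD T p R) : ∃ N : U → U → U → ZMod 2, ∀ a b c d, a < b → c < d → T.Adj a b → T.Adj c d →
      a ≠ c → a ≠ d → b ≠ c → b ≠ d → N a b c + N a b d + N c d a + N c d b =
        ((II b c + II c a + II d b + II a d : ℤ) : ZMod 2) := by
  classical
  have hγ : ∀ a b, ∃ γ : ℝ → Pl, T.Adj a b → Continuous γ ∧ γ 0 = p a ∧ γ 1 = p b ∧ ∀ t, γ t ∈ R a b := by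
    intro a b
    by_cases hab : T.Adj a b
    · have hj := h.joined a b hab
      exact ⟨hj.somePath.extend, fun _ => ⟨hj.somePath.continuous_extend, hj.somePath.extend_zero,
        hj.somePath.extend_one, fun t => hj.somePath_mem _⟩⟩
    · exact ⟨fun _ => 0, fun h => absurd h hab⟩
  choose γ hγ using hγ
  let l : U → U → ℂ := fun x y => if x < y then log (cx (p x) - cx (p y)) else log (cx (p y) - cx (p x)) + Real.pi * I
  have hl : ∀ x y, x ≠ y → exp (l x y) = cx (p x) - cx (p y) := by
    intro x y hxy
    simp only [l]
    split_ifs with hlt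
    · exact exp_log (cx_ne (h.inj.ne hxy))
    · rw [exp_add, exp_log (cx_ne (h.inj.ne hxy.symm)), exp_pi_mul_I]; ring
  have hll : ∀ x y, x ≠ y → l x y - l y x = (1 - 2 * (II x y : ℂ)) * (Real.pi * I) := by
    intro x y hxy
    rcases lt_or_gt_of_ne hxy with h1 | h1
    · simp only [l, II, if_pos h1, if_neg h1.not_gt]; push_cast; ring
    · simp only [l, II, if_pos h1, if_neg h1.not_gt]; push_cast; ring
  have hn : ∀ a b v, ∃ n : ℤ, T.Adj a b → v ≠ a → v ≠ b → ∀ (L : ℝ → ℂ) (k : ℂ), Continuous L →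
      (∀ t, exp (L t) = k * (cx (γ a b t) - cx (p v))) → L 1 - L 0 = l b v - l a v + n * (2 * Real.pi * I) := by
    intro a b v
    by_cases hab : T.Adj a b ∧ v ≠ a ∧ v ≠ b
    · obtain ⟨hab, h1, h2⟩ := hab
      obtain ⟨c0, c1, c2, c3⟩ := hγ a b hab
      obtain ⟨g, hg, he⟩ := log_ex (fun t => cx (γ a b t) - cx (p v)) (by fun_prop)
        (fun t => cx_ne (fun hh => h.off a b v hab h1 h2 (hh ▸ c3 t)))
      have e : exp (g 1 - g 0) = exp (l b v - l a v) := by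
        rw [exp_sub, exp_sub, he, he, c1, c2, hl _ _ h2.symm, hl _ _ h1.symm]
      obtain ⟨n, hn⟩ := exp_eq_exp_iff_exists_int.1 e
      refine ⟨n, fun _ _ _ L k hL hLe => ?_⟩
      have := log_const isPreconnected_univ (hL.sub hg).continuousOn (c := k) (x := 0) (y := 1) (by
        intro t _
        rw [Pi.sub_apply, exp_sub, hLe, he, mul_div_cancel_right₀ _ (he t ▸ exp_ne_zero _)]) trivial trivial
      simp only [Pi.sub_apply] at this
      rw [← hn]; linear_combination -this
    · exact ⟨0, fun x y z => absurd ⟨x, y, z⟩ hab⟩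
  choose n hn using hn
  refine ⟨fun a b v => n a b v, fun a b c d hab hcd eab ecd hac had hbc hbd => ?_⟩
  obtain ⟨c0, c1, c2, c3⟩ := hγ a b eab
  obtain ⟨d0, d1, d2, d3⟩ := hγ c d ecd
  obtain ⟨Λ, hΛ, he⟩ := log_ex (fun x : ℝ × ℝ => cx (γ a b x.1) - cx (γ c d x.2)) (by fun_prop)
    (fun x => cx_ne (fun hh => disjoint_left.1 (h.indep a b c d eab ecd hac had hbc hbd) (c3 x.1) (hh ▸ d3 x.2)))
  have e1 := hn a b c eab hac.symm hbc.symm (fun t => Λ (t, 0)) 1 (by fun_prop) (by intro t; rw [he, d1, one_mul])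
  have e2 := hn a b d eab had.symm hbd.symm (fun t => Λ (t, 1)) 1 (by fun_prop) (by intro t; rw [he, d2, one_mul])
  have e3 := hn c d a ecd hac had (fun t => Λ (0, t)) (-1) (by fun_prop) (by intro t; rw [he, c1]; ring)
  have e4 := hn c d b ecd hbc hbd (fun t => Λ (1, t)) (-1) (by fun_prop) (by intro t; rw [he, c2]; ring)
  have key : (((n a b c + n c d b - n a b d - n c d a - (II b c + II c a + II d b + II a d) + 2 : ℤ) : ℂ)) * (2 * Real.pi * I) = 0 := by
    push_cast
    linear_combination -e1 + e2 + e3 - e4 - hll b c hbc - hll c a hac.symm - hll d b hbd.symm - hll a d had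
  have k2 : n a b c + n c d b - n a b d - n c d a - (II b c + II c a + II d b + II a d) + 2 = 0 := by
    have := mul_eq_zero.1 key
    simp only [Complex.two_pi_I_ne_zero, or_false] at this
    exact_mod_cast this
  rw [← sub_eq_zero, ← Int.cast_add, ← Int.cast_add, ← Int.cast_add, ← Int.cast_sub, ZMod.intCast_zmod_eq_zero_iff_dvd]
  exact ⟨n a b d + n c d a - 1, by push_cast; linear_combination k2⟩

lemma WD.minor {U : Type u} {T : SimpleGraph U} {p : U → Pl} {R : U → U → Set Pl} (h : WD T p R)
    {ι : Type*} (H : SimpleGraph ι) (B : ι → Set U) (hC : ∀ i, Cn T (B i)) (hD : ∀ i j, i ≠ j → Dj (B i) (B j))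
    (hT : ∀ i j, H.Adj i j → Tch T (B i) (B j)) : ∃ p' R', WD H p' R' := by
  let R' : ι → ι → Set Pl := fun i j => {z | ∃ x y, (x ∈ B i ∨ x ∈ B j) ∧ (y ∈ B i ∨ y ∈ B j) ∧
    (z = p x ∨ T.Adj x y ∧ z ∈ R x y)}
  choose r hr using fun i => (hC i).1
  have hne : ∀ i j, i ≠ j → ∀ x y, x ∈ B i → y ∈ B j → x ≠ y := by
    rintro i j hij x _ hx hy rfl; exact hD i j hij x hx hy
  have conn : ∀ i j k, (∀ x ∈ B k, x ∈ B i ∨ x ∈ B j) → ∀ x ∈ B k, ∀ y ∈ B k, JoinedIn (R' i j) (p x) (p y) := by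
    intro i j k hk x hx y hy
    have := (hC k).2 {y ∈ B k | JoinedIn (R' i j) (p x) (p y)} (fun _ h => h.1)
      ⟨x, hx, JoinedIn.refl ⟨x, x, hk x hx, hk x hx, Or.inl rfl⟩⟩
      (fun a ha b hb hab => ⟨hb, ha.2.trans ((h.joined a b hab).mono
        fun z hz => ⟨a, b, hk a ha.1, hk b hb, Or.inr ⟨hab, hz⟩⟩)⟩)
    rw [← this] at hy; exact hy.2
  refine ⟨fun i => p (r i), R', ⟨?_, ?_, ?_, ?_⟩⟩
  · intro i j hij
    obtain ⟨a, ha, b, hb, hab⟩ := hT i j hij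
    exact ((conn i j i (fun _ => Or.inl) _ (hr i) a ha).trans ((h.joined a b hab).mono
        fun z hz => ⟨a, b, Or.inl ha, Or.inr hb, Or.inr ⟨hab, hz⟩⟩)).trans (conn i j j (fun _ => Or.inr) b hb _ (hr j))
  · intro i j k l _ _ h1 h2 h3 h4
    refine disjoint_left.2 ?_
    rintro z ⟨x, y, hx, hy, hz⟩ ⟨x', y', hx', hy', hz'⟩
    have hh : ∀ x y, (x ∈ B i ∨ x ∈ B j) → (y ∈ B k ∨ y ∈ B l) → x ≠ y := by
      rintro x y (h | h) (h' | h')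
      exacts [hne _ _ h1 _ _ h h', hne _ _ h2 _ _ h h', hne _ _ h3 _ _ h h', hne _ _ h4 _ _ h h']
    rcases hz with rfl | ⟨e, hz⟩ <;> rcases hz' with hz' | ⟨e', hz'⟩
    · exact hh _ _ hx hx' (h.inj hz')
    · exact h.off _ _ _ e' (hh _ _ hx hx') (hh _ _ hx hy') hz'
    · exact h.off _ _ _ e (hh _ _ hx hx').symm (hh _ _ hy hx').symm (hz' ▸ hz)
    · exact disjoint_left.1 (h.indep _ _ _ _ e e' (hh _ _ hx hx') (hh _ _ hx hy') (hh _ _ hy hx') (hh _ _ hy hy')) hz hz'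
  · rintro i j k _ h1 h2 ⟨x, y, hx, hy, hz⟩
    have hh : ∀ x, (x ∈ B i ∨ x ∈ B j) → r k ≠ x := by
      rintro x (h | h)
      exacts [hne _ _ h1 _ _ (hr k) h, hne _ _ h2 _ _ (hr k) h]
    rcases hz with hz | ⟨e, hz⟩
    · exact hh _ hx (h.inj hz)
    · exact h.off _ _ _ e (hh _ hx) (hh _ hy) hz
  · intro i j hij
    by_contra hne'
    exact hne i j hne' _ _ (hr i) (hr j) (h.inj hij)

lemma WD.k5 {p R} (h : WD (⊤ : SimpleGraph (Fin 5)) p R) : False := by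
  obtain ⟨N, hN⟩ := h.cochain
  have q : ∀ a b c d : Fin 5, a < b ∧ c < d ∧ a ≠ c ∧ a ≠ d ∧ b ≠ c ∧ b ≠ d →
      N a b c + N a b d + N c d a + N c d b = ((II b c + II c a + II d b + II a d : ℤ) : ZMod 2) :=
    fun a b c d ⟨h1, h2, h3, h4, h5, h6⟩ => hN a b c d h1 h2 (by simpa using h1.ne) (by simpa using h2.ne) h3 h4 h5 h6
  have t : (2 : ZMod 2) = 0 := rfl
  have := q 0 1 2 3 (by decide); have := q 0 2 1 3 (by decide); have := q 0 3 1 2 (by decide)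
  have := q 0 1 2 4 (by decide); have := q 0 2 1 4 (by decide); have := q 0 4 1 2 (by decide)
  have := q 0 1 3 4 (by decide); have := q 0 3 1 4 (by decide); have := q 0 4 1 3 (by decide)
  have := q 0 2 3 4 (by decide); have := q 0 3 2 4 (by decide); have := q 0 4 2 3 (by decide)
  have := q 1 2 3 4 (by decide); have := q 1 3 2 4 (by decide); have := q 1 4 2 3 (by decide)
  simp +decide only [II, if_true, if_false] at *
  norm_num at *
  clear q hN
  grind
end WDs

section WD2
def KK : SimpleGraph (Fin 6) := SimpleGraph.fromRel fun i j => i < 3 ∧ 3 ≤ j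

lemma WD.k33 {p R} (h : WD KK p R) : False := by
  obtain ⟨N, hN⟩ := h.cochain
  have q : ∀ a b c d : Fin 6, a < 3 ∧ c < 3 ∧ 3 ≤ b ∧ 3 ≤ d ∧ a ≠ c ∧ b ≠ d →
      N a b c + N a b d + N c d a + N c d b = ((II b c + II c a + II d b + II a d : ℤ) : ZMod 2) :=
    fun a b c d ⟨h1, h2, h3, h4, h5, h6⟩ => hN a b c d (by lia) (by lia)
      ((SimpleGraph.fromRel_adj _ _ _).2 ⟨by rintro rfl; lia, Or.inl ⟨h1, h3⟩⟩)
      ((SimpleGraph.fromRel_adj _ _ _).2 ⟨by rintro rfl; lia, Or.inl ⟨h2, h4⟩⟩) h5 (by lia) (by lia) h6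
  have t : (2 : ZMod 2) = 0 := rfl
  have := q 0 3 1 4 (by decide); have := q 0 3 1 5 (by decide); have := q 0 4 1 3 (by decide)
  have := q 0 4 1 5 (by decide); have := q 0 5 1 3 (by decide); have := q 0 5 1 4 (by decide)
  have := q 0 3 2 4 (by decide); have := q 0 3 2 5 (by decide); have := q 0 4 2 3 (by decide)
  have := q 0 4 2 5 (by decide); have := q 0 5 2 3 (by decide); have := q 0 5 2 4 (by decide)
  have := q 1 3 2 4 (by decide); have := q 1 3 2 5 (by decide); have := q 1 4 2 3 (by decide)
  have := q 1 4 2 5 (by decide); have := q 1 5 2 3 (by decide); have := q 1 5 2 4 (by decide)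
  simp +decide only [II, if_true, if_false] at *
  norm_num at *
  clear q hN
  grind

variable {U : Type u} {T : SimpleGraph U} {p : U → Pl} {R : U → U → Set Pl}

lemma WD.Cfun {n : ℕ} {A : Fin n → Set U} (h : ∀ i j, i < j → Dj (A i) (A j)) : ∀ i j, i ≠ j → Dj (A i) (A j) := by
  intro i j hij
  rcases lt_or_gt_of_ne hij with h1 | h1
  · exact h i j h1
  · exact fun x hx hx' => h j i h1 x hx' hx

lemma WD.no5 (h : WD T p R) (A B C D E : Set U) (a : Cn T A) (b : Cn T B) (c : Cn T C) (d : Cn T D) (e : Cn T E)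
    (h1 : Dj A B) (h2 : Dj A C) (h3 : Dj A D) (h4 : Dj A E) (h5 : Dj B C) (h6 : Dj B D) (h7 : Dj B E) (h8 : Dj C D)
    (h9 : Dj C E) (h0 : Dj D E) 
    (g1 : Tch T A B) (g2 : Tch T A C) (g3 : Tch T A D) (g4 : Tch T A E) (g5 : Tch T B C) (g6 : Tch T B D) (g7 : Tch T B E)
    (g8 : Tch T C D) (g9 : Tch T C E) (g0 : Tch T D E) : False := by
  obtain ⟨p', R', h'⟩ := h.minor (ι := Fin 5) ⊤ ![A, B, C, D, E] (by intro i; fin_cases i <;> assumption)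
    (WD.Cfun (by intro i j hij; fin_cases i <;> fin_cases j <;> first | assumption | (exact absurd hij (by decide))))
    (by intro i j hij; fin_cases i <;> fin_cases j <;> first | assumption | (apply Tch.symm; assumption) | (simp at hij))
  exact h'.k5

lemma WD.no33 (h : WD T p R) (A B C D E F : Set U) (a : Cn T A) (b : Cn T B) (c : Cn T C) (d : Cn T D) (e : Cn T E)
    (f : Cn T F) (h1 : Dj A B) (h2 : Dj A C) (h3 : Dj A D) (h4 : Dj A E) (h4' : Dj A F) (h5 : Dj B C) (h6 : Dj B D)
    (h7 : Dj B E) (h7' : Dj B F) (h8 : Dj C D) (h9 : Dj C E) (h9' : Dj C F) (h0 : Dj D E) (h0' : Dj D F) (h0'' : Dj E F)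
    (g1 : Tch T A D) (g2 : Tch T A E) (g3 : Tch T A F) (g4 : Tch T B D) (g5 : Tch T B E) (g6 : Tch T B F)
    (g7 : Tch T C D) (g8 : Tch T C E) (g9 : Tch T C F) : False := by
  obtain ⟨p', R', h'⟩ := h.minor (ι := Fin 6) KK ![A, B, C, D, E, F] (by intro i; fin_cases i <;> assumption)
    (WD.Cfun (by intro i j hij; fin_cases i <;> fin_cases j <;> first | assumption | (exact absurd hij (by decide))))
    (by intro i j hij; fin_cases i <;> fin_cases j <;> first | assumption | (apply Tch.symm; assumption) | (simp +decide [KK] at hij))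
  exact h'.k33
end WD2

lemma pages {K : Type} [CommRing K] (t : (2 : K) = 0) (one : (1 : K) ≠ 0) (n : ℕ) (hn : 3 ≤ n) (E : ℕ → ℕ → Prop) (N : ℕ → ℕ → ℕ → K) (hE : ∀ a b, E a b → a < b ∧ b < n)
    (hP : ∀ i, i + 1 < n → E i (i + 1)) (hcl : E 0 (n - 1))
    (hN : ∀ a b c d, E a b → E c d → a ≠ c → a ≠ d → b ≠ c → b ≠ d →
      N a b c + N a b d + N c d a + N c d b = ((II b c + II c a + II d b + II a d : ℤ) : K)) :
    ∃ s : ℕ → ℕ → K, ∀ a b c d, a < b → b < c → c < d → E a c → E b d → s a c ≠ s b d := by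
  let S : ℕ → ℕ → K := fun u k => ∑ i ∈ Finset.range k, if i = u ∨ i + 1 = u then 0 else N i (i + 1) u
  have S0 : ∀ u, S u 0 = 0 := fun u => by simp [S]
  have S1 : ∀ u k, k ≠ u → k + 1 ≠ u → S u (k + 1) = S u k + N k (k + 1) u := fun u k h1 h2 => by
    simp [S, Finset.sum_range_succ, h1, h2]
  clear_value S
  have run : ∀ a c, E a c → ∀ v w, v ≤ w → w < n → (∀ i, v ≤ i → i ≤ w → i ≠ a ∧ i ≠ c) →
      N a c v + S a v + S c v = N a c w + S a w + S c w := by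
    intro a c e v w hvw
    induction w, hvw using Nat.le_induction with
    | base => intros; rfl
    | succ w hvw ih =>
      intro hw hi
      have h0 := ih (by lia) fun i h1 h2 => hi i h1 (by lia)
      have h1 := hi w hvw (by lia)
      have h2 := hi (w + 1) (by lia) le_rfl
      have h3 := hN a c w (w + 1) e (hP w hw) h1.1.symm h2.1.symm h1.2.symm h2.2.symm
      have h4 := S1 a w h1.1 h2.1
      have h5 := S1 c w h1.2 h2.2
      have h7 := (hE a c e).1
      have h6 : ((II c w + II w a + II (w + 1) c + II a (w + 1) : ℤ) : K) = 0 := by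
        rcases lt_or_gt_of_ne h1.1 with q1 | q1 <;> rcases lt_or_gt_of_ne h1.2 with q2 | q2
        · rw [II, II, II, II, if_neg (by lia), if_pos (by lia), if_pos (by lia), if_neg (by lia)]; push_cast; grind
        · lia
        · rw [II, II, II, II, if_neg (by lia), if_neg (by lia), if_pos (by lia), if_pos (by lia)]; push_cast; grind
        · rw [II, II, II, II, if_pos (by lia), if_neg (by lia), if_neg (by lia), if_pos (by lia)]; push_cast; grind
      grind
  let κ : ℕ → ℕ → K := fun u v => S u v + S v u
  have k1 : ∀ p r, p + 1 < r → r + 1 < n → κ p r + κ p (r + 1) + κ (p + 1) r + κ (p + 1) (r + 1) = 0 := by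
    intro p r h1 h2
    have h3 := hN p (p + 1) r (r + 1) (hP p (by lia)) (hP r h2) (by lia) (by lia) (by lia) (by lia)
    rw [II, II, II, II, if_pos (by lia), if_neg (by lia), if_neg (by lia), if_pos (by lia)] at h3
    have q1 := S1 p r (by lia) (by lia)
    have q2 := S1 (p + 1) r (by lia) (by lia)
    have q3 := S1 r p (by lia) (by lia)
    have q4 := S1 (r + 1) p (by lia) (by lia)
    have : (((1 + 0 + 0 + 1 : ℤ)) : K) = 0 := by push_cast; grind
    grind
  have k2 : ∀ p r s, p + 1 < r → r ≤ s → s < n → κ p r + κ p s + κ (p + 1) r + κ (p + 1) s = 0 := by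
    intro p r s h1 h2
    induction s, h2 using Nat.le_induction with
    | base => intros; grind
    | succ s h2 ih => intro h3; have := ih (by lia); have := k1 p s (by lia) h3; grind
  have k3 : ∀ p q r s, p ≤ q → q < r → r ≤ s → s < n → κ p r + κ p s + κ q r + κ q s = 0 := by
    intro p q r s h1
    induction q, h1 using Nat.le_induction with
    | base => intros; grind
    | succ q h1 ih => intro h2 h3 h4; have := ih (by lia) h3 h4; have := k2 q r s h2 h3 h4; grind
  let G : ℕ → K := fun u => κ u (n - 1) + κ 0 u + κ 0 (n - 1)
  have k4 : ∀ u v, u < v → v < n → κ u v = κ u (n - 1) + κ 0 v + κ 0 (n - 1) := fun u v h1 h2 => by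
    have := k3 0 u v (n - 1) (by lia) h1 (by lia) (by lia)
    grind
  refine ⟨fun a c => if c < n - 1 then (N a c (a + 1) + S a (a + 1) + S c (a + 1)) + (N a c (n - 1) + S a (n - 1) + S c (n - 1)) + G c
    else (N a c (a + 1) + S a (a + 1) + S c (a + 1)) + N a c 0 + G a, fun a b c d h1 h2 h3 e f => ?_⟩
  have hd := (hE _ _ f).2
  have r1 := run a c e (a + 1) b (by lia) (by lia) (by lia)
  have r2 := run a c e d (n - 1) (by lia) (by lia) (by lia)
  have r3 := run b d f 0 a (by lia) (by lia) (by lia)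
  have r4 := run b d f (b + 1) c (by lia) (by lia) (by lia)
  have q := hN a c b d e f (by lia) (by lia) (by lia) (by lia)
  rw [II, II, II, II, if_neg (by lia), if_neg (by lia), if_neg (by lia), if_pos (by lia)] at q
  have q' : (((0 + 0 + 0 + 1 : ℤ)) : K) = 1 := by simp
  have m1 := k4 a b (by lia) (by lia)
  have m2 := k4 b c (by lia) (by lia)
  have m3 := k4 a d (by lia) (by lia)
  have m4 := k4 c d (by lia) (by lia)
  have z1 := S0 b
  have z2 := S0 d
  have main : (N a c (a + 1) + S a (a + 1) + S c (a + 1)) + (N a c (n - 1) + S a (n - 1) + S c (n - 1)) + G c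
    + ((N b d (b + 1) + S b (b + 1) + S d (b + 1)) + N b d 0 + G b) = 1 := by grind
  beta_reduce
  rw [if_pos (show c < n - 1 by lia)]
  split_ifs with hdn
  · have c1 := hN 0 (n - 1) b d hcl f (by lia) (by lia) (by lia) (by lia)
    rw [II, II, II, II, if_neg (by lia), if_neg (by lia), if_pos (by lia), if_pos (by lia)] at c1
    have : (((0 + 0 + 1 + 1 : ℤ)) : K) = 0 := by push_cast; grind
    have c2 := run 0 (n - 1) hcl b d (by lia) (by lia) (by lia)
    have c3 : N b d 0 + (N b d (n - 1) + S b (n - 1) + S d (n - 1)) = G b + G d := by grind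
    intro h0
    clear_value G κ
    clear q m1 m2 m3 m4 r1 r2 r3 r4
    apply one
    linear_combination (-1 : K) * main + h0 + c3 + ((N b d (b + 1) + S b (b + 1) + S d (b + 1)) + G b + G d) * t
  · intro h0
    clear_value G κ
    clear q m1 m2 m3 m4 r1 r2 r3 r4
    grind

section Faces1
open Topology Filter
variable {V : Type u} {G : SimpleGraph V} {E : PlaneEmbedding G} {u v w x : V} {F F' : Set Pl}

def ar (E : PlaneEmbedding G) (u v : V) : Set Pl := {z | ∃ h : G.Adj u v, z ∈ E.arc h}
def op (E : PlaneEmbedding G) (u v : V) : Set Pl := {z | z ∈ ar E u v ∧ ∀ w, z ≠ E.pos w}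
def dr (E : PlaneEmbedding G) (A : Set V) (P : V → V → Prop) : Set Pl :=
  {z | (∃ v ∈ A, z = E.pos v) ∨ ∃ u v, P u v ∧ z ∈ ar E u v}
def BF (E : PlaneEmbedding G) (F : Set Pl) : Set V := {v | E.pos v ∈ closure F}
def HF (E : PlaneEmbedding G) (F : Set Pl) (u v : V) : Prop := ∃ z ∈ op E u v, z ∈ closure F

lemma ar_eq (h : G.Adj u v) : ar E u v = E.arc h := by ext z; exact ⟨fun ⟨_, h⟩ => h, fun h' => ⟨h, h'⟩⟩
lemma ar_symm (E : PlaneEmbedding G) (u v : V) : ar E u v = ar E v u := by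
  ext z; constructor <;> rintro ⟨h, hz⟩ <;> exact ⟨h.symm, by rw [E.arc_symm]; exact hz⟩
lemma op_symm (E : PlaneEmbedding G) (u v : V) : op E u v = op E v u := by simp only [op, ar_symm E u v]
lemma HF.symm (h : HF E F u v) : HF E F v u := by rw [HF, op_symm]; exact h
lemma HF.adj (h : HF E F u v) : G.Adj u v := by obtain ⟨z, ⟨⟨h, _⟩, _⟩, _⟩ := h; exact h
lemma ar_curve (E : PlaneEmbedding G) (h : G.Adj u v) : ∃ f : ℝ → Pl, ContinuousOn f (Icc 0 1) ∧ InjOn f (Icc 0 1) ∧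
    f 0 = E.pos u ∧ f 1 = E.pos v ∧ f '' Icc 0 1 = ar E u v := by rw [ar_eq h]; exact E.arc_curve h
lemma ar_vert {w : V} (h : E.pos w ∈ ar E u v) : w = u ∨ w = v := by obtain ⟨h, h'⟩ := h; exact E.pos_arc h w h'
lemma ar_left (h : G.Adj u v) : E.pos u ∈ ar E u v := by
  obtain ⟨f, _, _, h0, _, h1⟩ := ar_curve E h; rw [← h1, ← h0]; exact ⟨0, by simp, rfl⟩
lemma ar_right (h : G.Adj u v) : E.pos v ∈ ar E u v := by rw [ar_symm]; exact ar_left h.symm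
lemma ar_inter {z : Pl} (h : z ∈ ar E u v) (h' : z ∈ ar E w x) (hne : s(u, v) ≠ s(w, x)) :
    ∃ y, z = E.pos y ∧ (y = u ∨ y = v) ∧ (y = w ∨ y = x) := by
  obtain ⟨h, hz⟩ := h
  obtain ⟨h', hz'⟩ := h'
  obtain ⟨h1, h2⟩ := E.arc_inter h h' hne ⟨hz, hz'⟩
  rcases h1 with rfl | rfl
  · exact ⟨u, rfl, Or.inl rfl, ar_vert (E := E) ⟨h', hz'⟩⟩
  · exact ⟨v, rfl, Or.inr rfl, ar_vert (E := E) ⟨h', hz'⟩⟩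
lemma op_uniq {z : Pl} (h : z ∈ op E u v) (h' : z ∈ ar E w x) : s(u, v) = s(w, x) := by
  by_contra hne
  obtain ⟨y, hy, _⟩ := ar_inter h.1 h' hne
  exact h.2 y hy
lemma ar_or {z : Pl} (h : z ∈ ar E u v) : z ∈ op E u v ∨ z = E.pos u ∨ z = E.pos v := by
  by_cases h' : z ∈ op E u v
  · exact Or.inl h'
  · simp only [op, mem_ofPred_eq, not_and, not_forall, not_not] at h'
    obtain ⟨w, rfl⟩ := h' h
    rcases ar_vert h with rfl | rfl <;> simp
lemma mem_drawing {z : Pl} : z ∈ E.drawing ↔ (∃ v, z = E.pos v) ∨ ∃ u v, z ∈ ar E u v := by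
  simp only [PlaneEmbedding.drawing, ar, mem_union, mem_range, mem_iUnion, mem_ofPred_eq, eq_comm]
lemma dr_sub {A P} : dr E A P ⊆ E.drawing := by
  rintro z (⟨v, _, h⟩ | ⟨u, v, _, h⟩) <;> rw [mem_drawing]
  exacts [Or.inl ⟨v, h⟩, Or.inr ⟨u, v, h⟩]
lemma ar_compact (E : PlaneEmbedding G) (u v : V) : IsCompact (ar E u v) := by
  by_cases h : G.Adj u v
  · obtain ⟨f, hf, _, _, _, h1⟩ := ar_curve E h
    rw [← h1]; exact isCompact_Icc.image_of_continuousOn hf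
  · have : ar E u v = ∅ := by ext z; exact ⟨fun ⟨h', _⟩ => h h', fun h => h.elim⟩
    rw [this]; exact isCompact_empty
lemma ar_NS (h : G.Adj u v) : NS (ar E u v) := by
  obtain ⟨f, hf, hi, _, _, h1⟩ := ar_curve E h
  rw [← h1]; exact arc_NS zero_le_one hf hi
lemma ar_conn (E : PlaneEmbedding G) (h : G.Adj u v) : IsPreconnected (ar E u v) := by
  obtain ⟨f, hf, hi, _, _, h1⟩ := ar_curve E h
  rw [← h1]; exact isPreconnected_Icc.image f hf
lemma dr_compact [Finite V] (A : Set V) (P) : IsCompact (dr E A P) := by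
  have : dr E A P = E.pos '' A ∪ ⋃ u ∈ univ, ⋃ v ∈ {v | P u v}, ar E u v := by
    ext z; simp [dr, eq_comm]
  rw [this]
  exact ((toFinite A).image _).isCompact.union ((toFinite _).isCompact_biUnion fun u _ =>
    (toFinite _).isCompact_biUnion fun v _ => ar_compact E u v)
lemma dr_all : dr E univ (fun _ _ => True) = E.drawing := by
  ext z; rw [mem_drawing]; simp [dr]
lemma drawing_closed [Finite V] (E : PlaneEmbedding G) : IsClosed E.drawing := by
  rw [← dr_all]; exact (dr_compact _ _).isClosed
lemma dr_conn {A : Set V} (hA : Cn G A) : IsPreconnected (dr E A fun u v => u ∈ A ∧ v ∈ A) := by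
  obtain ⟨x, hx⟩ := hA.1
  have h0 : ∀ y ∈ A, ∃ t ⊆ dr E A (fun u v => u ∈ A ∧ v ∈ A), E.pos x ∈ t ∧ E.pos y ∈ t ∧ IsPreconnected t := by
    have := hA.2 {y ∈ A | ∃ t ⊆ dr E A (fun u v => u ∈ A ∧ v ∈ A), E.pos x ∈ t ∧ E.pos y ∈ t ∧ IsPreconnected t}
      (fun _ h => h.1) ⟨x, hx, {E.pos x}, by rintro _ rfl; exact Or.inl ⟨x, hx, rfl⟩, rfl, rfl, isPreconnected_singleton⟩
      (by
        rintro a ⟨ha, t, h1, h2, h3, h4⟩ b hb hab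
        exact ⟨hb, t ∪ ar E a b, union_subset h1 fun z hz => Or.inr ⟨a, b, ⟨ha, hb⟩, hz⟩, Or.inl h2, Or.inr (ar_right hab),
          h4.union _ h3 (ar_left hab) (ar_conn E hab)⟩)
    grind
  refine isPreconnected_of_forall (E.pos x) ?_
  rintro _ (⟨y, hy, rfl⟩ | ⟨a, b, ⟨ha, hb⟩, hz⟩)
  · grind
  · obtain ⟨t, h1, h2, h3, h4⟩ := h0 a ha
    obtain ⟨hab, _⟩ := id hz
    exact ⟨t ∪ ar E a b, union_subset h1 fun z hz => Or.inr ⟨a, b, ⟨ha, hb⟩, hz⟩, Or.inl h2, Or.inr hz,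
          h4.union _ h3 (ar_left hab) (ar_conn E hab)⟩

lemma Cn_of_induce {S : Set V} (h : (G.induce S).Connected) : Cn G S := by
  obtain ⟨x⟩ := h.nonempty
  refine ⟨⟨x, x.2⟩, fun A hA ⟨a, ha⟩ hcl => subset_antisymm hA fun y hy => ?_⟩
  obtain ⟨p⟩ := h.preconnected ⟨a, hA ha⟩ ⟨y, hy⟩
  suffices ∀ b c : S, (G.induce S).Walk b c → b.1 ∈ A → c.1 ∈ A from this _ _ p ha
  intro b c p
  induction p with
  | nil => exact id
  | cons hab p ih => exact fun hb => ih (hcl _ hb _ (Subtype.property _) hab)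

lemma tri_Cn (h3 : G.IsTriconnected) (a b : V) : Cn G {w | w ≠ a ∧ w ≠ b} := Cn_of_induce (h3.2.2 a b)
lemma tri_fin (h3 : G.IsTriconnected) : Finite V := Nat.finite_of_card_ne_zero (by have := h3.1; lia)
lemma tri_four (h3 : G.IsTriconnected) (a b c : V) : ∃ d, d ≠ a ∧ d ≠ b ∧ d ≠ c := by
  by_contra h; push Not at h
  have := tri_fin h3
  have h1 : (univ : Set V) ⊆ {a, b, c} := fun d _ => by by_contra h'; simp [not_or] at h'; exact h'.2.2 (h d h'.1 h'.2.1)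
  have h2 := ncard_le_ncard h1
  rw [ncard_univ] at h2
  have h4 := (ncard_insert_le a {b, c}).trans (Nat.add_le_add_right (ncard_insert_le b {c}) 1)
  rw [ncard_singleton] at h4
  have := h3.1; lia
lemma tri_nbr (h3 : G.IsTriconnected) (v a b : V) : ∃ x, G.Adj v x ∧ x ≠ a ∧ x ≠ b := by
  have key : ∀ a b, v ≠ a → v ≠ b → ∃ x, G.Adj v x ∧ x ≠ a ∧ x ≠ b := by
    intro a b ha hb
    by_contra h; push Not at h
    obtain ⟨d, h1, h2, h4⟩ := tri_four h3 v a b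
    have := (tri_Cn h3 a b).2 {v} (by rintro _ rfl; exact ⟨ha, hb⟩) ⟨v, rfl⟩
      (by rintro _ rfl x hx hvx; exact absurd (h x hvx hx.1) hx.2)
    exact h1 (this.symm ▸ (⟨h2, h4⟩ : d ∈ {w | w ≠ a ∧ w ≠ b}) : d ∈ ({v} : Set V))
  obtain ⟨c, hc, _⟩ := tri_four h3 v v v
  by_cases ha : v = a <;> by_cases hb : v = b
  · obtain ⟨x, h, _⟩ := key c c hc.symm hc.symm; exact ⟨x, h, ha ▸ h.ne', hb ▸ h.ne'⟩
  · obtain ⟨x, h, h', _⟩ := key b b hb hb; exact ⟨x, h, ha ▸ h.ne', h'⟩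
  · obtain ⟨x, h, h', _⟩ := key a a ha ha; exact ⟨x, h, h', hb ▸ h.ne'⟩
  · exact key a b ha hb

structure FaceP (E : PlaneEmbedding G) (F : Set Pl) : Prop where
  o : IsOpen F
  c : IsPreconnected F
  ne : F.Nonempty
  d : ∀ z ∈ F, z ∉ E.drawing
  cl : ∀ z ∈ closure F, z ∈ F ∨ z ∈ E.drawing

lemma face_props [Finite V] (h : E.IsFace F) : FaceP E F := by
  obtain ⟨p, hp, rfl⟩ := h
  have hc := drawing_closed E
  have ho := hc.isOpen_compl.connectedComponentIn (x := p)
  refine ⟨ho, isPreconnected_connectedComponentIn, ⟨p, mem_connectedComponentIn hp⟩,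
    fun z hz => connectedComponentIn_subset _ _ hz, fun z hz => ?_⟩
  by_cases h : z ∈ connectedComponentIn E.drawingᶜ p
  · exact Or.inl h
  · exact Or.inr (cc_frontier hc p (by rw [ho.frontier_eq]; exact ⟨hz, h⟩))

lemma face_eq [Finite V] (h : E.IsFace F) (h' : E.IsFace F') {S : Set Pl} (hS : IsPreconnected S)
    (hd : Disjoint S E.drawing) {p q : Pl} (hp : p ∈ F) (hq : q ∈ F') (hp' : p ∈ S) (hq' : q ∈ S) : F = F' := by
  obtain ⟨a, ha, rfl⟩ := h
  obtain ⟨b, hb, rfl⟩ := h'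
  have hsub : S ⊆ E.drawingᶜ := fun z hz => disjoint_left.1 hd hz
  have := hS.subset_connectedComponentIn hp' hsub hq'
  rw [connectedComponentIn_eq hp, connectedComponentIn_eq hq, connectedComponentIn_eq this]

lemma face_of [Finite V] {p : Pl} (hp : p ∉ E.drawing) : ∃ F, E.IsFace F ∧ p ∈ F :=
  ⟨_, ⟨p, hp, rfl⟩, mem_connectedComponentIn hp⟩
end Faces1

section Faces2
open Topology Filter
variable {V : Type u} {G : SimpleGraph V} {E : PlaneEmbedding G} {u v w x : V} {F F' : Set Pl}

lemma curve_op {f : ℝ → Pl} (hi : InjOn f (Icc 0 1)) (h0 : f 0 = E.pos u) (h1 : f 1 = E.pos v)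
    (him : f '' Icc 0 1 = ar E u v) {t : ℝ} (ht : t ∈ Ioo (0 : ℝ) 1) : f t ∈ op E u v := by
  have hm : f t ∈ ar E u v := him ▸ ⟨t, Ioo_subset_Icc_self ht, rfl⟩
  refine ⟨hm, fun w hw => ?_⟩
  rcases ar_vert (hw ▸ hm) with rfl | rfl
  · exact ht.1.ne' (hi (Ioo_subset_Icc_self ht) (by simp) (hw.trans h0.symm))
  · exact ht.2.ne (hi (Ioo_subset_Icc_self ht) (by simp) (hw.trans h1.symm))

lemma ev_Ioo {f : ℝ → Pl} {a b t : ℝ} {s : Set ℝ} (hs : Ioo a b ⊆ s) (hf : ContinuousWithinAt f s t) (hab : a < b)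
    (ht : t ∈ Icc a b) {p : Pl → Prop} (hp : ∀ᶠ z in 𝓝 (f t), p z) : ∃ r ∈ Ioo a b, p (f r) := by
  have h1 : ∀ᶠ r in 𝓝[Ioo a b] t, p (f r) := (hf.mono hs) hp
  have : (𝓝[Ioo a b] t).NeBot := by rw [← mem_closure_iff_nhdsWithin_neBot, closure_Ioo hab.ne]; exact ht
  obtain ⟨r, hr⟩ := (h1.and self_mem_nhdsWithin).exists
  exact ⟨r, hr.2, hr.1⟩

lemma op_acc (h : G.Adj v x) {p : Pl → Prop} (hp : ∀ᶠ z in 𝓝 (E.pos v), p z) : ∃ z ∈ op E v x, p z := by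
  obtain ⟨f, hf, hi, h0, h1, him⟩ := ar_curve E h
  obtain ⟨r, hr, hr'⟩ := ev_Ioo (t := 0) Ioo_subset_Icc_self (hf 0 (by simp)) zero_lt_one (by simp) (h0 ▸ hp)
  exact ⟨_, curve_op hi h0 h1 him hr, hr'⟩

lemma HF_left [Finite V] (hF : FaceP E F) (h : HF E F u v) : u ∈ BF E F := by
  obtain ⟨f, hf, hi, h0, h1, him⟩ := ar_curve E h.adj
  obtain ⟨z, hz, hzF⟩ := h
  obtain ⟨t1, ht1, rfl⟩ : z ∈ f '' Icc 0 1 := him ▸ hz.1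
  have hT : IsCompact (Icc 0 1 ∩ f ⁻¹' closure F) :=
    isCompact_Icc.of_isClosed_subset (hf.preimage_isClosed_of_isClosed isClosed_Icc isClosed_closure) inter_subset_left
  obtain ⟨τ, ⟨hτ, hτF⟩, hmin⟩ := hT.exists_isLeast ⟨t1, ht1, hzF⟩
  rcases hτ.1.eq_or_lt with rfl | hpos
  · rw [BF, mem_ofPred_eq, ← h0]; exact hτF
  exfalso
  have hτ1 : τ < 1 := (hmin ⟨ht1, hzF⟩).trans_lt (lt_of_le_of_ne ht1.2 fun h => hz.2 v (by rw [← h1, h]))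
  have hsub : Icc τ 1 ⊆ Icc 0 1 := Icc_subset_Icc_left hτ.1
  have hop := curve_op hi h0 h1 him (t := τ) ⟨hpos, hτ1⟩
  let Y := dr E univ fun a b => s(a, b) ≠ s(u, v)
  have hYa : ∀ t ∈ Ioo (0 : ℝ) 1, f t ∉ Y := by
    rintro t ht (⟨w, _, hw⟩ | ⟨a, b, hab, hz⟩)
    · exact (curve_op hi h0 h1 him ht).2 w hw
    · exact hab (op_uniq (curve_op hi h0 h1 him ht) hz).symm
  have hup : Y ∪ f '' Icc τ 1 ⊆ E.drawing := by
    refine union_subset dr_sub ?_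
    rintro _ ⟨t, ht, rfl⟩
    exact mem_drawing.2 (Or.inr ⟨u, v, him ▸ ⟨t, hsub ht, rfl⟩⟩)
  have key := pend (Y := Y) (α := f '' Icc τ 1) (Ω := F) (z := f τ) (dr_compact _ _)
    (isCompact_Icc.image_of_continuousOn (hf.mono hsub)) (arc_NS hτ.2 (hf.mono hsub) (hi.mono hsub)) (by
      have : ∀ z ∈ Y ∩ f '' Icc τ 1, z = f 1 := by
        grind
      exact fun a ha b hb => (this a ha).trans (this b hb).symm)
    (hYa τ ⟨hpos, hτ1⟩) hF.o (disjoint_left.2 fun z hz hz' => hF.d z hz (hup hz')) (by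
      intro z hz
      rcases hF.cl z hz with h | h
      · exact Or.inl h
      right
      rcases mem_drawing.1 h with ⟨w, hw⟩ | ⟨a, b, hab⟩
      · exact Or.inl (Or.inl ⟨w, trivial, hw⟩)
      by_cases he : s(a, b) = s(u, v)
      · right
        have : z ∈ ar E u v := by
          rcases Sym2.eq_iff.1 he with ⟨rfl, rfl⟩ | ⟨rfl, rfl⟩
          · exact hab
          · rwa [ar_symm]
        rw [← him] at this
        obtain ⟨t, ht, rfl⟩ := this
        exact ⟨t, ⟨hmin ⟨ht, hz⟩, ht.2⟩, rfl⟩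
      · exact Or.inl (Or.inr ⟨a, b, he, hab⟩)) hτF
  obtain ⟨r, hr, hr'⟩ := ev_Ioo (a := 0) (b := τ) (s := Icc 0 1) (fun r hr => ⟨hr.1.le, hr.2.le.trans hτ.2⟩)
    (hf τ hτ) hpos ⟨hτ.1, le_rfl⟩ key
  have hr1 : r ∈ Ioo (0 : ℝ) 1 := by grind
  rcases hr' with h | h | ⟨t, ht, hrt⟩
  · exact hF.d _ h (mem_drawing.2 (Or.inr ⟨u, v, (curve_op hi h0 h1 him hr1).1⟩))
  · grind
  · have := hi (hsub ht) (Ioo_subset_Icc_self hr1) hrt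
    grind
lemma HF_right [Finite V] (hF : FaceP E F) (h : HF E F u v) : v ∈ BF E F := HF_left hF h.symm

lemma pend_vertex [Finite V] {Ω : Set Pl} {P : V → V → Prop} (hP : ∀ a b, P a b → P b a) (hO : IsOpen Ω)
    (hd : ∀ z ∈ Ω, z ∉ dr E univ P) (hcl : ∀ z ∈ closure Ω, z ∈ Ω ∨ z ∈ dr E univ P) (hv : E.pos v ∈ closure Ω)
    (hw : ∀ x, P v x → x = w) (hx : G.Adj v x) (hxw : x ≠ w) : ∃ z ∈ op E v x, z ∈ Ω := by
  let α := {E.pos v} ∪ {z | P v w ∧ z ∈ ar E v w}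
  let Y := dr E {v}ᶜ fun a b => P a b ∧ a ≠ v ∧ b ≠ v
  have hα : IsCompact α ∧ NS α := by
    by_cases h : P v w ∧ G.Adj v w
    · have : α = ar E v w := by
        ext z; constructor
        · rintro (rfl | ⟨_, h⟩)
          exacts [ar_left h.2, h]
        all_goals grind
      rw [this]; exact ⟨ar_compact _ _ _, ar_NS h.2⟩
    · have : α = (fun _ => E.pos v) '' Icc (0 : ℝ) 0 := by
        ext z; constructor
        · rintro (rfl | ⟨h1, h2, h3⟩)
          exacts [⟨0, by simp, rfl⟩, absurd ⟨h1, h2⟩ h]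
        all_goals grind
      rw [this]
      exact ⟨isCompact_Icc.image_of_continuousOn continuousOn_const, arc_NS le_rfl continuousOn_const (by
        rw [Icc_self]; exact injOn_singleton _ _)⟩
  have hvY : E.pos v ∉ Y := by
    rintro (⟨a, ha, h⟩ | ⟨a, b, ⟨_, h1, h2⟩, h⟩)
    · exact ha (E.pos_inj h).symm
    · rcases ar_vert h with rfl | rfl
      exacts [h1 rfl, h2 rfl]
  have hsub : Y ∪ α ⊆ dr E univ P := by
    rintro z ((⟨a, _, h⟩ | ⟨a, b, h, h'⟩) | (rfl | ⟨h, h'⟩))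
    exacts [Or.inl ⟨a, trivial, h⟩, Or.inr ⟨a, b, h.1, h'⟩, Or.inl ⟨v, trivial, rfl⟩, Or.inr ⟨_, _, h, h'⟩]
  have hsup : dr E univ P ⊆ Y ∪ α := by
    rintro z (⟨a, _, h⟩ | ⟨a, b, h, h'⟩)
    · by_cases ha : a = v
      · grind
      · exact Or.inl (Or.inl ⟨a, ha, h⟩)
    · by_cases ha : a = v
      · grind
      by_cases hb : b = v
      · subst hb; obtain rfl := hw _ (hP _ _ h); exact Or.inr (Or.inr ⟨hP _ _ h, by rwa [ar_symm]⟩)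
      exact Or.inl (Or.inr ⟨a, b, ⟨h, ha, hb⟩, h'⟩)
  have key := pend (Y := Y) (α := α) (Ω := Ω) (z := E.pos v) (dr_compact _ _) hα.1 hα.2 (by
      have : ∀ z ∈ Y ∩ α, z = E.pos w := by
        rintro z ⟨hY, h | ⟨-, h⟩⟩
        · grind
        rcases hY with ⟨a, ha, rfl⟩ | ⟨a, b, ⟨_, h1, h2⟩, h'⟩
        · rw [(ar_vert h).resolve_left ha]
        · obtain ⟨y, rfl, hy, hy'⟩ := ar_inter h h' (by
            intro h; rcases Sym2.eq_iff.1 h with ⟨h, _⟩ | ⟨h, _⟩ <;> simp_all)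
          grind
      exact fun a ha b hb => (this a ha).trans (this b hb).symm) hvY hO
    (disjoint_left.2 fun z hz hz' => hd z hz (hsub hz')) (fun z hz => (hcl z hz).imp id fun h => hsup h) hv
  obtain ⟨z, hz, h | h⟩ := op_acc hx key
  · grind
  exfalso
  rcases hsub h with ⟨a, _, h⟩ | ⟨a, b, h, h'⟩
  · exact hz.2 a h
  · rcases Sym2.eq_iff.1 (op_uniq hz h') with ⟨rfl, rfl⟩ | ⟨rfl, rfl⟩
    exacts [hxw (hw _ h), hxw (hw _ (hP _ _ h))]

lemma face_HF (hF : FaceP E F) : ∀ z ∈ closure F, z ∈ F ∨ z ∈ dr E univ (HF E F) := by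
  intro z hz
  rcases hF.cl z hz with h | h
  · exact Or.inl h
  right
  rcases mem_drawing.1 h with ⟨w, hw⟩ | ⟨a, b, hab⟩
  · exact Or.inl ⟨w, trivial, hw⟩
  rcases ar_or hab with h' | h' | h'
  exacts [Or.inr ⟨a, b, ⟨z, h', hz⟩, hab⟩, Or.inl ⟨a, trivial, h'⟩, Or.inl ⟨b, trivial, h'⟩]

lemma face_two [Finite V] (h3 : G.IsTriconnected) (hF : FaceP E F) (hv : v ∈ BF E F) (w : V) :
    ∃ x, x ≠ w ∧ HF E F v x := by
  by_contra h; push Not at h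
  obtain ⟨x, hx, hxw, _⟩ := tri_nbr h3 v w w
  obtain ⟨z, hz, hz'⟩ := pend_vertex (P := HF E F) (fun _ _ => HF.symm) hF.o (fun z hz hz' => hF.d z hz (dr_sub hz')) (face_HF hF) hv
    (w := w) (fun x hx => by by_contra h'; exact h x h' hx) hx hxw
  exact hF.d z hz' (mem_drawing.2 (Or.inr ⟨_, _, hz.1⟩))

lemma two_faces [Finite V] (h3 : G.IsTriconnected) (h : E.IsFace F) (h' : E.IsFace F') (huv : u ≠ v) (hn : ¬ G.Adj u v)
    (h1 : u ∈ BF E F) (h2 : v ∈ BF E F) (h1' : u ∈ BF E F') (h2' : v ∈ BF E F') : F = F' := by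
  have hF := face_props h
  have hF' := face_props h'
  obtain ⟨p, hp⟩ := hF.ne
  obtain ⟨q, hq⟩ := hF'.ne
  have key : ∀ v, v ∈ BF E F → v ∈ BF E F' → Jn (dr E {v}ᶜ fun a b => a ≠ v ∧ b ≠ v) p q := by
    intro v h h'
    have c1 : IsPreconnected (insert (E.pos v) F) := hF.c.subset_closure (subset_insert _ _)
      (insert_subset h subset_closure)
    have c2 : IsPreconnected (insert (E.pos v) F') := hF'.c.subset_closure (subset_insert _ _)
      (insert_subset h' subset_closure)
    refine ⟨_, c1.union _ (mem_insert _ _) (mem_insert _ _) c2, disjoint_left.2 ?_, Or.inl (Or.inr hp), Or.inr (Or.inr hq)⟩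
    have hv : E.pos v ∉ dr E {v}ᶜ fun a b => a ≠ v ∧ b ≠ v := by
      rintro (⟨a, ha, h⟩ | ⟨a, b, ⟨h1, h2⟩, h⟩)
      · exact ha (E.pos_inj h).symm
      · rcases ar_vert h with rfl | rfl
        exacts [h1 rfl, h2 rfl]
    rintro z ((rfl | hz) | (rfl | hz))
    exacts [hv, fun h => hF.d z hz (dr_sub h), hv, fun h => hF'.d z hz (dr_sub h)]
  have hJ := jan (dr_compact _ _) (dr_compact _ _) (by
    have e : (dr E {u}ᶜ fun a b => a ≠ u ∧ b ≠ u) ∩ (dr E {v}ᶜ fun a b => a ≠ v ∧ b ≠ v) =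
        dr E {w | w ≠ u ∧ w ≠ v} fun a b => a ∈ {w | w ≠ u ∧ w ≠ v} ∧ b ∈ {w | w ≠ u ∧ w ≠ v} := by
      ext z; constructor
      · rintro ⟨⟨a, ha, rfl⟩ | ⟨a, b, ⟨g1, g2⟩, hz⟩, ⟨c, hc, hz'⟩ | ⟨c, d, ⟨g3, g4⟩, hz'⟩⟩
        · obtain rfl := E.pos_inj hz'; exact Or.inl ⟨a, ⟨ha, hc⟩, rfl⟩
        · exact Or.inl ⟨a, ⟨ha, by rcases ar_vert hz' with rfl | rfl <;> assumption⟩, rfl⟩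
        · subst hz'; exact Or.inl ⟨c, ⟨by rcases ar_vert hz with rfl | rfl <;> assumption, hc⟩, rfl⟩
        · by_cases he : s(a, b) = s(c, d)
          · refine Or.inr ⟨a, b, ?_, hz⟩
            grind
          · obtain ⟨y, rfl, hy, hy'⟩ := ar_inter hz hz' he
            refine Or.inl ⟨y, ⟨?_, ?_⟩, rfl⟩
            all_goals grind
      · rintro (⟨a, ha, rfl⟩ | ⟨a, b, ⟨g1, g2⟩, hz⟩)
        · exact ⟨Or.inl ⟨a, ha.1, rfl⟩, Or.inl ⟨a, ha.2, rfl⟩⟩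
        · exact ⟨Or.inr ⟨a, b, ⟨g1.1, g2.1⟩, hz⟩, Or.inr ⟨a, b, ⟨g1.2, g2.2⟩, hz⟩⟩
    rw [e]; exact dr_conn (tri_Cn h3 u v)) (key u h1 h1') (key v h2 h2')
  obtain ⟨S, hS, hd, hpS, hqS⟩ := hJ
  refine face_eq h h' hS (hd.mono_right ?_) hp hq hpS hqS
  intro z hz
  rcases mem_drawing.1 hz with ⟨a, ha⟩ | ⟨a, b, hab⟩
  · by_cases h : a = u
    · exact Or.inr (Or.inl ⟨a, by rw [h]; exact huv, ha⟩)
    · exact Or.inl (Or.inl ⟨a, h, ha⟩)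
  · obtain ⟨h, _⟩ := id hab
    by_cases hu : a ≠ u ∧ b ≠ u
    · exact Or.inl (Or.inr ⟨a, b, hu, hab⟩)
    · refine Or.inr (Or.inr ⟨a, b, ?_, hab⟩)
      have h' := h.symm
      grind
lemma op_nbhd [Finite V] {z : Pl} (hz : z ∈ op E u v) : ∃ r > 0, ∀ y ∈ Metric.ball z r, y ∈ E.drawing → y ∈ op E u v := by
  have hc : IsClosed (dr E univ fun a b => s(a, b) ≠ s(u, v)) := (dr_compact _ _).isClosed
  obtain ⟨r, hr, hb⟩ := Metric.isOpen_iff.1 hc.isOpen_compl z (by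
    rintro (⟨w, _, hw⟩ | ⟨a, b, hab, h⟩)
    · exact hz.2 w hw
    · exact hab (op_uniq hz h).symm)
  refine ⟨r, hr, fun y hy hyd => ?_⟩
  have hy' := hb hy
  rcases mem_drawing.1 hyd with ⟨a, ha⟩ | ⟨a, b, hab⟩
  · exact absurd (Or.inl ⟨a, trivial, ha⟩) hy'
  by_cases he : s(a, b) = s(u, v)
  · refine ⟨?_, fun w hw => hy' (Or.inl ⟨w, trivial, hw⟩)⟩
    rcases Sym2.eq_iff.1 he with ⟨rfl, rfl⟩ | ⟨rfl, rfl⟩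
    exacts [hab, by rwa [ar_symm]]
  · exact absurd (Or.inr ⟨a, b, he, hab⟩) hy'

lemma ball_touch [Finite V] {z y : Pl} {r : ℝ} (hz : z ∈ op E u v)
    (hr : ∀ y ∈ Metric.ball z r, y ∈ E.drawing → y ∈ op E u v) (hy : y ∈ Metric.ball z r) (hF : FaceP E F) (hyF : y ∈ F) :
    HF E F u v := by
  by_contra hn
  have := (convex_ball z r).isPreconnected.subset_of_closure_inter_subset hF.o ⟨y, hy, hyF⟩ (by
    rintro w ⟨h1, h2⟩
    refine (hF.cl w h1).resolve_right fun h => hn ⟨w, hr w h2 h, h1⟩)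
    (Metric.mem_ball_self (by by_contra h; rw [Metric.ball_eq_empty.2 (not_lt.1 h)] at hy; exact hy))
  exact hF.d z this (mem_drawing.2 (Or.inr ⟨u, v, hz.1⟩))

lemma touch_ex [Finite V] (huv : G.Adj u v) : ∃ F, E.IsFace F ∧ HF E F u v := by
  obtain ⟨z, hz, _⟩ := op_acc (E := E) huv (p := fun _ => True) (by simp)
  obtain ⟨r, hr, hb⟩ := op_nbhd hz
  obtain ⟨f, hf, hi, h0, h1, him⟩ := ar_curve E huv
  obtain ⟨y, hy, hyn⟩ : ∃ y ∈ Metric.ball z r, y ∉ E.drawing := by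
    by_contra h; push Not at h
    have := arc_no_int hf hi Metric.isOpen_ball (fun y hy => him ▸ (hb y hy (h y hy)).1)
    exact (Metric.nonempty_ball.2 hr).ne_empty this
  obtain ⟨F, hF, hyF⟩ := face_of hyn
  exact ⟨F, hF, ball_touch hz hb hy (face_props hF) hyF⟩

lemma touch_one [Finite V] (h3 : G.IsTriconnected) (huv : G.Adj u v) (hF : E.IsFace F) (hH : HF E F u v)
    (h1 : ∀ F', E.IsFace F' → HF E F' u v → F' = F) (w : V) : ∃ x, x ≠ w ∧ x ≠ v ∧ HF E F u x := by
  by_contra h; push Not at h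
  have hP := face_props hF
  obtain ⟨x, hx, hxw, hxv⟩ := tri_nbr h3 u w v
  obtain ⟨z, hz, hz'⟩ := pend_vertex (E := E) (Ω := F ∪ op E u v) (P := fun a b => HF E F a b ∧ s(a, b) ≠ s(u, v))
    (v := u) (w := w) (x := x) (fun a b h => ⟨h.1.symm, by rw [Sym2.eq_swap]; exact h.2⟩) (by
      rw [Metric.isOpen_iff]
      rintro z (hz | hz)
      · obtain ⟨r, hr, hb⟩ := Metric.isOpen_iff.1 hP.o z hz
        grind
      · obtain ⟨r, hr, hb⟩ := op_nbhd hz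
        refine ⟨r, hr, fun y hy => ?_⟩
        by_cases hyd : y ∈ E.drawing
        · grind
        · obtain ⟨F', hF', hyF⟩ := face_of hyd
          rw [← h1 F' hF' (ball_touch hz hb hy (face_props hF') hyF)]
          exact Or.inl hyF) (by
      rintro z (hz | hz) hz'
      · exact hP.d z hz (dr_sub hz')
      · rcases hz' with ⟨a, _, ha⟩ | ⟨a, b, ⟨_, hab⟩, hz'⟩
        · exact hz.2 a ha
        · exact hab (op_uniq hz hz').symm) (by
      intro z hz
      have hz' : z ∈ closure F ∪ ar E u v := by
        rw [closure_union] at hz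
        exact hz.imp id fun h => closure_minimal (fun y hy => hy.1) (ar_compact E u v).isClosed h
      have har : z ∈ ar E u v → z ∈ F ∪ op E u v ∨ z ∈ dr E univ (fun a b => HF E F a b ∧ s(a, b) ≠ s(u, v)) := by
        intro h
        rcases ar_or h with h | h | h
        exacts [Or.inl (Or.inr h), Or.inr (Or.inl ⟨_, trivial, h⟩), Or.inr (Or.inl ⟨_, trivial, h⟩)]
      rcases hz' with hz | hz
      · rcases face_HF hP z hz with h | ⟨a, h⟩ | ⟨a, b, hab, hz2⟩
        · grind
        · exact Or.inr (Or.inl ⟨a, h⟩)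
        · by_cases he : s(a, b) = s(u, v)
          · refine har ?_
            rcases Sym2.eq_iff.1 he with ⟨rfl, rfl⟩ | ⟨rfl, rfl⟩
            exacts [hz2, by rwa [ar_symm]]
          · exact Or.inr (Or.inr ⟨a, b, ⟨hab, he⟩, hz2⟩)
      · exact har hz) (closure_mono subset_union_left (HF_left hP hH))
      (fun y hy => by
        by_contra hyw
        exact h y hyw (fun hyv => hy.2 (by rw [hyv])) hy.1) hx hxw
  rcases hz' with hz' | hz'
  · exact hP.d z hz' (mem_drawing.2 (Or.inr ⟨_, _, hz.1⟩))
  · have := op_uniq hz hz'.1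
    grind
end Faces2

section Dr1
open Topology Filter
variable {V : Type u} {G : SimpleGraph V} {E : PlaneEmbedding G} {u v w x : V} {F F' : Set Pl}

def TF (E : PlaneEmbedding G) (P : Set Pl → Prop) : SimpleGraph (V ⊕ {F // E.IsFace F ∧ P F}) where
  Adj
    | .inl u, .inl v => G.Adj u v
    | .inl v, .inr F => v ∈ BF E F.1
    | .inr F, .inl v => v ∈ BF E F.1
    | .inr _, .inr _ => False
  symm := ⟨by rintro (a | a) (b | b) h <;> first | exact h | exact h.symm⟩
  loopless := ⟨by rintro (a | a) h <;> first | exact h | exact h.ne rfl⟩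

lemma ar_loc (h : G.Adj v x) {ε : ℝ} (hε : 0 < ε) : ∀ᶠ y in 𝓝 (E.pos v), y ∈ ar E v x →
    JoinedIn (E.drawing ∩ Metric.ball (E.pos v) ε) y (E.pos v) := by
  obtain ⟨f, hf, hi, h0, h1, him⟩ := ar_curve E h
  have h2 : ∀ᶠ t in 𝓝[Icc 0 1] (0 : ℝ), f t ∈ Metric.ball (E.pos v) ε :=
    hf 0 (by simp) (h0 ▸ Metric.ball_mem_nhds _ hε)
  obtain ⟨η, hη, hb⟩ := Metric.mem_nhdsWithin_iff.1 h2
  have hK : IsCompact (f '' Icc (min η 1) 1) := isCompact_Icc.image_of_continuousOn (hf.mono (Icc_subset_Icc_left (by positivity)))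
  filter_upwards [hK.isClosed.isOpen_compl.mem_nhds (x := E.pos v) (by
    rintro ⟨t, ht, he⟩
    have : 0 < min η 1 := by positivity
    have := hi (x₁ := t) (x₂ := 0) ⟨by linarith [ht.1], ht.2⟩ (by simp) (he.trans h0.symm)
    linarith [ht.1])] with y hy hya
  obtain ⟨t, ht, rfl⟩ : y ∈ f '' Icc 0 1 := him ▸ hya
  have htη : t < min η 1 := by by_contra hh; exact hy ⟨t, ⟨not_lt.1 hh, ht.2⟩, rfl⟩
  have hP : IsPathConnected (f '' Icc 0 t) :=
    ((convex_Icc 0 t).isPathConnected ⟨0, by simp [ht.1]⟩).image' (hf.mono (Icc_subset_Icc_right ht.2))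
  rw [← h0]
  refine (hP.joinedIn _ ⟨t, by simp [ht.1], rfl⟩ _ ⟨0, by simp [ht.1], rfl⟩).mono ?_
  rintro _ ⟨s, hs, rfl⟩
  refine ⟨mem_drawing.2 (Or.inr ⟨v, x, him ▸ ⟨s, ⟨hs.1, hs.2.trans ht.2⟩, rfl⟩⟩), ?_⟩
  rw [h0]
  refine hb ⟨?_, hs.1, hs.2.trans ht.2⟩
  rw [Metric.mem_ball, Real.dist_eq, sub_zero, abs_of_nonneg hs.1]
  exact hs.2.trans_lt (htη.trans_le (min_le_left _ _))

lemma far_ev [Finite V] (E : PlaneEmbedding G) (v : V) : ∀ᶠ y in 𝓝 (E.pos v), y ∉ dr E {v}ᶜ (fun a b => a ≠ v ∧ b ≠ v) := by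
  refine (dr_compact _ _).isClosed.isOpen_compl.mem_nhds ?_
  rintro (⟨w, hw, h⟩ | ⟨a, b, hab, h⟩)
  · exact hw (E.pos_inj h.symm)
  · rcases ar_vert h with rfl | rfl
    exacts [hab.1 rfl, hab.2 rfl]

lemma acc [Finite V] (hF : FaceP E F) (hv : v ∈ BF E F) {ε : ℝ} (hε : 0 < ε) :
    ∃ x ∈ F, JoinedIn (F ∪ (E.drawing ∩ Metric.ball (E.pos v) ε)) x (E.pos v) := by
  have h1 : ∀ᶠ y in 𝓝 (E.pos v), ∀ x, y ∈ ar E v x → JoinedIn (E.drawing ∩ Metric.ball (E.pos v) ε) y (E.pos v) := by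
    rw [eventually_all]
    intro x
    by_cases h : G.Adj v x
    · exact ar_loc h hε
    · exact Eventually.of_forall fun y hy => absurd hy.1 h
  have h2 : ∀ᶠ y in 𝓝 (E.pos v), y ∈ E.drawing → JoinedIn (E.drawing ∩ Metric.ball (E.pos v) ε) y (E.pos v) := by
    filter_upwards [h1, far_ev E v] with y hy hy' hyd
    rcases mem_drawing.1 hyd with ⟨w, rfl⟩ | ⟨a, b, h⟩
    · by_cases hw : w = v
      · subst hw; exact JoinedIn.refl ⟨hyd, Metric.mem_ball_self hε⟩
      · exact absurd (Or.inl ⟨w, hw, rfl⟩) hy'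
    · by_cases ha : a = v
      · grind
      · by_cases hb : b = v
        · exact hy a (by rw [ar_symm]; exact hb ▸ h)
        · exact absurd (Or.inr ⟨a, b, ⟨ha, hb⟩, h⟩) hy'
  obtain ⟨δ, hδ, hb⟩ := Metric.eventually_nhds_iff_ball.1 h2
  obtain ⟨x, hx, hxF⟩ := mem_closure_iff.1 hv _ Metric.isOpen_ball (Metric.mem_ball_self hδ)
  refine ⟨x, hxF, ?_⟩
  let γ : ℝ → Pl := AffineMap.lineMap x (E.pos v)
  have hγ : Continuous γ := AffineMap.lineMap_continuous
  have hS : IsCompact (Icc 0 1 ∩ γ ⁻¹' E.drawing) := isCompact_Icc.inter_right ((drawing_closed E).preimage hγ)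
  obtain ⟨t, ⟨ht, htd⟩, hmin⟩ := hS.exists_isLeast ⟨1, by simp, by
    simp only [γ, mem_preimage, AffineMap.lineMap_apply_one]; exact mem_drawing.2 (Or.inl ⟨v, rfl⟩)⟩
  have hin : γ '' Ico 0 t ⊆ F := by
    rintro _ ⟨s, hs, rfl⟩
    by_contra hn
    have hsub : IsPreconnected (γ '' Ico 0 t) := isPreconnected_Ico.image _ hγ.continuousOn
    refine hn (hsub.subset_of_closure_inter_subset hF.o ⟨x, ⟨0, ⟨le_rfl, hs.1.trans_lt hs.2⟩, by simp [γ]⟩, hxF⟩ ?_ ⟨s, hs, rfl⟩)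
    rintro _ ⟨hz, ⟨r, hr, rfl⟩⟩
    refine (hF.cl _ hz).resolve_right fun hd => ?_
    exact hr.2.not_ge (hmin ⟨⟨hr.1, hr.2.le.trans ht.2⟩, hd⟩)
  have hj := hb (γ t) ((convex_ball _ _).lineMap_mem hx (Metric.mem_ball_self hδ) ht) htd
  refine JoinedIn.trans ?_ (hj.mono subset_union_right)
  have hP : IsPathConnected (γ '' Icc 0 t) :=
    ((convex_Icc 0 t).isPathConnected ⟨0, by simp [ht.1]⟩).image hγ
  refine (hP.joinedIn x ⟨0, by simp [ht.1], by simp [γ]⟩ _ ⟨t, by simp [ht.1], rfl⟩).mono ?_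
  rintro _ ⟨s, hs, rfl⟩
  rcases hs.2.eq_or_lt with rfl | h
  · exact Or.inr hj.source_mem
  · grind
lemma face_disj [Finite V] (h : E.IsFace F) (h' : E.IsFace F') {z : Pl} (hz : z ∈ F) (hz' : z ∈ F') : F = F' :=
  face_eq h h' (isPreconnected_singleton (x := z)) (disjoint_left.2 fun y hy hd => (face_props h).d z hz (hy ▸ hd)) hz hz' rfl rfl

lemma TF_WD [Finite V] (E : PlaneEmbedding G) (P) : ∃ p R, WD (TF E P) p R := by
  have h1 : ∃ ε > 0, ∀ v, (∀ y ∈ Metric.ball (E.pos v) ε, y ∉ dr E {v}ᶜ (fun a b => a ≠ v ∧ b ≠ v)) ∧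
      ∀ w ≠ v, ε + ε ≤ dist (E.pos v) (E.pos w) := by
    have : ∀ᶠ ε in 𝓝[>] (0 : ℝ), ∀ v, (∀ y ∈ Metric.ball (E.pos v) ε, y ∉ dr E {v}ᶜ (fun a b => a ≠ v ∧ b ≠ v)) ∧
      ∀ w, w ≠ v → ε + ε ≤ dist (E.pos v) (E.pos w) := by
      rw [eventually_all]; intro v
      refine Eventually.and ?_ ?_
      · obtain ⟨δ, hδ, hb⟩ := Metric.eventually_nhds_iff_ball.1 (far_ev E v)
        filter_upwards [Ioo_mem_nhdsGT hδ] with ε hε y hy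
        exact hb y (Metric.ball_subset_ball hε.2.le hy)
      · rw [eventually_all]; intro w
        by_cases hw : w = v
        · exact Eventually.of_forall fun _ h => absurd hw h
        · have : 0 < dist (E.pos v) (E.pos w) := dist_pos.2 fun h => hw (E.pos_inj h).symm
          filter_upwards [Ioo_mem_nhdsGT (half_pos this)] with ε hε _
          linarith [hε.2]
    obtain ⟨ε, h, h'⟩ := (this.and self_mem_nhdsWithin).exists
    exact ⟨ε, h', h⟩
  obtain ⟨ε, hε, hb⟩ := h1
  let st : V → Set Pl := fun v => E.drawing ∩ Metric.ball (E.pos v) ε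
  have hst : ∀ v w, v ≠ w → ∀ z, z ∈ st v → z ∉ st w := by
    intro v w hvw z hz hz'
    have h1 := (hb v).2 w hvw.symm
    have h2 := hz.2; have h3 := hz'.2
    rw [Metric.mem_ball] at h2 h3
    linarith [dist_triangle_left (E.pos v) (E.pos w) z]
  have hsa : ∀ v a b, v ≠ a → v ≠ b → ∀ z, z ∈ st v → z ∉ ar E a b := fun v a b ha hb' z hz hz' =>
    (hb v).1 z hz.2 (Or.inr ⟨a, b, ⟨ha.symm, hb'.symm⟩, hz'⟩)
  have hsp : ∀ v, E.pos v ∈ st v := fun v => ⟨mem_drawing.2 (Or.inl ⟨v, rfl⟩), Metric.mem_ball_self hε⟩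
  have hfd : ∀ F : {F // E.IsFace F ∧ P F}, ∀ z ∈ F.1, z ∉ E.drawing := fun F => (face_props F.2.1).d
  have hff : ∀ F F' : {F // E.IsFace F ∧ P F}, F ≠ F' → ∀ z ∈ F.1, z ∉ F'.1 := fun F F' hne z hz hz' =>
    hne (Subtype.ext (face_disj F.2.1 F'.2.1 hz hz'))
  have hda : ∀ {a b z}, z ∈ ar E a b → z ∈ E.drawing := fun h => mem_drawing.2 (Or.inr ⟨_, _, h⟩)
  have hdp : ∀ v, E.pos v ∈ E.drawing := fun v => mem_drawing.2 (Or.inl ⟨_, rfl⟩)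
  choose q hq using fun F : {F // E.IsFace F ∧ P F} => (face_props F.2.1).ne
  have hj : ∀ v (F : {F // E.IsFace F ∧ P F}), v ∈ BF E F.1 → JoinedIn (F.1 ∪ st v) (E.pos v) (q F) := by
    intro v F hv
    have hF := face_props F.2.1
    obtain ⟨x, hx, hxj⟩ := acc hF hv hε
    have : IsPathConnected F.1 := (hF.o.isConnected_iff_isPathConnected).1 ⟨hF.ne, hF.c⟩
    exact hxj.symm.trans ((this.joinedIn x hx _ (hq F)).mono subset_union_left)
  let R : V ⊕ {F // E.IsFace F ∧ P F} → V ⊕ {F // E.IsFace F ∧ P F} → Set Pl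
    | .inl u, .inl v => ar E u v
    | .inl v, .inr F => F.1 ∪ st v
    | .inr F, .inl v => F.1 ∪ st v
    | .inr _, .inr _ => ∅
  refine ⟨Sum.elim E.pos q, R, ?_, ?_, ?_, ?_⟩
  · rintro (u | F) (v | F') h
    · obtain ⟨f, hf, hi, h0, h1, him⟩ := ar_curve E h
      have hP := ((convex_Icc (0 : ℝ) 1).isPathConnected ⟨0, by simp⟩).image' hf
      have := hP.joinedIn _ ⟨0, by simp, h0⟩ _ ⟨1, by simp, h1⟩
      rw [him] at this; exact this
    · exact hj u F' h
    · exact (hj v F h).symm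
    · exact h.elim
  · have aa : ∀ a b c d, a ≠ c → a ≠ d → b ≠ c → b ≠ d → Disjoint (ar E a b) (ar E c d) := by
      intro a b c d h1 h2 h3 h4
      refine disjoint_left.2 fun z hz hz' => ?_
      obtain ⟨y, _, hy, hy'⟩ := ar_inter hz hz' (by simp; grind)
      grind
    have af : ∀ a b v (F : {F // E.IsFace F ∧ P F}), a ≠ v → b ≠ v → Disjoint (ar E a b) (F.1 ∪ st v) := by
      intro a b v F h1 h2
      refine disjoint_left.2 fun z hz hz' => ?_
      rcases hz' with h | h
      exacts [hfd F z h (hda hz), hsa v a b h1.symm h2.symm z h hz]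
    have ff : ∀ u (F' : {F // E.IsFace F ∧ P F}) v F, u ≠ v → F' ≠ F → Disjoint (F'.1 ∪ st u) (F.1 ∪ st v) := by
      intro u F' v F h1 h2
      refine disjoint_left.2 fun z hz hz' => ?_
      rcases hz with hz | hz <;> rcases hz' with h | h
      exacts [hff _ _ h2 z hz h, hfd _ z hz h.1, hfd _ z h hz.1, hst u v h1 z hz h]
    rintro (a | a) (b | b) (c | c) (d | d) h h' h1 h2 h3 h4
    all_goals simp only [ne_eq, Sum.inl.injEq, Sum.inr.injEq, reduceCtorEq, not_false_eq_true] at h1 h2 h3 h4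
    all_goals first
      | exact h.elim
      | exact h'.elim
      | exact aa _ _ _ _ h1 h2 h3 h4
      | (apply af <;> assumption)
      | (apply Disjoint.symm; apply af <;> first | assumption | (apply Ne.symm; assumption))
      | (apply ff <;> assumption)
  · have vf : ∀ v w (F : {F // E.IsFace F ∧ P F}), w ≠ v → E.pos w ∉ F.1 ∪ st v := by
      rintro v w F h (h' | h')
      exacts [hfd F _ h' (hdp w), hst w v h _ (hsp w) h']
    have fv : ∀ v (F' F : {F // E.IsFace F ∧ P F}), F' ≠ F → q F' ∉ F.1 ∪ st v := by
      rintro v F' F h (h' | h')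
      exacts [hff _ _ h _ (hq F') h', hfd _ _ (hq F') h'.1]
    rintro (a | a) (b | b) (c | c) h h1 h2
    all_goals simp only [ne_eq, Sum.inl.injEq, Sum.inr.injEq, reduceCtorEq, not_false_eq_true] at h1 h2
    all_goals first
      | exact h.elim
      | exact fun hh => (ar_vert hh).elim h1 h2
      | exact fun hh => hfd _ _ (hq _) (hda hh)
      | (apply vf; assumption)
      | (apply fv; assumption)
  · rintro (a | a) (b | b) h <;> simp only [Sum.elim_inl, Sum.elim_inr] at h
    · rw [E.pos_inj h]
    · exact absurd (hdp a) (h ▸ hfd _ _ (hq b))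
    · exact absurd (hdp b) (h ▸ hfd _ _ (hq a))
    · by_contra hne
      exact hff a b (fun h => hne (by rw [h])) _ (hq a) (h ▸ hq b)
end Dr1

section Dr2
open Topology Filter
variable {V : Type u} {G : SimpleGraph V} {E : PlaneEmbedding G} {u v w x : V} {F F' : Set Pl}

lemma vert_nbhd [Finite V] (E : PlaneEmbedding G) (v : V) : ∃ δ > 0, ∀ y ∈ Metric.ball (E.pos v) δ,
    (y ∈ E.drawing → y = E.pos v ∨ ∃ x, y ∈ op E v x) ∧ ∀ F, FaceP E F → y ∈ F → v ∈ BF E F := by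
  obtain ⟨δ, hδ, hb⟩ := Metric.eventually_nhds_iff_ball.1 (far_ev E v)
  have h1 : ∀ y ∈ Metric.ball (E.pos v) δ, y ∈ E.drawing → y = E.pos v ∨ ∃ x, y ∈ op E v x := by
    intro y hy hd
    have key : ∀ x, y ∈ ar E v x → y = E.pos v ∨ ∃ x, y ∈ op E v x := by
      intro x hx
      rcases ar_or hx with h | h | h
      · grind
      · exact Or.inl h
      · obtain ⟨hvx, _⟩ := hx
        exact absurd (Or.inl ⟨x, hvx.ne', h⟩) (hb y hy)
    rcases mem_drawing.1 hd with ⟨w, rfl⟩ | ⟨a, b, h⟩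
    · left; by_contra hw; exact hb _ hy (Or.inl ⟨w, fun h => hw (by rw [h]), rfl⟩)
    · by_cases ha : a = v
      · grind
      · by_cases hb' : b = v
        · exact key a (by rw [ar_symm]; exact hb' ▸ h)
        · exact absurd (Or.inr ⟨a, b, ⟨ha, hb'⟩, h⟩) (hb y hy)
  refine ⟨δ, hδ, fun y hy => ⟨h1 y hy, fun F hF hyF => ?_⟩⟩
  by_contra hn
  have := (convex_ball (E.pos v) δ).isPreconnected.subset_of_closure_inter_subset hF.o ⟨y, hy, hyF⟩ (by
    rintro w ⟨h2, h3⟩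
    refine (hF.cl w h2).resolve_right fun h => hn ?_
    rcases h1 w h3 h with rfl | ⟨x, hx⟩
    exacts [h2, HF_left hF ⟨w, hx, h2⟩]) (Metric.mem_ball_self hδ)
  exact hF.d _ this (mem_drawing.2 (Or.inl ⟨v, rfl⟩))

def WA (E : PlaneEmbedding G) (A : Set V) : Set Pl := {z | (∃ v ∈ A, z = E.pos v) ∨ (∃ u ∈ A, ∃ x, z ∈ op E u x) ∨
  ∃ F, E.IsFace F ∧ z ∈ F ∧ ∃ v ∈ A, v ∈ BF E F}

lemma WA_open [Finite V] (A : Set V) : IsOpen (WA E A) := by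
  rw [Metric.isOpen_iff]
  rintro z (⟨v, hv, rfl⟩ | ⟨u, hu, x, hz⟩ | ⟨F, hF, hz, h⟩)
  · obtain ⟨δ, hδ, hb⟩ := vert_nbhd E v
    refine ⟨δ, hδ, fun y hy => ?_⟩
    by_cases hyd : y ∈ E.drawing
    · rcases (hb y hy).1 hyd with h | ⟨x, hx⟩
      exacts [Or.inl ⟨v, hv, h⟩, Or.inr (Or.inl ⟨v, hv, x, hx⟩)]
    · obtain ⟨F, hF, hyF⟩ := face_of hyd
      exact Or.inr (Or.inr ⟨F, hF, hyF, v, hv, (hb y hy).2 F (face_props hF) hyF⟩)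
  · obtain ⟨r, hr, hb⟩ := op_nbhd hz
    refine ⟨r, hr, fun y hy => ?_⟩
    by_cases hyd : y ∈ E.drawing
    · exact Or.inr (Or.inl ⟨u, hu, x, hb y hy hyd⟩)
    · obtain ⟨F, hF, hyF⟩ := face_of hyd
      exact Or.inr (Or.inr ⟨F, hF, hyF, u, hu, HF_left (face_props hF) (ball_touch hz hb hy (face_props hF) hyF)⟩)
  · obtain ⟨r, hr, hb⟩ := Metric.isOpen_iff.1 (face_props hF).o z hz
    exact ⟨r, hr, fun y hy => Or.inr (Or.inr ⟨F, hF, hb hy, h⟩)⟩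

lemma NS_single (p : Pl) : NS {p} := by
  have := arc_NS (f := fun _ => p) (a := 0) (b := 0) le_rfl continuousOn_const (by simp)
  simpa using this

lemma NS_seg (E : PlaneEmbedding G) (a b : V) : IsCompact ({E.pos a, E.pos b} ∪ ar E a b) ∧ NS ({E.pos a, E.pos b} ∪ ar E a b) := by
  refine ⟨(toFinite _).isCompact.union (ar_compact E a b), ?_⟩
  by_cases h : G.Adj a b
  · rw [union_eq_self_of_subset_left]
    · exact ar_NS h
    · rintro _ (rfl | rfl)
      exacts [ar_left h, ar_right h]
  · have : ar E a b = ∅ := by ext z; exact ⟨fun ⟨h', _⟩ => h h', fun h => h.elim⟩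
    rw [this, union_empty, ← singleton_union]
    exact NS.union isCompact_singleton isCompact_singleton
      (subsingleton_singleton.anti inter_subset_left).isPreconnected (NS_single _) (NS_single _)

lemma sep_top [Finite V] {a b c : V} (hab : a ≠ b) (hbc : b ≠ c) (hac : a ≠ c) (hn : ¬ G.Adj a c) {A B : Set V} (hA : A.Nonempty) (hB : B.Nonempty)
    (hd : ∀ x ∈ A, x ∉ B) (hAC : ∀ x ∈ A, x ≠ a ∧ x ≠ b ∧ x ≠ c) (hBC : ∀ x ∈ B, x ≠ a ∧ x ≠ b ∧ x ≠ c)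
    (hcov : ∀ x, x ∈ A ∨ x ∈ B ∨ x = a ∨ x = b ∨ x = c) (hE : ∀ x ∈ A, ∀ y ∈ B, ¬ G.Adj x y)
    (hF : ∀ F, E.IsFace F → ∀ x ∈ A, ∀ y ∈ B, x ∈ BF E F → y ∉ BF E F) : False := by
  let Z := ({E.pos a, E.pos b} ∪ ar E a b) ∪ ({E.pos b, E.pos c} ∪ ar E b c)
  have hZ : NS Z := by
    refine NS.union (NS_seg E a b).1 (NS_seg E b c).1 ?_ (NS_seg E a b).2 (NS_seg E b c).2
    refine (subsingleton_singleton (a := E.pos b)).anti ?_ |>.isPreconnected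
    have i := E.pos_inj.ne hab
    have i' := E.pos_inj.ne hbc
    have i'' := E.pos_inj.ne hac
    rintro z ⟨(h | h), (h' | h')⟩
    · grind
    · rcases h with rfl | h
      · rcases ar_vert h' with h | h
        exacts [absurd h hab, absurd h hac]
      · exact h
    · rcases h' with rfl | h'
      · rfl
      · rw [mem_singleton_iff.1 h'] at h
        rcases ar_vert h with h | h
        exacts [absurd h.symm hac, absurd h.symm hbc]
    · obtain ⟨y, rfl, h1, h2⟩ := ar_inter h h' (by simp; grind)
      grind
  have hv : ∀ x, x ≠ a ∧ x ≠ b ∧ x ≠ c → E.pos x ∉ Z := by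
    rintro x ⟨h1, h2, h3⟩ (h | h) <;> rcases h with h | h
    · rcases h with h | h
      exacts [h1 (E.pos_inj h), h2 (E.pos_inj h)]
    · exact (ar_vert h).elim h1 h2
    · rcases h with h | h
      exacts [h2 (E.pos_inj h), h3 (E.pos_inj h)]
    · exact (ar_vert h).elim h2 h3
  obtain ⟨α, hα⟩ := hA
  obtain ⟨β, hβ⟩ := hB
  obtain ⟨S, hS, hSZ, h1, h2⟩ := hZ _ _ (hv α (hAC α hα)) (hv β (hBC β hβ))
  let Q := ⋃₀ {F | E.IsFace F ∧ ∀ v ∈ A, v ∉ BF E F}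
  have hQ : IsOpen Q := isOpen_sUnion fun F h => (face_props h.1).o
  obtain ⟨z, _, hzA, hzB⟩ := hS (WA E A) (WA E B ∪ Q) (WA_open A) ((WA_open B).union hQ) (by
    intro z hz
    have hzZ : z ∉ Z := disjoint_left.1 hSZ hz
    by_cases hzd : z ∈ E.drawing
    · rcases mem_drawing.1 hzd with ⟨w, rfl⟩ | ⟨u, x, h⟩
      · rcases hcov w with h | h | h
        · exact Or.inl (Or.inl ⟨w, h, rfl⟩)
        · exact Or.inr (Or.inl (Or.inl ⟨w, h, rfl⟩))
        all_goals grind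
      · have hu := hcov u
        have hx := hcov x
        obtain ⟨hux, _⟩ := id h
        by_cases ho : z ∈ op E u x
        · have ho' := op_symm E u x ▸ ho
          rcases hu with hu | hu | hu
          · exact Or.inl (Or.inr (Or.inl ⟨u, hu, x, ho⟩))
          · exact Or.inr (Or.inl (Or.inr (Or.inl ⟨u, hu, x, ho⟩)))
          rcases hx with hx | hx | hx
          · exact Or.inl (Or.inr (Or.inl ⟨x, hx, u, ho'⟩))
          · exact Or.inr (Or.inl (Or.inr (Or.inl ⟨x, hx, u, ho'⟩)))
          exfalso; apply hzZ
          have h' := ar_symm E u x ▸ h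
          rcases hu with rfl | rfl | rfl <;> rcases hx with rfl | rfl | rfl <;>
            first
            | exact absurd hux hn
            | exact absurd hux.symm hn
            | exact absurd rfl hux.ne
            | exact Or.inl (Or.inr h)
            | exact Or.inr (Or.inr h)
            | exact Or.inl (Or.inr h')
            | exact Or.inr (Or.inr h')
        · have : ∃ w, z = E.pos w := by by_contra hh; push Not at hh; exact ho ⟨h, hh⟩
          obtain ⟨w, rfl⟩ := this
          rcases hcov w with h | h | h
          · exact Or.inl (Or.inl ⟨w, h, rfl⟩)
          · exact Or.inr (Or.inl (Or.inl ⟨w, h, rfl⟩))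
          · exfalso; apply hzZ; rcases h with rfl | rfl | rfl <;> simp [Z]
    · obtain ⟨F, hF, hyF⟩ := face_of hzd
      by_cases h : ∃ v ∈ A, v ∈ BF E F
      · exact Or.inl (Or.inr (Or.inr ⟨F, hF, hyF, h⟩))
      · exact Or.inr (Or.inr ⟨F, ⟨hF, fun v hv hv' => h ⟨v, hv, hv'⟩⟩, hyF⟩))
    ⟨_, h1, Or.inl ⟨α, hα, rfl⟩⟩ ⟨_, h2, Or.inl (Or.inl ⟨β, hβ, rfl⟩)⟩
  have hdo : ∀ {u x z}, z ∈ op E u x → z ∈ E.drawing := fun h => mem_drawing.2 (Or.inr ⟨_, _, h.1⟩)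
  rcases hzA with ⟨v, hv, rfl⟩ | ⟨u, hu, x, hz⟩ | ⟨F, hF1, hz, v, hvA, hvF⟩
  · have hd' : E.pos v ∈ E.drawing := mem_drawing.2 (Or.inl ⟨v, rfl⟩)
    rcases hzB with (⟨v', hv', h⟩ | ⟨u', hu', x', h⟩ | ⟨F', hF', h, _⟩) | ⟨F', ⟨hF', _⟩, h⟩
    · rw [E.pos_inj h] at hv; exact hd _ hv hv'
    · exact h.2 v rfl
    · exact (face_props hF').d _ h hd'
    · exact (face_props hF').d _ h hd'
  · rcases hzB with (⟨v', hv', h⟩ | ⟨u', hu', x', h⟩ | ⟨F', hF', h, _⟩) | ⟨F', ⟨hF', _⟩, h⟩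
    · exact hz.2 _ h
    · rcases Sym2.eq_iff.1 (op_uniq hz h.1) with ⟨rfl, rfl⟩ | ⟨rfl, rfl⟩
      · exact hd _ hu hu'
      · obtain ⟨⟨hh, _⟩, _⟩ := hz
        exact hE _ hu _ hu' hh
    · exact (face_props hF').d _ h (hdo hz)
    · exact (face_props hF').d _ h (hdo hz)
  · rcases hzB with (⟨v', hv', rfl⟩ | ⟨u', hu', x', h⟩ | ⟨F', hF', h, v', hv', hvF'⟩) | ⟨F', ⟨hF', h'⟩, h⟩
    · exact (face_props hF1).d _ hz (mem_drawing.2 (Or.inl ⟨_, rfl⟩))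
    · exact (face_props hF1).d _ hz (hdo h)
    · rw [← face_disj hF1 hF' hz h] at hvF'
      exact hF F hF1 v hvA v' hv' hvF hvF'
    · rw [← face_disj hF1 hF' hz h] at h'
      exact h' v hvA hvF

def NP (E : PlaneEmbedding G) (F : Set Pl) : Prop := ∃ u ∈ BF E F, ∃ v ∈ BF E F, u ≠ v ∧ ¬ G.Adj u v

lemma NP_three [Finite V] (h3 : G.IsTriconnected) (hF : FaceP E F) (hN : NP E F) (a b c : V) (h : ∀ x ∈ BF E F, x = a ∨ x = b ∨ x = c) : False := by
  obtain ⟨u, hu, v, hv, huv, hn⟩ := hN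
  obtain ⟨x, hx, hx1⟩ := face_two h3 hF hu v
  obtain ⟨y, hy, hy1⟩ := face_two h3 hF hu x
  have e1 := h u hu
  have e2 := h v hv
  have e3 := h x (HF_right hF hx1)
  have e4 := h y (HF_right hF hy1)
  have n1 := hx1.adj.ne
  have n2 := hy1.adj.ne
  have n3 : y ≠ v := fun h => hn (h ▸ hy1.adj)
  grind

lemma NP_fin [Finite V] (h3 : G.IsTriconnected) : Finite {F // E.IsFace F ∧ NP E F} := by
  choose a ha b hb hab hn using fun F : {F // E.IsFace F ∧ NP E F} => F.2.2
  refine Finite.of_injective (fun F => (a F, b F)) fun F F' h => Subtype.ext ?_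
  rw [Prod.mk.injEq] at h
  exact two_faces h3 F.2.1 F'.2.1 (hab F) (hn F) (ha F) (hb F) (h.1 ▸ ha F') (h.2 ▸ hb F')

lemma TF_h4 [Finite V] (h3 : G.IsTriconnected) (hs : ∀ a b c : V, ¬ G.IsSepTriangle a b c)
    (S : Set (V ⊕ {F // E.IsFace F ∧ NP E F})) (p q r) (hS : S.Nonempty)
    (hcl : ∀ s ∈ S, ∀ y, (TF E (NP E)).Adj s y → y ∈ S ∨ y = p ∨ y = q ∨ y = r) (y) : y ∈ S ∨ y = p ∨ y = q ∨ y = r := by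
  by_contra hy
  have hd1 : ∃ s ∈ S, s ≠ p ∧ s ≠ q ∧ s ≠ r := by
    by_contra hh; push Not at hh
    obtain ⟨s, hs⟩ := hS
    have hdeg : ∀ (t p q : V ⊕ {F // E.IsFace F ∧ NP E F}), ∃ x, (TF E (NP E)).Adj t x ∧ x ≠ p ∧ x ≠ q := by
      rintro (t | t) p q
      · have : ∃ a b : V, ∀ x, x ≠ a → x ≠ b → Sum.inl x ≠ p ∧ Sum.inl x ≠ q := by
          rcases p with p | p <;> rcases q with q | q
          exacts [⟨p, q, by simp_all⟩, ⟨p, p, by simp_all⟩, ⟨q, q, by simp_all⟩, ⟨t, t, by simp_all⟩]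
        obtain ⟨a, b, hab⟩ := this
        obtain ⟨x, hx, h1, h2⟩ := tri_nbr h3 t a b
        exact ⟨.inl x, hx, hab x h1 h2⟩
      · by_contra hh; push Not at hh
        obtain ⟨v, hv, _⟩ := t.2.2
        have : ∃ a b : V, ∀ x, x ≠ a → x ≠ b → Sum.inl x ≠ p ∧ Sum.inl x ≠ q := by
          rcases p with p | p <;> rcases q with q | q
          exacts [⟨p, q, by simp_all⟩, ⟨p, p, by simp_all⟩, ⟨q, q, by simp_all⟩, ⟨v, v, by simp_all⟩]
        obtain ⟨a, b, hab⟩ := this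
        refine NP_three h3 (face_props t.2.1) t.2.2 a b b fun x hx => ?_
        by_contra hx'
        have := hab x (by grind) (by grind)
        exact this.2 (hh (.inl x) hx this.1)
    have h1 : ∀ t ∈ S, t = p ∨ t = q ∨ t = r := fun t ht => by
      grind
    have h2 : ∀ y, (TF E (NP E)).Adj s y → y = p ∨ y = q ∨ y = r := by grind
    have h5 := h1 s hs
    obtain ⟨x, hx, x1, x2⟩ := hdeg s q r
    obtain ⟨y, hy, y1, y2⟩ := hdeg s p r
    obtain ⟨z, hz, z1, z2⟩ := hdeg s p q
    have := hx.ne; have := hy.ne; have := hz.ne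
    grind
  obtain ⟨s, hsS, hs1⟩ := hd1
  let A : Set V := {v | .inl v ∈ S ∧ Sum.inl v ≠ p ∧ Sum.inl v ≠ q ∧ Sum.inl v ≠ r}
  let B : Set V := {v | Sum.inl v ∉ S ∧ Sum.inl v ≠ p ∧ Sum.inl v ≠ q ∧ Sum.inl v ≠ r}
  have hAB : ∀ x ∈ A, ∀ z ∈ B, ¬ G.Adj x z := by
    rintro x hx z hz h
    have := hcl (.inl x) hx.1 (.inl z) h
    grind
  obtain ⟨o1⟩ := h3.2.1.nonempty
  obtain ⟨a, b, c, hC⟩ : ∃ a b c : V, ∀ x, Sum.inl x = p ∨ Sum.inl x = q ∨ Sum.inl x = r → x = a ∨ x = b ∨ x = c := by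
    rcases p with p | p <;> rcases q with q | q <;> rcases r with r | r
    exacts [⟨p, q, r, by simp⟩, ⟨p, q, q, by simp⟩, ⟨p, r, r, by simp⟩, ⟨p, p, p, by simp⟩, ⟨q, r, r, by simp⟩,
      ⟨q, q, q, by simp⟩, ⟨r, r, r, by simp⟩, ⟨o1, o1, o1, by simp⟩]
  have hA : A.Nonempty := by
    by_contra hA
    have hA' : ∀ v, Sum.inl v ∈ S → Sum.inl v = p ∨ Sum.inl v = q ∨ Sum.inl v = r := fun v hv => by
      by_contra hh; exact hA ⟨v, hv, by grind⟩
    rcases s with s | s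
    · grind
    · exact NP_three h3 (face_props s.2.1) s.2.2 a b c fun x hx => hC x ((hcl _ hsS (.inl x) hx).elim (hA' x) id)
  have hB : B.Nonempty := by
    by_contra hB
    have hB' : ∀ v, Sum.inl v ∉ S → Sum.inl v = p ∨ Sum.inl v = q ∨ Sum.inl v = r := fun v hv => by
      by_contra hh; exact hB ⟨v, hv, by grind⟩
    rcases y with s | s
    · grind
    · exact NP_three h3 (face_props s.2.1) s.2.2 a b c fun x hx => hC x (by
        by_cases h : Sum.inl x ∈ S
        · exact absurd (hcl _ h (.inr s) hx) hy
        · exact hB' x h)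
  have hcov : ∀ x, x ∈ A ∨ x ∈ B ∨ Sum.inl x = p ∨ Sum.inl x = q ∨ Sum.inl x = r := by
    grind
  have hdj : ∀ x ∈ A, x ∉ B := fun x hx hx' => hx'.1 hx.1
  have small : ∀ a b : V, (∀ x, Sum.inl x = p ∨ Sum.inl x = q ∨ Sum.inl x = r → x = a ∨ x = b) → False := by
    intro a b hab
    by_cases hne : (A \ {a, b}).Nonempty
    · have := (tri_Cn h3 a b).2 (A \ {a, b}) (fun x hx => by simpa using hx.2) hne (fun x hx z hz hxz => by
        refine ⟨?_, by simpa using hz⟩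
        rcases hcov z with h | h | h
        · exact h
        · grind
        · have := hab z h; have := hz.1; have := hz.2; grind)
      obtain ⟨v, hv⟩ := hB
      obtain ⟨x, hx, h1, h2⟩ := tri_nbr h3 v a b
      have hxA : x ∈ A \ {a, b} := by grind
      exact hAB x hxA.1 v hv hx.symm
    · obtain ⟨v, hv⟩ := hA
      obtain ⟨x, hx, h1, h2⟩ := tri_nbr h3 v a b
      rcases hcov x with h | h | h
      · exact hne ⟨x, h, by simp [h1, h2]⟩
      all_goals grind
  rcases p with p | p
  swap
  · obtain ⟨a, b, h⟩ : ∃ a b : V, ∀ x, Sum.inl x = q ∨ Sum.inl x = r → x = a ∨ x = b := by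
      rcases q with q | q <;> rcases r with r | r
      exacts [⟨q, r, by simp⟩, ⟨q, q, by simp⟩, ⟨r, r, by simp⟩, ⟨o1, o1, by simp⟩]
    exact small a b (fun x hx => h x (by simpa using hx))
  rcases q with q | q
  swap
  · rcases r with r | r
    exacts [small p r (by simp), small p p (by simp)]
  rcases r with r | r
  swap
  · exact small p q (by simp)
  by_cases hpq : p = q
  · exact small p r (by simp [hpq])
  by_cases hqr : q = r
  · exact small p r (by simp [hqr])
  by_cases hpr : p = r
  · exact small q r (by simp [hpr])
  have hF : ∀ F, E.IsFace F → ∀ x ∈ A, ∀ y ∈ B, x ∈ BF E F → y ∉ BF E F := by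
    intro F hF x hx y hy h1 h2
    have hN : NP E F := ⟨x, h1, y, h2, fun h => hdj x hx (h ▸ hy), hAB x hx y hy⟩
    have := hcl (.inl x) hx.1 (.inr ⟨F, hF, hN⟩) h1
    have := hcl (.inr ⟨F, hF, hN⟩) (by simpa using this) (.inl y) h2
    grind
  have hA1 : ∀ x ∈ A, x ≠ p ∧ x ≠ q ∧ x ≠ r := fun x hx => by simpa using hx.2
  have hB1 : ∀ x ∈ B, x ≠ p ∧ x ≠ q ∧ x ≠ r := fun x hx => by simpa using hx.2
  simp only [Sum.inl.injEq] at hcov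
  by_cases h1 : G.Adj p r
  swap
  · exact sep_top hpq hqr hpr h1 hA hB hdj hA1 hB1 hcov hAB hF
  by_cases h2 : G.Adj p q
  swap
  · exact sep_top (b := r) hpr (Ne.symm hqr) hpq h2 hA hB hdj (by grind) (by grind) (by grind) hAB hF
  by_cases h5 : G.Adj q r
  swap
  · exact sep_top (b := p) (Ne.symm hpq) hpr hqr h5 hA hB hdj (by grind) (by grind) (by grind) hAB hF
  have hc := Cn_of_induce (not_not.1 fun h => hs p q r ⟨h2, h5, h1, h⟩)
  have := hc.2 A (fun x hx => hA1 x hx) hA (fun x hx z hz hxz => by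
    rcases hcov z with h | h | h
    · exact h
    · grind
    · have := hz.1; have := hz.2; grind)
  obtain ⟨v, hv⟩ := hB
  exact hdj v (by rw [this]; exact hB1 v hv) hv
end Dr2

section Dr3
variable {V : Type u} {G : SimpleGraph V} {E : PlaneEmbedding G} {u v w x : V} {F F' : Set Pl}

lemma TF_tri0 [Finite V] (h3 : G.IsTriconnected) (hs : ∀ a b c : V, ¬ G.IsSepTriangle a b c) : Tri0 (TF E (NP E)) := by
  obtain ⟨p, R, h⟩ := TF_WD E (NP E)
  exact ⟨h.no5, h.no33, TF_h4 h3 hs⟩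

lemma Cn_inl {P} {S : Set V} (h : Cn G S) : Cn (TF E P) (Sum.inl '' S) := by
  refine ⟨h.1.image _, fun A hA ⟨a, ha⟩ hcl => ?_⟩
  have := h.2 (Sum.inl ⁻¹' A) (fun x hx => by obtain ⟨y, hy, he⟩ := hA hx; rw [← Sum.inl_injective he]; exact hy)
    (by obtain ⟨y, hy, rfl⟩ := hA ha; exact ⟨y, ha⟩) (fun a ha b hb hab => hcl _ ha _ ⟨b, hb, rfl⟩ hab)
  grind
lemma touch_two [Finite V] (h3 : G.IsTriconnected) (hs : ∀ a b c : V, ¬ G.IsSepTriangle a b c) (hF : E.IsFace F)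
    (hH : HF E F u v) : ∃ F', E.IsFace F' ∧ HF E F' u v ∧ F' ≠ F := by
  by_contra h1; push Not at h1
  obtain ⟨x, _, hxv, hx⟩ := touch_one h3 hH.adj hF hH h1 v
  obtain ⟨y, hyx, hyv, hy⟩ := touch_one h3 hH.adj hF hH h1 x
  have hP := face_props hF
  have bu := HF_left hP hH
  have bv := HF_right hP hH
  have bx := HF_right hP hx
  have bY := HF_right hP hy
  by_cases hN : NP E F
  · have := NP_fin (E := E) h3
    exact (TF_tri0 (E := E) h3 hs).three (u := .inl u) (v := .inr ⟨F, hF, hN⟩) (x1 := .inl v) (x2 := .inl x) (x3 := .inl y)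
      bu hH.adj hx.adj hy.adj bv bx bY (by simpa using hxv.symm) (by simpa using hyv.symm) (by simpa using hyx.symm)
  · have hc : ∀ a ∈ BF E F, ∀ b ∈ BF E F, a ≠ b → G.Adj a b := fun a ha b hb hab => by
      by_contra hh; exact hN ⟨a, ha, b, hb, hab, hh⟩
    obtain ⟨p, R, h⟩ := TF_WD E (fun _ => True)
    have dj : ∀ a b : V ⊕ {F // E.IsFace F ∧ True}, a ≠ b → Dj {a} {b} := by grind
    have tc : ∀ a b : V ⊕ {F // E.IsFace F ∧ True}, (TF E (fun _ => True)).Adj a b → Tch (TF E (fun _ => True)) {a} {b} :=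
      fun a b hab => ⟨a, rfl, b, rfl, hab⟩
    have d : ∀ {a b : V}, a ≠ b → Dj {(Sum.inl a : V ⊕ {F // E.IsFace F ∧ True})} {Sum.inl b} := by grind
    let f : V ⊕ {F // E.IsFace F ∧ True} := .inr ⟨F, hF, trivial⟩
    have d' : ∀ {a : V}, Dj {(Sum.inl a : V ⊕ {F // E.IsFace F ∧ True})} {f} := by grind
    have t : ∀ {a b : V}, G.Adj a b → Tch (TF E (fun _ => True)) {.inl a} {.inl b} := fun h => tc _ _ h
    have t' : ∀ {a : V}, a ∈ BF E F → Tch (TF E (fun _ => True)) {.inl a} {f} := fun h => tc _ _ h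
    exact h.no5 {.inl u} {.inl v} {.inl x} {.inl y} {f} (Cn.single _) (Cn.single _) (Cn.single _) (Cn.single _) (Cn.single _)
      (d hH.adj.ne) (d hx.adj.ne) (d hy.adj.ne) d' (d hxv.symm) (d hyv.symm) d' (d hyx.symm) d' d'
      (t hH.adj) (t hx.adj) (t hy.adj) (t' bu) (t (hc _ bv _ bx hxv.symm)) (t (hc _ bv _ bY hyv.symm)) (t' bv)
      (t (hc _ bx _ bY hyx.symm)) (t' bx) (t' bY)

lemma TF_tri [Finite V] (h3 : G.IsTriconnected) (hs : ∀ a b c : V, ¬ G.IsSepTriangle a b c) : Tri (TF E (NP E)) := by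
  refine ⟨TF_tri0 h3 hs, ?_⟩
  have vf : ∀ v (F : {F // E.IsFace F ∧ NP E F}), v ∈ BF E F.1 → ∃ x y : V, x ≠ y ∧ G.Adj v x ∧ x ∈ BF E F.1 ∧ G.Adj v y ∧ y ∈ BF E F.1 := by
    intro v F hv
    have hF := face_props F.2.1
    obtain ⟨x, _, hx⟩ := face_two h3 hF hv v
    obtain ⟨y, hy', hy⟩ := face_two h3 hF hv x
    exact ⟨x, y, hy'.symm, hx.adj, HF_right hF hx, hy.adj, HF_right hF hy⟩
  rintro (u | F) (v | F') huv
  · obtain ⟨F1, hF1, H1⟩ := touch_ex (E := E) (G := G) (u := u) (v := v) huv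
    obtain ⟨F2, hF2, H2, hne⟩ := touch_two h3 hs hF1 H1
    have third : ∀ F, E.IsFace F → ¬ NP E F → HF E F u v → ∃ x, G.Adj u x ∧ G.Adj v x ∧ x ∈ BF E F := by
      intro F hF hN H
      have hP := face_props hF
      obtain ⟨x, hxv, hx⟩ := face_two h3 hP (HF_left hP H) v
      refine ⟨x, hx.adj, ?_, HF_right hP hx⟩
      by_contra hh; exact hN ⟨v, HF_right hP H, x, HF_right hP hx, hxv.symm, hh⟩
    have p1 := face_props hF1
    have p2 := face_props hF2
    by_cases n1 : NP E F1 <;> by_cases n2 : NP E F2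
    · exact ⟨.inr ⟨F1, hF1, n1⟩, .inr ⟨F2, hF2, n2⟩, by simpa using hne.symm, HF_left p1 H1, HF_right p1 H1, HF_left p2 H2, HF_right p2 H2⟩
    · obtain ⟨x, a, b, _⟩ := third F2 hF2 n2 H2
      exact ⟨.inr ⟨F1, hF1, n1⟩, .inl x, by simp, HF_left p1 H1, HF_right p1 H1, a, b⟩
    · obtain ⟨x, a, b, _⟩ := third F1 hF1 n1 H1
      exact ⟨.inr ⟨F2, hF2, n2⟩, .inl x, by simp, HF_left p2 H2, HF_right p2 H2, a, b⟩
    · obtain ⟨x, a, b, x1⟩ := third F1 hF1 n1 H1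
      obtain ⟨y, a', b', x2⟩ := third F2 hF2 n2 H2
      by_cases hxy : x = y
      swap
      · exact ⟨.inl x, .inl y, by simpa using hxy, a, b, a', b'⟩
      subst hxy
      exfalso
      obtain ⟨p, R, h⟩ := TF_WD E (fun _ => True)
      have hc := Cn_of_induce (not_not.1 fun h => hs u v x ⟨huv, b, a, h⟩)
      have hC := Cn_inl (E := E) (P := fun _ => True) hc
      have e1 := H1.adj.ne
      have tr : ∀ a b c : V, ∀ S : Set V, (∀ z, z ≠ a → z ≠ b → z ≠ c → z ∈ S) → Tch (TF E (fun _ => True)) {.inl a} (Sum.inl '' S) := by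
        intro a b c S hS
        obtain ⟨z, hz, h1, h2⟩ := tri_nbr h3 a b c
        exact ⟨_, rfl, _, ⟨z, hS z hz.ne' h1 h2, rfl⟩, hz⟩
      have tf : ∀ a F (hF : E.IsFace F), a ∈ BF E F → Tch (TF E (fun _ => True)) {.inl a} {.inr ⟨F, hF, trivial⟩} :=
        fun a F hF ha => ⟨_, rfl, _, rfl, ha⟩
      refine h.no33 {.inl u} {.inl v} {.inl x} {.inr ⟨F1, hF1, trivial⟩} {.inr ⟨F2, hF2, trivial⟩} _ (Cn.single _) (Cn.single _) (Cn.single _) (Cn.single _) (Cn.single _) hC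
        ?_ ?_ ?_ ?_ ?_ ?_ ?_ ?_ ?_ ?_ ?_ ?_ ?_ ?_ ?_ (tf _ _ hF1 (HF_left p1 H1)) (tf _ _ hF2 (HF_left p2 H2)) (tr u v x _ ?_)
        (tf _ _ hF1 (HF_right p1 H1)) (tf _ _ hF2 (HF_right p2 H2)) (tr v u x _ ?_) (tf _ _ hF1 x1) (tf _ _ hF2 x2) (tr x u v _ ?_)
      all_goals first
        | (intro z h1 h2 h3; simp [h1, h2, h3]; done)
        | (rintro _ rfl; simp [H1.adj.ne, a.ne, b.ne, hne.symm]; done)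
  · obtain ⟨x, y, hxy, a, b, c, d⟩ := vf u F' huv
    exact ⟨.inl x, .inl y, by simpa using hxy, a, b, c, d⟩
  · obtain ⟨x, y, hxy, a, b, c, d⟩ := vf v F huv
    exact ⟨.inl x, .inl y, by simpa using hxy, b, a, d, c⟩
  · exact huv.elim
end Dr3

section Fin1
variable {V : Type u}

lemma para {a b c d : ℕ} (hab : a < b) (hcd : c < d) (hne : ¬ (a = c ∧ b = d)) {x e e' : ℝ} (he : e = 1 ∨ e = -1) (he' : e' = 1 ∨ e' = -1)
    (h1 : a ≤ x) (h2 : x ≤ b) (h3 : c ≤ x) (h4 : x ≤ d) (h : e * ((x - a) * (b - x)) = e' * ((x - c) * (d - x)))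
    (i1 : a < c → c < b → b < d → e ≠ e') (i2 : c < a → a < d → d < b → e' ≠ e) : (x = a ∨ x = b) ∧ (x = c ∨ x = d) := by
  have nest : ∀ {a b c d : ℕ}, a ≤ c → d ≤ b → ¬ (a = c ∧ b = d) → a ≤ x → x ≤ b → c ≤ x → x ≤ d →
      (x - a) * (b - x) = (x - c) * (d - x) → (x = a ∨ x = b) ∧ (x = c ∨ x = d) := by
    intro a b c d hac hdb hne h1 h2 h3 h4 h
    have k1 : (a : ℝ) ≤ c := by exact_mod_cast hac
    have k2 : (d : ℝ) ≤ b := by exact_mod_cast hdb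
    have m1 := mul_nonneg (sub_nonneg.2 h3) (sub_nonneg.2 k2)
    have m2 := mul_nonneg (sub_nonneg.2 k1) (sub_nonneg.2 h4)
    have m3 := mul_nonneg (sub_nonneg.2 k1) (sub_nonneg.2 k2)
    by_cases hca : a = c
    · subst hca
      have : (x - a) * (b - d) = 0 := by nlinarith
      rcases mul_eq_zero.1 this with h | h
      · have : x = a := by linarith
        exact ⟨Or.inl this, Or.inl this⟩
      · exact absurd ⟨rfl, by exact_mod_cast sub_eq_zero.1 h⟩ hne
    · have m4 : (0 : ℝ) < c - a := by
        have : (a : ℝ) < c := by exact_mod_cast lt_of_le_of_ne hac hca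
        linarith
      have z1 : (c - a) * (d - x) = 0 := by nlinarith
      have z2 : ((c : ℝ) - a) * (b - d) = 0 := by nlinarith
      have z1 := (mul_eq_zero.1 z1).resolve_left m4.ne'
      have z2 := (mul_eq_zero.1 z2).resolve_left m4.ne'
      exact ⟨Or.inr (by linarith), Or.inr (by linarith)⟩
  have p1 := mul_nonneg (sub_nonneg.2 h1) (sub_nonneg.2 h2)
  have p2 := mul_nonneg (sub_nonneg.2 h3) (sub_nonneg.2 h4)
  by_cases hee : e = e'
  · have h' : (x - a) * (b - x) = (x - c) * (d - x) := by
      subst hee; rcases he with rfl | rfl <;> linarith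
    have i1 : ¬ (a < c ∧ c < b ∧ b < d) := fun h => i1 h.1 h.2.1 h.2.2 hee
    have i2 : ¬ (c < a ∧ a < d ∧ d < b) := fun h => i2 h.1 h.2.1 h.2.2 hee.symm
    by_cases q1 : b ≤ c
    · have : (b : ℝ) ≤ c := by exact_mod_cast q1
      exact ⟨Or.inr (by linarith), Or.inl (by linarith)⟩
    by_cases q2 : d ≤ a
    · have : (d : ℝ) ≤ a := by exact_mod_cast q2
      exact ⟨Or.inl (by linarith), Or.inr (by linarith)⟩
    by_cases q3 : a ≤ c ∧ d ≤ b
    · exact nest q3.1 q3.2 hne h1 h2 h3 h4 h'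
    · exact (nest (by lia) (by lia) (by lia) h3 h4 h1 h2 h'.symm).symm
  · have z : (x - a) * (b - x) = 0 ∧ (x - c) * (d - x) = 0 := by
      rcases he with rfl | rfl <;> rcases he' with rfl | rfl
      · exact absurd rfl hee
      · constructor <;> linarith
      · constructor <;> linarith
      · exact absurd rfl hee
    refine ⟨(mul_eq_zero.1 z.1).imp ?_ ?_, (mul_eq_zero.1 z.2).imp ?_ ?_⟩ <;> intro h <;> linarith

lemma planar_of_pages (H : SimpleGraph V) (ps : V → ℕ) (hi : Function.Injective ps) (s : ℕ → ℕ → ZMod 2)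
    (hs : ∀ a b c d : V, ps a < ps b → ps b < ps c → ps c < ps d → H.Adj a c → H.Adj b d → s (ps a) (ps c) ≠ s (ps b) (ps d)) :
    H.IsPlanar := by
  let e : V → V → ℝ := fun u v => if s (min (ps u) (ps v)) (max (ps u) (ps v)) = 0 then 1 else -1
  have he : ∀ u v, e u v = 1 ∨ e u v = -1 := fun u v => by simp only [e]; split_ifs <;> simp
  have hes : ∀ u v, e u v = e v u := fun u v => by simp only [e, min_comm, max_comm]
  have hlt : ∀ u v, ps u < ps v → e u v = if s (ps u) (ps v) = 0 then 1 else -1 := fun u v h => by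
    simp only [e, min_eq_left h.le, max_eq_right h.le]
  have hz : ∀ x y : ZMod 2, x ≠ y → ¬ (x = 0 ↔ y = 0) := by decide
  have hs' : ∀ a b c d : V, ps a < ps b → ps b < ps c → ps c < ps d → H.Adj a c → H.Adj b d → e a c ≠ e b d := by
    intro a b c d h1 h2 h3 hac hbd
    have := hz _ _ (hs a b c d h1 h2 h3 hac hbd)
    rw [hlt a c (h1.trans h2), hlt b d (h2.trans h3)]
    split_ifs <;> first | (norm_num; done) | (exfalso; grind)
  let P : V → Pl := fun v => ((ps v : ℝ), 0)
  let f : V → V → ℝ → Pl := fun u v x => (x, e u v * ((x - ps u) * (ps v - x)))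
  let A : V → V → Set Pl := fun u v => f u v '' uIcc (ps u : ℝ) (ps v)
  have hP : Function.Injective P := fun u v h => hi (by have : (ps u : ℝ) = ps v := congrArg Prod.fst h; exact_mod_cast this)
  have hA : ∀ u v, A u v = A v u := by
    intro u v
    have : f u v = f v u := by funext x; simp only [f, hes u v]; congr 2; ring
    simp only [A, this, uIcc_comm]
  have key : ∀ u v w z, ps u < ps v → ps w < ps z → H.Adj u v → H.Adj w z → s(u, v) ≠ s(w, z) →
      A u v ∩ A w z ⊆ ({P u, P v} ∩ {P w, P z} : Set Pl) := by
    rintro u v w z huv hwz a1 a2 hne y ⟨⟨x, hx, rfl⟩, ⟨x', hx', h⟩⟩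
    obtain rfl : x' = x := congrArg Prod.fst h
    have h' : e w z * ((x' - ps w) * (ps z - x')) = e u v * ((x' - ps u) * (ps v - x')) := congrArg Prod.snd h
    rw [uIcc_of_le (by exact_mod_cast huv.le)] at hx
    rw [uIcc_of_le (by exact_mod_cast hwz.le)] at hx'
    have := para huv hwz (fun h => hne (by rw [hi h.1, hi h.2])) (he u v) (he w z) hx.1 hx.2 hx'.1 hx'.2 h'.symm
      (fun k1 k2 k3 => hs' u w v z k1 k2 k3 a1 a2) (fun k1 k2 k3 => hs' w u z v k1 k2 k3 a2 a1)
    have t1 : ∀ a, x' = a → (x' = ps u ∨ x' = ps v) → f u v x' = (a, 0) := by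
      rintro a rfl (h | h) <;> simp [f, h]
    refine ⟨?_, ?_⟩
    · exact this.1.imp (fun h => t1 _ h this.1) (fun h => t1 _ h this.1)
    · exact this.2.imp (fun h => t1 _ h this.1) (fun h => t1 _ h this.1)
  have hne : ∀ u v, H.Adj u v → ps u ≠ ps v := fun u v h => hi.ne h.ne
  refine ⟨⟨P, hP, fun u v _ => A u v, fun u v _ => hA v u, ?_, ?_, ?_⟩⟩
  · intro u v h
    have hn : (ps u : ℝ) ≠ ps v := by exact_mod_cast hne u v h
    refine ⟨fun t => f u v (AffineMap.lineMap (ps u : ℝ) (ps v : ℝ) t), ?_, ?_, ?_, ?_, ?_⟩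
    · have h1 : Continuous (f u v) := by fun_prop
      exact (h1.comp AffineMap.lineMap_continuous).continuousOn
    · intro t _ t' _ h
      exact AffineMap.lineMap_injective ℝ hn (congrArg Prod.fst h)
    · simp [f, P]
    · simp [f, P]
    · simp only [A]
      rw [← segment_eq_uIcc, segment_eq_image_lineMap, image_image]
  · intro u v w z h1 h2 hn
    rcases lt_or_gt_of_ne (hne u v h1) with a | a <;> rcases lt_or_gt_of_ne (hne w z h2) with b | b
    · exact key u v w z a b h1 h2 hn
    · rw [hA w z, pair_comm (P w)]; exact key u v z w a b h1 h2.symm (by rwa [Sym2.eq_swap (a := z)])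
    · rw [hA u v, pair_comm (P u)]; exact key v u w z a b h1.symm h2 (by rwa [Sym2.eq_swap (a := v)])
    · rw [hA w z, pair_comm (P w), hA u v, pair_comm (P u)]
      exact key v u z w a b h1.symm h2.symm (by rwa [Sym2.eq_swap (a := v), Sym2.eq_swap (a := z)])
  · rintro u v h w ⟨x, hx, hw⟩
    obtain rfl : x = ps w := congrArg Prod.fst hw
    have h' : e u v * (((ps w : ℝ) - ps u) * (ps v - ps w)) = 0 := congrArg Prod.snd hw
    have h0 : e u v ≠ 0 := by rcases he u v with h | h <;> rw [h] <;> norm_num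
    rcases mul_eq_zero.1 ((mul_eq_zero.1 h').resolve_left h0) with h | h
    · exact Or.inl (hi (by exact_mod_cast sub_eq_zero.1 h))
    · exact Or.inr (hi (by exact_mod_cast (sub_eq_zero.1 h).symm))

lemma WD_planar {H : SimpleGraph V} {p R} (h : WD H p R) (h4 : 3 < Nat.card V) (σ : ZMod (Nat.card V) ≃ V)
    (hσ : cyclicSuccGraph σ ≤ H) : H.IsPlanar := by
  have : NeZero (Nat.card V) := ⟨by lia⟩
  have : Fact (1 < (Nat.card V)) := ⟨by lia⟩
  let ps : V → ℕ := fun v => (σ.symm v).val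
  have hi : Function.Injective ps := fun u v h => σ.symm.injective (ZMod.val_injective (Nat.card V) h)
  letI : LinearOrder V := LinearOrder.lift' ps hi
  have hlt : ∀ u v : V, u < v ↔ ps u < ps v := fun u v => Iff.rfl
  let τ : ℕ → V := fun k => σ k
  have hτ : ∀ k, k < (Nat.card V) → ps (τ k) = k := fun k hk => by simp [ps, τ, ZMod.val_cast_of_lt hk]
  have hpt : ∀ v, τ (ps v) = v := fun v => by simp [ps, τ]
  have hpl : ∀ v, ps v < (Nat.card V) := fun v => ZMod.val_lt _
  have hII : ∀ u v : V, II u v = II (ps u) (ps v) := fun u v => by simp only [II, hlt]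
  obtain ⟨N, hN⟩ := h.cochain
  have hcy : ∀ i : ZMod (Nat.card V), H.Adj (σ i) (σ (i + 1)) := fun i => hσ ⟨fun h => by simpa using σ.injective h, Or.inl ⟨i, rfl, rfl⟩⟩
  obtain ⟨s, hs⟩ := pages (K := ZMod 2) rfl one_ne_zero (Nat.card V) (by lia) (fun a b => a < b ∧ b < (Nat.card V) ∧ H.Adj (τ a) (τ b))
    (fun a b c => N (τ a) (τ b) (τ c)) (fun a b h => ⟨h.1, h.2.1⟩)
    (fun i hi => ⟨by lia, hi, by have := hcy i; simpa [τ] using this⟩)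
    ⟨by lia, by lia, by
      have := (hcy (((Nat.card V) - 1 : ℕ) : ZMod (Nat.card V))).symm
      rw [← Nat.cast_add_one, Nat.sub_add_cancel (by lia)] at this
      simpa [τ] using this⟩
    (fun a b c d h1 h2 n1 n2 n3 n4 => by
      have ha := hτ a (by lia)
      have hb := hτ b (by lia)
      have hc := hτ c (by lia)
      have hd := hτ d (by lia)
      have ne : ∀ {x y : ℕ}, ps (τ x) = x → ps (τ y) = y → x ≠ y → τ x ≠ τ y := fun e1 e2 hxy h => hxy (by rw [← e1, ← e2, h])
      have := hN (τ a) (τ b) (τ c) (τ d) (by rw [hlt, ha, hb]; exact h1.1) (by rw [hlt, hc, hd]; exact h2.1) h1.2.2 h2.2.2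
        (ne ha hc n1) (ne ha hd n2) (ne hb hc n3) (ne hb hd n4)
      simp only [hII, ha, hb, hc, hd] at this
      exact this)
  refine planar_of_pages H ps hi s fun a b c d h1 h2 h3 hac hbd => ?_
  exact hs _ _ _ _ h1 h2 h3 ⟨h1.trans h2, hpl c, by simpa only [hpt] using hac⟩ ⟨h2.trans h3, hpl d, by simpa only [hpt] using hbd⟩
end Fin1

section Fin2
variable {V : Type u}

lemma ham_perm {U : Type*} {T : SimpleGraph U} {l : List U} (hn : l.Nodup) (hm : ∀ x, x ∈ l) (hc : l.IsChain T.Adj) {a z : U}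
    (ha : l.head? = some a) (hz : l.getLast? = some z) (hza : T.Adj z a) :
    ∃ s : Equiv.Perm U, (∀ u, T.Adj u (s u)) ∧ ∀ A : Set U, A.Nonempty → (∀ u ∈ A, s u ∈ A) → ∀ u, u ∈ A := by
  classical
  refine ⟨l.formPerm, fun u => ?_, ?_⟩
  · obtain ⟨i, hi, rfl⟩ := List.getElem_of_mem (hm u)
    rw [List.formPerm_apply_getElem l hn i hi]
    by_cases h : i + 1 < l.length
    · have := List.isChain_iff_getElem.1 hc i h
      simpa only [Nat.mod_eq_of_lt h] using this
    · have e : i + 1 = l.length := by lia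
      have h0 : l[0]'(by lia) = a := by
        rw [List.head?_eq_getElem?] at ha; exact (List.getElem?_eq_some_iff.1 ha).2
      have h1 : l[i] = z := by
        grind
      simp only [e, Nat.mod_self, h0, h1, hza]
  · rintro A ⟨x, hx⟩ hA u
    have hx' : ∀ k : ℕ, (l.formPerm ^ k) x ∈ A := by
      intro k
      induction k with
      | zero => simpa using hx
      | succ k ih => rw [pow_succ', Equiv.Perm.mul_apply]; exact hA _ ih
    have hcy := hn.isCycleOn_formPerm
    have he : {a | a ∈ l} = ((l.toFinset : Finset U) : Set U) := by ext; simp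
    rw [he] at hcy
    obtain ⟨k, -, hk⟩ := hcy.exists_pow_eq (by simp [hm]) (by simp [hm] : u ∈ l.toFinset) (a := x)
    grind
lemma cyc_enum [Finite V] (nx : V → V) (hi : Function.Injective nx) (v0 : V) (h : ∀ A : Set V, A.Nonempty → (∀ u ∈ A, nx u ∈ A) → ∀ u, u ∈ A) :
    ∃ σ : ZMod (Nat.card V) ≃ V, ∀ i, σ (i + 1) = nx (σ i) := by
  have hsur : ∀ v, ∃ k : ℕ, nx^[k] v0 = v := h {v | ∃ k : ℕ, nx^[k] v0 = v} ⟨v0, 0, rfl⟩ (by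
    rintro _ ⟨k, rfl⟩; exact ⟨k + 1, Function.iterate_succ_apply' _ _ _⟩)
  have hp : 0 < Function.minimalPeriod nx v0 := Function.minimalPeriod_pos_of_mem_periodicPts (hi.mem_periodicPts v0)
  have hb : Function.Bijective (fun k : Fin (Function.minimalPeriod nx v0) => nx^[k] v0) := by
    constructor
    · intro a b h
      exact Fin.ext (Function.iterate_injOn_Iio_minimalPeriod a.2 b.2 h)
    · intro v
      obtain ⟨k, hk⟩ := hsur v
      exact ⟨⟨k % _, Nat.mod_lt _ hp⟩, by rw [← hk]; exact Function.iterate_mod_minimalPeriod_eq⟩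
  have hcard : Function.minimalPeriod nx v0 = Nat.card V := by
    rw [← Nat.card_eq_of_bijective _ hb, Nat.card_fin]
  have : NeZero (Nat.card V) := ⟨by lia⟩
  have hm : ∀ k : ℕ, nx^[k % Nat.card V] v0 = nx^[k] v0 := fun k => by
    rw [← hcard]; exact Function.iterate_mod_minimalPeriod_eq
  have hb' : Function.Bijective (fun i : ZMod (Nat.card V) => nx^[i.val] v0) := by
    constructor
    · intro a b h
      refine ZMod.val_injective _ (Function.iterate_injOn_Iio_minimalPeriod (f := nx) (x := v0) ?_ ?_ h)
      all_goals grind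
    · intro v
      obtain ⟨k, hk⟩ := hsur v
      exact ⟨(k : ZMod (Nat.card V)), by simp only [ZMod.val_natCast, hm, hk]⟩
  refine ⟨Equiv.ofBijective _ hb', fun i => ?_⟩
  have : ((i.val + 1 : ℕ) : ZMod (Nat.card V)) = i + 1 := by simp
  simp only [Equiv.ofBijective_apply]
  rw [← this, ZMod.val_natCast, hm, Function.iterate_succ_apply']

lemma skip_enum [Finite V] {N : Type*} (s : Equiv.Perm (V ⊕ N)) (hN : ∀ a b, s (Sum.inr a) ≠ Sum.inr b)
    (v0 : V) (h : ∀ A : Set (V ⊕ N), A.Nonempty → (∀ u ∈ A, s u ∈ A) → ∀ u, u ∈ A) :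
    ∃ σ : ZMod (Nat.card V) ≃ V, ∀ i, s (Sum.inl (σ i)) = Sum.inl (σ (i + 1)) ∨
      ∃ F, s (Sum.inl (σ i)) = Sum.inr F ∧ s (Sum.inr F) = Sum.inl (σ (i + 1)) := by
  have : ∀ v : V, ∃ w : V, s (Sum.inl v) = Sum.inl w ∨ ∃ F, s (Sum.inl v) = Sum.inr F ∧ s (Sum.inr F) = Sum.inl w := by
    intro v
    rcases h1 : s (Sum.inl v) with w | F
    · grind
    · rcases h2 : s (Sum.inr F) with w | F'
      all_goals grind
  choose nx hnx using this
  have hi : Function.Injective nx := by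
    intro v w e
    rcases hnx v with a | ⟨F, a, a'⟩ <;> rcases hnx w with b | ⟨F', b, b'⟩
    · exact Sum.inl_injective (s.injective (by rw [a, b, e]))
    · cases s.injective (a.trans (by rw [b', e]))
    · cases s.injective (b.trans (by rw [a', e]))
    · have := s.injective (a'.trans (by rw [b', e]))
      exact Sum.inl_injective (s.injective (by rw [a, b, this]))
  obtain ⟨σ, hσ⟩ := cyc_enum nx hi v0 (by
    rintro A ⟨x, hx⟩ hA u
    have := h {y | (∃ v ∈ A, y = Sum.inl v) ∨ ∃ F, y = Sum.inr F ∧ ∃ v ∈ A, s (Sum.inl v) = Sum.inr F} ⟨Sum.inl x, Or.inl ⟨x, hx, rfl⟩⟩ (by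
      rintro y (⟨v, hv, rfl⟩ | ⟨F, rfl, v, hv, hF⟩)
      · grind
      · rcases hnx v with a | ⟨F', a, a'⟩
        · grind
        · rw [a] at hF; cases hF
          exact Or.inl ⟨_, hA v hv, a'⟩) (Sum.inl u)
    rcases this with ⟨v, hv, e⟩ | ⟨F, e, _⟩
    · cases e; exact hv
    · cases e)
  exact ⟨σ, fun i => by rw [hσ]; exact hnx _⟩
end Fin2

/-- Every triconnected planar graph with no separating triangles has a
subhamiltonian cycle that crosses every face at most once. -/
theorem no_sep_triangle_subhamiltonian_cycle_crossing_once {V : Type u}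
    (G : SimpleGraph V) (h3 : G.IsTriconnected)
    (hnosep : ∀ a b c : V, ¬ G.IsSepTriangle a b c) (E : PlaneEmbedding G) :
    ∃ σ : ZMod (Nat.card V) ≃ V, G.IsSubhamiltonianCycle σ ∧
      ∀ F : Set (ℝ × ℝ), E.IsFace F →
        {i : ZMod (Nat.card V) | CrossesFaceAt E σ F i}.Subsingleton := by
  have : Finite V := tri_fin h3
  have := NP_fin (E := E) h3
  have : Nonempty V := h3.2.1.nonempty
  obtain ⟨v0⟩ := this
  obtain ⟨w0, hw0⟩ := tri_nbr h3 v0 v0 v0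
  have h12 : (TF E (NP E)).Adj (Sum.inl v0) (Sum.inl w0) := hw0.1
  obtain ⟨l, hn, hm, hc, a, z, ha, hz, hza⟩ := Tri.ham (TF_tri h3 hnosep) h12
  obtain ⟨s, hs, hcl⟩ := ham_perm hn hm hc ha hz hza
  obtain ⟨σ, hσ⟩ := skip_enum s (fun F F' h => by have := hs (Sum.inr F); rw [h] at this; exact this) v0 hcl
  have hFact : Fact (1 < Nat.card V) := ⟨by have := h3.1; lia⟩
  have hne : ∀ i, σ i ≠ σ (i + 1) := fun i h => by simpa using σ.injective h
  refine ⟨σ, ?_, ?_⟩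
  · obtain ⟨p, R, hWD⟩ := TF_WD E (NP E)
    let B : V → Set (V ⊕ {F // E.IsFace F ∧ NP E F}) := fun v => {Sum.inl v} ∪ {x | ∃ F, x = Sum.inr F ∧ s (Sum.inl v) = Sum.inr F}
    have hin : ∀ v, Sum.inl v ∈ B v := by grind
    have hcyc : ∀ i, Tch (TF E (NP E)) (B (σ i)) (B (σ (i + 1))) := by
      intro i
      rcases hσ i with h | ⟨F, h, h'⟩
      · exact ⟨_, hin _, _, hin _, by rw [← h]; exact hs _⟩
      · exact ⟨Sum.inr F, Or.inr ⟨F, rfl, h⟩, _, hin _, by rw [← h']; exact hs _⟩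
    obtain ⟨p', R', hWD'⟩ := hWD.minor (G ⊔ cyclicSuccGraph σ) B (by
        intro v
        by_cases h : ∃ F, s (Sum.inl v) = Sum.inr F
        · obtain ⟨F, hF⟩ := h
          have : B v = {Sum.inl v} ∪ {Sum.inr F} := by
            ext x
            constructor
            · rintro (h | ⟨F', rfl, h⟩)
              all_goals grind
            all_goals grind
          rw [this]
          exact Cn.union (Cn.single _) (Cn.single _) ⟨_, rfl, _, rfl, by rw [← hF]; exact hs _⟩
        · have : B v = {Sum.inl v} := by
            grind
          rw [this]; exact Cn.single _) (by
        rintro v w hvw x (rfl | ⟨F, rfl, h⟩) (h' | ⟨F', h1, h2⟩)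
        · grind
        · cases h1
        · cases h'
        · cases h1
          exact hvw (Sum.inl_injective (s.injective (h.trans h2.symm)))) (by
        rintro v w (h | ⟨-, ⟨i, rfl, rfl⟩ | ⟨i, rfl, rfl⟩⟩)
        · exact ⟨_, hin _, _, hin _, h⟩
        · exact hcyc i
        · obtain ⟨a, ha, b, hb, hab⟩ := hcyc i
          exact ⟨b, hb, a, ha, hab.symm⟩)
    exact WD_planar hWD' h3.1 σ le_sup_right
  · intro F hF
    have key : ∀ i, CrossesFaceAt E σ F i → ∃ F' : {F // E.IsFace F ∧ NP E F}, F'.1 = F ∧ s (Sum.inl (σ i)) = Sum.inr F' := by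
      rintro i ⟨h1, h2, h12⟩
      rcases hσ i with h | ⟨F', h, h'⟩
      · have := hs (Sum.inl (σ i)); rw [h] at this; exact absurd this h12
      · have e1 := hs (Sum.inl (σ i))
        have e2 := hs (Sum.inr F')
        rw [h] at e1; rw [h'] at e2
        exact ⟨F', two_faces h3 F'.2.1 hF (hne i) h12 e1 e2 h1 h2, h⟩
    intro i hi j hj
    obtain ⟨F1, e1, k1⟩ := key i hi
    obtain ⟨F2, e2, k2⟩ := key j hj
    have : F1 = F2 := by grind
    exact σ.injective (Sum.inl_injective (s.injective (by rw [k1, k2, this])))
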